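/- For every IP set 𝒜 consisting of even positive integers, there exist infinitely many a ∈ 𝒜 such that p_{n+1} − p_n = a holds for infinitely many n (i.e., 𝒜 contains infinitely many de Polignac numbers). -/

import Mathlib

/-- `FS M` is the set of all nonzero finite sums of distinct elements of `M`. -/
def FS (M : Set ℕ) : Set ℕ :=
  {a | a ≠ 0 ∧ ∃ F : Finset ℕ, F.Nonempty ∧ ↑F ⊆ M ∧ ∑ x ∈ F, x = a}

/-- `A` is an IP set if `A = FS M` for some infinite `M ⊆ ℕ`. -/
def IsIPSet (A : Set ℕ) : Prop :=
  ∃ M : Set ℕ, M.Infinite ∧ (∀ m ∈ M, 0 < m) ∧ A = FS M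

/-- `m` is a de Polignac number if `p_{n+1} - p_n = m` for infinitely many `n`. -/
def DePolignac (m : ℕ) : Prop :=
  {n : ℕ | Nat.nth Nat.Prime (n + 1) - Nat.nth Nat.Prime n = m}.Infinite

set_option linter.all false
open Real (exp log)

section
open Finset

/-! ## The smooth weight -/

noncomputable def phiW (m:ℕ) (L u:ℝ) : ℝ := (u/L)^m*exp (-(u-L)^2)

noncomputable def FF (m:ℕ) (L:ℝ) (n:ℕ) : ℝ := phiW m L (log n)

noncomputable def CF (m:ℕ) : ℝ := (m+2)*(m+1).factorial*exp 2

lemma one_add_pow_mul_exp_le (j:ℕ) (v:ℝ) (hv : 0 ≤ v) :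
    (1+v)^j*exp (-v^2) ≤ j.factorial*exp 2 := by
  have h1 : (1+v)^j/j.factorial ≤ exp (1+v) :=
    Real.pow_div_factorial_le_exp (1+v) (by linarith) j
  have hf : (0:ℝ) < j.factorial := by exact_mod_cast Nat.factorial_pos j
  rw [div_le_iff₀ hf] at h1
  calc (1+v)^j*exp (-v^2) ≤ (exp (1+v)*j.factorial)*exp (-v^2) := by
        gcongr
    _ = j.factorial*exp (1+v-v^2) := by
        rw [mul_comm (exp _), mul_assoc, ← Real.exp_add]; ring_nf
    _ ≤ j.factorial*exp 2 := by
        gcongr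
        nlinarith [sq_nonneg (v-1/2)]

lemma div_le_one_add (L u:ℝ) (hL : 1 ≤ L) : u/L ≤ 1 + |u-L| := by
  rw [div_le_iff₀ (by linarith)]
  have := le_abs_self (u-L)
  have := abs_nonneg (u-L)
  nlinarith

lemma phiW_nonneg (m:ℕ) (L u:ℝ) (hL : 1 ≤ L) (hu : 0 ≤ u) : 0 ≤ phiW m L u := by
  unfold phiW; positivity

lemma factorial_le_succ' (m:ℕ) : (m.factorial:ℝ) ≤ (m+1).factorial := by
  exact_mod_cast Nat.factorial_le (Nat.le_succ m)

lemma CF_pos (m:ℕ) : 0 < CF m := by unfold CF; positivity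

lemma phi_aux (j:ℕ) (L u:ℝ) (hL : 1 ≤ L) (hu : 0 ≤ u) :
    (u/L)^j*exp (-(u-L)^2) ≤ j.factorial*exp 2 := by
  have h0 := one_add_pow_mul_exp_le j |u-L| (abs_nonneg _)
  rw [sq_abs] at h0
  refine le_trans ?_ h0
  gcongr
  exact div_le_one_add L u hL

lemma phiW_le (m:ℕ) (L u:ℝ) (hL : 1 ≤ L) (hu : 0 ≤ u) : phiW m L u ≤ CF m := by
  refine (phi_aux m L u hL hu).trans ?_
  unfold CF
  have := factorial_le_succ' m
  have h2 : (1:ℝ) ≤ m+2 := by linarith [(Nat.cast_nonneg m : (0:ℝ) ≤ m)]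
  have : (m.factorial:ℝ) ≤ (m+2)*(m+1).factorial := by
    nlinarith [(Nat.cast_nonneg (m+1).factorial : (0:ℝ) ≤ _)]
  gcongr

lemma phiW_hasDerivAt (m:ℕ) (L u:ℝ) :
    HasDerivAt (phiW m L)
      ((m*(u/L)^(m-1)*(1/L))*exp (-(u-L)^2) +
        (u/L)^m*(exp (-(u-L)^2)*(-(2*(u-L))))) u := by
  unfold phiW
  have h1 : HasDerivAt (fun u : ℝ => (u/L)^m) (m*(u/L)^(m-1)*(1/L)) u := by
    have := HasDerivAt.fun_pow ((hasDerivAt_id u).div_const L) m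
    simpa using this
  have h2 : HasDerivAt (fun u : ℝ => exp (-(u-L)^2))
      (exp (-(u-L)^2)*(-(2*(u-L)))) u := by
    have := ((((hasDerivAt_id u).sub_const L).pow 2).neg).exp
    simpa using this
  exact h1.mul h2

lemma phiW_deriv_le (m:ℕ) (L u:ℝ) (hL : 1 ≤ L) (hu : 0 ≤ u) :
    ‖(m*(u/L)^(m-1)*(1/L))*exp (-(u-L)^2) +
        (u/L)^m*(exp (-(u-L)^2)*(-(2*(u-L))))‖ ≤ CF m := by
  have hL0 : 0 < L := by linarith
  have hq : 0 ≤ u/L := by positivity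
  have hq1 := div_le_one_add L u hL
  have hv := abs_nonneg (u-L)
  set v := |u-L| with hvdef
  have hexp : exp (-(u-L)^2) = exp (-v^2) := by rw [hvdef, sq_abs]
  have e1 : ‖(m*(u/L)^(m-1)*(1/L))*exp (-(u-L)^2)‖ ≤
      m*((m+1).factorial*exp 2) := by
    have hh := phi_aux (m-1) L u hL hu
    have h3 : ((m-1).factorial:ℝ) ≤ (m+1).factorial := by
      exact_mod_cast Nat.factorial_le (by omega)
    rw [Real.norm_of_nonneg (by positivity)]
    have h4 : 1/L ≤ 1 := by rw [div_le_one hL0]; exact hL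
    calc (m*(u/L)^(m-1)*(1/L))*exp (-(u-L)^2)
        = (1/L)*(m*((u/L)^(m-1)*exp (-(u-L)^2))) := by ring
      _ ≤ 1*(m*((m+1).factorial*exp 2)) := by
          refine mul_le_mul h4 ?_ (by positivity) zero_le_one
          refine mul_le_mul_of_nonneg_left ?_ (by positivity)
          exact hh.trans (by gcongr)
      _ = _ := by ring
  have e2 : ‖(u/L)^m*(exp (-(u-L)^2)*(-(2*(u-L))))‖ ≤
      2*((m+1).factorial*exp 2) := by
    rw [norm_mul, norm_mul, norm_neg, norm_mul, Real.norm_of_nonneg (by positivity : 0 ≤ (u/L)^m),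
      Real.norm_of_nonneg (Real.exp_pos _).le, Real.norm_of_nonneg (by norm_num : (0:ℝ) ≤ 2),
      Real.norm_eq_abs, ← hvdef, hexp]
    calc (u/L)^m*(exp (-v^2)*(2*v))
        ≤ (1+v)^m*(exp (-v^2)*(2*(1+v))) := by gcongr; linarith
      _ = 2*((1+v)^(m+1)*exp (-v^2)) := by ring
      _ ≤ _ := by
          exact mul_le_mul_of_nonneg_left (one_add_pow_mul_exp_le (m+1) v hv) (by norm_num)
  refine (norm_add_le _ _).trans ((add_le_add e1 e2).trans ?_)
  unfold CF
  apply le_of_eq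
  ring

lemma phiW_lip (m:ℕ) (L u v:ℝ) (hL : 1 ≤ L) (hu : 0 ≤ u) (hv : 0 ≤ v) :
    |phiW m L u-phiW m L v| ≤ CF m * |u-v| := by
  have := (convex_Ici (0:ℝ)).norm_image_sub_le_of_norm_hasDerivWithin_le
    (f := phiW m L) (C := CF m) (x := v) (y := u)
    (fun x _ => (phiW_hasDerivAt m L x).hasDerivWithinAt)
    (fun x hx => phiW_deriv_le m L x hL hx) hv hu
  simpa [Real.norm_eq_abs] using this

lemma FF_nonneg (m:ℕ) (L:ℝ) (n:ℕ) (hL : 1 ≤ L) : 0 ≤ FF m L n :=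
  phiW_nonneg m L _ hL (Real.log_natCast_nonneg n)

lemma FF_le (m:ℕ) (L:ℝ) (n:ℕ) (hL : 1 ≤ L) : FF m L n ≤ CF m :=
  phiW_le m L _ hL (Real.log_natCast_nonneg n)

lemma FF_zero (m:ℕ) (L:ℝ) (hm : m ≠ 0) : FF m L 0 = 0 := by simp [FF, phiW, hm]

lemma log_succ_sub_le (n:ℕ) (hn : 1 ≤ n) :
    |log ((n+1:ℕ):ℝ)-log n| ≤ 1/n := by
  have hn' : (0:ℝ) < n := by exact_mod_cast hn
  rw [← Real.log_div (by positivity) (by positivity), abs_of_nonneg]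
  · have : ((n+1:ℕ):ℝ)/n = 1+1/n := by push_cast; field_simp
    rw [this]
    have := Real.log_le_sub_one_of_pos (show (0:ℝ) < 1+1/n by positivity)
    linarith
  · apply Real.log_nonneg
    rw [le_div_iff₀ hn']; push_cast; linarith

lemma FF_diff (m:ℕ) (L:ℝ) (d n:ℕ) (hL : 1 ≤ L) (hd : 1 ≤ d) (hn : 1 ≤ n) :
    |FF m L (d*(n+1))-FF m L (d*n)| ≤ CF m*(1/n) := by
  unfold FF
  refine (phiW_lip m L _ _ hL (Real.log_natCast_nonneg _) (Real.log_natCast_nonneg _)).trans ?_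
  have hC := (CF_pos m).le
  gcongr
  have hd' : (d:ℝ) ≠ 0 := by exact_mod_cast (by omega : d ≠ 0)
  have hn' : (n:ℝ) ≠ 0 := by exact_mod_cast (by omega : n ≠ 0)
  have hn1' : ((n+1:ℕ):ℝ) ≠ 0 := by exact_mod_cast (by omega : n+1 ≠ 0)
  rw [Nat.cast_mul, Nat.cast_mul, Real.log_mul hd' hn1', Real.log_mul hd' hn']
  have := log_succ_sub_le n hn
  simpa using this

/-! ## Abel summation -/

lemma abel_range (f G : ℕ → ℂ) (B:ℝ) (hB : ∀ n, ‖∑ i ∈ range n, f i‖ ≤ B) (M:ℕ) :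
    ‖∑ i ∈ range M, f i*G i‖ ≤
      B*(‖G (M-1)‖ + ∑ i ∈ range (M-1), ‖G (i+1)-G i‖) := by
  have h := Finset.sum_range_by_parts G f M
  have e : ∑ i ∈ range M, f i*G i = ∑ i ∈ range M, G i • f i :=
    sum_congr rfl fun i _ => by rw [smul_eq_mul, mul_comm]
  rw [e, h, mul_add, mul_sum]
  refine (norm_sub_le _ _).trans (add_le_add ?_ ?_)
  · rw [norm_smul, mul_comm]
    gcongr
    exact hB M
  · refine (norm_sum_le _ _).trans (sum_le_sum fun i _ => ?_)
    rw [norm_smul, mul_comm]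
    gcongr
    exact hB (i+1)

lemma abel_Ico (f G : ℕ → ℂ) (B:ℝ) (hB : ∀ a b, ‖∑ i ∈ Ico a b, f i‖ ≤ B) (V M:ℕ)
    (hVM : V < M) :
    ‖∑ i ∈ Ico V M, f i*G i‖ ≤
      B*(‖G (M-1)‖ + ∑ i ∈ Ico V (M-1), ‖G (i+1)-G i‖) := by
  have h := abel_range (fun i => f (V+i)) (fun i => G (V+i)) B (by
    intro n
    have := hB V (V+n)
    rw [Finset.sum_Ico_eq_sum_range] at this
    simpa using this) (M-V)
  rw [Finset.sum_Ico_eq_sum_range, Finset.sum_Ico_eq_sum_range]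
  have e1 : V+(M-V-1) = M-1 := by omega
  have e2 : M-V-1 = M-1-V := by omega
  simp only [e1] at h
  rw [e2] at h
  exact h

lemma sum_one_div_le (M:ℕ) : ∑ i ∈ Ico 1 M, (1:ℝ)/i ≤ 1+log M := by
  rcases Nat.eq_zero_or_pos M with rfl | hM
  · simp
  have h := harmonic_le_one_add_log M
  rw [harmonic_eq_sum_Icc] at h
  push_cast at h
  refine le_trans ?_ h
  simp only [one_div]
  apply sum_le_sum_of_subset_of_nonneg
  · intro i hi; simp only [mem_Ico, mem_Icc] at *; omega
  · intros; positivity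

/-- sums of a function with bounded interval sums against the smooth weight -/
lemma sum_FF_le (m:ℕ) (L:ℝ) (hL : 1 ≤ L) (f : ℕ → ℂ) (B:ℝ)
    (hB : ∀ a b, ‖∑ i ∈ Ico a b, f i‖ ≤ B) (d:ℕ) (hd : 1 ≤ d) (M:ℕ) :
    ‖∑ n ∈ range M, f n*(FF m L (d*n) : ℂ)‖ ≤ B*(CF m*(3+log M)) := by
  have hB0 : 0 ≤ B := (norm_nonneg _).trans (hB 0 0)
  have hC := (CF_pos m).le
  refine (abel_range f _ B (fun n => by simpa using hB 0 n) M).trans ?_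
  gcongr
  have habs : ∀ n, |FF m L n| ≤ CF m := fun n => by
    rw [abs_of_nonneg (FF_nonneg m L n hL)]; exact FF_le m L n hL
  have h1 : ‖(FF m L (d*(M-1)) : ℂ)‖ ≤ CF m := by
    rw [Complex.norm_real]; exact habs _
  have h2 : ∑ i ∈ range (M-1), ‖(FF m L (d*(i+1)) : ℂ)-(FF m L (d*i) : ℂ)‖ ≤
      CF m*(2+log M) := by
    have hterm : ∀ i, ‖(FF m L (d*(i+1)) : ℂ)-(FF m L (d*i) : ℂ)‖
        = |FF m L (d*(i+1))-FF m L (d*i)| := fun i => by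
      rw [← Complex.ofReal_sub, Complex.norm_real, Real.norm_eq_abs]
    simp only [hterm]
    have hlM : 0 ≤ log M := Real.log_natCast_nonneg M
    rcases Nat.eq_zero_or_pos (M-1) with h0 | h0
    · rw [h0]; simp; positivity
    rw [Finset.range_eq_Ico, Finset.sum_eq_sum_Ico_succ_bot h0]
    have a1 : |FF m L (d*(0+1))-FF m L (d*0)| ≤ CF m := by
      rw [abs_sub_le_iff]
      constructor
      · linarith [FF_le m L (d*(0+1)) hL, FF_nonneg m L (d*0) hL]
      · linarith [FF_le m L (d*0) hL, FF_nonneg m L (d*(0+1)) hL]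
    have a2 : ∑ i ∈ Ico (0+1) (M-1), |FF m L (d*(i+1))-FF m L (d*i)| ≤
        CF m*(1+log M) := by
      calc _ ≤ ∑ i ∈ Ico 1 (M-1), CF m*(1/(i:ℝ)) := by
            apply sum_le_sum
            intro i hi
            exact FF_diff m L d i hL hd (by simp at hi; omega)
        _ = CF m*∑ i ∈ Ico 1 (M-1), (1/(i:ℝ)) := by rw [mul_sum]
        _ ≤ CF m*∑ i ∈ Ico 1 M, (1/(i:ℝ)) := by
            gcongr
            exact Nat.sub_le M 1
        _ ≤ _ := by
            gcongr
            exact sum_one_div_le M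
    nlinarith
  linarith

/-! ## Character sums over intervals -/

lemma periodic_sum_Ico (f : ℕ → ℂ) (r:ℕ) (hf : ∀ n, f (n+r) = f n) (a:ℕ) :
    ∑ n ∈ Ico a (a+r), f n = ∑ n ∈ range r, f n := by
  induction a with
  | zero => simp
  | succ a ih =>
    rw [← ih]
    rcases Nat.eq_zero_or_pos r with rfl | hr
    · simp
    rw [Finset.sum_eq_sum_Ico_succ_bot (by omega : a < a+r) f,
      show a+1+r = a+r+1 by ring,
      Finset.sum_Ico_succ_top (by omega : a+1 ≤ a+r), hf, add_comm]

lemma sum_range_zmod (r:ℕ) [NeZero r] (g : ZMod r → ℂ) :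
    ∑ n ∈ range r, g (n : ZMod r) = ∑ x : ZMod r, g x := by
  obtain ⟨k, rfl⟩ : ∃ k, r = k+1 := ⟨r-1, by have := NeZero.ne r; omega⟩
  rw [Finset.sum_range]
  refine Fintype.sum_congr _ _ fun i => ?_
  congr 1
  exact Fin.cast_val_eq_self i

lemma char_period (r:ℕ) [NeZero r] (g : ZMod r → ℂ) (hg : ∑ x, g x = 0) (hg1 : ∀ x, ‖g x‖ ≤ 1)
    (a b:ℕ) : ‖∑ n ∈ Ico a b, g (n : ZMod r)‖ ≤ r := by
  have hr : 0 < r := NeZero.pos r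
  induction hb : b-a using Nat.strong_induction_on generalizing a with
  | _ k ih =>
    by_cases hk : b-a < r
    · refine (norm_sum_le _ _).trans ?_
      refine (sum_le_sum fun i _ => hg1 _).trans ?_
      simp only [sum_const, Nat.card_Ico, nsmul_eq_mul, mul_one]
      exact_mod_cast hk.le
    · have h1 : ∑ n ∈ Ico a b, g (n : ZMod r) = ∑ n ∈ Ico a (a+r), g (n : ZMod r)
          + ∑ n ∈ Ico (a+r) b, g (n : ZMod r) := by
        rw [Finset.sum_Ico_consecutive _ (by omega) (by omega)]
      rw [h1, periodic_sum_Ico (fun n : ℕ => g (n : ZMod r)) r (by intro n; simp),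
        sum_range_zmod, hg, zero_add]
      exact ih (b-(a+r)) (by omega) (a+r) rfl

lemma char_sum_le {r : ℕ} (hr : r ≠ 0) (χ : DirichletCharacter ℂ r) (hχ : χ ≠ 1) (a b:ℕ) :
    ‖∑ n ∈ Ico a b, χ (n : ZMod r)‖ ≤ r := by
  haveI : NeZero r := ⟨hr⟩
  exact char_period r (fun x => χ x) (MulChar.sum_eq_zero_of_ne_one hχ) (fun x => χ.norm_le_one x) a b

/-- class indicator minus density -/
lemma class_sum_le (q:ℕ) (hq : q ≠ 0) (c:ℕ) (a b:ℕ) :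
    ‖∑ n ∈ Ico a b, ((if n ≡ c [MOD q] then (1:ℂ) else 0)-1/q)‖ ≤ 1 := by
  have hq0 : 0 < q := Nat.pos_of_ne_zero hq
  rcases le_total b a with hab | hab
  · rw [Finset.Ico_eq_empty (by omega)]; simp
  have hsum : ∑ n ∈ Ico a b, ((if n ≡ c [MOD q] then (1:ℂ) else 0)-1/q)
      = (((((Ico a b).filter (fun n => n ≡ c [MOD q])).card:ℝ)-((b:ℝ)-a)/q:ℝ) : ℂ) := by
    rw [sum_sub_distrib, Finset.sum_boole]
    simp [Nat.cast_sub hab]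
    ring
  rw [hsum, Complex.norm_real, Real.norm_eq_abs]
  have hcard := Nat.Ico_filter_modEq_card a b hq0 c
  have hc : (((Ico a b).filter (fun n => n ≡ c [MOD q])).card : ℤ) =
    max (⌈((b:ℚ)-c)/q⌉ - ⌈((a:ℚ)-c)/q⌉) 0 := by
    simpa using hcard
  have hq' : (0:ℚ) < q := by exact_mod_cast hq0
  have hmono : ⌈((a:ℚ)-c)/q⌉ ≤ ⌈((b:ℚ)-c)/q⌉ := by
    apply Int.ceil_le_ceil
    gcongr
  rw [max_eq_left (by linarith)] at hc
  have h1 := Int.ceil_lt_add_one (((b:ℚ)-c)/q)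
  have h2 := Int.le_ceil (((b:ℚ)-c)/q)
  have h3 := Int.ceil_lt_add_one (((a:ℚ)-c)/q)
  have h4 := Int.le_ceil (((a:ℚ)-c)/q)
  have hcq : (((Ico a b).filter (fun n => n ≡ c [MOD q])).card : ℚ) =
    ⌈((b:ℚ)-c)/q⌉ - ⌈((a:ℚ)-c)/q⌉ := by exact_mod_cast hc
  have key : |(((Ico a b).filter (fun n => n ≡ c [MOD q])).card : ℚ)-((b:ℚ)-a)/q| ≤ 1 := by
    rw [hcq, abs_le]
    have : ((b:ℚ)-a)/q = ((b:ℚ)-c)/q-((a:ℚ)-c)/q := by ring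
    rw [this]
    constructor <;> linarith
  have key2 := (Rat.cast_le (K := ℝ)).2 key
  push_cast at key2
  exact key2

lemma progression_FF (m:ℕ) (L:ℝ) (hL : 1 ≤ L) (q:ℕ) (hq : q ≠ 0) (c M:ℕ) :
    |∑ n ∈ (range M).filter (fun n => n ≡ c [MOD q]), FF m L n-(∑ n ∈ range M, FF m L n)/q| ≤
      CF m*(3+log M) := by
  have h := sum_FF_le m L hL _ 1 (class_sum_le q hq c) 1 le_rfl M
  have e : ∑ n ∈ range M, ((if n ≡ c [MOD q] then (1:ℂ) else 0)-1/q)*(FF m L (1*n) : ℂ)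
     = ((∑ n ∈ (range M).filter (fun n => n ≡ c [MOD q]), FF m L n
        - (∑ n ∈ range M, FF m L n)/q:ℝ) : ℂ) := by
    push_cast
    rw [sum_filter, Finset.sum_div, ← sum_sub_distrib]
    refine sum_congr rfl fun n _ => ?_
    rw [one_mul]
    split_ifs <;> ring
  rw [e, Complex.norm_real, Real.norm_eq_abs, one_mul] at h
  exact h
end

section
open Finset

/-! ## A weak large sieve inequality -/

lemma sum_div_nat_le (g : ℕ → ℂ) (B:ℝ) (hB : ∀ a b, ‖∑ i ∈ Ico a b, g i‖ ≤ B) (V M:ℕ)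
    (hV : 1 ≤ V) : ‖∑ n ∈ Ico V M, g n*((1/(n:ℝ):ℝ) : ℂ)‖ ≤ B/V := by
  have hB0 : 0 ≤ B := (norm_nonneg _).trans (hB 0 0)
  rcases le_or_gt M V with h | h
  · rw [Finset.Ico_eq_empty (by omega)]; simp; positivity
  refine (abel_Ico g _ B hB V M h).trans ?_
  rw [div_eq_mul_inv]
  refine mul_le_mul_of_nonneg_left ?_ hB0
  have e : ∑ i ∈ Ico V (M-1), ‖((1/((i+1:ℕ):ℝ):ℝ) : ℂ)-((1/(i:ℝ):ℝ) : ℂ)‖ =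
      ∑ i ∈ Ico V (M-1), ((fun i : ℕ => -(1/(i:ℝ))) (i+1)-(fun i : ℕ => -(1/(i:ℝ))) i) := by
    refine sum_congr rfl fun i hi => ?_
    rw [← Complex.ofReal_sub, Complex.norm_real, Real.norm_eq_abs, abs_sub_comm, abs_of_nonneg]
    · simp; ring
    · have : (0:ℝ) < i := by
        have := (Finset.mem_Ico.1 hi).1
        exact_mod_cast (by omega : 0 < i)
      rw [sub_nonneg]
      apply one_div_le_one_div_of_le this
      push_cast; linarith
  rw [e, Finset.sum_Ico_sub (fun i : ℕ => -(1/(i:ℝ))) (by omega), Complex.norm_real, Real.norm_of_nonneg (by positivity)]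
  simp

lemma large_sieve {ι : Type*} [DecidableEq ι] (S : Finset ι) (f : ι → ℕ → ℂ) (B:ℝ)
    (hf1 : ∀ i ∈ S, ∀ n, ‖f i n‖ ≤ 1)
    (hB : ∀ i ∈ S, ∀ j ∈ S, i ≠ j → ∀ a b, ‖∑ n ∈ Ico a b, f i n*(starRingEnd ℂ) (f j n)‖ ≤ B)
    (hB0 : 0 ≤ B)
    (V M:ℕ) (hV : 1 ≤ V) (c : ℕ → ℂ) :
    ∑ i ∈ S, ‖∑ n ∈ Ico V M, c n*f i n‖^2 ≤
      (1+log M+S.card*(B/V))*∑ n ∈ Ico V M, n*‖c n‖^2 := by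
  set T : ι → ℂ := fun i => ∑ n ∈ Ico V M, c n*f i n with hT
  set Z : ℝ := ∑ i ∈ S, ‖T i‖^2 with hZ
  set A : ℝ := ∑ n ∈ Ico V M, n*‖c n‖^2 with hA
  set K : ℝ := 1+log M+S.card*(B/V) with hK
  have hA0 : 0 ≤ A := sum_nonneg fun n _ => by positivity
  have hZ0 : 0 ≤ Z := sum_nonneg fun n _ => by positivity
  have hK0 : 0 ≤ K := by
    have := Real.log_natCast_nonneg M
    positivity
  let U : ℕ → ℂ := fun n => ∑ i ∈ S, (starRingEnd ℂ) (T i)*f i n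
  have e1 : (Z : ℂ) = ∑ n ∈ Ico V M, c n*U n := by
    simp only [hZ, U, mul_sum]
    rw [sum_comm]
    push_cast
    refine sum_congr rfl fun i _ => ?_
    rw [← Complex.conj_mul']
    conv_lhs => rw [hT]
    simp only [mul_sum]
    refine sum_congr rfl fun n _ => ?_
    ring
  have e2 : Z ≤ ∑ n ∈ Ico V M, ‖c n‖*‖U n‖ := by
    have h := congrArg norm e1
    rw [Complex.norm_real, Real.norm_of_nonneg hZ0] at h
    rw [h]
    refine (norm_sum_le _ _).trans (sum_le_sum fun n _ => by rw [norm_mul])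
  have e3 : Z^2 ≤ A*∑ n ∈ Ico V M, (1/(n:ℝ))*‖U n‖^2 := by
    have hcs := Finset.sum_mul_sq_le_sq_mul_sq (Ico V M) (fun n => Real.sqrt n*‖c n‖)
      (fun n => (1/Real.sqrt n)*‖U n‖)
    have h1 : ∑ n ∈ Ico V M, (Real.sqrt n*‖c n‖)*((1/Real.sqrt n)*‖U n‖) =
        ∑ n ∈ Ico V M, ‖c n‖*‖U n‖ := by
      refine sum_congr rfl fun n hn => ?_
      have : (0:ℝ) < n := by
        have := (Finset.mem_Ico.1 hn).1
        exact_mod_cast (by omega : 0 < n)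
      have : Real.sqrt n ≠ 0 := (Real.sqrt_pos.2 this).ne'
      field_simp
    rw [h1] at hcs
    have h2 : ∑ n ∈ Ico V M, (Real.sqrt n*‖c n‖)^2 = A := by
      refine sum_congr rfl fun n hn => ?_
      rw [mul_pow, Real.sq_sqrt (Nat.cast_nonneg n)]
    have h3 : ∑ n ∈ Ico V M, ((1/Real.sqrt n)*‖U n‖)^2 =
        ∑ n ∈ Ico V M, (1/(n:ℝ))*‖U n‖^2 := by
      refine sum_congr rfl fun n hn => ?_
      rw [mul_pow, div_pow, Real.sq_sqrt (Nat.cast_nonneg n), one_pow]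
    rw [h2, h3] at hcs
    refine le_trans ?_ hcs
    gcongr
  have e4 : ∑ n ∈ Ico V M, (1/(n:ℝ))*‖U n‖^2 ≤ K*Z := by
    have h1 : ((∑ n ∈ Ico V M, (1/(n:ℝ))*‖U n‖^2:ℝ) : ℂ) =
        ∑ i ∈ S, ∑ j ∈ S, (starRingEnd ℂ) (T i)*T j *
          ∑ n ∈ Ico V M, (f i n*(starRingEnd ℂ) (f j n))*((1/(n:ℝ):ℝ) : ℂ) := by
      push_cast
      simp only [mul_sum]
      have : ∀ n : ℕ, (1/(n:ℂ))*(‖U n‖ : ℂ)^2 = ∑ i ∈ S, ∑ j ∈ S, (starRingEnd ℂ) (T i)*T j *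
          ((f i n*(starRingEnd ℂ) (f j n))*(1/(n : ℂ))) := by
        intro n
        rw [← Complex.mul_conj']
        simp only [U, map_sum, map_mul, Complex.conj_conj]
        rw [Finset.sum_mul_sum, mul_sum]
        simp only [mul_sum]
        refine sum_congr rfl fun i _ => sum_congr rfl fun j _ => ?_
        ring
      simp only [this]
      rw [sum_comm]
      refine sum_congr rfl fun i _ => ?_
      rw [sum_comm]
    have h2 : ∑ n ∈ Ico V M, (1/(n:ℝ))*‖U n‖^2 ≤ ∑ i ∈ S, ∑ j ∈ S, ‖T i‖*‖T j‖ *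
        ((if i = j then 1+log M else 0)+B/V) := by
      have h := congrArg norm h1
      rw [Complex.norm_real, Real.norm_of_nonneg (sum_nonneg fun n _ => by positivity)] at h
      rw [h]
      refine (norm_sum_le _ _).trans (sum_le_sum fun i hi => ?_)
      refine (norm_sum_le _ _).trans (sum_le_sum fun j hj => ?_)
      rw [norm_mul, norm_mul, RCLike.norm_conj]
      gcongr
      by_cases hij : i = j
      · rw [if_pos hij]
        have hb : 0 ≤ B/V := by positivity
        refine le_trans ?_ (le_add_of_nonneg_right hb)
        refine (norm_sum_le _ _).trans ?_
        refine le_trans ?_ (sum_one_div_le M)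
        refine le_trans (b := ∑ n ∈ Ico V M, 1/(n:ℝ)) (sum_le_sum fun n _ => ?_) ?_
        · rw [norm_mul, norm_mul, RCLike.norm_conj, Complex.norm_real,
            Real.norm_of_nonneg (by positivity : 0 ≤ 1/(n:ℝ))]
          have a1 := hf1 i hi n
          have a2 := hf1 j hj n
          have a3 : ‖f i n‖*‖f j n‖ ≤ 1 := mul_le_one₀ a1 (norm_nonneg _) a2
          exact mul_le_of_le_one_left (by positivity) a3
        · apply sum_le_sum_of_subset_of_nonneg
          · intro x hx; simp only [mem_Ico] at *; omega
          · intros; positivity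
      · rw [if_neg hij, zero_add]
        exact sum_div_nat_le _ B (hB i hi j hj hij) V M hV
    refine h2.trans ?_
    have h3 : ∑ i ∈ S, ∑ j ∈ S, ‖T i‖*‖T j‖*((if i = j then 1+log M else 0)+B/V)
        = (1+log M)*Z+(B/V)*(∑ i ∈ S, ‖T i‖)^2 := by
      simp only [mul_add, sum_add_distrib]
      congr 1
      · rw [hZ, mul_sum]
        refine sum_congr rfl fun i hi => ?_
        simp only [mul_ite, mul_zero]
        rw [Finset.sum_ite_eq, if_pos hi]
        ring
      · rw [sq, Finset.sum_mul_sum, mul_sum]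
        refine sum_congr rfl fun i hi => ?_
        rw [mul_sum]
        refine sum_congr rfl fun j hj => ?_
        ring
    rw [h3, hK, add_mul]
    have h4 : (∑ i ∈ S, ‖T i‖)^2 ≤ S.card*Z := sq_sum_le_card_mul_sum_sq
    have hb : 0 ≤ B/V := by positivity
    have := mul_le_mul_of_nonneg_left h4 hb
    nlinarith
  have e5 : Z^2 ≤ A*(K*Z) := e3.trans (mul_le_mul_of_nonneg_left e4 hA0)
  rcases hZ0.eq_or_lt with h0 | h0
  · rw [← h0]; positivity
  · have : Z*Z ≤ (K*A)*Z := by nlinarith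
    exact le_of_mul_le_mul_right this h0
end

section
open Finset
open ArithmeticFunction (vonMangoldt zeta moebius)
open scoped ArithmeticFunction.vonMangoldt ArithmeticFunction.zeta ArithmeticFunction.Moebius

/-! ## Vaughan's identity, type I part -/

def truncA (f : ArithmeticFunction ℝ) (V:ℕ) : ArithmeticFunction ℝ :=
  ⟨fun n => if n ≤ V then f n else 0, by simp⟩

lemma truncA_apply (f : ArithmeticFunction ℝ) (V n:ℕ) :
    truncA f V n = if n ≤ V then f n else 0 := rfl

lemma sum_conv_prod (f g : ArithmeticFunction ℝ) (H : ℕ → ℂ) (N:ℕ) :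
    ∑ n ∈ Ioc 0 N, ((f*g) n : ℂ)*H n =
      ∑ x ∈ (Ioc 0 N ×ˢ Ioc 0 N).filter (fun x => x.1*x.2 ≤ N),
        (f x.1 : ℂ)*(g x.2 : ℂ)*H (x.1*x.2) := by
  simp only [ArithmeticFunction.mul_apply]
  trans ∑ n ∈ Ioc 0 N, ∑ x ∈ Ioc 0 N ×ˢ Ioc 0 N with x.1*x.2 = n,
    (f x.1 : ℂ)*(g x.2 : ℂ)*H (x.1*x.2)
  · refine sum_congr rfl fun n hn ↦ ?_
    simp only [mem_Ioc] at hn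
    rw [Nat.divisorsAntidiagonal_eq_prod_filter_of_le hn.1.ne' hn.2]
    push_cast
    rw [sum_mul]
    refine sum_congr rfl fun x hx => ?_
    rw [(Finset.mem_filter.1 hx).2]
  · simp_rw [sum_filter]
    rw [sum_comm]
    exact sum_congr rfl fun _ _ ↦ (by simp_all)

lemma sum_conv (f g : ArithmeticFunction ℝ) (H : ℕ → ℂ) (N:ℕ) :
    ∑ n ∈ Ioc 0 N, ((f*g) n : ℂ)*H n =
      ∑ d ∈ Ioc 0 N, ∑ e ∈ Ioc 0 (N/d), (f d : ℂ)*(g e : ℂ)*H (d*e) := by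
  rw [sum_conv_prod, sum_filter, sum_product]
  refine sum_congr rfl fun n hn ↦ ?_
  rw [← sum_filter]
  congr 1
  ext x
  simp only [mem_filter, mem_Ioc, and_assoc, and_congr_right_iff] at hn ⊢
  intro _
  constructor
  · intro ⟨_, h⟩
    rw [Nat.le_div_iff_mul_le hn.1]; linarith [mul_comm n x]
  · intro hm
    rw [Nat.le_div_iff_mul_le hn.1] at hm
    exact ⟨le_trans (Nat.le_mul_of_pos_right x hn.1) hm, by linarith [mul_comm n x]⟩

lemma log_mul_FF (m:ℕ) (L:ℝ) (hL : 1 ≤ L) (n:ℕ) :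
    log n*FF m L n = L*FF (m+1) L n := by
  unfold FF phiW
  have : L ≠ 0 := by linarith
  have h : log n = L*(log n/L) := by field_simp
  calc _ = (L*(log n/L))*((log n/L)^m*exp (-(log n-L)^2)) := by
        rw [← h]
    _ = _ := by ring

lemma sum_Ioc_FF_le (m:ℕ) (hm : m ≠ 0) (L:ℝ) (hL : 1 ≤ L) (f : ℕ → ℂ) (B:ℝ)
    (hB : ∀ a b, ‖∑ i ∈ Ico a b, f i‖ ≤ B) (d:ℕ) (hd : 1 ≤ d) (M:ℕ) :
    ‖∑ n ∈ Ioc 0 M, f n*(FF m L (d*n) : ℂ)‖ ≤ B*(CF m*(3+log ((M+1:ℕ):ℝ))) := by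
  have h := sum_FF_le m L hL f B hB d hd (M+1)
  rw [Finset.sum_range_succ'] at h
  simp only [mul_zero, FF_zero m L hm, Complex.ofReal_zero, add_zero] at h
  convert! h using 2
  rw [Finset.range_eq_Ico]
  rw [Finset.sum_Ico_add' (fun n => f n*(FF m L (d*n) : ℂ)) 0 M 1]
  rfl

structure MChar (f : ℕ → ℂ) (B:ℝ) : Prop where
  mul : ∀ a b, f (a*b) = f a*f b
  norm : ∀ a, ‖f a‖ ≤ 1
  sum : ∀ a b, ‖∑ i ∈ Ico a b, f i‖ ≤ B

lemma typeI (m:ℕ) (hm : m ≠ 0) (L:ℝ) (hL : 1 ≤ L) (f : ℕ → ℂ) (B:ℝ) (hf : MChar f B)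
    (c : ArithmeticFunction ℝ) (D:ℕ) (K:ℝ) (hD : ∀ d, D < d → c d = 0)
    (hK : ∀ d, d ≤ D → |c d| ≤ K) (N:ℕ) :
    ‖∑ n ∈ Ioc 0 N, ((c*(ζ : ArithmeticFunction ℝ)) n : ℂ)*(FF m L n*f n)‖ ≤
      D*(K*(B*(CF m*(3+log ((N+1:ℕ):ℝ))))) := by
  have hB0 : 0 ≤ B := (norm_nonneg _).trans (hf.sum 0 0)
  have hC := (CF_pos m).le
  have hlog := Real.log_natCast_nonneg (N+1)
  have hK0 : 0 ≤ K := (abs_nonneg _).trans (hK 0 (Nat.zero_le _))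
  rw [sum_conv]
  refine (norm_sum_le _ _).trans ?_
  have hterm : ∀ d ∈ Ioc 0 N,
      ‖∑ e ∈ Ioc 0 (N/d), (c d : ℂ)*((ζ : ArithmeticFunction ℝ) e : ℂ) *
        (FF m L (d*e)*f (d*e))‖ ≤
      if d ≤ D then K*(B*(CF m*(3+log ((N+1:ℕ):ℝ)))) else 0 := by
    intro d hd
    have hd' := Finset.mem_Ioc.1 hd
    have e1 : ∑ e ∈ Ioc 0 (N/d), (c d : ℂ)*((ζ : ArithmeticFunction ℝ) e : ℂ) *
        (FF m L (d*e)*f (d*e)) = (c d : ℂ)*f d *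
          ∑ e ∈ Ioc 0 (N/d), f e*(FF m L (d*e) : ℂ) := by
      rw [mul_sum]
      refine sum_congr rfl fun e he => ?_
      have he' : e ≠ 0 := by have := Finset.mem_Ioc.1 he; omega
      rw [ArithmeticFunction.natCoe_apply, ArithmeticFunction.zeta_apply_ne he', hf.mul]
      push_cast; ring
    split_ifs with h
    · rw [e1, norm_mul, norm_mul, Complex.norm_real, Real.norm_eq_abs]
      have h1 := hK d h
      have h2 := hf.norm d
      have h3 := sum_Ioc_FF_le m hm L hL f B hf.sum d (by omega) (N/d)
      have h4 : log ((N/d+1:ℕ):ℝ) ≤ log ((N+1:ℕ):ℝ) := by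
        apply Real.log_le_log (by positivity)
        exact_mod_cast Nat.succ_le_succ (Nat.div_le_self N d)
      have h5 : |c d| * ‖f d‖ ≤ K := by
        calc |c d| * ‖f d‖ ≤ K*1 := by gcongr
          _ = K := mul_one K
      refine mul_le_mul h5 (h3.trans ?_) (norm_nonneg _) hK0
      gcongr
    · rw [e1, hD d (by omega)]; simp
  refine (sum_le_sum hterm).trans ?_
  rw [← sum_filter, Finset.sum_const, nsmul_eq_mul]
  gcongr
  calc _ ≤ (Ioc 0 D).card := by
        apply Finset.card_le_card
        intro x hx
        simp only [mem_filter, mem_Ioc] at *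
        omega
    _ = D := by simp

noncomputable def lamV (V:ℕ) : ArithmeticFunction ℝ := truncA Λ V
noncomputable def muV (V:ℕ) : ArithmeticFunction ℝ := truncA (μ : ArithmeticFunction ℝ) V
noncomputable def betaV (V:ℕ) : ArithmeticFunction ℝ := 1-muV V*(ζ : ArithmeticFunction ℝ)

lemma vaughan (V:ℕ) : (Λ : ArithmeticFunction ℝ) = lamV V+muV V*ArithmeticFunction.log
    - (lamV V*muV V)*(ζ : ArithmeticFunction ℝ)+(Λ-lamV V)*betaV V := by
  rw [← ArithmeticFunction.vonMangoldt_mul_zeta, betaV]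
  ring

lemma muV_le (V d:ℕ) : |muV V d| ≤ 1 := by
  unfold muV
  rw [truncA_apply]
  split_ifs
  · rw [ArithmeticFunction.intCoe_apply]
    exact_mod_cast ArithmeticFunction.abs_moebius_le_one
  · simp

lemma lamV_nonneg (V d:ℕ) : 0 ≤ lamV V d := by
  unfold lamV; rw [truncA_apply]; split_ifs
  · exact ArithmeticFunction.vonMangoldt_nonneg
  · rfl

lemma lamV_le (V d:ℕ) : lamV V d ≤ Λ d := by
  unfold lamV; rw [truncA_apply]; split_ifs
  · rfl
  · exact ArithmeticFunction.vonMangoldt_nonneg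

lemma conv_supp (f g : ArithmeticFunction ℝ) (V U d:ℕ) (hf : ∀ d, V < d → f d = 0)
    (hg : ∀ d, U < d → g d = 0) (hd : V*U < d) : (f*g) d = 0 := by
  rw [ArithmeticFunction.mul_apply]
  apply Finset.sum_eq_zero
  intro x hx
  have hx' := (Nat.mem_divisorsAntidiagonal.1 hx).1
  by_cases h1 : V < x.1
  · rw [hf _ h1, zero_mul]
  by_cases h2 : U < x.2
  · rw [hg _ h2, mul_zero]
  exfalso
  have : x.1*x.2 ≤ V*U := Nat.mul_le_mul (by omega) (by omega)
  omega

lemma lam_conv_mu_le (V d:ℕ) : |(lamV V*muV V) d| ≤ log d := by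
  rw [ArithmeticFunction.mul_apply, ← ArithmeticFunction.vonMangoldt_sum]
  refine (Finset.abs_sum_le_sum_abs _ _).trans ?_
  rw [Nat.sum_divisorsAntidiagonal (f := fun a b => |lamV V a*muV V b|)]
  refine sum_le_sum fun i _ => ?_
  rw [abs_mul, abs_of_nonneg (lamV_nonneg V i)]
  calc _ ≤ lamV V i*1 := by
        gcongr
        · exact lamV_nonneg V i
        · exact muV_le V _
    _ ≤ _ := by rw [mul_one]; exact lamV_le V i

lemma conv_log (c : ArithmeticFunction ℝ) (n:ℕ) :
    (c*ArithmeticFunction.log) n = log n*(c*(ζ : ArithmeticFunction ℝ)) n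
      - ((c.pmul ArithmeticFunction.log)*(ζ : ArithmeticFunction ℝ)) n := by
  simp only [ArithmeticFunction.mul_apply, mul_sum]
  rw [← sum_sub_distrib]
  refine sum_congr rfl fun x hx => ?_
  have hx' := Nat.mem_divisorsAntidiagonal.1 hx
  have h1 : x.1 ≠ 0 := fun h => hx'.2 (by rw [← hx'.1, h, zero_mul])
  have h2 : x.2 ≠ 0 := fun h => hx'.2 (by rw [← hx'.1, h, mul_zero])
  rw [ArithmeticFunction.natCoe_apply, ArithmeticFunction.zeta_apply_ne h2, ← hx'.1,
    ArithmeticFunction.pmul_apply, ArithmeticFunction.log_apply, ArithmeticFunction.log_apply, Nat.cast_mul,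
    Real.log_mul (by exact_mod_cast h1) (by exact_mod_cast h2)]
  push_cast; ring

lemma typeI_total (m:ℕ) (hm : m ≠ 0) (L:ℝ) (hL : 1 ≤ L) (f : ℕ → ℂ) (B:ℝ) (hB1 : 1 ≤ B)
    (hf : MChar f B) (V N:ℕ) (hV : 1 ≤ V) (hVL : log V ≤ L) (hN : log ((N+1:ℕ):ℝ) ≤ 2*L) :
    ‖∑ n ∈ Ioc 0 N, (Λ n : ℂ)*(FF m L n*f n) -
      ∑ n ∈ Ioc 0 N, (((Λ-lamV V)*betaV V : ArithmeticFunction ℝ) n : ℂ)*(FF m L n*f n)‖ ≤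
      (20*(CF m+CF (m+1)))*((V:ℝ)^2*B*L^2) := by
  have hC := (CF_pos m).le
  have hC1 := (CF_pos (m+1)).le
  have hV' : (1:ℝ) ≤ V := by exact_mod_cast hV
  have hVV : (V:ℝ) ≤ (V:ℝ)^2 := by nlinarith
  have hlN := Real.log_natCast_nonneg (N+1)
  have hlV := Real.log_natCast_nonneg V
  have key : ∀ n, (Λ n : ℂ)*(FF m L n*f n) -
      (((Λ-lamV V)*betaV V : ArithmeticFunction ℝ) n : ℂ)*(FF m L n*f n) =
      (lamV V n : ℂ)*(FF m L n*f n) +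
      L*(((muV V*(ζ : ArithmeticFunction ℝ)) n : ℂ)*(FF (m+1) L n*f n)) -
      ((((muV V).pmul ArithmeticFunction.log)*(ζ : ArithmeticFunction ℝ) : ArithmeticFunction ℝ) n : ℂ)*(FF m L n*f n) -
      (((lamV V*muV V)*(ζ : ArithmeticFunction ℝ) : ArithmeticFunction ℝ) n : ℂ)*(FF m L n*f n) := by
    intro n
    have h1 : Λ n = lamV V n+(muV V*ArithmeticFunction.log) n
      - ((lamV V*muV V)*(ζ : ArithmeticFunction ℝ)) n+((Λ-lamV V)*betaV V) n := by
      conv_lhs => rw [vaughan V]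
      rfl
    have h2 := log_mul_FF m L hL n
    rw [conv_log] at h1
    have h3 : (L:ℂ)*(FF (m+1) L n : ℂ) = log n*FF m L n := by exact_mod_cast h2.symm
    rw [show (L:ℂ)*(((muV V*(ζ : ArithmeticFunction ℝ)) n : ℂ)*(FF (m+1) L n*f n)) =
      ((muV V*(ζ : ArithmeticFunction ℝ)) n : ℂ)*(((L:ℂ)*FF (m+1) L n)*f n) by ring, h3, h1]
    push_cast; ring
  rw [← sum_sub_distrib, sum_congr rfl fun n _ => key n, sum_sub_distrib,
    sum_sub_distrib, sum_add_distrib, ← mul_sum]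
  have t1 : ‖∑ n ∈ Ioc 0 N, (lamV V n : ℂ)*(FF m L n*f n)‖ ≤ V*(L*CF m) := by
    refine (norm_sum_le _ _).trans ?_
    have : ∀ n ∈ Ioc 0 N, ‖(lamV V n : ℂ)*(FF m L n*f n)‖ ≤ if n ≤ V then L*CF m else 0 := by
      intro n hn
      split_ifs with h
      · rw [norm_mul, norm_mul, Complex.norm_real, Complex.norm_real,
          Real.norm_of_nonneg (lamV_nonneg V n), Real.norm_of_nonneg (FF_nonneg m L n hL)]
        have a1 : lamV V n ≤ L := by
          refine (lamV_le V n).trans (ArithmeticFunction.vonMangoldt_le_log.trans (le_trans ?_ hVL))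
          have : 0 < n := (Finset.mem_Ioc.1 hn).1
          apply Real.log_le_log (by exact_mod_cast this)
          exact_mod_cast h
        have a2 := FF_le m L n hL
        have a3 := hf.norm n
        have a4 := FF_nonneg m L n hL
        have a5 := lamV_nonneg V n
        have a6 : FF m L n*‖f n‖ ≤ CF m := (mul_le_of_le_one_right a4 a3).trans a2
        exact mul_le_mul a1 a6 (by positivity) (by linarith)
      · rw [lamV, truncA_apply, if_neg h]; simp
    refine (sum_le_sum this).trans ?_
    rw [← sum_filter, Finset.sum_const, nsmul_eq_mul]
    gcongr
    calc _ ≤ (Ioc 0 V).card := by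
          apply Finset.card_le_card
          intro x hx
          simp only [mem_filter, mem_Ioc] at *
          omega
      _ = V := by simp
  have hmu0 : ∀ d, V < d → muV V d = 0 := fun d hd => by
    rw [muV, truncA_apply, if_neg (by omega)]
  have hlam0 : ∀ d, V < d → lamV V d = 0 := fun d hd => by
    rw [lamV, truncA_apply, if_neg (by omega)]
  have hlogd : ∀ d W : ℕ, 1 ≤ W → d ≤ W → log d ≤ log W := by
    intro d W hW hd
    rcases Nat.eq_zero_or_pos d with rfl | h
    · simp [Real.log_natCast_nonneg]
    · exact Real.log_le_log (by exact_mod_cast h) (by exact_mod_cast hd)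
  have t2 := typeI (m+1) (by omega) L hL f B hf (muV V) V 1 hmu0 (fun d _ => muV_le V d) N
  have t3 := typeI m hm L hL f B hf ((muV V).pmul ArithmeticFunction.log) V L
    (fun d hd => by rw [ArithmeticFunction.pmul_apply, hmu0 d hd, zero_mul])
    (fun d hd => by
      rw [ArithmeticFunction.pmul_apply, abs_mul, ArithmeticFunction.log_apply,
        abs_of_nonneg (Real.log_natCast_nonneg d)]
      calc _ ≤ 1*L := by
            gcongr
            · exact muV_le V d
            · exact (hlogd d V hV hd).trans hVL
        _ = L := one_mul L) N
  have t4 := typeI m hm L hL f B hf (lamV V*muV V) (V*V) (2*L)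
    (fun d hd => conv_supp _ _ V V d hlam0 hmu0 hd)
    (fun d hd => (lam_conv_mu_le V d).trans (by
      refine (hlogd d (V*V) (Nat.mul_pos hV hV) hd).trans ?_
      rw [Nat.cast_mul, Real.log_mul (by positivity) (by positivity)]; linarith)) N
  have hb : 3+log ((N+1:ℕ):ℝ) ≤ 5*L := by linarith
  have hLL : L ≤ L^2 := by nlinarith
  have T2 : V*(1*(B*(CF (m+1)*(3+log ((N+1:ℕ):ℝ))))) ≤
      (V:ℝ)^2*(1*(B*(CF (m+1)*(5*L)))) := by gcongr
  have T3 : V*(L*(B*(CF m*(3+log ((N+1:ℕ):ℝ))))) ≤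
      (V:ℝ)^2*(L*(B*(CF m*(5*L)))) := by gcongr
  have T4 : ((V*V:ℕ):ℝ)*(2*L*(B*(CF m*(3+log ((N+1:ℕ):ℝ))))) ≤
      (V:ℝ)^2*(2*L*(B*(CF m*(5*L)))) := by
    rw [Nat.cast_mul, ← sq]; gcongr
  have T1 : V*(L*CF m) ≤ (V:ℝ)^2*(B*L^2*CF m) := by
    have : L ≤ B*L^2 := by nlinarith [sq_nonneg L]
    gcongr
  have N2 : ‖(L:ℂ)*∑ n ∈ Ioc 0 N, ((muV V*(ζ : ArithmeticFunction ℝ)) n : ℂ)*(FF (m+1) L n*f n)‖ ≤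
      L*((V:ℝ)^2*(1*(B*(CF (m+1)*(5*L))))) := by
    rw [norm_mul, Complex.norm_real, Real.norm_of_nonneg (by linarith)]
    gcongr
    exact t2.trans T2
  refine (norm_sub_le _ _).trans ?_
  refine (add_le_add (norm_sub_le _ _) le_rfl).trans ?_
  refine (add_le_add (add_le_add (norm_add_le _ _) le_rfl) le_rfl).trans ?_
  have hfin : (V:ℝ)^2*(B*L^2*CF m)+L*((V:ℝ)^2*(1*(B*(CF (m+1)*(5*L))))) +
     (V:ℝ)^2*(L*(B*(CF m*(5*L))))+(V:ℝ)^2*(2*L*(B*(CF m*(5*L))))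
     ≤ (20*(CF m+CF (m+1)))*((V:ℝ)^2*B*L^2) := by
    have : 0 ≤ (V:ℝ)^2*B*L^2 := by positivity
    nlinarith [mul_nonneg hC this, mul_nonneg hC1 this]
  linarith [t1.trans T1, N2, t3.trans T3, t4.trans T4]
end

section
open Finset
open ArithmeticFunction (vonMangoldt zeta moebius)
open scoped ArithmeticFunction.vonMangoldt ArithmeticFunction.zeta ArithmeticFunction.Moebius

/-! ## Gaussian kernel -/

noncomputable def KK (σ t:ℝ) : ℂ :=
  ((1/(2*Real.sqrt Real.pi):ℝ) : ℂ)*Complex.exp (((σ : ℂ)-Complex.I*t)^2/4)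

lemma KK_norm (σ t:ℝ) :
    ‖KK σ t‖ = (1/(2*Real.sqrt Real.pi))*(exp (σ^2/4)*exp (-(1/4)*t^2)) := by
  unfold KK
  rw [norm_mul, Complex.norm_real, Real.norm_of_nonneg (by positivity), Complex.norm_exp,
    ← Real.exp_add]
  congr 2
  have : ((σ : ℂ)-Complex.I*t)^2/4 = ((σ^2/4 + -(1/4)*t^2:ℝ) : ℂ) +
      ((-(σ*t/2):ℝ) : ℂ)*Complex.I := by
    push_cast
    linear_combination ((t:ℂ)^2/4)*Complex.I_sq
  rw [this]
  simp [-Complex.ofReal_add, -Complex.ofReal_mul, -Complex.ofReal_neg]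

lemma KK_integrable_norm (σ:ℝ) : MeasureTheory.Integrable (fun t => ‖KK σ t‖) := by
  simp only [KK_norm]
  exact ((integrable_exp_neg_mul_sq (by norm_num : (0:ℝ) < 1/4)).const_mul _).const_mul _

lemma KK_continuous (σ:ℝ) : Continuous (KK σ) := by
  unfold KK; fun_prop

lemma KK_norm_integral : ∫ t, ‖KK 1 t‖ ≤ 2 := by
  simp only [KK_norm]
  rw [MeasureTheory.integral_const_mul, MeasureTheory.integral_const_mul, integral_gaussian]
  have h1 : Real.sqrt (Real.pi/(1/4)) = 2*Real.sqrt Real.pi := by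
    rw [show Real.pi/(1/4) = 2^2*Real.pi by ring, Real.sqrt_mul (by norm_num), Real.sqrt_sq (by norm_num)]
  rw [h1]
  have hp : 0 < Real.sqrt Real.pi := Real.sqrt_pos.2 Real.pi_pos
  have : 1/(2*Real.sqrt Real.pi)*(exp (1^2/4)*(2*Real.sqrt Real.pi)) = exp (1/4) := by
    field_simp
  rw [this]
  have h2 : exp (1/4) ≤ exp (1/2) := Real.exp_le_exp.2 (by norm_num)
  have h3 : exp (1/2) ≤ 2 := by
    have : exp (1/2)^2 = exp 1 := by rw [← Real.exp_nat_mul]; norm_num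
    have h4 := Real.exp_one_lt_d9
    nlinarith [Real.exp_pos (1/2)]
  linarith

lemma KK_int (σ u:ℝ) :
    ∫ t : ℝ, KK σ t*Complex.exp (Complex.I*t*u) = (exp (σ*u-u^2) : ℂ) := by
  have h := integral_cexp_quadratic (b := (-(1/4) : ℂ)) (by norm_num) (Complex.I*(u-σ/2)) ((σ:ℂ)^2/4)
  have e : ∀ t : ℝ, KK σ t*Complex.exp (Complex.I*t*u) =
      ((1/(2*Real.sqrt Real.pi):ℝ) : ℂ) *
      Complex.exp (-(1/4)*(t:ℂ)^2+Complex.I*(u-σ/2)*t+(σ:ℂ)^2/4) := by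
    intro t
    unfold KK
    rw [mul_assoc, ← Complex.exp_add]
    congr 2
    linear_combination ((t:ℂ)^2/4)*Complex.I_sq
  simp only [e]
  rw [MeasureTheory.integral_const_mul, h]
  have h1 : ((Real.pi : ℂ) / - -(1/4))^(1/2 : ℂ) = ((2*Real.sqrt Real.pi:ℝ) : ℂ) := by
    have : (Real.pi : ℂ) / - -(1/4) = ((4*Real.pi:ℝ) : ℂ) := by push_cast; ring
    rw [this, show (1/2 : ℂ) = ((1/2:ℝ) : ℂ) by push_cast; ring,
      ← Complex.ofReal_cpow (by positivity), ← Real.sqrt_eq_rpow,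
      show 4*Real.pi = 2^2*Real.pi by ring, Real.sqrt_mul (by norm_num), Real.sqrt_sq (by norm_num)]
  rw [h1, ← mul_assoc, ← Complex.ofReal_mul]
  have hp : 0 < Real.sqrt Real.pi := Real.sqrt_pos.2 Real.pi_pos
  rw [show 1/(2*Real.sqrt Real.pi)*(2*Real.sqrt Real.pi) = 1 by field_simp]
  rw [Complex.ofReal_one, one_mul, Complex.ofReal_exp]
  congr 1
  push_cast
  linear_combination ((u:ℂ)-σ/2)^2*Complex.I_sq

lemma norm_exp_I_mul (t u:ℝ) : ‖Complex.exp (Complex.I*t*u)‖ = 1 := by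
  rw [show Complex.I*(t:ℂ)*u = ((t*u:ℝ) : ℂ)*Complex.I by push_cast; ring]
  exact Complex.norm_exp_ofReal_mul_I _

lemma KK_mul_integrable (σ u:ℝ) :
    MeasureTheory.Integrable (fun t : ℝ => KK σ t*Complex.exp (Complex.I*t*u)) := by
  refine (KK_integrable_norm σ).mono' ?_ (Filter.Eventually.of_forall fun t => ?_)
  · have := KK_continuous σ
    exact (by fun_prop : Continuous fun t : ℝ => KK σ t*Complex.exp (Complex.I*t*u)).aestronglyMeasurable
  · rw [norm_mul, norm_exp_I_mul, mul_one]

lemma gauss_sum_bound {ω : Type*} (Ω : Finset ω) (c : ω → ℂ) (u : ω → ℝ) (D:ℝ)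
    (hD : ∀ t : ℝ, ‖∑ w ∈ Ω, c w*Complex.exp (Complex.I*t*u w)‖ ≤ D) :
    ‖∑ w ∈ Ω, c w*(exp (u w-u w^2) : ℂ)‖ ≤ 2*D := by
  have hD0 : 0 ≤ D := (norm_nonneg _).trans (hD 0)
  have e : ∑ w ∈ Ω, c w*(exp (u w-u w^2) : ℂ) =
      ∫ t : ℝ, ∑ w ∈ Ω, c w*(KK 1 t*Complex.exp (Complex.I*t*u w)) := by
    rw [MeasureTheory.integral_finsetSum]
    · refine sum_congr rfl fun w _ => ?_
      rw [MeasureTheory.integral_const_mul, KK_int, one_mul]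
    · intro w _
      exact (KK_mul_integrable 1 (u w)).const_mul _
  rw [e]
  refine (MeasureTheory.norm_integral_le_of_norm_le ((KK_integrable_norm 1).mul_const D)
    (Filter.Eventually.of_forall fun t => ?_)).trans ?_
  · have : ∑ w ∈ Ω, c w*(KK 1 t*Complex.exp (Complex.I*t*u w)) =
        KK 1 t*∑ w ∈ Ω, c w*Complex.exp (Complex.I*t*u w) := by
      rw [mul_sum]
      exact sum_congr rfl fun w _ => by ring
    rw [this, norm_mul]
    gcongr
    exact hD t
  · rw [MeasureTheory.integral_mul_const]
    exact mul_le_mul_of_nonneg_right KK_norm_integral hD0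

/-! ## divisor sums -/

lemma sum_antidiag_le (F : ℕ × ℕ → ℝ) (hF : ∀ x, 0 ≤ F x) (N:ℕ) :
    ∑ b ∈ Ioc 0 N, ∑ x ∈ b.divisorsAntidiagonal, F x ≤ ∑ x ∈ Ioc 0 N ×ˢ Ioc 0 N, F x := by
  have h : ∑ b ∈ Ioc 0 N, ∑ x ∈ b.divisorsAntidiagonal, F x =
      ∑ b ∈ Ioc 0 N, ∑ x ∈ Ioc 0 N ×ˢ Ioc 0 N, if x.1*x.2 = b then F x else 0 := by
    refine sum_congr rfl fun n hn ↦ ?_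
    simp only [mem_Ioc] at hn
    rw [Nat.divisorsAntidiagonal_eq_prod_filter_of_le hn.1.ne' hn.2, sum_filter]
  rw [h, sum_comm]
  refine sum_le_sum fun x _ => ?_
  rw [Finset.sum_ite_eq]
  split_ifs
  · exact le_rfl
  · exact hF x

lemma card_antidiag (b:ℕ) : b.divisorsAntidiagonal.card = b.divisors.card := by
  rw [Finset.card_eq_sum_ones, Finset.card_eq_sum_ones,
    Nat.sum_divisorsAntidiagonal (f := fun _ _ => 1)]

lemma card_divisors_mul_le (a b:ℕ) : (a*b).divisors.card ≤ a.divisors.card*b.divisors.card := by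
  open scoped Pointwise in
  rw [Nat.divisors_mul]
  open scoped Pointwise in
  exact Finset.card_mul_le

lemma sum_Ioc_one_div_le (N:ℕ) : ∑ i ∈ Ioc 0 N, (1:ℝ)/i ≤ 1+log ((N+1:ℕ):ℝ) := by
  have h := sum_one_div_le (N+1)
  exact h

lemma sum_tau_div_le (N:ℕ) : ∑ b ∈ Ioc 0 N, (b.divisors.card:ℝ)/b ≤
    (1+log ((N+1:ℕ):ℝ))^2 := by
  have h := sum_antidiag_le (fun x => (1/(x.1:ℝ))*(1/x.2)) (fun x => by positivity) N
  rw [sum_product] at h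
  dsimp only at h
  rw [← Finset.sum_mul_sum] at h
  have e : ∑ b ∈ Ioc 0 N, (b.divisors.card:ℝ)/b =
      ∑ b ∈ Ioc 0 N, ∑ x ∈ b.divisorsAntidiagonal, (1/(x.1:ℝ))*(1/x.2) := by
    refine sum_congr rfl fun b hb => ?_
    have : ∀ x ∈ b.divisorsAntidiagonal, (1/(x.1:ℝ))*(1/x.2) = 1/b := by
      intro x hx
      rw [← (Nat.mem_divisorsAntidiagonal.1 hx).1]
      push_cast
      rw [one_div_mul_one_div]
    rw [sum_congr rfl this, Finset.sum_const, nsmul_eq_mul, card_antidiag]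
    ring
  rw [e]
  refine h.trans ?_
  rw [← sq]
  have h0 : 0 ≤ ∑ i ∈ Ioc 0 N, (1:ℝ)/i := sum_nonneg fun i _ => by positivity
  gcongr
  exact sum_Ioc_one_div_le N

lemma sum_tau_sq_div_le (N:ℕ) : ∑ b ∈ Ioc 0 N, (b.divisors.card:ℝ)^2/b ≤
    (1+log ((N+1:ℕ):ℝ))^4 := by
  have h := sum_antidiag_le (fun x => ((x.1.divisors.card:ℝ)/x.1)*((x.2.divisors.card:ℝ)/x.2))
    (fun x => by positivity) N
  rw [sum_product] at h
  dsimp only at h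
  rw [← Finset.sum_mul_sum] at h
  have e : ∑ b ∈ Ioc 0 N, (b.divisors.card:ℝ)^2/b ≤
      ∑ b ∈ Ioc 0 N, ∑ x ∈ b.divisorsAntidiagonal,
        ((x.1.divisors.card:ℝ)/x.1)*((x.2.divisors.card:ℝ)/x.2) := by
    refine sum_le_sum fun b hb => ?_
    have : ∀ x ∈ b.divisorsAntidiagonal, (b.divisors.card:ℝ)/b ≤
        ((x.1.divisors.card:ℝ)/x.1)*((x.2.divisors.card:ℝ)/x.2) := by
      intro x hx
      rw [← (Nat.mem_divisorsAntidiagonal.1 hx).1, div_mul_div_comm]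
      push_cast
      gcongr
      exact_mod_cast card_divisors_mul_le x.1 x.2
    refine le_trans ?_ (sum_le_sum this)
    rw [Finset.sum_const, nsmul_eq_mul, card_antidiag]
    apply le_of_eq; ring
  refine e.trans (h.trans ?_)
  have h0 : 0 ≤ ∑ b ∈ Ioc 0 N, (b.divisors.card:ℝ)/b := sum_nonneg fun i _ => by positivity
  calc _ ≤ (1+log ((N+1:ℕ):ℝ))^2*(1+log ((N+1:ℕ):ℝ))^2 := by
        have := sum_tau_div_le N
        gcongr
    _ = _ := by ring

/-! ## the coefficients -/

lemma betaV_zero (V b:ℕ) (hb : b ≤ V) : betaV V b = 0 := by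
  have h : (muV V*(ζ : ArithmeticFunction ℝ)) b = ((μ : ArithmeticFunction ℝ)*(ζ : ArithmeticFunction ℝ)) b := by
    rw [ArithmeticFunction.mul_apply, ArithmeticFunction.mul_apply]
    refine sum_congr rfl fun x hx => ?_
    have hx' := Nat.mem_divisorsAntidiagonal.1 hx
    have : x.1 ≤ b := Nat.le_of_dvd (Nat.pos_of_ne_zero hx'.2) ⟨x.2, hx'.1.symm⟩
    rw [muV, truncA_apply, if_pos (this.trans hb)]
  rw [ArithmeticFunction.coe_moebius_mul_coe_zeta] at h
  change (1 : ArithmeticFunction ℝ) b-_ = 0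
  rw [h, sub_self]

lemma betaV_le (V b:ℕ) (hV : 1 ≤ V) : |betaV V b| ≤ b.divisors.card := by
  by_cases hb : b ≤ V
  · rw [betaV_zero V b hb]; simp
  have h1 : (1 : ArithmeticFunction ℝ) b = 0 := ArithmeticFunction.one_apply_ne (by omega)
  have : betaV V b = - (muV V*(ζ : ArithmeticFunction ℝ)) b := by
    change (1 : ArithmeticFunction ℝ) b-_ = _
    rw [h1, zero_sub]
  rw [this, abs_neg, ArithmeticFunction.mul_apply, ← card_antidiag]
  refine (Finset.abs_sum_le_sum_abs _ _).trans ?_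
  refine (Finset.sum_le_card_nsmul _ _ 1 fun x hx => ?_).trans (by simp)
  have hx' := Nat.mem_divisorsAntidiagonal.1 hx
  have h2 : x.2 ≠ 0 := fun h => hx'.2 (by rw [← hx'.1, h, mul_zero])
  rw [ArithmeticFunction.natCoe_apply, ArithmeticFunction.zeta_apply_ne h2]
  simpa using muV_le V x.1

lemma alphaV_apply (V a:ℕ) : (Λ-lamV V : ArithmeticFunction ℝ) a = if a ≤ V then 0 else Λ a := by
  change Λ a-lamV V a = _
  rw [lamV, truncA_apply]
  split_ifs <;> ring
end

section
open Finset
open ArithmeticFunction (vonMangoldt zeta moebius)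
open scoped ArithmeticFunction.vonMangoldt ArithmeticFunction.zeta ArithmeticFunction.Moebius

lemma exists_unimod (z : ℂ) : ∃ c : ℂ, ‖c‖ = 1 ∧ c*z = (‖z‖ : ℂ) := by
  by_cases hz : z = 0
  · exact ⟨1, by simp, by simp [hz]⟩
  · refine ⟨(starRingEnd ℂ) z / ‖z‖, ?_, ?_⟩
    · have : ‖z‖ ≠ 0 := by simpa using hz
      rw [norm_div, RCLike.norm_conj]; simp [this]
    · have : (‖z‖ : ℂ) ≠ 0 := by simpa using hz
      field_simp
      rw [Complex.conj_mul']

/-- the Dirichlet polynomial coefficients used in type II sums -/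
noncomputable def tcoef (g : ArithmeticFunction ℝ) (j:ℕ) (t:ℝ) (a:ℕ) : ℂ :=
  ((g a*log a^j/a:ℝ) : ℂ)*Complex.exp (Complex.I*t*log a)

lemma tcoef_norm (g : ArithmeticFunction ℝ) (j:ℕ) (t:ℝ) (a:ℕ) :
    ‖tcoef g j t a‖ = |g a| * log a^j/a := by
  unfold tcoef
  rw [norm_mul, norm_exp_I_mul, mul_one, Complex.norm_real, Real.norm_eq_abs, abs_div, abs_mul, abs_pow,
    abs_of_nonneg (Real.log_natCast_nonneg a), Nat.abs_cast]

lemma ls_tcoef {ι : Type*} [DecidableEq ι] (S : Finset ι) (f : ι → ℕ → ℂ) (B:ℝ)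
    (hf1 : ∀ i ∈ S, ∀ n, ‖f i n‖ ≤ 1)
    (hB : ∀ i ∈ S, ∀ j ∈ S, i ≠ j → ∀ a b, ‖∑ n ∈ Ico a b, f i n*(starRingEnd ℂ) (f j n)‖ ≤ B)
    (hB0 : 0 ≤ B) (V N:ℕ) (L:ℝ) (hL : 1 ≤ L) (hN : log ((N+1:ℕ):ℝ) ≤ 2*L)
    (hS : S.card*(B/((V+1:ℕ):ℝ)) ≤ 1)
    (g : ArithmeticFunction ℝ) (hg : ∀ a, a ≤ V → g a = 0) (G:ℝ)
    (hG : ∑ a ∈ Ioc 0 N, g a^2/a ≤ G) (j:ℕ) (t:ℝ) :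
    ∑ i ∈ S, ‖∑ a ∈ Ioc 0 N, tcoef g j t a*f i a‖^2 ≤ 4*L*(G*((2*L)^j)^2) := by
  have hG0 : 0 ≤ G := le_trans (sum_nonneg fun a _ => by positivity) hG
  have hz : ∀ a, a ≤ V → tcoef g j t a = 0 := fun a ha => by
    unfold tcoef; rw [hg a ha]; simp
  have e : ∀ i, ∑ a ∈ Ioc 0 N, tcoef g j t a*f i a = ∑ a ∈ Ico (V+1) (N+1), tcoef g j t a*f i a := by
    intro i
    symm
    apply Finset.sum_subset
    · intro x hx; simp only [mem_Ico, mem_Ioc] at *; omega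
    · intro x hx hx2
      rw [hz x, zero_mul]
      simp only [mem_Ico, mem_Ioc] at *; omega
  simp only [e]
  refine (large_sieve S f B hf1 hB hB0 (V+1) (N+1) (by omega) _).trans ?_
  refine mul_le_mul (by linarith) ?_ (sum_nonneg fun a _ => by positivity) (by linarith)
  calc ∑ n ∈ Ico (V+1) (N+1), (n:ℝ)*‖tcoef g j t n‖^2
      ≤ ∑ n ∈ Ico (V+1) (N+1), g n^2/n*((2*L)^j)^2 := by
        refine sum_le_sum fun n hn => ?_
        have hn0 : (0:ℝ) < n := by
          have := (Finset.mem_Ico.1 hn).1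
          exact_mod_cast (by omega : 0 < n)
        rw [tcoef_norm]
        have hl : log n ≤ 2*L := by
          refine le_trans (Real.log_le_log hn0 ?_) hN
          exact_mod_cast (by have := (Finset.mem_Ico.1 hn).2; omega : n ≤ N+1)
        have : (n:ℝ)*(|g n| * log n^j/n)^2 = g n^2/n*(log n^j)^2 := by
          rw [div_pow, mul_pow, sq_abs]; field_simp
        rw [this]
        have := Real.log_natCast_nonneg n
        gcongr
    _ ≤ ∑ n ∈ Ioc 0 N, g n^2/n*((2*L)^j)^2 := by
        apply sum_le_sum_of_subset_of_nonneg
        · intro x hx; simp only [mem_Ico, mem_Ioc] at *; omega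
        · intros; positivity
    _ = (∑ n ∈ Ioc 0 N, g n^2/n)*((2*L)^j)^2 := by rw [sum_mul]
    _ ≤ _ := by gcongr

lemma sum_alpha_sq (V N:ℕ) (L:ℝ) (hL : 1 ≤ L) (hN : log ((N+1:ℕ):ℝ) ≤ 2*L) :
    ∑ a ∈ Ioc 0 N, (Λ-lamV V : ArithmeticFunction ℝ) a^2/a ≤ (2*L)^2*(3*L) := by
  have h := sum_Ioc_one_div_le N
  calc _ ≤ ∑ a ∈ Ioc 0 N, (2*L)^2*(1/(a:ℝ)) := by
        refine sum_le_sum fun a ha => ?_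
        have h1 : 0 ≤ (Λ-lamV V : ArithmeticFunction ℝ) a ∧ (Λ-lamV V : ArithmeticFunction ℝ) a ≤ 2*L := by
          rw [alphaV_apply]
          split_ifs
          · exact ⟨le_rfl, by linarith⟩
          · refine ⟨ArithmeticFunction.vonMangoldt_nonneg, ArithmeticFunction.vonMangoldt_le_log.trans (le_trans ?_ hN)⟩
            have := Finset.mem_Ioc.1 ha
            apply Real.log_le_log (by exact_mod_cast this.1)
            exact_mod_cast (by omega : a ≤ N+1)
        rw [div_eq_mul_one_div]
        have := h1.1
        have := h1.2
        gcongr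
    _ = (2*L)^2*∑ a ∈ Ioc 0 N, (1/(a:ℝ)) := by rw [mul_sum]
    _ ≤ _ := by gcongr; linarith

lemma sum_beta_sq (V N:ℕ) (hV : 1 ≤ V) (L:ℝ) (hL : 1 ≤ L) (hN : log ((N+1:ℕ):ℝ) ≤ 2*L) :
    ∑ a ∈ Ioc 0 N, betaV V a^2/a ≤ (3*L)^4 := by
  have h := sum_tau_sq_div_le N
  refine le_trans (sum_le_sum fun a ha => ?_) (h.trans ?_)
  · have := betaV_le V a hV
    rw [← sq_abs]
    gcongr
  · have := Real.log_natCast_nonneg (N+1)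
    gcongr
    linarith

/-- the full bilinear sum -/
noncomputable def bilin (m:ℕ) (L:ℝ) (V N:ℕ) (f : ℕ → ℂ) : ℂ :=
  ∑ x ∈ Ioc 0 N ×ˢ Ioc 0 N, ((Λ-lamV V : ArithmeticFunction ℝ) x.1 : ℂ)*(betaV V x.2 : ℂ) *
    (FF m L (x.1*x.2)*f (x.1*x.2))

lemma bilin_sum {ι : Type*} [DecidableEq ι] (S : Finset ι) (f : ι → ℕ → ℂ) (B:ℝ)
    (hf1 : ∀ i ∈ S, ∀ n, ‖f i n‖ ≤ 1) (hfm : ∀ i ∈ S, ∀ a b, f i (a*b) = f i a*f i b)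
    (hB : ∀ i ∈ S, ∀ j ∈ S, i ≠ j → ∀ a b, ‖∑ n ∈ Ico a b, f i n*(starRingEnd ℂ) (f j n)‖ ≤ B)
    (hB0 : 0 ≤ B) (m V N:ℕ) (hV : 1 ≤ V) (L:ℝ) (hL : 1 ≤ L) (hN : log ((N+1:ℕ):ℝ) ≤ 2*L)
    (hS : S.card*(B/((V+1:ℕ):ℝ)) ≤ 1) :
    ∑ i ∈ S, ‖bilin m L V N (f i)‖ ≤ 300*4^m*(exp L*L^5) := by
  have hL0 : L ≠ 0 := by linarith
  choose ε hε1 hε2 using fun i => exists_unimod (bilin m L V N (f i))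
  set α : ArithmeticFunction ℝ := Λ-lamV V with hα
  set β : ArithmeticFunction ℝ := betaV V with hβ
  let Ω := S ×ˢ (Ioc 0 N ×ˢ Ioc 0 N)
  let c : ι × ℕ × ℕ → ℂ := fun w => ε w.1*(α w.2.1 : ℂ)*(β w.2.2 : ℂ) *
    ((((log w.2.1+log w.2.2)/L)^m/(w.2.1*w.2.2):ℝ) : ℂ)*(f w.1 w.2.1*f w.1 w.2.2)
  let u : ι × ℕ × ℕ → ℝ := fun w => log w.2.1+log w.2.2-L
  have e1 : ((∑ i ∈ S, ‖bilin m L V N (f i)‖:ℝ) : ℂ) =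
      exp L*∑ w ∈ Ω, c w*(exp (u w-u w^2) : ℂ) := by
    push_cast
    simp only [← hε2]
    rw [sum_product, mul_sum]
    refine sum_congr rfl fun i hi => ?_
    rw [mul_sum]
    unfold bilin
    rw [mul_sum]
    refine sum_congr rfl fun x hx => ?_
    have hx' := Finset.mem_product.1 hx
    have h1 := (Finset.mem_Ioc.1 hx'.1).1
    have h2 := (Finset.mem_Ioc.1 hx'.2).1
    have h1' : (0:ℝ) < x.1 := by exact_mod_cast h1
    have h2' : (0:ℝ) < x.2 := by exact_mod_cast h2
    have hF : FF m L (x.1*x.2) = exp L*((((log x.1+log x.2)/L)^m/(x.1*x.2)) *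
        exp ((log x.1+log x.2-L)-(log x.1+log x.2-L)^2)) := by
      unfold FF phiW
      rw [Nat.cast_mul, Real.log_mul h1'.ne' h2'.ne']
      rw [sub_eq_add_neg (log x.1+log x.2-L), Real.exp_add, Real.exp_sub, Real.exp_add,
        Real.exp_log h1', Real.exp_log h2']
      have := Real.exp_pos L
      field_simp
    rw [hF, hfm i hi]
    simp only [c, u]
    push_cast
    ring
  have hD : ∀ t : ℝ, ‖∑ w ∈ Ω, c w*Complex.exp (Complex.I*t*u w)‖ ≤ 150*4^m*L^5 := by
    intro t
    have e2 : ∑ w ∈ Ω, c w*Complex.exp (Complex.I*t*u w) =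
        ∑ i ∈ S, ∑ j ∈ range (m+1), (ε i*Complex.exp (Complex.I*t*((-L:ℝ) : ℂ))*((1/L^m*(m.choose j):ℝ) : ℂ)) *
          ((∑ a ∈ Ioc 0 N, tcoef α j t a*f i a)*(∑ b ∈ Ioc 0 N, tcoef β (m-j) t b*f i b)) := by
      rw [sum_product]
      refine sum_congr rfl fun i hi => ?_
      simp only [Finset.sum_mul_sum]
      have : ∀ j ∈ range (m+1), (ε i*Complex.exp (Complex.I*t*((-L:ℝ) : ℂ))*((1/L^m*(m.choose j):ℝ) : ℂ)) *
          (∑ a ∈ Ioc 0 N, ∑ b ∈ Ioc 0 N, tcoef α j t a*f i a*(tcoef β (m-j) t b*f i b)) =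
          ∑ x ∈ Ioc 0 N ×ˢ Ioc 0 N, (ε i*Complex.exp (Complex.I*t*((-L:ℝ) : ℂ))*((1/L^m*(m.choose j):ℝ) : ℂ)) *
          (tcoef α j t x.1*f i x.1*(tcoef β (m-j) t x.2*f i x.2)) := by
        intro j _
        rw [sum_product, mul_sum]
        refine sum_congr rfl fun a _ => ?_
        rw [mul_sum]
      rw [sum_congr rfl this, sum_comm]
      refine sum_congr rfl fun x hx => ?_
      simp only [c, u, tcoef]
      have hexp : Complex.exp (Complex.I*t*((log x.1+log x.2-L:ℝ) : ℂ)) =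
          Complex.exp (Complex.I*t*((-L:ℝ) : ℂ))*Complex.exp (Complex.I*t*log x.1) *
          Complex.exp (Complex.I*t*log x.2) := by
        rw [← Complex.exp_add, ← Complex.exp_add]
        congr 1
        push_cast; ring
      rw [hexp, div_pow, add_pow]
      push_cast
      simp only [Finset.sum_div, mul_sum, sum_mul]
      refine sum_congr rfl fun j _ => ?_
      ring
    rw [e2, sum_comm]
    refine (norm_sum_le _ _).trans ?_
    have hj : ∀ j ∈ range (m+1), ‖∑ i ∈ S, (ε i*Complex.exp (Complex.I*t*((-L:ℝ) : ℂ))*((1/L^m*(m.choose j):ℝ) : ℂ)) *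
          ((∑ a ∈ Ioc 0 N, tcoef α j t a*f i a)*(∑ b ∈ Ioc 0 N, tcoef β (m-j) t b*f i b))‖ ≤
          (m.choose j:ℝ)*(150*2^m*L^5) := by
      intro j hj
      have hjm : j ≤ m := by simp at hj; omega
      refine (norm_sum_le _ _).trans ?_
      have e3 : ∀ i ∈ S, ‖(ε i*Complex.exp (Complex.I*t*((-L:ℝ) : ℂ))*((1/L^m*(m.choose j):ℝ) : ℂ)) *
          ((∑ a ∈ Ioc 0 N, tcoef α j t a*f i a)*(∑ b ∈ Ioc 0 N, tcoef β (m-j) t b*f i b))‖ =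
          (1/L^m*(m.choose j))*(‖∑ a ∈ Ioc 0 N, tcoef α j t a*f i a‖ *
            ‖∑ b ∈ Ioc 0 N, tcoef β (m-j) t b*f i b‖) := by
        intro i _
        rw [norm_mul, norm_mul, norm_mul, hε1, norm_exp_I_mul, Complex.norm_real,
          Real.norm_of_nonneg (by positivity), norm_mul]
        ring
      rw [sum_congr rfl e3, ← mul_sum]
      have hcs := Finset.sum_mul_sq_le_sq_mul_sq S (fun i => ‖∑ a ∈ Ioc 0 N, tcoef α j t a*f i a‖)
        (fun i => ‖∑ b ∈ Ioc 0 N, tcoef β (m-j) t b*f i b‖)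
      have hA := ls_tcoef S f B hf1 hB hB0 V N L hL hN hS α
        (fun a ha => by rw [hα, alphaV_apply, if_pos ha]) _ (sum_alpha_sq V N L hL hN) j t
      have hBB := ls_tcoef S f B hf1 hB hB0 V N L hL hN hS β
        (fun a ha => betaV_zero V a ha) _ (sum_beta_sq V N hV L hL hN) (m-j) t
      have hbound : ∑ i ∈ S, ‖∑ a ∈ Ioc 0 N, tcoef α j t a*f i a‖ *
            ‖∑ b ∈ Ioc 0 N, tcoef β (m-j) t b*f i b‖ ≤ 150*L^5*(2*L)^m := by
        have hsq : (∑ i ∈ S, ‖∑ a ∈ Ioc 0 N, tcoef α j t a*f i a‖ *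
            ‖∑ b ∈ Ioc 0 N, tcoef β (m-j) t b*f i b‖)^2 ≤ (150*L^5*(2*L)^m)^2 := by
          refine hcs.trans ((mul_le_mul hA hBB (sum_nonneg fun i _ => by positivity) (by positivity)).trans ?_)
          have hpow : (2*L)^m = (2*L)^j*(2*L)^(m-j) := by
            rw [← pow_add]; congr 1; omega
          rw [hpow]
          have hP : 0 ≤ ((2*L)^j*(2*L)^(m-j))^2 := by positivity
          have h10 : L^9 ≤ L^10 := pow_le_pow_right₀ hL (by norm_num)
          calc _ = 15552*L^9*((2*L)^j*(2*L)^(m-j))^2 := by ring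
            _ ≤ 22500*L^10*((2*L)^j*(2*L)^(m-j))^2 := by
                gcongr; norm_num
            _ = _ := by ring
        exact le_of_sq_le_sq hsq (by positivity)
      calc _ ≤ (1/L^m*(m.choose j))*(150*L^5*(2*L)^m) := by gcongr
        _ = _ := by rw [mul_pow]; field_simp
    refine (sum_le_sum hj).trans ?_
    rw [← sum_mul]
    have : ∑ i ∈ range (m+1), (m.choose i:ℝ) = 2^m := by exact_mod_cast Nat.sum_range_choose m
    rw [this]
    apply le_of_eq
    rw [show (4:ℝ)^m = 2^m*2^m by rw [← mul_pow]; norm_num]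
    ring
  have hfin := gauss_sum_bound Ω c u _ hD
  have h := congrArg norm e1
  rw [Complex.norm_real, Real.norm_of_nonneg (sum_nonneg fun i _ => norm_nonneg _), norm_mul,
    Complex.norm_real, Real.norm_of_nonneg (Real.exp_pos L).le] at h
  rw [h]
  calc _ ≤ exp L*(2*(150*4^m*L^5)) := by gcongr
    _ = _ := by ring

lemma bilin_tail (m V N:ℕ) (hV : 1 ≤ V) (L:ℝ) (hL : 48 ≤ L) (f : ℕ → ℂ) (hf : ∀ n, ‖f n‖ ≤ 1)
    (hN1 : log N ≤ 5/4*L) (hN2 : exp (5/4*L) ≤ N+1) :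
    ‖∑ n ∈ Ioc 0 N, (((Λ-lamV V)*betaV V : ArithmeticFunction ℝ) n : ℂ)*(FF m L n*f n)
      - bilin m L V N f‖ ≤ 3^m*(2*L)*exp (3*L/4) := by
  have hN0 : 0 < N := by
    by_contra h
    have h0 : N = 0 := by omega
    subst h0
    have := Real.add_one_le_exp (5/4*L)
    simp at hN2
    linarith
  have hNe : (N:ℝ) ≤ exp (5/4*L) := by
    rw [← Real.exp_log (by exact_mod_cast hN0 : (0:ℝ) < N)]
    exact Real.exp_le_exp.2 hN1
  rw [sum_conv_prod _ _ (fun n => FF m L n*f n)]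
  unfold bilin
  rw [sum_filter, ← sum_sub_distrib]
  refine (norm_sum_le _ _).trans ?_
  have hterm : ∀ x ∈ Ioc 0 N ×ˢ Ioc 0 N, ‖(if x.1*x.2 ≤ N then
      ((Λ-lamV V : ArithmeticFunction ℝ) x.1 : ℂ)*(betaV V x.2 : ℂ)*(FF m L (x.1*x.2)*f (x.1*x.2)) else 0)
      - ((Λ-lamV V : ArithmeticFunction ℝ) x.1 : ℂ)*(betaV V x.2 : ℂ)*(FF m L (x.1*x.2)*f (x.1*x.2))‖
      ≤ (2*L)*N*(3^m*exp (-(L/4)^2)) := by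
    intro x hx
    have hx' := Finset.mem_product.1 hx
    have h1 := (Finset.mem_Ioc.1 hx'.1)
    have h2 := (Finset.mem_Ioc.1 hx'.2)
    have h1' : (0:ℝ) < x.1 := by exact_mod_cast h1.1
    have h2' : (0:ℝ) < x.2 := by exact_mod_cast h2.1
    split_ifs with h
    · rw [sub_self, norm_zero]; positivity
    rw [zero_sub, norm_neg, norm_mul, norm_mul, norm_mul, Complex.norm_real, Complex.norm_real, Complex.norm_real]
    have l1 : log x.1 ≤ 5/4*L :=
      (Real.log_le_log h1' (by exact_mod_cast h1.2)).trans hN1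
    have l2 : log x.2 ≤ 5/4*L :=
      (Real.log_le_log h2' (by exact_mod_cast h2.2)).trans hN1
    have b1 : ‖(Λ-lamV V : ArithmeticFunction ℝ) x.1‖ ≤ 2*L := by
      rw [alphaV_apply]
      split_ifs
      · simp; linarith
      · rw [Real.norm_of_nonneg ArithmeticFunction.vonMangoldt_nonneg]
        exact ArithmeticFunction.vonMangoldt_le_log.trans (by linarith)
    have b2 : ‖betaV V x.2‖ ≤ N := by
      rw [Real.norm_eq_abs]
      refine (betaV_le V x.2 hV).trans ?_
      exact_mod_cast (Nat.card_divisors_le_self x.2).trans h2.2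
    have b3 : ‖FF m L (x.1*x.2)‖ ≤ 3^m*exp (-(L/4)^2) := by
      rw [Real.norm_of_nonneg (FF_nonneg m L _ (by linarith))]
      unfold FF phiW
      have hlow : 5/4*L ≤ log ((x.1*x.2:ℕ):ℝ) := by
        rw [Real.le_log_iff_exp_le (by push_cast; positivity)]
        refine hN2.trans ?_
        exact_mod_cast (by omega : N+1 ≤ x.1*x.2)
      have hup : log ((x.1*x.2:ℕ):ℝ) ≤ 3*L := by
        rw [Nat.cast_mul, Real.log_mul h1'.ne' h2'.ne']; linarith
      set u := log ((x.1*x.2:ℕ):ℝ)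
      have hu : 0 ≤ u := by linarith
      gcongr
      · rw [div_le_iff₀ (by linarith)]; exact hup
      · nlinarith
    have b4 := hf (x.1*x.2)
    calc _ ≤ (2*L)*N*((3^m*exp (-(L/4)^2))*1) := by gcongr
      _ = _ := by ring
  refine (Finset.sum_le_card_nsmul _ _ _ hterm).trans ?_
  rw [Finset.card_product, Nat.card_Ioc, nsmul_eq_mul]
  push_cast
  simp only [Nat.sub_zero]
  calc (N:ℝ)*N*(2*L*N*(3^m*exp (-(L/4)^2)))
      ≤ exp (5/4*L)*exp (5/4*L)*(2*L*exp (5/4*L)*(3^m*exp (-(L/4)^2))) := by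
        gcongr
    _ = 3^m*(2*L)*(exp (5/4*L)*exp (5/4*L)*exp (5/4*L)*exp (-(L/4)^2)) := by ring
    _ ≤ _ := by
        rw [← Real.exp_add, ← Real.exp_add, ← Real.exp_add]
        have : 5/4*L+5/4*L+5/4*L + -(L/4)^2 ≤ 3*L/4 := by nlinarith
        gcongr
end

section
open Finset
open ArithmeticFunction (vonMangoldt zeta moebius)
open scoped ArithmeticFunction.vonMangoldt ArithmeticFunction.zeta ArithmeticFunction.Moebius

/-- Dirichlet characters of arbitrary level, bundled -/
abbrev PC := Σ r : ℕ, DirichletCharacter ℂ r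

noncomputable def chiN (ξ : PC) (n:ℕ) : ℂ := ξ.2 (n : ZMod ξ.1)

noncomputable def psiF (m:ℕ) (L:ℝ) (N:ℕ) (f : ℕ → ℂ) : ℂ :=
  ∑ n ∈ Ioc 0 N, (Λ n : ℂ)*(FF m L n*f n)

lemma chiN_mul (ξ : PC) (a b:ℕ) : chiN ξ (a*b) = chiN ξ a*chiN ξ b := by
  simp [chiN]

lemma chiN_norm (ξ : PC) (a:ℕ) : ‖chiN ξ a‖ ≤ 1 := DirichletCharacter.norm_le_one _ _

noncomputable instance (r:ℕ) [NeZero r] : Fintype (DirichletCharacter ℂ r) := Fintype.ofFinite _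

open Classical in
noncomputable def primF (r:ℕ) : Finset (DirichletCharacter ℂ r) :=
  if h : r = 0 then ∅ else
    haveI : NeZero r := ⟨h⟩
    Finset.univ.filter fun χ => χ.IsPrimitive

lemma mem_primF {r : ℕ} (hr : r ≠ 0) (χ : DirichletCharacter ℂ r) : χ ∈ primF r ↔ χ.IsPrimitive := by
  simp [primF, hr]

lemma card_primF (r:ℕ) : (primF r).card ≤ r := by
  unfold primF
  split_ifs with h
  · simp
  · have : NeZero r := ⟨h⟩
    refine (Finset.card_le_univ _).trans ?_
    rw [← Nat.card_eq_fintype_card, DirichletCharacter.card_eq_totient_of_hasEnoughRootsOfUnity]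
    exact Nat.totient_le r

noncomputable def primSet (Q:ℕ) : Finset PC := (Icc 2 Q).sigma primF

lemma mem_primSet {Q : ℕ} {ξ : PC} : ξ ∈ primSet Q ↔ 2 ≤ ξ.1 ∧ ξ.1 ≤ Q ∧ ξ.2.IsPrimitive := by
  unfold primSet
  rw [Finset.mem_sigma, mem_Icc]
  constructor
  · rintro ⟨⟨h1, h2⟩, h3⟩
    exact ⟨h1, h2, (mem_primF (by omega) _).1 h3⟩
  · rintro ⟨h1, h2, h3⟩
    exact ⟨⟨h1, h2⟩, (mem_primF (by omega) _).2 h3⟩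

lemma card_primSet (Q:ℕ) : (primSet Q).card ≤ Q^2 := by
  unfold primSet
  rw [Finset.card_sigma]
  calc ∑ r ∈ Icc 2 Q, (primF r).card ≤ ∑ r ∈ Icc 2 Q, Q :=
        sum_le_sum fun r hr => (card_primF r).trans (mem_Icc.1 hr).2
    _ ≤ Q^2 := by
        rw [Finset.sum_const, Nat.card_Icc, smul_eq_mul, sq]
        exact Nat.mul_le_mul_right _ (by omega)

lemma prim_ne_one {ξ : PC} (h2 : 2 ≤ ξ.1) (h : ξ.2.IsPrimitive) : ξ.2 ≠ 1 := by
  intro h1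
  have : NeZero ξ.1 := ⟨by omega⟩
  rw [DirichletCharacter.isPrimitive_def, h1, DirichletCharacter.conductor_one] at h
  omega

lemma chiN_MChar {Q : ℕ} {ξ : PC} (h : ξ ∈ primSet Q) : MChar (chiN ξ) Q where
  mul := chiN_mul ξ
  norm := chiN_norm ξ
  sum := by
    intro a b
    obtain ⟨h1, h2, h3⟩ := mem_primSet.1 h
    refine (char_sum_le (by omega) ξ.2 (prim_ne_one h1 h3) a b).trans ?_
    exact_mod_cast h2

lemma pair_char {ξ η : PC} (h1 : ξ.1 ≠ 0) (h2 : η.1 ≠ 0) (hp1 : ξ.2.IsPrimitive) (hp2 : η.2.IsPrimitive)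
    (hne : ξ ≠ η) : ∃ ρ : DirichletCharacter ℂ (ξ.1*η.1), ρ ≠ 1 ∧
      ∀ n : ℕ, chiN ξ n*(starRingEnd ℂ) (chiN η n) = ρ n := by
  obtain ⟨r, χ⟩ := ξ
  obtain ⟨s, ψ⟩ := η
  dsimp only at *
  have hrs : r*s ≠ 0 := mul_ne_zero h1 h2
  have : NeZero (r*s) := ⟨hrs⟩
  have : NeZero r := ⟨h1⟩
  have : NeZero s := ⟨h2⟩
  let χ' := DirichletCharacter.changeLevel (Dvd.intro s rfl : r ∣ r*s) χ
  let ψ' := DirichletCharacter.changeLevel (Dvd.intro_left r rfl : s ∣ r*s) ψ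
  have hρ : χ'*ψ'⁻¹ ≠ 1 := by
    intro h
    have h' : χ' = ψ' := by rwa [mul_inv_eq_one] at h
    have hc : r = s := by
      have e1 : χ'.conductor = r := by
        rw [DirichletCharacter.conductor_changeLevel]; exact hp1
      have e2 : ψ'.conductor = s := by
        rw [DirichletCharacter.conductor_changeLevel]; exact hp2
      exact e1.symm.trans ((congrArg _ h').trans e2)
    subst hc
    exact hne (by rw [DirichletCharacter.changeLevel_injective _ h'])
  have key : ∀ n : ℕ, chiN ⟨r, χ⟩ n*(starRingEnd ℂ) (chiN ⟨s, ψ⟩ n) = (χ'*ψ'⁻¹) (n : ZMod (r*s)) := by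
    intro n
    unfold chiN
    dsimp only
    by_cases hn : n.Coprime (r*s)
    · have hi : IsCoprime (n : ℤ) ((r*s:ℕ) : ℤ) := Nat.isCoprime_iff_coprime.2 hn
      have e1 := DirichletCharacter.changeLevel_eq_cast_of_dvd' χ (Dvd.intro s rfl : r ∣ r*s) hi
      have e2 := DirichletCharacter.changeLevel_eq_cast_of_dvd' ψ (Dvd.intro_left r rfl : s ∣ r*s) hi
      simp only [Int.cast_natCast] at e1 e2
      rw [MulChar.mul_apply, ← MulChar.star_eq_inv, MulChar.star_apply, e1, e2]
      rfl
    · have : ¬ IsUnit ((n : ZMod (r*s))) := by rwa [ZMod.isUnit_iff_coprime]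
      rw [MulChar.map_nonunit _ this]
      rw [Nat.coprime_mul_iff_right, not_and_or] at hn
      rcases hn with hn | hn
      · rw [MulChar.map_nonunit χ (by rwa [ZMod.isUnit_iff_coprime]), zero_mul]
      · rw [MulChar.map_nonunit ψ (by rwa [ZMod.isUnit_iff_coprime]), map_zero, mul_zero]
  exact ⟨_, hρ, key⟩

lemma pair_sum {ξ η : PC} (h1 : ξ.1 ≠ 0) (h2 : η.1 ≠ 0) (hp1 : ξ.2.IsPrimitive) (hp2 : η.2.IsPrimitive)
    (hne : ξ ≠ η) (a b:ℕ) :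
    ‖∑ n ∈ Ico a b, chiN ξ n*(starRingEnd ℂ) (chiN η n)‖ ≤ (ξ.1*η.1:ℕ) := by
  obtain ⟨ρ, hρ, key⟩ := pair_char h1 h2 hp1 hp2 hne
  simp only [key]
  exact char_sum_le (mul_ne_zero h1 h2) _ hρ a b

lemma exp_pow_trade (c:ℝ) (hc : 0 < c) (j:ℕ) (L:ℝ) (hL : 0 ≤ L) :
    L^j ≤ (j.factorial/c^j)*exp (c*L) := by
  have := Real.pow_div_factorial_le_exp (c*L) (by positivity) j
  rw [div_le_iff₀ (by positivity), mul_pow] at this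
  rw [div_mul_eq_mul_div, le_div_iff₀ (by positivity)]
  linarith

/-- A5: total over primitive characters of conductor up to `e^{L/16}`. -/
theorem prim_total (m:ℕ) (hm : m ≠ 0) : ∃ C : ℝ, 0 < C ∧ ∀ L : ℝ, 48 ≤ L → ∀ N Q : ℕ,
    log N ≤ 5/4*L → exp (5/4*L) ≤ N+1 → (Q:ℝ) ≤ exp (L/16) →
    ∑ ξ ∈ primSet Q, ‖psiF m L N (chiN ξ)‖ ≤ C*(exp L*L^5) := by
  refine ⟨(20*(CF m+CF (m+1)))+3^m*2*16+300*4^m, by have := CF_pos m; have := CF_pos (m+1); positivity, ?_⟩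
  intro L hL N Q hN1 hN2 hQ
  classical
  set V := ⌊exp (L/4)⌋₊ with hVdef
  have hVle : (V:ℝ) ≤ exp (L/4) := Nat.floor_le (Real.exp_pos _).le
  have hVlt : exp (L/4) < V+1 := Nat.lt_floor_add_one _
  have hV1 : 1 ≤ V := Nat.le_floor (by simpa using Real.one_le_exp (by linarith : 0 ≤ L/4))
  have hVr : (1:ℝ) ≤ V := by exact_mod_cast hV1
  have hVL : log V ≤ L := by
    rw [Real.log_le_iff_le_exp (by linarith)]
    exact hVle.trans (Real.exp_le_exp.2 (by linarith))
  have hN0 : 0 < N := by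
    by_contra h
    have h0 : N = 0 := by omega
    subst h0
    have := Real.add_one_le_exp (5/4*L)
    simp at hN2
    linarith
  have hN : log ((N+1:ℕ):ℝ) ≤ 2*L := by
    have hNr : (1:ℝ) ≤ N := by exact_mod_cast hN0
    have : ((N+1:ℕ):ℝ) ≤ 2*N := by push_cast; linarith
    refine (Real.log_le_log (by positivity) this).trans ?_
    rw [Real.log_mul (by norm_num) (by positivity)]
    have := Real.log_two_lt_d9
    linarith
  by_cases hQ0 : Q = 0
  · subst hQ0
    have : primSet 0 = ∅ := by
      ext ξ; simp only [mem_primSet]; simp; omega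
    rw [this, Finset.sum_empty]
    have := CF_pos m; have := CF_pos (m+1); positivity
  have hQ1 : (1:ℝ) ≤ Q := by exact_mod_cast Nat.one_le_iff_ne_zero.2 hQ0
  have hcard : ((primSet Q).card:ℝ) ≤ exp (L/8) := by
    calc ((primSet Q).card:ℝ) ≤ (Q:ℝ)^2 := by exact_mod_cast card_primSet Q
      _ ≤ exp (L/16)^2 := by gcongr
      _ = exp (L/8) := by rw [← Real.exp_nat_mul]; congr 1; push_cast; ring
  have hQ2 : (Q:ℝ)^2 ≤ exp (L/8) := by
    calc (Q:ℝ)^2 ≤ exp (L/16)^2 := by gcongr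
      _ = exp (L/8) := by rw [← Real.exp_nat_mul]; congr 1; push_cast; ring
  have hbil := bilin_sum (primSet Q) chiN ((Q:ℝ)^2) (fun i _ n => chiN_norm i n)
    (fun i _ a b => chiN_mul i a b) (by
      intro ξ hξ η hη hne a b
      obtain ⟨h1, h2, h3⟩ := mem_primSet.1 hξ
      obtain ⟨h1', h2', h3'⟩ := mem_primSet.1 hη
      refine (pair_sum (by omega) (by omega) h3 h3' hne a b).trans ?_
      rw [sq]; exact_mod_cast Nat.mul_le_mul h2 h2') (by positivity) m V N hV1 L (by linarith) hN (by
      have hV' : exp (L/4) ≤ ((V+1:ℕ):ℝ) := by push_cast; exact hVlt.le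
      rw [← mul_div_assoc, div_le_one (by positivity)]
      refine le_trans ?_ hV'
      calc ((primSet Q).card:ℝ)*(Q:ℝ)^2 ≤ exp (L/8)*exp (L/8) := by gcongr
        _ = _ := by rw [← Real.exp_add]; ring_nf)
  have hterm : ∀ ξ ∈ primSet Q, ‖psiF m L N (chiN ξ)‖ ≤
      (20*(CF m+CF (m+1)))*((V:ℝ)^2*Q*L^2)+3^m*(2*L)*exp (3*L/4)
        + ‖bilin m L V N (chiN ξ)‖ := by
    intro ξ hξ
    have e1 := typeI_total m hm L (by linarith) (chiN ξ) Q hQ1 (chiN_MChar hξ) V N hV1 hVL hN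
    have e2 := bilin_tail m V N hV1 L hL (chiN ξ) (chiN_norm ξ) hN1 hN2
    unfold psiF
    set A := ∑ n ∈ Ioc 0 N, (Λ n : ℂ)*(FF m L n*chiN ξ n)
    set D := ∑ n ∈ Ioc 0 N, (((Λ-lamV V)*betaV V : ArithmeticFunction ℝ) n : ℂ)*(FF m L n*chiN ξ n)
    calc ‖A‖ = ‖(A-D)+(D-bilin m L V N (chiN ξ))+bilin m L V N (chiN ξ)‖ := by congr 1; ring
      _ ≤ ‖A-D‖ + ‖D-bilin m L V N (chiN ξ)‖ + ‖bilin m L V N (chiN ξ)‖ := norm_add₃_le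
      _ ≤ _ := by gcongr
  refine (sum_le_sum hterm).trans ?_
  rw [sum_add_distrib, Finset.sum_const, nsmul_eq_mul]
  have hC : 0 ≤ 20*(CF m+CF (m+1)) := by have := CF_pos m; have := CF_pos (m+1); positivity
  have hL1 : (1:ℝ) ≤ L := by linarith
  have b1 : exp (L/8)*((V:ℝ)^2*Q*L^2) ≤ exp L*L^5 := by
    calc exp (L/8)*((V:ℝ)^2*Q*L^2)
        ≤ exp (L/8)*(exp (L/4)^2*exp (L/16)*L^2) := by gcongr
      _ = exp (11*L/16)*L^2 := by
          rw [← Real.exp_nat_mul, ← mul_assoc, ← mul_assoc, ← Real.exp_add, ← Real.exp_add]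
          congr 2; push_cast; ring
      _ ≤ exp L*L^5 := by
          gcongr
          · linarith
          · norm_num
  have b2 : exp (L/8)*(L*exp (3*L/4)) ≤ exp L*L^5 := by
    calc exp (L/8)*(L*exp (3*L/4)) = exp (7*L/8)*L^1 := by
          rw [mul_comm L, ← mul_assoc, ← Real.exp_add, pow_one]; congr 2; ring
      _ ≤ exp L*L^5 := by
          gcongr
          · linarith
          · norm_num
  have h0 : 0 ≤ exp L*L^5 := by positivity
  calc ((primSet Q).card:ℝ)*((20*(CF m+CF (m+1)))*((V:ℝ)^2*Q*L^2)
        + 3^m*(2*L)*exp (3*L/4)) + ∑ ξ ∈ primSet Q, ‖bilin m L V N (chiN ξ)‖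
      ≤ exp (L/8)*((20*(CF m+CF (m+1)))*((V:ℝ)^2*Q*L^2)
        + 3^m*(2*L)*exp (3*L/4))+300*4^m*(exp L*L^5) := by gcongr
    _ = (20*(CF m+CF (m+1)))*(exp (L/8)*((V:ℝ)^2*Q*L^2))
        + 3^m*2*(exp (L/8)*(L*exp (3*L/4)))+300*4^m*(exp L*L^5) := by ring
    _ ≤ (20*(CF m+CF (m+1)))*(exp L*L^5)
        + 3^m*2*(exp L*L^5)+300*4^m*(exp L*L^5) := by gcongr
    _ ≤ _ := by
        have : (0:ℝ) ≤ 3^m*2*15*(exp L*L^5) := by positivity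
        nlinarith
end

section
open Finset

/-! ## Bounds for (derivatives of) L-series on `1 < Re s ≤ 2` -/

noncomputable def gT (j:ℕ) (s : ℂ) (u:ℝ) : ℂ := (u : ℂ)^j*Complex.exp (-s*u)

lemma gT_hasDerivAt (j:ℕ) (s : ℂ) (u:ℝ) :
    HasDerivAt (gT j s) ((j*(u : ℂ)^(j-1))*Complex.exp (-s*u) +
      (u : ℂ)^j*(Complex.exp (-s*u)*(-s))) u := by
  unfold gT
  have h1 : HasDerivAt (fun u : ℝ => (u : ℂ)) 1 u := Complex.ofRealCLM.hasDerivAt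
  have h2 := h1.fun_pow j
  have h3 := (h1.const_mul (-s)).cexp
  simp only [mul_one] at h2 h3
  exact h2.mul h3

lemma gT_norm (j:ℕ) (s : ℂ) (u:ℝ) (hu : 0 ≤ u) (hs : 1 ≤ s.re) :
    ‖gT j s u‖ ≤ u^j*exp (-u) := by
  unfold gT
  rw [norm_mul, norm_pow, Complex.norm_real, Real.norm_of_nonneg hu, Complex.norm_exp]
  gcongr
  simp
  nlinarith

lemma gT_deriv_norm (j:ℕ) (s : ℂ) (u:ℝ) (hu : 0 ≤ u) (hs : 1 ≤ s.re) :
    ‖(j*(u : ℂ)^(j-1))*Complex.exp (-s*u) +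
      (u : ℂ)^j*(Complex.exp (-s*u)*(-s))‖ ≤ (j + ‖s‖)*((1+u)^j*exp (-u)) := by
  have he : ‖Complex.exp (-s*u)‖ ≤ exp (-u) := by
    rw [Complex.norm_exp]
    gcongr
    simp
    nlinarith
  have hu1 : ‖(u : ℂ)‖ = u := by rw [Complex.norm_real, Real.norm_of_nonneg hu]
  have a1 : u^(j-1) ≤ (1+u)^j := by
    calc u^(j-1) ≤ (1+u)^(j-1) := by gcongr; linarith
      _ ≤ (1+u)^j := pow_le_pow_right₀ (by linarith) (by omega)
  have a2 : u^j ≤ (1+u)^j := by gcongr; linarith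
  refine (norm_add_le _ _).trans ?_
  rw [norm_mul, norm_mul, norm_mul, norm_mul, norm_pow, norm_pow, hu1, norm_neg, Complex.norm_natCast]
  calc j*u^(j-1)*‖Complex.exp (-s*u)‖ + u^j*(‖Complex.exp (-s*u)‖*‖s‖)
      ≤ j*(1+u)^j*exp (-u)+(1+u)^j*(exp (-u)*‖s‖) := by gcongr
    _ = _ := by ring

lemma gT_diff (j:ℕ) (s : ℂ) (hs : 1 ≤ s.re) (n:ℕ) (hn : 1 ≤ n) :
    ‖gT j s (log ((n+1:ℕ):ℝ))-gT j s (log n)‖ ≤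
      (j + ‖s‖)*((2+log n)^j/(n:ℝ)^2) := by
  have hn' : (0:ℝ) < n := by exact_mod_cast hn
  have hl0 : 0 ≤ log n := Real.log_natCast_nonneg n
  have hd := (le_abs_self _).trans (log_succ_sub_le n hn)
  have hle : log n ≤ log ((n+1:ℕ):ℝ) :=
    Real.log_le_log hn' (by push_cast; linarith)
  have h1n : (1:ℝ)/n ≤ 1 := by
    rw [div_le_one hn']; exact_mod_cast hn
  have key := Convex.norm_image_sub_le_of_norm_hasDerivWithin_le (f := gT j s)
    (f' := fun u => (j*(u : ℂ)^(j-1))*Complex.exp (-s*u) +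
      (u : ℂ)^j*(Complex.exp (-s*u)*(-s)))
    (s := Set.Icc (log n) (log ((n+1:ℕ):ℝ)))
    (C := (j + ‖s‖)*((2+log n)^j*(1/n)))
    (x := log n) (y := log ((n+1:ℕ):ℝ))
    (fun u _ => (gT_hasDerivAt j s u).hasDerivWithinAt)
    (by
      intro u hu
      have hu0 : 0 ≤ u := hl0.trans hu.1
      refine (gT_deriv_norm j s u hu0 hs).trans ?_
      have e1 : 1+u ≤ 2+log n := by
        have := hu.2
        push_cast at this hd
        linarith
      have e2 : exp (-u) ≤ 1/n := by
        rw [Real.exp_neg, ← one_div]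
        apply one_div_le_one_div_of_le hn'
        rw [← Real.log_le_iff_le_exp hn']
        exact hu.1
      gcongr)
    (convex_Icc _ _) ⟨le_refl _, hle⟩ ⟨hle, le_refl _⟩
  refine key.trans ?_
  have : ‖log ((n+1:ℕ):ℝ)-log n‖ ≤ 1/n := by
    rw [Real.norm_of_nonneg (by linarith)]
    push_cast at hd ⊢
    exact hd
  calc (j + ‖s‖)*((2+log n)^j*(1/n))*‖log ((n+1:ℕ):ℝ)-log n‖
      ≤ (j + ‖s‖)*((2+log n)^j*(1/n))*(1/n) := by gcongr
    _ = _ := by field_simp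

noncomputable def CT (j:ℕ) : ℝ := j.factorial*2^j*2

lemma CT_pos (j:ℕ) : 0 < CT j := by unfold CT; positivity

lemma log_pow_le (j r n:ℕ) (hr : 1 ≤ r) (hn : r ≤ n) :
    (2+log n)^j ≤ CT j*(log r+2)^j*Real.sqrt (n/r) := by
  have hr' : (0:ℝ) < r := by exact_mod_cast hr
  have hn' : (0:ℝ) < n := by exact_mod_cast (by omega : 0 < n)
  have hlr : 0 ≤ log r := Real.log_natCast_nonneg r
  set v := log (n/r) with hv
  have hv0 : 0 ≤ v := Real.log_nonneg (by rw [le_div_iff₀ hr']; simpa using (by exact_mod_cast hn : (r:ℝ) ≤ n))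
  have hlog : log n = log r+v := by
    rw [hv, Real.log_div hn'.ne' hr'.ne']; ring
  have e1 : 2+log n ≤ (log r+2)*(1+v) := by
    rw [hlog]; nlinarith
  have e2 : (1+v)^j ≤ CT j*exp (v/2) := by
    have := Real.pow_div_factorial_le_exp ((1+v)/2) (by linarith) j
    rw [div_le_iff₀ (by positivity), div_pow, div_le_iff₀ (by positivity)] at this
    refine this.trans ?_
    have h3 : exp ((1+v)/2) ≤ 2*exp (v/2) := by
      rw [show (1+v)/2 = 1/2+v/2 by ring, Real.exp_add]
      gcongr
      have h4 : exp (1/2)^2 = exp 1 := by rw [← Real.exp_nat_mul]; norm_num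
      have h5 := Real.exp_one_lt_d9
      by_contra hh
      push Not at hh
      nlinarith
    unfold CT
    calc exp ((1+v)/2)*j.factorial*2^j ≤ (2*exp (v/2))*j.factorial*2^j := by gcongr
      _ = _ := by ring
  have e3 : exp (v/2) = Real.sqrt (n/r) := by
    rw [Real.exp_half, hv, Real.exp_log (by positivity)]
  calc (2+log n)^j ≤ ((log r+2)*(1+v))^j := by
        gcongr
    _ = (log r+2)^j*(1+v)^j := mul_pow _ _ _
    _ ≤ (log r+2)^j*(CT j*exp (v/2)) := by gcongr
    _ = _ := by rw [e3]; ring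

lemma sum_sqrt_tail (r M:ℕ) (hr : 2 ≤ r) :
    ∑ n ∈ Ico r M, Real.sqrt (n/r)/(n:ℝ)^2 ≤ 4/r := by
  have hr' : (0:ℝ) < r := by exact_mod_cast (by omega : 0 < r)
  have key : ∀ n ∈ Ico r M, Real.sqrt (n/r)/(n:ℝ)^2 ≤
      (2/Real.sqrt r)*(1/Real.sqrt ((n:ℝ)-1)-1/Real.sqrt (((n+1:ℕ):ℝ)-1)) := by
    intro n hn
    have hn2 : 2 ≤ n := hr.trans (mem_Ico.1 hn).1
    have hnr : (2:ℝ) ≤ n := by exact_mod_cast hn2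
    rw [Real.sqrt_div' _ hr'.le]
    push_cast
    rw [show (n:ℝ)+1-1 = n by ring]
    set a := Real.sqrt ((n:ℝ)-1) with ha
    set b := Real.sqrt n with hb
    have ha2 : a^2 = n-1 := Real.sq_sqrt (by linarith)
    have hb2 : b^2 = n := Real.sq_sqrt (by linarith)
    have ha0 : 0 < a := Real.sqrt_pos.2 (by linarith)
    have hb0 : 0 < b := Real.sqrt_pos.2 (by linarith)
    have hab : a ≤ b := Real.sqrt_le_sqrt (by linarith)
    have hs0 : 0 < Real.sqrt r := Real.sqrt_pos.2 hr'
    rw [← hb2]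
    rw [show b/Real.sqrt r/(b^2)^2 = (1/Real.sqrt r)*(1/b^3) by field_simp]
    rw [show (2/Real.sqrt r)*(1/a-1/b) = (1/Real.sqrt r)*(2*(1/a-1/b)) by ring]
    gcongr
    have h1 : 1/a-1/b = 1/(a*b*(a+b)) := by
      field_simp
      nlinarith
    rw [h1]
    rw [show 2*(1/(a*b*(a+b))) = 1/(a*b*((a+b)/2)) by field_simp] 
    apply one_div_le_one_div_of_le (by positivity)
    calc a*b*((a+b)/2) ≤ b*b*((b+b)/2) := by gcongr
      _ = b^3 := by ring
  refine (sum_le_sum key).trans ?_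
  rw [← mul_sum]
  rcases le_or_gt r M with hM | hM
  · have tel := Finset.sum_Ico_sub (fun n : ℕ => - (1/Real.sqrt ((n:ℝ)-1))) hM
    simp only [sub_neg_eq_add] at tel
    have : ∑ n ∈ Ico r M, (1/Real.sqrt ((n:ℝ)-1)-1/Real.sqrt (((n+1:ℕ):ℝ)-1)) =
        -(1/Real.sqrt ((M:ℝ)-1))+1/Real.sqrt ((r:ℝ)-1) := by
      rw [← tel]; refine sum_congr rfl fun n _ => by ring
    rw [this]
    have h0 : 0 ≤ 1/Real.sqrt ((M:ℝ)-1) := by positivity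
    have hr2 : (2:ℝ) ≤ r := by exact_mod_cast hr
    have h1 : 1/Real.sqrt ((r:ℝ)-1) ≤ 2/Real.sqrt r := by
      have hs : 0 < Real.sqrt ((r:ℝ)-1) := Real.sqrt_pos.2 (by linarith)
      rw [div_le_div_iff₀ hs (Real.sqrt_pos.2 hr'), one_mul]
      rw [Real.sqrt_le_left (by positivity), mul_pow, Real.sq_sqrt (by linarith)]
      linarith
    calc 2/Real.sqrt r*(-(1/Real.sqrt ((M:ℝ)-1))+1/Real.sqrt ((r:ℝ)-1))
        ≤ 2/Real.sqrt r*(2/Real.sqrt r) := by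
          gcongr
          linarith
      _ = 4/r := by
          rw [div_mul_div_comm, Real.mul_self_sqrt hr'.le]; norm_num
  · rw [Finset.Ico_eq_empty (by omega), Finset.sum_empty]
    simp only [mul_zero]
    positivity

lemma term_eq_gT (f : ℕ → ℂ) (j:ℕ) (s : ℂ) (n:ℕ) (hn : n ≠ 0) :
    LSeries.term (LSeries.logMul^[j] f) s n = f n*gT j s (log n) := by
  have h1 : ∀ j, LSeries.logMul^[j] f n = (Complex.log n)^j*f n := by
    intro j
    induction j with
    | zero => simp
    | succ j ih =>
      rw [Function.iterate_succ', Function.comp, LSeries.logMul, ih, pow_succ]; ring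
  rw [LSeries.term_of_ne_zero hn, h1, gT, div_eq_mul_inv, ← Complex.cpow_neg,
    Complex.cpow_def_of_ne_zero (by exact_mod_cast hn), Complex.natCast_log]
  rw [mul_comm (Complex.log n) (-s)]
  ring

lemma absc_le_one {f : ℕ → ℂ} (hf : ∀ n, ‖f n‖ ≤ 1) : LSeries.abscissaOfAbsConv f ≤ 1 :=
  LSeries.abscissaOfAbsConv_le_of_le_const ⟨1, fun n _ => hf n⟩

lemma absc_lt {f : ℕ → ℂ} (hf : ∀ n, ‖f n‖ ≤ 1) {s : ℂ} (hs : 1 < s.re) :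
    LSeries.abscissaOfAbsConv f < s.re :=
  (absc_le_one hf).trans_lt (by exact_mod_cast hs)

/-- partial sum bound -/
lemma T_bound (j:ℕ) (f : ℕ → ℂ) (hf : ∀ n, ‖f n‖ ≤ 1) (r:ℕ) (hr : 2 ≤ r)
    (hS : ∀ a b, ‖∑ i ∈ Ico a b, f i‖ ≤ r) (s : ℂ) (hs : 1 < s.re) :
    ‖LSeries (LSeries.logMul^[j] f) s‖ ≤
      (2+CT j*(4*j+5))*((log r+2)^(j+1)*(‖s‖ + 1)) := by
  have hsum : LSeriesSummable (LSeries.logMul^[j] f) s :=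
    LSeriesSummable_of_abscissaOfAbsConv_lt_re (by
      rw [LSeries.absicssaOfAbsConv_logPowMul]; exact absc_lt hf hs)
  have hr' : (0:ℝ) < r := by exact_mod_cast (by omega : 0 < r)
  have hlr : 0 ≤ log r := Real.log_natCast_nonneg r
  set ℓ := log r+2 with hℓ
  have hℓ1 : 1 ≤ ℓ := by linarith
  have ht := hsum.hasSum.tendsto_sum_nat
  refine le_of_tendsto ht.norm ?_
  filter_upwards [Filter.eventually_gt_atTop r] with M hM
  have hCT := (CT_pos j).le
  rw [← Finset.sum_range_add_sum_Ico _ hM.le]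
  have b1 : ‖∑ n ∈ range r, LSeries.term (LSeries.logMul^[j] f) s n‖ ≤ ℓ^(j+1) := by
    refine (norm_sum_le _ _).trans ?_
    have : ∀ n ∈ range r, ‖LSeries.term (LSeries.logMul^[j] f) s n‖ ≤
        if n ∈ Ico 1 r then ℓ^j*(1/n) else 0 := by
      intro n hn
      have hn := mem_range.1 hn
      rcases Nat.eq_zero_or_pos n with h0 | h0
      · subst h0; simp
      · rw [if_pos (mem_Ico.2 ⟨h0, hn⟩), term_eq_gT f j s n h0.ne', norm_mul]
        have hn' : (0:ℝ) < n := by exact_mod_cast h0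
        have g := gT_norm j s (log n) (Real.log_natCast_nonneg n) hs.le
        rw [Real.exp_neg, Real.exp_log hn', ← one_div] at g
        calc ‖f n‖*‖gT j s (log n)‖ ≤ 1*((log n)^j*(1/n)) := by
              gcongr; exact hf n
          _ ≤ ℓ^j*(1/n) := by
              rw [one_mul]
              have h1 : log n ≤ ℓ := by
                have : log n ≤ log r := Real.log_le_log hn' (by exact_mod_cast hn.le)
                linarith
              have := Real.log_natCast_nonneg n
              gcongr
    refine (sum_le_sum this).trans ?_
    rw [← sum_filter]
    have hfil : (range r).filter (· ∈ Ico 1 r) = Ico 1 r := by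
      ext n; simp
    rw [hfil, ← mul_sum, pow_succ]
    have := sum_one_div_le r
    gcongr
    linarith
  have b2 : ‖∑ n ∈ Ico r M, LSeries.term (LSeries.logMul^[j] f) s n‖ ≤
      r*(CT j*ℓ^j*(1/r)+(j + ‖s‖)*(CT j*ℓ^j*(4/r))) := by
    have e : ∑ n ∈ Ico r M, LSeries.term (LSeries.logMul^[j] f) s n =
        ∑ n ∈ Ico r M, f n*(fun n : ℕ => gT j s (log n)) n := by
      refine sum_congr rfl fun n hn => ?_
      exact term_eq_gT f j s n (by have := (mem_Ico.1 hn).1; omega)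
    rw [e]
    refine (abel_Ico f (fun n : ℕ => gT j s (log n)) r hS r M hM).trans ?_
    gcongr
    · have hM1 : r ≤ M-1 := by omega
      have hM' : (0:ℝ) < ((M-1:ℕ):ℝ) := by exact_mod_cast (by omega : 0 < M-1)
      have g := gT_norm j s (log ((M-1:ℕ):ℝ)) (Real.log_natCast_nonneg _) hs.le
      rw [Real.exp_neg, Real.exp_log hM'] at g
      have hp := log_pow_le j r (M-1) (by omega) hM1
      have h0 := Real.log_natCast_nonneg (M-1)
      have hrM : (r:ℝ) ≤ ((M-1:ℕ):ℝ) := by exact_mod_cast hM1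
      have hq1 : 1 ≤ ((M-1:ℕ):ℝ)/r := by rw [le_div_iff₀ hr']; linarith
      have hsq : Real.sqrt (((M-1:ℕ):ℝ)/r) ≤ ((M-1:ℕ):ℝ)/r := by
        rw [Real.sqrt_le_left (by positivity)]
        nlinarith
      calc ‖gT j s (log ((M-1:ℕ):ℝ))‖ ≤ (2+log ((M-1:ℕ):ℝ))^j*(((M-1:ℕ):ℝ))⁻¹ := by
            refine g.trans ?_
            gcongr
            linarith
        _ ≤ (CT j*ℓ^j*(((M-1:ℕ):ℝ)/r))*(((M-1:ℕ):ℝ))⁻¹ := by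
            have := hp.trans (mul_le_mul_of_nonneg_left hsq (by positivity))
            gcongr
        _ = CT j*ℓ^j*(1/r) := by field_simp
    · calc ∑ i ∈ Ico r (M-1), ‖gT j s (log ((i+1:ℕ):ℝ))-gT j s (log i)‖
          ≤ ∑ i ∈ Ico r (M-1), (j + ‖s‖)*(CT j*ℓ^j*(Real.sqrt (i/r)/(i:ℝ)^2)) := by
            refine sum_le_sum fun i hi => ?_
            have hi := mem_Ico.1 hi
            refine (gT_diff j s hs.le i (by omega)).trans ?_
            have := log_pow_le j r i (by omega) hi.1
            gcongr
            rw [← mul_div_assoc]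
            gcongr
        _ = (j + ‖s‖)*(CT j*ℓ^j*∑ i ∈ Ico r (M-1), (Real.sqrt (i/r)/(i:ℝ)^2)) := by
            rw [← mul_sum, ← mul_sum]
        _ ≤ _ := by
            have := sum_sqrt_tail r (M-1) hr
            gcongr
  refine (norm_add_le _ _).trans ((add_le_add b1 b2).trans ?_)
  have e3 : (r:ℝ)*(CT j*ℓ^j*(1/r)+(j + ‖s‖)*(CT j*ℓ^j*(4/r))) =
      CT j*(1+4*(j + ‖s‖))*ℓ^j := by field_simp
  rw [e3]
  have hs0 := norm_nonneg s
  have hpow : ℓ^j ≤ ℓ^(j+1) := pow_le_pow_right₀ hℓ1 (by omega)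
  calc ℓ^(j+1)+CT j*(1+4*(j + ‖s‖))*ℓ^j
      ≤ ℓ^(j+1)+CT j*(1+4*(j + ‖s‖))*ℓ^(j+1) := by gcongr
    _ = (1+CT j*(1+4*(j + ‖s‖)))*ℓ^(j+1) := by ring
    _ ≤ ((2+CT j*(4*j+5))*(‖s‖ + 1))*ℓ^(j+1) := by
        gcongr
        have : 0 ≤ (j:ℝ) := Nat.cast_nonneg j
        have : 0 ≤ CT j*((j:ℝ)*‖s‖) := by positivity
        have : 0 ≤ CT j*‖s‖ := by positivity
        nlinarith
    _ = _ := by ring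
end

section
open Finset

/-! ### zeta-type bounds -/

lemma gT_zero_diff (s : ℂ) (hs : 1 ≤ s.re) (v u:ℝ) (hv : 0 ≤ v) (hvu : v ≤ u) :
    ‖gT 0 s u-gT 0 s v‖ ≤ ‖s‖*exp (-v)*(u-v) := by
  have key := Convex.norm_image_sub_le_of_norm_hasDerivWithin_le (f := gT 0 s)
    (f' := fun u => ((0:ℕ)*(u : ℂ)^(0-1))*Complex.exp (-s*u) +
      (u : ℂ)^0*(Complex.exp (-s*u)*(-s)))
    (s := Set.Icc v u) (C := ‖s‖*exp (-v)) (x := v) (y := u)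
    (fun u _ => (gT_hasDerivAt 0 s u).hasDerivWithinAt)
    (by
      intro w hw
      refine (gT_deriv_norm 0 s w (hv.trans hw.1) hs).trans ?_
      simp only [Nat.cast_zero, zero_add, pow_zero, one_mul]
      gcongr
      exact hw.1)
    (convex_Icc _ _) ⟨le_refl _, hvu⟩ ⟨hvu, le_refl _⟩
  rwa [Real.norm_of_nonneg (by linarith)] at key

noncomputable def hZ (s : ℂ) (x:ℝ) : ℂ := Complex.exp ((1-s)*(log x:ℝ))/(1-s)

lemma hZ_hasDerivAt (s : ℂ) (hs : s ≠ 1) (x:ℝ) (hx : 0 < x) :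
    HasDerivAt (hZ s) (gT 0 s (log x)) x := by
  unfold hZ
  have h1 : HasDerivAt (fun x : ℝ => ((log x:ℝ) : ℂ)) ((x⁻¹:ℝ) : ℂ) x :=
    (Real.hasDerivAt_log hx.ne').ofReal_comp
  have h2 := ((h1.const_mul (1-s)).cexp).div_const (1-s)
  refine h2.congr_deriv ?_
  have h3 : (1 : ℂ)-s ≠ 0 := sub_ne_zero.2 hs.symm
  unfold gT
  rw [show (1-s)*((log x:ℝ) : ℂ) = (log x:ℝ)+(-s)*(log x:ℝ) by ring, Complex.exp_add,
    ← Complex.ofReal_exp, Real.exp_log hx]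
  have : (x : ℂ) ≠ 0 := by exact_mod_cast hx.ne'
  push_cast
  field_simp

lemma sum_inv_sq_le (M:ℕ) : ∑ n ∈ Ico 1 M, (1:ℝ)/(n:ℝ)^2 ≤ 2 := by
  suffices h : ∀ M : ℕ, 1 ≤ M → ∑ n ∈ Ico 1 M, (1:ℝ)/(n:ℝ)^2 ≤ 2-1/(M:ℝ) by
    rcases Nat.eq_zero_or_pos M with h0 | h0
    · subst h0; simp
    · refine (h M h0).trans ?_
      have : (0:ℝ) ≤ 1/(M:ℝ) := by positivity
      linarith
  intro M hM
  induction M, hM using Nat.le_induction with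
  | base => norm_num
  | succ M hM ih =>
    rw [Finset.sum_Ico_succ_top hM]
    have hM' : (1:ℝ) ≤ M := by exact_mod_cast hM
    have : (1:ℝ)/(M:ℝ)^2 ≤ 1/M-1/((M+1:ℕ):ℝ)+1/(M:ℝ)^2-(1/M-1/((M+1:ℕ):ℝ)) := by linarith
    rcases eq_or_lt_of_le hM with h1 | h1
    · subst h1; norm_num
    · have h2 : ∀ k : ℕ, 1 ≤ k → ∑ n ∈ Ico 1 k, (1:ℝ)/(n:ℝ)^2+1/(k:ℝ)^2 ≤ 2-1/(k:ℝ) := by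
        intro k hk
        induction k, hk using Nat.le_induction with
        | base => norm_num
        | succ k hk ih2 =>
          rw [Finset.sum_Ico_succ_top hk]
          have hk' : (1:ℝ) ≤ k := by exact_mod_cast hk
          have e : (1:ℝ)/((k+1:ℕ):ℝ)^2 ≤ 1/(k:ℝ)-1/((k+1:ℕ):ℝ) := by
            push_cast
            rw [div_sub_div _ _ (by positivity) (by positivity), div_le_div_iff₀ (by positivity) (by positivity)]
            nlinarith
          linarith
      have h3 := h2 M hM
      have e : 1/((M+1:ℕ):ℝ) ≤ 1/(M:ℝ) := by
        apply one_div_le_one_div_of_le (by linarith); push_cast; linarith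
      linarith

lemma zeta_partial (s : ℂ) (hs : 1 < s.re) (M:ℕ) (hM : 1 ≤ M) :
    ‖∑ n ∈ Ico 1 M, gT 0 s (log n)‖ ≤ 2 / ‖s-1‖ + 2*‖s‖ := by
  have hs1 : s ≠ 1 := by
    intro h; rw [h] at hs; simp at hs
  have step : ∀ n ∈ Ico 1 M, ‖(hZ s ((n+1:ℕ):ℝ)-hZ s n)-gT 0 s (log n)‖ ≤ ‖s‖*(1/(n:ℝ)^2) := by
    intro n hn
    have hn1 : 1 ≤ n := (mem_Ico.1 hn).1
    have hn' : (1:ℝ) ≤ n := by exact_mod_cast hn1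
    have hn0 : (0:ℝ) < n := by linarith
    have key := Convex.norm_image_sub_le_of_norm_hasDerivWithin_le
      (f := fun x : ℝ => hZ s x-(x : ℂ)*gT 0 s (log n))
      (f' := fun x => gT 0 s (log x)-1*gT 0 s (log n))
      (s := Set.Icc (n:ℝ) ((n+1:ℕ):ℝ)) (C := ‖s‖*(1/(n:ℝ)^2)) (x := (n:ℝ)) (y := ((n+1:ℕ):ℝ))
      (by
        intro x hx
        have hx0 : 0 < x := hn0.trans_le hx.1
        exact ((hZ_hasDerivAt s hs1 x hx0).sub
          ((Complex.ofRealCLM.hasDerivAt (x := x)).mul_const _)).hasDerivWithinAt)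
      (by
        intro x hx
        have hx0 : 0 < x := hn0.trans_le hx.1
        rw [one_mul]
        have hll : log n ≤ log x := Real.log_le_log hn0 hx.1
        refine (gT_zero_diff s hs.le (log n) (log x) (Real.log_natCast_nonneg n) hll).trans ?_
        rw [mul_assoc]
        gcongr
        rw [Real.exp_neg, Real.exp_log hn0]
        have h1 : log x-log n ≤ 1/n := by
          rw [← Real.log_div hx0.ne' hn0.ne']
          have := Real.log_le_sub_one_of_pos (show 0 < x/n by positivity)
          refine this.trans ?_
          have h2 := hx.2
          push_cast at h2
          rw [div_sub_one hn0.ne']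
          gcongr
          linarith
        calc (n:ℝ)⁻¹*(log x-log n) ≤ (n:ℝ)⁻¹*(1/n) := by gcongr
          _ = _ := by field_simp)
      (convex_Icc _ _) ⟨le_refl _, by push_cast; linarith⟩ ⟨by push_cast; linarith, le_refl _⟩
    have e1 : ‖((n+1:ℕ):ℝ)-(n:ℝ)‖ = 1 := by push_cast; simp
    rw [e1, mul_one] at key
    refine le_trans (le_of_eq ?_) key
    congr 1
    push_cast
    ring
  have tel := Finset.sum_Ico_sub (fun n : ℕ => hZ s n) hM
  have hb : ∀ x : ℝ, 1 ≤ x → ‖hZ s x‖ ≤ 1 / ‖s-1‖ := by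
    intro x hx
    unfold hZ
    rw [norm_div, ← norm_neg (1-s), neg_sub, Complex.norm_exp]
    gcongr
    rw [← Real.exp_zero]
    gcongr
    have := Real.log_nonneg hx
    simp
    nlinarith
  have e : ∑ n ∈ Ico 1 M, gT 0 s (log n) = (hZ s M-hZ s ((1:ℕ):ℝ)) -
      ∑ n ∈ Ico 1 M, ((hZ s ((n+1:ℕ):ℝ)-hZ s n)-gT 0 s (log n)) := by
    rw [sum_sub_distrib, tel]; ring
  rw [e]
  have h1 := hb M (by exact_mod_cast hM)
  have h2 := hb ((1:ℕ):ℝ) (by simp)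
  have h3 : ‖∑ n ∈ Ico 1 M, ((hZ s ((n+1:ℕ):ℝ)-hZ s n)-gT 0 s (log n))‖ ≤ 2*‖s‖ := by
    refine (norm_sum_le _ _).trans ((sum_le_sum step).trans ?_)
    rw [← mul_sum]
    have := sum_inv_sq_le M
    nlinarith [norm_nonneg s]
  calc _ ≤ ‖hZ s M-hZ s ((1:ℕ):ℝ)‖ + ‖∑ n ∈ Ico 1 M, ((hZ s ((n+1:ℕ):ℝ)-hZ s n)-gT 0 s (log n))‖ :=
        norm_sub_le _ _
    _ ≤ (‖hZ s M‖ + ‖hZ s ((1:ℕ):ℝ)‖)+2*‖s‖ := by gcongr; exact norm_sub_le _ _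
    _ ≤ _ := by
        rw [show 2 / ‖s-1‖ = 1 / ‖s-1‖ + 1 / ‖s-1‖ by ring]; gcongr

lemma sum_range_eq_Ico_term (f : ℕ → ℂ) (s : ℂ) (M:ℕ) :
    ∑ n ∈ range M, LSeries.term f s n = ∑ n ∈ Ico 1 M, f n*gT 0 s (log n) := by
  have e : ∀ n ∈ Ico 1 M, f n*gT 0 s (log n) = LSeries.term f s n := by
    intro n hn
    have := term_eq_gT f 0 s n (by have := (mem_Ico.1 hn).1; omega)
    simpa using this.symm
  rw [sum_congr rfl e]
  rcases Nat.eq_zero_or_pos M with h0 | h0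
  · subst h0; simp
  · rw [Finset.range_eq_Ico, Finset.sum_eq_sum_Ico_succ_bot h0]; simp

lemma LS_one_bound (s : ℂ) (hs : 1 < s.re) :
    ‖LSeries (fun _ => (1 : ℂ)) s‖ ≤ 2 / ‖s-1‖ + 2*‖s‖ := by
  have hsum : LSeriesSummable (fun _ => (1 : ℂ)) s :=
    LSeriesSummable_of_bounded_of_one_lt_re (m := 1) (fun n _ => by simp) hs
  refine le_of_tendsto hsum.hasSum.tendsto_sum_nat.norm ?_
  filter_upwards [Filter.eventually_ge_atTop 1] with M hM
  rw [sum_range_eq_Ico_term]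
  simpa using zeta_partial s hs M hM

lemma LS_bound_real (f : ℕ → ℂ) (hf : ∀ n, ‖f n‖ ≤ 1) (x:ℝ) (hx : 0 < x) (hx1 : x ≤ 1) (s : ℂ) (hs : s.re = 1+x) :
    ‖LSeries f s‖ ≤ 6/x := by
  have hs' : 1 < s.re := by rw [hs]; linarith
  have hsum : LSeriesSummable f s :=
    LSeriesSummable_of_bounded_of_one_lt_re (m := 1) (fun n _ => hf n) hs'
  refine le_of_tendsto hsum.hasSum.tendsto_sum_nat.norm ?_
  filter_upwards [Filter.eventually_ge_atTop 1] with M hM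
  rw [sum_range_eq_Ico_term]
  have h1 : ∀ n : ℕ, gT 0 ((1+x:ℝ) : ℂ) (log n) = ((exp (-(1+x)*log n):ℝ) : ℂ) := by
    intro n; unfold gT; push_cast; simp
  have h2 := zeta_partial ((1+x:ℝ) : ℂ) (by simp; linarith) M hM
  simp only [h1] at h2
  rw [← Complex.ofReal_sum, Complex.norm_real, Real.norm_of_nonneg (by positivity), Complex.norm_real,
    Real.norm_of_nonneg (by linarith), show (((1+x:ℝ) : ℂ)-1) = (x : ℂ) by push_cast; ring,
    Complex.norm_real, Real.norm_of_nonneg hx.le] at h2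
  calc ‖∑ n ∈ Ico 1 M, f n*gT 0 s (log n)‖ ≤ ∑ n ∈ Ico 1 M, exp (-(1+x)*log n) := by
        refine norm_sum_le_of_le _ fun n hn => ?_
        rw [norm_mul]
        have : ‖gT 0 s (log n)‖ = exp (-(1+x)*log n) := by
          unfold gT
          rw [pow_zero, one_mul, Complex.norm_exp]
          rw [Complex.re_mul_ofReal, Complex.neg_re, hs]
        rw [this]
        have := hf n
        have h0 := Real.exp_pos (-(1+x)*log n)
        nlinarith
    _ ≤ 2/x+2*(1+x) := h2
    _ ≤ 2/x+4/x := by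
        gcongr
        rw [le_div_iff₀ hx]; nlinarith
    _ = _ := by ring

lemma char_T_bound {r : ℕ} (hr : 2 ≤ r) (χ : DirichletCharacter ℂ r) (hχ : χ ≠ 1) (j:ℕ) (s : ℂ) (hs : 1 < s.re) :
    ‖LSeries (LSeries.logMul^[j] (fun n : ℕ => χ n)) s‖ ≤
      (2+CT j*(4*j+5))*((log r+2)^(j+1)*(‖s‖ + 1)) :=
  T_bound j _ (fun n => DirichletCharacter.norm_le_one _ _) r hr
    (char_sum_le (by omega) χ hχ) s hs

lemma principal_bound {r : ℕ} (hr : 2 ≤ r) (s : ℂ) (hs : 1 < s.re) :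
    ‖LSeries (fun n : ℕ => (1 : DirichletCharacter ℂ r) n) s‖ ≤
      2 / ‖s-1‖ + 2*‖s‖ + 12*((log r+2)*(‖s‖ + 1)) := by
  have : NeZero r := ⟨by omega⟩
  have hr' : (0:ℝ) < r := by exact_mod_cast (by omega : 0 < r)
  set a : ℝ := (r.totient:ℝ)/r with ha
  have ha0 : 0 ≤ a := by positivity
  have ha1 : a ≤ 1 := by
    rw [ha, div_le_one hr']; exact_mod_cast Nat.totient_le r
  let g : ZMod r → ℂ := fun x => (1 : DirichletCharacter ℂ r) x-(a : ℂ)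
  have hg1 : ∀ x, ‖g x‖ ≤ 1 := by
    intro x
    by_cases hx : IsUnit x
    · have : g x = ((1-a:ℝ) : ℂ) := by simp [g, MulChar.one_apply hx]
      rw [this, Complex.norm_real, Real.norm_of_nonneg (by linarith)]; linarith
    · have : g x = ((-a:ℝ) : ℂ) := by simp [g, MulChar.map_nonunit _ hx]
      rw [this, Complex.norm_real, norm_neg, Real.norm_of_nonneg ha0]; exact ha1
  have hg0 : ∑ x, g x = 0 := by
    simp only [g, sum_sub_distrib]
    rw [MulChar.sum_one_eq_card_units, ZMod.card_units_eq_totient, Finset.sum_const, Finset.card_univ, ZMod.card, nsmul_eq_mul, ha]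
    push_cast
    have : (r : ℂ) ≠ 0 := by exact_mod_cast hr'.ne'
    field_simp
    simp
  have hb := T_bound 0 (fun n : ℕ => g n) (fun n => hg1 _) r hr (char_period r g hg0 hg1) s hs
  simp only [Function.iterate_zero, id, Nat.cast_zero, mul_zero, zero_add, pow_one] at hb
  have s1 : LSeriesSummable (fun n : ℕ => g n) s :=
    LSeriesSummable_of_bounded_of_one_lt_re (m := 1) (fun n _ => hg1 _) hs
  have s2 : LSeriesSummable (fun _ => (1 : ℂ)) s :=
    LSeriesSummable_of_bounded_of_one_lt_re (m := 1) (fun n _ => by simp) hs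
  have e : (fun n : ℕ => (1 : DirichletCharacter ℂ r) n) = (fun n : ℕ => g n)+(a : ℂ) • (fun _ => (1 : ℂ)) := by
    funext n; simp [g]
  rw [e, LSeries_add s1 (s2.smul _), LSeries_smul]
  refine (norm_add_le _ _).trans ?_
  rw [norm_mul, Complex.norm_real, Real.norm_of_nonneg ha0]
  have h1 := LS_one_bound s hs
  have h2 : CT 0 = 2 := by simp [CT]
  rw [h2] at hb
  have h3 : a*‖LSeries (fun _ => (1 : ℂ)) s‖ ≤ 1*‖LSeries (fun _ => (1 : ℂ)) s‖ := by gcongr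
  linarith
end

section
open Finset

noncomputable def LL {r : ℕ} (χ : DirichletCharacter ℂ r) (s : ℂ) : ℂ := LSeries (fun n : ℕ => χ n) s

lemma LL_lip {r : ℕ} (hr : 2 ≤ r) (χ : DirichletCharacter ℂ r) (hχ : χ ≠ 1) (ℓ:ℝ) (hℓ : log r+2 ≤ ℓ)
    (Y:ℝ) (s₁ s₂ : ℂ) (h1 : 1 < s₁.re) (h1' : s₁.re ≤ 2) (h2 : 1 < s₂.re) (h2' : s₂.re ≤ 2)
    (hy1 : |s₁.im| ≤ Y) (hy2 : |s₂.im| ≤ Y) :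
    ‖LL χ s₂-LL χ s₁‖ ≤ 38*ℓ^2*(Y+3)*‖s₂-s₁‖ := by
  have hlr : 0 ≤ log r := Real.log_natCast_nonneg r
  have hf : ∀ n : ℕ, ‖χ n‖ ≤ 1 := fun n => DirichletCharacter.norm_le_one _ _
  have hconv : Convex ℝ ({s : ℂ | 1 < s.re} ∩ ({s | s.re ≤ 2} ∩ ({s | -Y ≤ s.im} ∩ {s | s.im ≤ Y}))) :=
    (convex_halfSpace_re_gt 1).inter ((convex_halfSpace_re_le 2).inter
      ((convex_halfSpace_im_ge (-Y)).inter (convex_halfSpace_im_le Y)))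
  refine hconv.norm_image_sub_le_of_norm_hasDerivWithin_le (f := LL χ)
    (f' := fun s => -LSeries (LSeries.logMul (fun n : ℕ => χ n)) s) ?_ ?_
    ⟨h1, h1', (abs_le.1 hy1).1, (abs_le.1 hy1).2⟩ ⟨h2, h2', (abs_le.1 hy2).1, (abs_le.1 hy2).2⟩
  · rintro s ⟨hs, -⟩
    exact (LSeries_hasDerivAt (absc_lt hf hs)).hasDerivWithinAt
  · rintro s ⟨hs, hs2, hi1, hi2⟩
    simp only [Set.mem_setOf_eq] at hs hs2 hi1 hi2
    rw [norm_neg]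
    have := char_T_bound hr χ hχ 1 s hs
    simp only [Function.iterate_one] at this
    refine this.trans ?_
    have e : (2+CT 1*(4*((1:ℕ):ℝ)+5)) = 38 := by norm_num [CT]
    rw [e]
    have hn : ‖s‖ ≤ Y+2 := by
      refine (Complex.norm_le_abs_re_add_abs_im s).trans ?_
      rw [abs_of_pos (by linarith : 0 < s.re)]
      have := abs_le.2 ⟨hi1, hi2⟩
      linarith
    have h0 := norm_nonneg s
    calc 38*((log r+2)^(1+1)*(‖s‖ + 1)) ≤ 38*(ℓ^2*(Y+2+1)) := by gcongr
      _ = _ := by ring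

lemma LL_bound {r : ℕ} (hr : 2 ≤ r) (χ : DirichletCharacter ℂ r) (hχ : χ ≠ 1) (ℓ:ℝ) (hℓ : log r+2 ≤ ℓ)
    (s : ℂ) (hs : 1 < s.re) : ‖LL χ s‖ ≤ 12*(ℓ*(‖s‖ + 1)) := by
  have := char_T_bound hr χ hχ 0 s hs
  have e : (2+CT 0*(4*((0:ℕ):ℝ)+5)) = 12 := by norm_num [CT]
  rw [e] at this
  simp only [Function.iterate_zero, id, zero_add, pow_one] at this
  refine this.trans ?_
  have h0 := norm_nonneg s
  gcongr

/-- 3-4-1 lower bound, with a bound `E` for `L(χ²)` -/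
lemma LL_lower {r : ℕ} (hr : 2 ≤ r) (χ : DirichletCharacter ℂ r) (hχ : χ ≠ 1) (ℓ:ℝ) (hℓ : log r+2 ≤ ℓ)
    (y E:ℝ) (hE1 : 1 ≤ E)
    (hE : ∀ x : ℝ, 0 < x → x ≤ 1 → ‖LSeries (fun n : ℕ => (χ^2) n) (1+x+2*Complex.I*y)‖ ≤ E)
    (x₀:ℝ) (hx₀ : 0 < x₀) (hx₀1 : x₀ ≤ 1) :
    1/(3456*E*(38*ℓ^2*(|y| + 3))^4) ≤ ‖LL χ (1+x₀+Complex.I*y)‖ := by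
  have : NeZero r := ⟨by omega⟩
  have hlr : 0 ≤ log r := Real.log_natCast_nonneg r
  have hy := abs_nonneg y
  set D := 38*ℓ^2*(|y| + 3) with hD
  have hD1 : 1 ≤ D := by
    have : 1 ≤ ℓ^2 := one_le_pow₀ (by linarith)
    nlinarith
  have hre : ∀ x : ℝ, (1+(x:ℂ)+Complex.I*y).re = 1+x := by intro x; simp
  have him : ∀ x : ℝ, (1+(x:ℂ)+Complex.I*y).im = y := by intro x; simp
  have key : ∀ x : ℝ, 0 < x → x ≤ 1 → x^3/(216*E) ≤ ‖LL χ (1+x+Complex.I*y)‖^4 := by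
    intro x hx hx1
    have h341 := DirichletCharacter.norm_LSeries_product_ge_one χ hx y
    have h1 := LS_bound_real (fun n : ℕ => (1 : DirichletCharacter ℂ r) n)
      (fun n => DirichletCharacter.norm_le_one _ _) x hx hx1 (1+x) (by simp)
    have h2 := hE x hx hx1
    rw [norm_mul, norm_mul, norm_pow, norm_pow] at h341
    have h341' : 1 ≤ (6/x)^3*‖LL χ (1+x+Complex.I*y)‖^4*E := by
      refine le_trans h341 ?_
      unfold LL
      gcongr
    have h3 : (6/x)^3 = 216/x^3 := by rw [div_pow]; norm_num
    rw [h3, mul_assoc, div_mul_eq_mul_div, le_div_iff₀ (by positivity)] at h341'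
    rw [div_le_iff₀ (by positivity)]
    linarith
  set x₁ := 1/(3456*E*D^4) with hx₁
  have hx₁0 : 0 < x₁ := by positivity
  have hx₁1 : x₁ ≤ 1 := by
    rw [hx₁, div_le_one (by positivity)]
    have : 1 ≤ D^4 := one_le_pow₀ hD1
    nlinarith
  have hx₁e : 3456*E*D^4*x₁ = 1 := by
    rw [hx₁]; field_simp
  have claim : ∀ x : ℝ, x₁ ≤ x → x ≤ 1 → 2*D*x₁ ≤ ‖LL χ (1+x+Complex.I*y)‖ := by
    intro x hx hx1
    have h := key x (by linarith) hx1
    refine le_of_pow_le_pow_left₀ (n := 4) (by norm_num) (norm_nonneg _) (le_trans ?_ h)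
    rw [le_div_iff₀ (by positivity)]
    calc (2*D*x₁)^4*(216*E) = x₁^3*(3456*E*D^4*x₁) := by ring
      _ = x₁^3 := by rw [hx₁e, mul_one]
      _ ≤ x^3 := by gcongr
  rcases le_total x₁ x₀ with h | h
  · have := claim x₀ h hx₀1
    nlinarith
  · have c1 := claim x₁ le_rfl hx₁1
    have lip := LL_lip hr χ hχ ℓ hℓ |y| (1+x₀+Complex.I*y) (1+x₁+Complex.I*y)
      (by rw [hre]; linarith) (by rw [hre]; linarith) (by rw [hre]; linarith) (by rw [hre]; linarith)
      (by rw [him]) (by rw [him])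
    have e : ‖(1+(x₁:ℂ)+Complex.I*y)-(1+(x₀:ℂ)+Complex.I*y)‖ = x₁-x₀ := by
      rw [show (1+(x₁:ℂ)+Complex.I*y)-(1+(x₀:ℂ)+Complex.I*y) = ((x₁-x₀:ℝ) : ℂ) by push_cast; ring,
        Complex.norm_real, Real.norm_of_nonneg (by linarith)]
    rw [e] at lip
    have tri := norm_sub_norm_le (LL χ (1+x₁+Complex.I*y)) (LL χ (1+x₀+Complex.I*y))
    have : D*(x₁-x₀) ≤ D*x₁ := by nlinarith
    nlinarith

/-- the general lower bound -/
theorem LL_lower_all : ∃ c : ℝ, 0 < c ∧ ∀ (r:ℕ), 2 ≤ r → ∀ (χ : DirichletCharacter ℂ r), χ ≠ 1 →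
    ∀ ℓ : ℝ, log r+2 ≤ ℓ → ∀ κ : ℝ, 0 < κ → κ ≤ 1 → ∀ x₀ : ℝ, 0 < x₀ → x₀ ≤ 1 →
    (χ^2 = 1 → κ ≤ ‖LL χ (1+x₀)‖) → ∀ y : ℝ,
    c*κ/(ℓ^11*(|y| + 3)^5) ≤ ‖LL χ (1+x₀+Complex.I*y)‖ := by
  refine ⟨1/(3456*38^4*30000), by norm_num, ?_⟩
  intro r hr χ hχ ℓ hℓ κ hκ hκ1 x₀ hx₀ hx₀1 hreal y
  have : NeZero r := ⟨by omega⟩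
  have hlr : 0 ≤ log r := Real.log_natCast_nonneg r
  have hy := abs_nonneg y
  have hℓ2 : 2 ≤ ℓ := by linarith
  set τ := |y| + 3 with hτ
  have hτ3 : 3 ≤ τ := by linarith
  have hnorm : ∀ x : ℝ, 0 < x → x ≤ 1 → ‖(1+(x:ℂ)+2*Complex.I*y)‖ + 1 ≤ 2*τ := by
    intro x hx hx1
    have h := Complex.norm_le_abs_re_add_abs_im (1+(x:ℂ)+2*Complex.I*y)
    have e1 : (1+(x:ℂ)+2*Complex.I*y).re = 1+x := by simp
    have e2 : (1+(x:ℂ)+2*Complex.I*y).im = 2*y := by simp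
    rw [e1, e2, abs_of_pos (by linarith), abs_mul, abs_two] at h
    linarith
  have hre : ∀ x : ℝ, (1+(x:ℂ)+2*Complex.I*y).re = 1+x := by intro x; simp
  set η := κ/(456*ℓ^2) with hη
  have hη0 : 0 < η := by positivity
  have hη1 : η ≤ 1 := by
    rw [hη, div_le_one (by positivity)]; nlinarith
  have fin : ∀ E : ℝ, E ≤ 64*ℓ*τ/η → 1 ≤ E → 1/(3456*E*(38*ℓ^2*τ)^4) ≥
      1/(3456*38^4*30000)*κ/(ℓ^11*τ^5) := by
    intro E hE hE1
    have hE' : E ≤ 64*ℓ*τ*(456*ℓ^2)/κ := by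
      refine hE.trans (le_of_eq ?_); rw [hη]; field_simp
    calc 1/(3456*E*(38*ℓ^2*τ)^4) ≥ 1/(3456*(64*ℓ*τ*(456*ℓ^2)/κ)*(38*ℓ^2*τ)^4) := by
          apply one_div_le_one_div_of_le (by positivity)
          gcongr
      _ = 1/(3456*38^4*(64*456))*κ/(ℓ^11*τ^5) := by field_simp
      _ ≥ _ := by
          gcongr
          norm_num
  by_cases h2 : χ^2 = 1
  · rcases le_total η |y| with hyη | hyη
    · have hE1 : 1 ≤ 64*ℓ*τ/η := by
        rw [le_div_iff₀ hη0]; nlinarith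
      refine (fin _ le_rfl hE1).le.trans (LL_lower hr χ hχ ℓ hℓ y _ hE1 ?_ x₀ hx₀ hx₀1)
      intro x hx hx1
      rw [h2]
      refine (principal_bound hr _ (by rw [hre]; linarith)).trans ?_
      have hn := hnorm x hx hx1
      have hs1 : 2*η ≤ ‖(1+(x:ℂ)+2*Complex.I*y)-1‖ := by
        have := Complex.abs_im_le_norm ((1+(x:ℂ)+2*Complex.I*y)-1)
        have e2 : ((1+(x:ℂ)+2*Complex.I*y)-1).im = 2*y := by simp
        rw [e2, abs_mul, abs_two] at this
        linarith
      set n := ‖(1+(x:ℂ)+2*Complex.I*y)‖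
      have a1 : 2 / ‖(1+(x:ℂ)+2*Complex.I*y)-1‖ ≤ 1/η := by
        calc 2 / ‖(1+(x:ℂ)+2*Complex.I*y)-1‖ ≤ 2/(2*η) := by gcongr
          _ = 1/η := by field_simp
      have hn0 : 0 ≤ n := norm_nonneg _
      have a2 : 12*((log r+2)*(n+1)) ≤ 12*(ℓ*(2*τ)) := by gcongr
      have a3 : 2*n ≤ 4*τ := by linarith
      have a4 : 1/η+4*τ+24*ℓ*τ ≤ 64*ℓ*τ/η := by
        rw [le_div_iff₀ hη0, add_mul, add_mul, one_div_mul_cancel hη0.ne']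
        have b1 : 4*τ*η ≤ 4*τ*1 := by gcongr
        have b2 : 24*ℓ*τ*η ≤ 24*ℓ*τ*1 := by gcongr
        nlinarith [mul_le_mul hℓ2 hτ3 (by norm_num) (by linarith)]
      linarith
    · have hk := hreal h2
      have lip := LL_lip hr χ hχ ℓ hℓ |y| (1+x₀) (1+x₀+Complex.I*y)
        (by simp; linarith) (by simp; linarith) (by simp; linarith) (by simp; linarith) (by simp) (by simp)
      have e : ‖(1+(x₀:ℂ)+Complex.I*y)-(1+(x₀:ℂ))‖ = |y| := by
        rw [add_sub_cancel_left, norm_mul, Complex.norm_I, one_mul, Complex.norm_real, Real.norm_eq_abs]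
      rw [e] at lip
      have tri := norm_sub_norm_le (LL χ (1+x₀)) (LL χ (1+x₀+Complex.I*y))
      rw [norm_sub_rev] at tri
      have b : 38*ℓ^2*(|y| + 3) * |y| ≤ κ/3 := by
        calc 38*ℓ^2*(|y| + 3) * |y| ≤ 38*ℓ^2*(1+3)*η := by
              gcongr; linarith
          _ = κ/3 := by rw [hη]; field_simp; norm_num
      have b2 : 1/(3456*38^4*30000)*κ/(ℓ^11*τ^5) ≤ κ/2 := by
        rw [div_le_div_iff₀ (by positivity) (by norm_num)]
        have h1 : 1 ≤ ℓ^11*τ^5 := one_le_mul_of_one_le_of_one_le (one_le_pow₀ (by linarith)) (one_le_pow₀ (by linarith))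
        nlinarith
      linarith
  · have hE1 : 1 ≤ 24*ℓ*τ := by nlinarith
    refine (fin (24*ℓ*τ) ?_ hE1).le.trans (LL_lower hr χ hχ ℓ hℓ y _ hE1 ?_ x₀ hx₀ hx₀1)
    · rw [le_div_iff₀ hη0]
      have : 0 < ℓ*τ := by positivity
      nlinarith
    · intro x hx hx1
      refine (LL_bound hr (χ^2) h2 ℓ hℓ _ (by rw [hre]; linarith)).trans ?_
      have hn := hnorm x hx hx1
      calc 12*(ℓ*(‖(1+(x:ℂ)+2*Complex.I*y)‖ + 1)) ≤ 12*(ℓ*(2*τ)) := by gcongr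
        _ = _ := by ring
end

section
open Finset

lemma real_vals {r : ℕ} (χ : DirichletCharacter ℂ r) (h : χ^2 = 1) (n:ℕ) : χ n = 0 ∨ χ n = 1 ∨ χ n = -1 := by
  by_cases hu : IsUnit (n : ZMod r)
  · right
    have : (χ n)^2 = 1 := by
      obtain ⟨u, hu⟩ := hu
      rw [← hu, ← MulChar.pow_apply_coe, h, MulChar.one_apply_coe]
    simpa using this
  · left; exact MulChar.map_nonunit _ hu

lemma local_factor (x:ℝ) (hx : 0 < x) (hx1 : x < 1) (a b : ℂ) (ha : a = 0 ∨ a = 1 ∨ a = -1) (hb : b = 0 ∨ b = 1 ∨ b = -1) :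
    1 ≤ ‖(1-(x:ℂ))⁻¹*(1-a*x)⁻¹*(1-b*x)⁻¹*(1-a*b*x)⁻¹‖ := by
  have n1 : ‖(1-(x:ℂ))‖ = 1-x := by
    rw [show (1-(x:ℂ)) = ((1-x:ℝ) : ℂ) by push_cast; ring, Complex.norm_real, Real.norm_of_nonneg (by linarith)]
  have n2 : ‖(1+(x:ℂ))‖ = 1+x := by
    rw [show (1+(x:ℂ)) = ((1+x:ℝ) : ℂ) by push_cast; ring, Complex.norm_real, Real.norm_of_nonneg (by linarith)]
  have p1 : 0 < 1-x := by linarith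
  have p2 : 0 < 1+x := by linarith
  have q1 : (1-x)*(1+x) ≤ 1 := by nlinarith
  have q0 : 0 < (1-x)*(1+x) := by positivity
  have q2 : (1-x)*(1-x) ≤ 1 := by nlinarith
  have q3 : 0 < (1-x)*(1-x) := by positivity
  simp only [norm_mul, norm_inv, ← mul_inv]
  rw [one_le_inv₀]
  · rcases ha with rfl | rfl | rfl <;> rcases hb with rfl | rfl | rfl <;>
      simp only [zero_mul, mul_zero, sub_zero, norm_one, one_mul, mul_one, neg_mul, sub_neg_eq_add, neg_neg, n1, n2] <;> nlinarith
  · rcases ha with rfl | rfl | rfl <;> rcases hb with rfl | rfl | rfl <;>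
      simp only [zero_mul, mul_zero, sub_zero, norm_one, one_mul, mul_one, neg_mul, sub_neg_eq_add, neg_neg, n1, n2] <;> positivity

lemma four_prod {ξ η : PC} (h1 : ξ.1 ≠ 0) (h2 : η.1 ≠ 0) (hp1 : ξ.2.IsPrimitive) (hp2 : η.2.IsPrimitive)
    (hne : ξ ≠ η) (hr1 : ξ.2^2 = 1) (hr2 : η.2^2 = 1) (x:ℝ) (hx : 0 < x) :
    ∃ ρ : DirichletCharacter ℂ (ξ.1*η.1), ρ ≠ 1 ∧
      1 ≤ ‖LL (1 : DirichletCharacter ℂ 1) (1+x)‖*‖LL ξ.2 (1+x)‖*‖LL η.2 (1+x)‖*‖LL ρ (1+x)‖ := by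
  obtain ⟨ρ, hρ, hv⟩ := pair_char h1 h2 hp1 hp2 hne
  refine ⟨ρ, hρ, ?_⟩
  have hs : 1 < (1+(x:ℂ)).re := by simp; linarith
  have H := ((((DirichletCharacter.LSeries_eulerProduct_hasProd (1 : DirichletCharacter ℂ 1) hs).mul
    (DirichletCharacter.LSeries_eulerProduct_hasProd ξ.2 hs)).mul
    (DirichletCharacter.LSeries_eulerProduct_hasProd η.2 hs)).mul
    (DirichletCharacter.LSeries_eulerProduct_hasProd ρ hs)).norm
  rw [norm_mul, norm_mul, norm_mul] at H
  refine ge_of_tendsto H (Filter.Eventually.of_forall fun S => ?_)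
  refine le_trans (le_of_eq Finset.prod_const_one.symm) (Finset.prod_le_prod (fun _ _ => zero_le_one) ?_)
  rintro p -
  have hp2' : (2:ℝ) ≤ (p:ℕ) := by exact_mod_cast p.2.two_le
  have e : ((p:ℕ):ℂ)^(-(1+(x:ℂ))) = (((p:ℕ):ℝ)^(-(1+x)):ℝ) := by
    rw [Complex.ofReal_cpow (by positivity)]; push_cast; rfl
  have hconj : (starRingEnd ℂ) (η.2 ((p:ℕ) : ZMod η.1)) = η.2 ((p:ℕ) : ZMod η.1) := by
    rcases real_vals η.2 hr2 p with h | h | h <;> rw [h] <;> simp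
  have e2 := hv p
  unfold chiN at e2
  rw [hconj] at e2
  have e1 : (1 : DirichletCharacter ℂ 1) ((p:ℕ) : ZMod 1) = 1 := by
    rw [Subsingleton.elim ((p:ℕ) : ZMod 1) 1, map_one]
  rw [← e2, e, e1, one_mul]
  exact local_factor _ (by positivity) (Real.rpow_lt_one_of_one_lt_of_neg (by linarith) (by linarith)) _ _
    (real_vals ξ.2 hr1 p) (real_vals η.2 hr2 p)

/-- at most one exceptional real primitive character -/
theorem exc_unique {ξ η : PC} (h1 : 2 ≤ ξ.1) (h2 : 2 ≤ η.1) (hp1 : ξ.2.IsPrimitive) (hp2 : η.2.IsPrimitive)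
    (hne : ξ ≠ η) (hr1 : ξ.2^2 = 1) (hr2 : η.2^2 = 1) (ℓ:ℝ) (hl1 : log ξ.1+2 ≤ ℓ)
    (hl2 : log η.1+2 ≤ ℓ) (κ:ℝ) (hκ : κ = 1/(6000000*ℓ^5)) (x₀:ℝ) (hx₀ : 0 < x₀) (hx₀κ : x₀ ≤ κ)
    (hs1 : ‖LL ξ.2 (1+x₀)‖ ≤ κ) (hs2 : ‖LL η.2 (1+x₀)‖ ≤ κ) : False := by
  have hlr : 0 ≤ log ξ.1 := Real.log_natCast_nonneg _
  have hℓ2 : 2 ≤ ℓ := by linarith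
  have hκ0 : 0 < κ := by rw [hκ]; positivity
  have hκ1 : κ ≤ 1 := by
    rw [hκ, div_le_one (by positivity)]
    have : 1 ≤ ℓ^5 := one_le_pow₀ (by linarith)
    linarith
  obtain ⟨ρ, hρ, hprod⟩ := four_prod (by omega) (by omega) hp1 hp2 hne hr1 hr2 κ hκ0
  have hζ : ‖LL (1 : DirichletCharacter ℂ 1) (1+κ)‖ ≤ 6/κ :=
    LS_bound_real _ (fun n => DirichletCharacter.norm_le_one _ _) κ hκ0 hκ1 (1+κ) (by simp)
  have hne1 : ∀ ξ : PC, 2 ≤ ξ.1 → ξ.2.IsPrimitive → ξ.2 ≠ 1 := by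
    intro ξ h hp he
    have : NeZero ξ.1 := ⟨by omega⟩
    have := (DirichletCharacter.eq_one_iff_conductor_eq_one (χ := ξ.2)).1 he
    have hp' : ξ.2.conductor = ξ.1 := hp
    omega
  have hb : ∀ ξ : PC, 2 ≤ ξ.1 → ξ.2.IsPrimitive → log ξ.1+2 ≤ ℓ → ‖LL ξ.2 (1+x₀)‖ ≤ κ →
      ‖LL ξ.2 (1+κ)‖ ≤ 115*ℓ^2*κ := by
    intro ξ h hp hl hs
    have lip := LL_lip h ξ.2 (hne1 ξ h hp) ℓ hl 0 (1+x₀) (1+κ)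
      (by simp; linarith) (by simp; linarith) (by simp; linarith) (by simp; linarith) (by simp) (by simp)
    have e : ‖(1+(κ:ℂ))-(1+(x₀:ℂ))‖ = κ-x₀ := by
      rw [show (1+(κ:ℂ))-(1+(x₀:ℂ)) = ((κ-x₀:ℝ) : ℂ) by push_cast; ring,
        Complex.norm_real, Real.norm_of_nonneg (by linarith)]
    rw [e] at lip
    have tri := norm_sub_norm_le (LL ξ.2 (1+κ)) (LL ξ.2 (1+x₀))
    have b : 38*ℓ^2*(0+3)*(κ-x₀) ≤ 38*ℓ^2*(0+3)*κ := by gcongr; linarith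
    have : 1*κ ≤ ℓ^2*κ := by gcongr; exact one_le_pow₀ (by linarith)
    nlinarith
  have b1 := hb ξ h1 hp1 hl1 hs1
  have b2 := hb η h2 hp2 hl2 hs2
  have b3 : ‖LL ρ (1+κ)‖ ≤ 72*ℓ := by
    have hl : log ((ξ.1*η.1:ℕ):ℝ)+2 ≤ 2*ℓ := by
      push_cast
      rw [Real.log_mul (by positivity) (by positivity)]
      linarith
    refine (LL_bound (by nlinarith) ρ hρ (2*ℓ) hl _ (by simp; linarith)).trans ?_
    have : ‖1+(κ:ℂ)‖ ≤ 2 := by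
      refine (norm_add_le _ _).trans ?_
      rw [norm_one, Complex.norm_real, Real.norm_of_nonneg hκ0.le]; linarith
    nlinarith
  have : (1:ℝ) ≤ 6/κ*(115*ℓ^2*κ)*(115*ℓ^2*κ)*(72*ℓ) := by
    refine hprod.trans ?_
    gcongr
  have e : 6/κ*(115*ℓ^2*κ)*(115*ℓ^2*κ)*(72*ℓ) = 5713200*(ℓ^5*κ) := by
    field_simp; ring
  have e2 : ℓ^5*κ = 1/6000000 := by rw [hκ]; field_simp
  rw [e, e2] at this
  norm_num at this

/-- for a fixed character no exception eventually -/
lemma fixed_lower {r : ℕ} (χ : DirichletCharacter ℂ r) (hr : 2 ≤ r) (hχ : χ ≠ 1) :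
    ∃ c : ℝ, 0 < c ∧ ∃ x₁ : ℝ, 0 < x₁ ∧ ∀ x : ℝ, 0 < x → x ≤ x₁ → c ≤ ‖LL χ (1+x)‖ := by
  have : NeZero r := ⟨by omega⟩
  have h0 := DirichletCharacter.LFunction_apply_one_ne_zero hχ
  have hc : Continuous (fun x : ℝ => ‖DirichletCharacter.LFunction χ (1+x)‖) :=
    ((DirichletCharacter.differentiable_LFunction hχ).continuous.comp (by fun_prop)).norm
  have hp : 0 < ‖DirichletCharacter.LFunction χ 1‖ := norm_pos_iff.2 h0
  have ht : Filter.Tendsto (fun x : ℝ => ‖DirichletCharacter.LFunction χ (1+x)‖) (nhds 0)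
      (nhds ‖DirichletCharacter.LFunction χ 1‖) := by
    have := hc.tendsto 0
    simpa using this
  have hev := ht.eventually (lt_mem_nhds (half_lt_self hp))
  obtain ⟨ε, hε, hball⟩ := Metric.eventually_nhds_iff.1 hev
  refine ⟨_, half_pos hp, ε/2, by positivity, fun x hx hx1 => ?_⟩
  have := hball (y := x) (by rw [Real.dist_eq, sub_zero, abs_of_pos hx]; linarith)
  rw [DirichletCharacter.LFunction_eq_LSeries χ (s := 1+(x:ℂ)) (by simp; linarith)] at this
  exact this.le
end

section
open Finset
open scoped ArithmeticFunction.vonMangoldt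

noncomputable def cLam {r : ℕ} (χ : DirichletCharacter ℂ r) : ℕ → ℂ := (fun n : ℕ => χ n)*fun n => ((Λ n:ℝ) : ℂ)

noncomputable def DD {r : ℕ} (χ : DirichletCharacter ℂ r) (j:ℕ) (s : ℂ) : ℂ := LSeries (LSeries.logMul^[j] (cLam χ)) s
noncomputable def TT {r : ℕ} (χ : DirichletCharacter ℂ r) (j:ℕ) (s : ℂ) : ℂ :=
  LSeries (LSeries.logMul^[j] (fun n : ℕ => χ n)) s

lemma cLam_absc {r : ℕ} (χ : DirichletCharacter ℂ r) {s : ℂ} (hs : 1 < s.re) :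
    LSeries.abscissaOfAbsConv (cLam χ) < s.re := by
  refine lt_of_le_of_lt (LSeries.abscissaOfAbsConv_le_of_forall_lt_LSeriesSummable (x := 1) ?_) (by exact_mod_cast hs)
  intro y hy
  exact DirichletCharacter.LSeriesSummable_twist_vonMangoldt χ (by simpa using hy)

lemma TD_rec {r : ℕ} (χ : DirichletCharacter ℂ r) (m:ℕ) (s : ℂ) (hs : 1 < s.re) :
    TT χ (m+1) s = ∑ j ∈ range (m+1), (m.choose j : ℂ)*DD χ j s*TT χ (m-j) s := by
  have hf : ∀ n : ℕ, ‖χ n‖ ≤ 1 := fun n => DirichletCharacter.norm_le_one _ _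
  have hopen : IsOpen {z : ℂ | 1 < z.re} := isOpen_lt continuous_const Complex.continuous_re
  have hmem : {z : ℂ | 1 < z.re} ∈ nhds s := hopen.mem_nhds hs
  have ev : (fun z => LSeries (LSeries.logMul (fun n : ℕ => χ n)) z) =ᶠ[nhds s]
      (LSeries (cLam χ)*LSeries (fun n : ℕ => χ n)) := by
    filter_upwards [hmem] with z hz
    rw [Pi.mul_apply, cLam, DirichletCharacter.LSeries_twist_vonMangoldt_eq χ hz,
      div_mul_cancel₀ _ (DirichletCharacter.LSeries_ne_zero_of_one_lt_re χ hz), LSeries_deriv (absc_lt hf hz), neg_neg]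
  have h1 := ev.iteratedDeriv_eq m
  rw [LSeries_iteratedDeriv m (by rw [LSeries.abscissaOfAbsConv_logMul]; exact absc_lt hf hs),
    iteratedDeriv_mul (LSeries_analyticOnNhd _ s (cLam_absc χ hs)).contDiffAt
      (LSeries_analyticOnNhd _ s (absc_lt hf hs)).contDiffAt] at h1
  have e : TT χ (m+1) s = LSeries (LSeries.logMul^[m] (LSeries.logMul (fun n : ℕ => χ n))) s := by
    unfold TT; rw [Function.iterate_succ_apply]
  have hsq : ((-1 : ℂ)^m)*(-1)^m = 1 := by rw [← mul_pow]; norm_num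
  rw [e, ← one_mul (LSeries _ s), ← hsq, mul_assoc, h1, mul_sum]
  refine sum_congr rfl fun j hj => ?_
  have hj' : j ≤ m := by simpa [Nat.lt_succ_iff] using hj
  rw [LSeries_iteratedDeriv j (cLam_absc χ hs), LSeries_iteratedDeriv (m-j) (absc_lt hf hs)]
  have e2 : (-1 : ℂ)^m = (-1)^j*(-1)^(m-j) := by rw [← pow_add]; congr 1; omega
  have hsq1 : ((-1 : ℂ)^j)*(-1)^j = 1 := by rw [← mul_pow]; norm_num
  have hsq2 : ((-1 : ℂ)^(m-j))*(-1)^(m-j) = 1 := by rw [← mul_pow]; norm_num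
  unfold DD TT
  rw [e2]
  set A := (-1 : ℂ)^j
  set B := (-1 : ℂ)^(m-j)
  linear_combination ((m.choose j : ℂ)*LSeries (LSeries.logMul^[j] (cLam χ)) s*LSeries (LSeries.logMul^[m-j] fun n : ℕ => χ n) s)*(B*B*hsq1+hsq2)

lemma DD_bound (m:ℕ) : ∃ C : ℝ, 0 < C ∧ ∀ r : ℕ, 2 ≤ r → ∀ χ : DirichletCharacter ℂ r, χ ≠ 1 → ∀ s : ℂ, 1 < s.re →
    ∀ P : ℝ, (log r+2)*(‖s‖ + 1) ≤ P → 1 / ‖TT χ 0 s‖ ≤ P → ‖DD χ m s‖ ≤ C*P^(3*m+3) := by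
  induction m using Nat.strong_induction_on with
  | _ m ih =>
  choose! C hC0 hC using ih
  set c : ℕ → ℝ := fun j => 2+CT j*(4*j+5) with hc
  have hCT : ∀ j, 0 ≤ CT j := fun j => by unfold CT; positivity
  have hc0 : ∀ j, 0 < c j := fun j => by have := hCT j; simp only [hc]; positivity
  refine ⟨c (m+1) + ∑ j ∈ range m, m.choose j*(C j)*c (m-j), ?_, ?_⟩
  · have : 0 ≤ ∑ j ∈ range m, m.choose j*(C j)*c (m-j) := sum_nonneg fun j hj => by
      have := hC0 j (by simpa using hj); have := hc0 (m-j); positivity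
    linarith [hc0 (m+1)]
  intro r hr χ hχ s hs P hP hP2
  have hlr : 0 ≤ log r := Real.log_natCast_nonneg r
  have hsn : 0 ≤ ‖s‖ := norm_nonneg s
  have hP1 : 1 ≤ P := by nlinarith
  have hT : ∀ j, ‖TT χ j s‖ ≤ c j*P^(j+1) := by
    intro j
    refine (char_T_bound hr χ hχ j s hs).trans ?_
    have := hc0 j
    have h1 : (log r+2)^(j+1)*(‖s‖ + 1) ≤ P^(j+1) := by
      calc (log r+2)^(j+1)*(‖s‖ + 1) ≤ (log r+2)^(j+1)*(‖s‖ + 1)^(j+1) := by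
            gcongr
            exact le_self_pow₀ (by linarith) (by omega)
        _ = ((log r+2)*(‖s‖ + 1))^(j+1) := (mul_pow _ _ _).symm
        _ ≤ _ := by gcongr
    exact mul_le_mul_of_nonneg_left h1 this.le
  have hrec := TD_rec χ m s hs
  rw [Finset.sum_range_succ, Nat.choose_self, Nat.sub_self, Nat.cast_one, one_mul] at hrec
  have hT0 : TT χ 0 s ≠ 0 := DirichletCharacter.LSeries_ne_zero_of_one_lt_re χ hs
  have hD : DD χ m s = (TT χ (m+1) s - ∑ j ∈ range m, (m.choose j : ℂ)*DD χ j s*TT χ (m-j) s)/TT χ 0 s := by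
    rw [eq_div_iff hT0, hrec]; ring
  rw [hD, norm_div, div_eq_mul_one_div]
  have hnum : ‖TT χ (m+1) s - ∑ j ∈ range m, (m.choose j : ℂ)*DD χ j s*TT χ (m-j) s‖ ≤
      (c (m+1) + ∑ j ∈ range m, m.choose j*(C j)*c (m-j))*P^(3*m+2) := by
    refine (norm_sub_le _ _).trans ?_
    rw [add_mul, sum_mul]
    gcongr
    · refine (hT (m+1)).trans ?_
      have := hc0 (m+1)
      exact mul_le_mul_of_nonneg_left (pow_le_pow_right₀ hP1 (by omega)) this.le
    · refine (norm_sum_le _ _).trans (sum_le_sum fun j hj => ?_)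
      have hjm : j < m := by simpa using hj
      have h1 := hC j hjm r hr χ hχ s hs P hP hP2
      have h2 := hT (m-j)
      rw [norm_mul, norm_mul, Complex.norm_natCast]
      have := hC0 j hjm
      have := hc0 (m-j)
      calc (m.choose j:ℝ)*‖DD χ j s‖*‖TT χ (m-j) s‖ ≤ m.choose j*(C j*P^(3*j+3))*(c (m-j)*P^(m-j+1)) := by gcongr
        _ = m.choose j*C j*c (m-j)*P^((3*j+3)+(m-j+1)) := by rw [pow_add]; ring
        _ ≤ _ := by
          exact mul_le_mul_of_nonneg_left (pow_le_pow_right₀ hP1 (by omega)) (by positivity)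
  have hn0 := (norm_nonneg _).trans hnum
  calc _ ≤ (c (m+1) + ∑ j ∈ range m, m.choose j*(C j)*c (m-j))*P^(3*m+2)*P := by gcongr
    _ = _ := by ring
end

section
open Finset
open scoped ArithmeticFunction.vonMangoldt

lemma KK_poly (J:ℕ) : ∃ C : ℝ, 0 < C ∧ ∀ σ : ℝ, 0 ≤ σ → σ ≤ 2 → ∀ G : ℝ → ℂ, ∀ B : ℝ, 0 ≤ B →
    (∀ t, ‖G t‖ ≤ B*(|t| + 4)^J) → ‖∫ t : ℝ, KK σ t*G t‖ ≤ C*B := by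
  have hIntegr : MeasureTheory.Integrable (fun t : ℝ => exp (-(1/8)*t^2)) := integrable_exp_neg_mul_sq (by norm_num)
  set I₀ := ∫ t : ℝ, exp (-(1/8)*t^2) with hI₀
  have hI0 : 0 ≤ I₀ := MeasureTheory.integral_nonneg fun t => (Real.exp_pos _).le
  set c₀ := (1/(2*Real.sqrt Real.pi))*exp 1*(J.factorial*exp 6) with hc₀
  have hc0 : 0 < c₀ := by positivity
  refine ⟨c₀*I₀+1, by positivity, ?_⟩
  intro σ hσ0 hσ G B hB hG
  have hbd : ∀ t, ‖KK σ t*G t‖ ≤ (c₀*B)*exp (-(1/8)*t^2) := by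
    intro t
    rw [norm_mul, KK_norm]
    have h1 : (|t| + 4)^J ≤ J.factorial*(exp 6*exp (t^2/8)) := by
      have := Real.pow_div_factorial_le_exp (|t| + 4) (by positivity) J
      rw [div_le_iff₀ (by positivity)] at this
      refine this.trans ?_
      rw [mul_comm, ← Real.exp_add]
      refine mul_le_mul_of_nonneg_left (Real.exp_le_exp.2 ?_) (by positivity)
      have := sq_nonneg (|t| - 4)
      have h2 := sq_abs t
      nlinarith
    have h2 : exp (σ^2/4) ≤ exp 1 := Real.exp_le_exp.2 (by nlinarith)
    have h3 : exp (-(1/8)*t^2) = exp (-(1/4)*t^2)*exp (t^2/8) := by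
      rw [← Real.exp_add]; congr 1; ring
    calc 1/(2*Real.sqrt Real.pi)*(exp (σ^2/4)*exp (-(1/4)*t^2))*‖G t‖
        ≤ 1/(2*Real.sqrt Real.pi)*(exp 1*exp (-(1/4)*t^2)) *
          (B*(J.factorial*(exp 6*exp (t^2/8)))) := by
          gcongr
          exact (hG t).trans (mul_le_mul_of_nonneg_left h1 hB)
      _ = _ := by rw [h3, hc₀]; ring
  refine (MeasureTheory.norm_integral_le_of_norm_le (hIntegr.const_mul (c₀*B)) (Filter.Eventually.of_forall hbd)).trans ?_
  rw [MeasureTheory.integral_const_mul, ← hI₀]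
  nlinarith

lemma psi_hasSum {r : ℕ} (χ : DirichletCharacter ℂ r) (m:ℕ) (L:ℝ) (hL : 1 ≤ L) (σ:ℝ) (hσ : 1 < σ) :
    HasSum (fun n : ℕ => cLam χ n*(FF m L n : ℂ))
      ((exp (σ*L)/L^m:ℝ)*∫ t : ℝ, KK σ t*(Complex.exp (-(Complex.I*t*L))*DD χ m (σ-Complex.I*t))) := by
  set c : ℕ → ℂ := fun n => LSeries.term (LSeries.logMul^[m] (cLam χ)) σ n with hc
  have hcs : Summable fun n => ‖c n‖ := by
    refine (LSeriesSummable_of_abscissaOfAbsConv_lt_re (f := LSeries.logMul^[m] (cLam χ)) (s := σ) ?_).norm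
    rw [LSeries.absicssaOfAbsConv_logPowMul]; exact cLam_absc χ (by simpa using hσ)
  set F : ℕ → ℝ → ℂ := fun n t => c n*(KK σ t*Complex.exp (Complex.I*t*((log n-L:ℝ) : ℂ))) with hF
  have hFint : ∀ n, MeasureTheory.Integrable (F n) := fun n => (KK_mul_integrable σ _).const_mul _
  have hFn : ∀ n t, ‖F n t‖ = ‖c n‖*‖KK σ t‖ := by
    intro n t
    simp only [hF]
    rw [norm_mul, norm_mul]
    congr 1
    rw [show Complex.I*t*((log n-L:ℝ) : ℂ) = ((t*(log n-L):ℝ) : ℂ)*Complex.I by push_cast; ring,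
      Complex.norm_exp_ofReal_mul_I, mul_one]
  have hsum : Summable fun n => ∫ t, ‖F n t‖ := by
    simp only [hFn, MeasureTheory.integral_const_mul]
    exact hcs.mul_right _
  have H := MeasureTheory.hasSum_integral_of_summable_integral_norm hFint hsum
  have hterm : ∀ n : ℕ, ∀ t : ℝ, F n t = KK σ t*Complex.exp (-(Complex.I*t*L)) *
      LSeries.term (LSeries.logMul^[m] (cLam χ)) (σ-Complex.I*t) n := by
    intro n t
    rcases eq_or_ne n 0 with rfl | hn
    · simp [hF, hc, LSeries.term_zero]
    · simp only [hF, hc]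
      rw [term_eq_gT _ _ _ _ hn, term_eq_gT _ _ _ _ hn]
      unfold gT
      have e : Complex.exp (-(σ-Complex.I*t)*(log n:ℝ)) =
          Complex.exp (-σ*(log n:ℝ))*Complex.exp (Complex.I*t*(log n:ℝ)) := by
        rw [← Complex.exp_add]; congr 1; ring
      have e2 : Complex.exp (Complex.I*t*((log n-L:ℝ) : ℂ)) =
          Complex.exp (-(Complex.I*t*L))*Complex.exp (Complex.I*t*(log n:ℝ)) := by
        rw [← Complex.exp_add]; congr 1
        rw [Complex.ofReal_sub]; ring
      rw [e, e2]; ring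
  have htsum : ∀ t : ℝ, ∑' n, F n t = KK σ t*(Complex.exp (-(Complex.I*t*L))*DD χ m (σ-Complex.I*t)) := by
    intro t
    simp only [hterm]
    rw [tsum_mul_left, mul_assoc]; rfl
  have hE : (∫ t, ∑' n, F n t) = _ := MeasureTheory.integral_congr_ae (Filter.Eventually.of_forall htsum)
  rw [hE] at H
  have H2 := H.mul_left (((exp (σ*L)/L^m:ℝ) : ℂ))
  have hfun : (fun n : ℕ => cLam χ n*(FF m L n : ℂ)) =
      fun n => ((exp (σ*L)/L^m:ℝ) : ℂ)*∫ t : ℝ, F n t := ?_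
  · rw [hfun]; exact H2
  funext n
  change _ = _*∫ t : ℝ, c n*(KK σ t*Complex.exp (Complex.I*t*((log n-L:ℝ) : ℂ)))
  rw [MeasureTheory.integral_const_mul, KK_int]
  rcases eq_or_ne n 0 with rfl | hn
  · simp [hc, LSeries.term_zero, cLam]
  · simp only [hc]
    rw [term_eq_gT _ _ _ _ hn]
    unfold gT FF phiW
    set u := log n
    have e1 : Complex.exp (-(σ:ℂ)*(u:ℂ)) = ((exp (-σ*u):ℝ) : ℂ) := by push_cast; rfl
    rw [e1]
    have e2 : exp (-(u-L)^2) = exp (σ*L)*(exp (-σ*u)*exp (σ*(u-L)-(u-L)^2)) := by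
      rw [← Real.exp_add, ← Real.exp_add]; congr 1; ring
    rw [e2, div_pow]
    push_cast
    ring

lemma tail_term (m:ℕ) (L:ℝ) (hL : 100 ≤ L) (n:ℕ) (hn : exp (5/4*L) ≤ n) :
    log n*FF m L n ≤ (m+1).factorial*(1/(n:ℝ)^2) := by
  have hn0 : (0:ℝ) < n := (Real.exp_pos _).trans_le hn
  set u := log n with hu
  have hu1 : 5/4*L ≤ u := (Real.le_log_iff_exp_le hn0).2 hn
  have hnu : (n:ℝ) = exp u := (Real.exp_log hn0).symm
  have e1 : (1:ℝ)/(n:ℝ)^2 = exp (-2*u) := by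
    rw [hnu, ← Real.exp_nat_mul, one_div, ← Real.exp_neg]; congr 1; push_cast; ring
  rw [e1]
  unfold FF phiW
  rw [← hu]
  have h1 : (u/L)^m ≤ u^m := by
    have : u/L ≤ u := div_le_self (by linarith) (by linarith)
    exact pow_le_pow_left₀ (by apply div_nonneg <;> linarith) this m
  have h2 := Real.pow_div_factorial_le_exp u (by linarith) (m+1)
  rw [div_le_iff₀ (by positivity)] at h2
  have h3 : exp (-(u-L)^2) ≤ exp (-3*u) := by
    apply Real.exp_le_exp.2
    nlinarith
  have hu0 : 0 ≤ u := by linarith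
  calc u*((u/L)^m*exp (-(u-L)^2)) ≤ u*(u^m*exp (-3*u)) := by gcongr
    _ = u^(m+1)*exp (-3*u) := by ring
    _ ≤ (exp u*(m+1).factorial)*exp (-3*u) := by gcongr
    _ = (m+1).factorial*(exp u*exp (-3*u)) := by ring
    _ = _ := by rw [← Real.exp_add]; congr 2; ring

/-- main small-conductor estimate -/
lemma psi_small (m:ℕ) : ∃ C : ℝ, 0 < C ∧ ∀ r : ℕ, 2 ≤ r → ∀ χ : DirichletCharacter ℂ r, χ ≠ 1 →
    ∀ L : ℝ, 100 ≤ L → ∀ N : ℕ, exp (5/4*L) ≤ N+1 → ∀ A : ℝ, log r+2 ≤ A →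
    (∀ t : ℝ, 1 / ‖LL χ (1+(1/L:ℝ)+Complex.I*t)‖ ≤ A*(|t| + 3)^5) →
    ‖psiF m L N (fun n => χ n)‖ ≤ C*(exp L*A^(3*m+3)/L^m+1) := by
  obtain ⟨C1, hC1, hD⟩ := DD_bound m
  obtain ⟨C2, hC2, hK⟩ := KK_poly (5*(3*m+3))
  have hs2 : Summable fun n : ℕ => 1/(n:ℝ)^2 := Real.summable_one_div_nat_pow.2 (by norm_num)
  set Z := ∑' n : ℕ, 1/(n:ℝ)^2 with hZ
  have hZ0 : 0 ≤ Z := tsum_nonneg fun n => by positivity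
  refine ⟨exp 1*C2*C1+(m+1).factorial*Z, by positivity, ?_⟩
  intro r hr χ hχ L hL N hN A hA hlow
  have hlr : 0 ≤ log r := Real.log_natCast_nonneg r
  have hA0 : 0 < A := by linarith
  have hL0 : 0 < L := by linarith
  set σ : ℝ := 1+1/L with hσ
  have hσ1 : 1 < σ := by have : 0 < 1/L := by positivity
                         linarith
  have hσ2 : σ ≤ 2 := by
    have : 1/L ≤ 1 := by rw [div_le_one hL0]; linarith
    linarith
  have H := psi_hasSum χ m L (by linarith) σ hσ1
  set g : ℕ → ℂ := fun n => cLam χ n*(FF m L n : ℂ) with hg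
  have hpsi : psiF m L N (fun n => χ n) = ∑ n ∈ Ioc 0 N, g n := by
    unfold psiF
    refine sum_congr rfl fun n _ => ?_
    simp only [hg, cLam, Pi.mul_apply]; ring
  rw [hpsi]
  have hmain : ‖((exp (σ*L)/L^m:ℝ) : ℂ)*∫ t : ℝ, KK σ t*(Complex.exp (-(Complex.I*t*L))*DD χ m (σ-Complex.I*t))‖
      ≤ exp 1*C2*C1*(exp L*A^(3*m+3)/L^m) := by
    rw [norm_mul, Complex.norm_real, Real.norm_of_nonneg (by positivity)]
    have h1 := hK σ (by linarith) hσ2 (fun t => Complex.exp (-(Complex.I*t*L))*DD χ m (σ-Complex.I*t))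
      (C1*A^(3*m+3)) (by positivity) (fun t => by
        rw [norm_mul, show -(Complex.I*t*L) = ((-(t*L):ℝ) : ℂ)*Complex.I by push_cast; ring,
          Complex.norm_exp_ofReal_mul_I, one_mul, pow_mul, mul_assoc, ← mul_pow]
        have hn : ‖(σ-Complex.I*t : ℂ)‖ ≤ |t| + 2 := by
          refine (norm_sub_le _ _).trans ?_
          rw [norm_mul, Complex.norm_I, one_mul, Complex.norm_real, Complex.norm_real, Real.norm_of_nonneg (by linarith), Real.norm_eq_abs]
          linarith
        have ht := abs_nonneg t
        refine hD r hr χ hχ _ (by simpa using hσ1) _ ?_ ?_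
        · calc (log r+2)*(‖(σ-Complex.I*t : ℂ)‖ + 1) ≤ A*(|t| + 4) :=
                mul_le_mul hA (by linarith) (by positivity) hA0.le
            _ ≤ A*(|t| + 4)^5 := by
                gcongr; exact le_self_pow₀ (by linarith) (by norm_num)
        · have := hlow (-t)
          rw [show (1+((1/L:ℝ) : ℂ)+Complex.I*((-t:ℝ) : ℂ)) = (σ-Complex.I*t) by rw [hσ]; push_cast; ring] at this
          rw [abs_neg] at this
          refine le_trans this ?_
          gcongr; norm_num)
    calc _ ≤ exp (σ*L)/L^m*(C2*(C1*A^(3*m+3))) := by gcongr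
      _ = _ := by
        have : σ*L = 1+L := by rw [hσ]; field_simp; ring
        rw [this, Real.exp_add]; ring
  set S : ℂ := ((exp (σ*L)/L^m:ℝ) : ℂ)*∫ t : ℝ, KK σ t*(Complex.exp (-(Complex.I*t*L))*DD χ m (σ-Complex.I*t))
  have hfin : HasSum (fun n => if n ∈ Ioc 0 N then g n else 0) (∑ n ∈ Ioc 0 N, g n) := by
    have := hasSum_sum_of_ne_finset_zero (f := fun n => if n ∈ Ioc 0 N then g n else 0) (s := Ioc 0 N)
      (L := SummationFilter.unconditional ℕ) (fun b hb => if_neg hb)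
    convert this using 1
    exact sum_congr rfl fun n hn => (if_pos hn).symm
  have hdiff := hfin.sub H
  have hb : ∀ n, ‖(if n ∈ Ioc 0 N then g n else 0)-g n‖ ≤ (m+1).factorial*(1/(n:ℝ)^2) := by
    intro n
    split_ifs with h
    · rw [sub_self, norm_zero]; positivity
    · rw [zero_sub, norm_neg]
      rcases Nat.eq_zero_or_pos n with rfl | hn
      · simp [hg, cLam]
      · have hnN : N+1 ≤ n := by simp only [mem_Ioc, not_and, not_le] at h; exact h hn
        have hnN' : ((N:ℝ)+1) ≤ n := by exact_mod_cast hnN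
        refine le_trans ?_ (tail_term m L hL n (hN.trans hnN'))
        simp only [hg, cLam, Pi.mul_apply]
        rw [norm_mul, norm_mul, Complex.norm_real, Complex.norm_real, Real.norm_of_nonneg ArithmeticFunction.vonMangoldt_nonneg,
          Real.norm_of_nonneg (FF_nonneg m L n (by linarith))]
        have h1 := DirichletCharacter.norm_le_one χ (n : ZMod r)
        have h2 := ArithmeticFunction.vonMangoldt_le_log (n := n)
        have h3 := FF_nonneg m L n (by linarith)
        have h4 : (0:ℝ) ≤ Λ n := ArithmeticFunction.vonMangoldt_nonneg
        calc ‖χ n‖*Λ n*FF m L n ≤ 1*log n*FF m L n := by gcongr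
          _ = _ := by ring
  have hnd := tsum_of_norm_bounded (hs2.hasSum.mul_left ((m+1).factorial:ℝ)) hb
  rw [hdiff.tsum_eq, ← hZ] at hnd
  have tri : ‖∑ n ∈ Ioc 0 N, g n‖ ≤ ‖∑ n ∈ Ioc 0 N, g n-S‖ + ‖S‖ := by
    have := norm_add_le (∑ n ∈ Ioc 0 N, g n-S) S
    simpa using this
  have q1 : 0 ≤ exp L*A^(3*m+3)/L^m := by positivity
  have q2 : 0 ≤ (m+1).factorial*Z := by positivity
  have q3 : 0 ≤ exp 1*C2*C1 := by positivity
  nlinarith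
end

section
open Finset Filter

lemma ev_log_pow (K:ℝ) (hK : 0 ≤ K) (B J:ℕ) : ∀ᶠ L : ℝ in atTop, K*((B+1)*log L+2)^J ≤ L := by
  have h1 := (Real.isLittleO_pow_log_id_atTop (n := J)).bound (c := 1/(K*(B+3)^J+1)) (by positivity)
  filter_upwards [h1, eventually_ge_atTop (exp 1)] with L h hL
  have hL0 : 0 < L := (Real.exp_pos 1).trans_le hL
  have hl : 1 ≤ log L := (Real.le_log_iff_exp_le hL0).2 hL
  rw [Real.norm_of_nonneg (by positivity), id, Real.norm_of_nonneg hL0.le, div_mul_eq_mul_div, le_div_iff₀ (by positivity)] at h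
  have h2 : ((B+1)*log L+2)^J ≤ ((B+3)*log L)^J := by
    apply pow_le_pow_left₀ (by positivity)
    nlinarith
  rw [mul_pow] at h2
  have h3 := mul_le_mul_of_nonneg_left h2 hK
  have h4 : 0 ≤ log L^J := by positivity
  nlinarith

lemma ev_pow_exp (K:ℝ) (J:ℕ) : ∀ᶠ L : ℝ in atTop, K*L^J ≤ exp L := by
  have h1 := (Real.isLittleO_pow_exp_atTop (n := J)).bound (c := 1/(|K| + 1)) (by positivity)
  filter_upwards [h1, eventually_ge_atTop 0] with L h hL
  rw [Real.norm_of_nonneg (by positivity), Real.norm_of_nonneg (by positivity), div_mul_eq_mul_div, le_div_iff₀ (by positivity)] at h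
  have := le_abs_self K
  have h4 : 0 ≤ L^J := by positivity
  nlinarith

lemma alg_kappa (c x y:ℝ) (hc : 0 < c) (hx : 0 < x) (hy : 0 < y) :
    1/(c*(1/(6000000*x^5))/(x^11*y^5)) = (6000000/c)*x^16*y^5 := by
  field_simp

lemma ne_one_of_prim {ξ : PC} (h : 2 ≤ ξ.1) (hp : ξ.2.IsPrimitive) : ξ.2 ≠ 1 := by
  intro he
  have : NeZero ξ.1 := ⟨by omega⟩
  have := (DirichletCharacter.eq_one_iff_conductor_eq_one (χ := ξ.2)).1 he
  have hp' : ξ.2.conductor = ξ.1 := hp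
  omega

theorem small_cond (m B W:ℕ) (hW : 0 < W) : ∃ L0 : ℝ, 1 ≤ L0 ∧ ∀ L : ℝ, L0 ≤ L → ∃ p0 : ℕ, p0.Prime ∧ ¬ p0 ∣ W ∧
    ∀ N : ℕ, exp (5/4*L) ≤ N+1 → ∀ ξ : PC, 2 ≤ ξ.1 → ξ.2.IsPrimitive → (ξ.1:ℝ) ≤ L^B →
    (∃ q : ℕ, q.Coprime (W*p0) ∧ ξ.1 ∣ W*q) → ‖psiF m L N (chiN ξ)‖ ≤ exp L*L/L^m := by
  classical
  obtain ⟨c, hc, hlow⟩ := LL_lower_all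
  obtain ⟨C, hC, hsm⟩ := psi_small m
  obtain ⟨p1, hp1W, hp1⟩ := Nat.exists_infinite_primes (W+1)
  have hp1d : ¬ p1 ∣ W := fun h => by have := Nat.le_of_dvd hW h; omega
  set K := 6000000/c+1 with hK
  have hK0 : 0 < K := by positivity
  have ev1 := ev_log_pow 6000000 (by norm_num) B 5
  have ev2 := ev_log_pow (2*C*K^(3*m+3)) (by positivity) B (16*(3*m+3))
  have ev3 := ev_pow_exp (2*C) m
  have htend : Tendsto (fun L : ℝ => 1/(6000000*((B+1)*log L+2)^5)) atTop (nhds 0) := by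
    have h1 : Tendsto (fun L : ℝ => (B+1)*log L+2) atTop atTop :=
      tendsto_atTop_add_const_right _ _ (Real.tendsto_log_atTop.const_mul_atTop (by positivity))
    have h2 := ((tendsto_pow_atTop (n := 5) (by norm_num)).comp h1).const_mul_atTop (by norm_num : (0:ℝ) < 6000000)
    have h3 := tendsto_inv_atTop_zero.comp h2
    refine h3.congr fun L => ?_
    simp [Function.comp]
  have ev4 : ∀ᶠ L : ℝ in atTop, ∀ ξ ∈ primSet W, 1/(6000000*((B+1)*log L+2)^5) < ‖LL ξ.2 (1+(1/L:ℝ))‖ := by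
    rw [Finset.eventually_all]
    intro ξ hξ
    rw [mem_primSet] at hξ
    obtain ⟨c1, hc1, x1, hx1, h⟩ := fixed_lower ξ.2 hξ.1 (ne_one_of_prim hξ.1 hξ.2.2)
    filter_upwards [htend.eventually (gt_mem_nhds hc1), eventually_ge_atTop (1/x1), eventually_gt_atTop 0] with L h1 h2 h3
    refine h1.trans_le (h _ (by positivity) ?_)
    rw [div_le_iff₀ h3]
    rw [div_le_iff₀ hx1] at h2
    linarith
  obtain ⟨L0, hL0⟩ := eventually_atTop.1 (ev1.and (ev2.and (ev3.and ev4)))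
  refine ⟨max L0 100, le_trans (by norm_num) (le_max_right _ _), fun L hL => ?_⟩
  have hL100 : 100 ≤ L := (le_max_right _ _).trans hL
  obtain ⟨e1, e2, e3, e4⟩ := hL0 L ((le_max_left _ _).trans hL)
  have hLpos : 0 < L := by linarith
  have hL1 : 1/L ≤ 1 := by rw [div_le_one hLpos]; linarith
  have hlogL : 0 ≤ log L := Real.log_nonneg (by linarith)
  set ℓ := (B+1)*log L+2 with hℓ
  have hℓ2 : 2 ≤ ℓ := by have : 0 ≤ (B+1)*log L := by positivity
                         linarith
  set κ := 1/(6000000*ℓ^5) with hκ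
  have hκ0 : 0 < κ := by positivity
  have hκ1 : κ ≤ 1 := by
    rw [hκ, div_le_one (by positivity)]
    have : 1 ≤ ℓ^5 := one_le_pow₀ (by linarith)
    linarith
  have hxκ : 1/L ≤ κ := one_div_le_one_div_of_le (by positivity) e1
  have hlogr : ∀ ξ : PC, 2 ≤ ξ.1 → (ξ.1:ℝ) ≤ L^B → log ξ.1+2 ≤ ℓ := by
    intro ξ h2 hB
    have : log ξ.1 ≤ B*log L := by
      rw [← Real.log_pow]
      exact Real.log_le_log (by exact_mod_cast (by omega : 0 < ξ.1)) hB
    rw [hℓ]; linarith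
  clear_value ℓ κ K
  -- non-exceptional characters are fine
  have good : ∀ N : ℕ, exp (5/4*L) ≤ N+1 → ∀ ξ : PC, 2 ≤ ξ.1 → ξ.2.IsPrimitive → (ξ.1:ℝ) ≤ L^B →
      (ξ.2^2 = 1 → κ ≤ ‖LL ξ.2 (1+(1/L:ℝ))‖) → ‖psiF m L N (chiN ξ)‖ ≤ exp L*L/L^m := by
    intro N hN ξ h2 hp hB hk
    have hne := ne_one_of_prim h2 hp
    have hl := hlogr ξ h2 hB
    have hA1 : ℓ ≤ K*ℓ^16 := by
      have h1 : ℓ ≤ ℓ^16 := le_self_pow₀ (by linarith) (by norm_num)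
      have h2 : 1 ≤ K := by rw [hK]; have : 0 < 6000000/c := by positivity
                            linarith
      nlinarith
    refine (hsm ξ.1 h2 ξ.2 hne L hL100 N hN (K*ℓ^16) (hl.trans hA1) (fun t => ?_)).trans ?_
    · have hb := hlow ξ.1 h2 ξ.2 hne ℓ hl κ hκ0 hκ1 (1/L) (by positivity) hL1 hk t
      have ht := abs_nonneg t
      have hpos : 0 < c*κ/(ℓ^11*(|t| + 3)^5) := by positivity
      refine (one_div_le_one_div_of_le hpos hb).trans ?_
      have : 1/(c*κ/(ℓ^11*(|t| + 3)^5)) = (6000000/c)*ℓ^16*(|t| + 3)^5 := by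
        rw [hκ]; exact alg_kappa c ℓ (|t| + 3) hc (by linarith) (by linarith)
      rw [this]
      gcongr
      rw [hK]; linarith
    · rw [mul_pow, ← pow_mul]
      have hLm : 0 < L^m := by positivity
      have hA2 : C*(exp L*(K^(3*m+3)*ℓ^(16*(3*m+3)))/L^m) ≤ exp L*L/L^m/2 := by
        rw [div_div, mul_div_assoc', div_le_div_iff₀ hLm (by positivity)]
        have : 0 < exp L*L^m := by positivity
        nlinarith
      have hA3 : C ≤ exp L*L/L^m/2 := by
        rw [div_div, le_div_iff₀ (by positivity)]
        have : exp L*1 ≤ exp L*L := by gcongr; linarith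
        linarith
      linarith
  by_cases hex : ∃ ξ : PC, 2 ≤ ξ.1 ∧ ξ.2.IsPrimitive ∧ (ξ.1:ℝ) ≤ L^B ∧ ξ.2^2 = 1 ∧ ‖LL ξ.2 (1+(1/L:ℝ))‖ ≤ κ
  · obtain ⟨ξ₀, a1, a2, a3, a4, a5⟩ := hex
    have hr0 : W < ξ₀.1 := by
      by_contra h
      have := e4 ξ₀ (mem_primSet.2 ⟨a1, by omega, a2⟩)
      linarith
    have hother : ∀ N : ℕ, exp (5/4*L) ≤ N+1 → ∀ ξ : PC, 2 ≤ ξ.1 → ξ.2.IsPrimitive → (ξ.1:ℝ) ≤ L^B →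
        ξ ≠ ξ₀ → ‖psiF m L N (chiN ξ)‖ ≤ exp L*L/L^m := by
      intro N hN ξ h2 hp hB hne
      refine good N hN ξ h2 hp hB (fun hreal => ?_)
      by_contra hlt
      exact exc_unique h2 a1 hp a2 hne hreal a4 ℓ (hlogr ξ h2 hB) (hlogr ξ₀ a1 a3) κ hκ (1/L) (by positivity) hxκ
        (not_le.1 hlt).le a5
    by_cases hpr : ∃ p : ℕ, p.Prime ∧ p ∣ ξ₀.1 ∧ ¬ p ∣ W
    · obtain ⟨p, hp, hpd, hpW⟩ := hpr
      refine ⟨p, hp, hpW, fun N hN ξ h2 hpi hB hq => hother N hN ξ h2 hpi hB ?_⟩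
      rintro rfl
      obtain ⟨q, hq, hd⟩ := hq
      rcases hp.dvd_mul.1 (hpd.trans hd) with h | h
      · exact hpW h
      · exact hp.one_lt.ne' (Nat.dvd_one.1 (hq ▸ Nat.dvd_gcd h (Dvd.intro_left W rfl)))
    · refine ⟨p1, hp1, hp1d, fun N hN ξ h2 hpi hB hq => hother N hN ξ h2 hpi hB ?_⟩
      rintro rfl
      obtain ⟨q, hq, hd⟩ := hq
      push Not at hpr
      have hcop : Nat.Coprime ξ.1 q := by
        refine Nat.Coprime.symm ?_
        by_contra hnc
        obtain ⟨p, hp, h1, h3⟩ := Nat.Prime.not_coprime_iff_dvd.1 hnc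
        have := hpr p hp h3
        exact hp.one_lt.ne' (Nat.dvd_one.1 (hq ▸ Nat.dvd_gcd h1 (this.mul_right p1)))
      have := Nat.le_of_dvd hW (hcop.dvd_of_dvd_mul_right hd)
      omega
  · refine ⟨p1, hp1, hp1d, fun N hN ξ h2 hpi hB _ => good N hN ξ h2 hpi hB (fun hr => ?_)⟩
    by_contra h
    exact hex ⟨ξ, h2, hpi, hB, hr, (not_le.1 h).le⟩
end

section
open Finset

lemma pow_om_sqfree (k q:ℕ) (hq : Squarefree q) :
    ((k+1:ℕ):ℝ)^q.primeFactors.card = ∑ d ∈ q.divisors, (k:ℝ)^d.primeFactors.card := by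
  have hm : (ArithmeticFunction.prodPrimeFactors (fun _ : ℕ => (k:ℝ))).IsMultiplicative :=
    ArithmeticFunction.IsMultiplicative.prodPrimeFactors _
  have h := hm.prodPrimeFactors_one_add_of_squarefree hq
  have e1 : ∏ p ∈ q.primeFactors, (1+(ArithmeticFunction.prodPrimeFactors (fun _ : ℕ => (k:ℝ))) p) =
      ((k+1:ℕ):ℝ)^q.primeFactors.card := by
    rw [← Finset.prod_const]
    refine prod_congr rfl fun p hp => ?_
    have hp' := Nat.prime_of_mem_primeFactors hp
    rw [ArithmeticFunction.prodPrimeFactors_apply hp'.ne_zero, hp'.primeFactors, Finset.prod_singleton]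
    push_cast; ring
  rw [← e1, h]
  refine sum_congr rfl fun d hd => ?_
  rw [ArithmeticFunction.prodPrimeFactors_apply (Nat.pos_of_mem_divisors hd).ne', Finset.prod_const]

open Classical in
lemma sum_omega (k x:ℕ) : ∑ q ∈ Ioc 0 x, (if Squarefree q then (k:ℝ)^q.primeFactors.card/q else 0) ≤
    (1+log ((x+1:ℕ):ℝ))^k := by
  induction k with
  | zero =>
    rw [pow_zero]
    calc _ ≤ ∑ q ∈ Ioc 0 x, (if q = 1 then (1:ℝ) else 0) := by
          refine sum_le_sum fun q hq => ?_
          have hq0 : 0 < q := (mem_Ioc.1 hq).1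
          split_ifs with h1 h2 h2
          · subst h2; simp
          · have : q.primeFactors.card ≠ 0 := by
              rw [Finset.card_ne_zero, Nat.nonempty_primeFactors]; omega
            simp [this]
          · norm_num
          · rfl
      _ ≤ 1 := by
          rw [Finset.sum_ite_eq']; split_ifs <;> norm_num
  | succ k ih =>
    have h0 : ∀ q : ℕ, (0:ℝ) ≤ (if Squarefree q then (k:ℝ)^q.primeFactors.card/q else 0) := by
      intro q; split_ifs <;> positivity
    calc ∑ q ∈ Ioc 0 x, (if Squarefree q then ((k+1:ℕ):ℝ)^q.primeFactors.card/q else 0)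
        ≤ ∑ q ∈ Ioc 0 x, ∑ y ∈ q.divisorsAntidiagonal,
          (if Squarefree y.1 then (k:ℝ)^y.1.primeFactors.card/y.1 else 0)*(1/(y.2:ℝ)) := by
          refine sum_le_sum fun q hq => ?_
          have hq0 : 0 < q := (mem_Ioc.1 hq).1
          split_ifs with hs
          · rw [pow_om_sqfree k q hs, Nat.sum_divisorsAntidiagonal (f := fun a b =>
              (if Squarefree a then (k:ℝ)^a.primeFactors.card/a else 0)*(1/(b:ℝ))), Finset.sum_div]
            refine sum_le_sum fun d hd => ?_
            have hdq := Nat.dvd_of_mem_divisors hd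
            have hd0 := Nat.pos_of_mem_divisors hd
            rw [if_pos (hs.squarefree_of_dvd hdq), Nat.cast_div hdq (by positivity)]
            apply le_of_eq
            have : (d:ℝ) ≠ 0 := by positivity
            have : (q:ℝ) ≠ 0 := by positivity
            field_simp
          · exact sum_nonneg fun y _ => mul_nonneg (h0 _) (by positivity)
      _ ≤ _ := sum_antidiag_le _ (fun y => mul_nonneg (h0 _) (by positivity)) x
      _ = (∑ q ∈ Ioc 0 x, (if Squarefree q then (k:ℝ)^q.primeFactors.card/q else 0))*∑ e ∈ Ioc 0 x, (1:ℝ)/e := by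
          rw [sum_product, Finset.sum_mul_sum]
      _ ≤ (1+log ((x+1:ℕ):ℝ))^k*(1+log ((x+1:ℕ):ℝ)) := by
          have : 0 ≤ log ((x+1:ℕ):ℝ) := Real.log_natCast_nonneg _
          refine mul_le_mul ih (sum_Ioc_one_div_le x) (sum_nonneg fun _ _ => by positivity) (by positivity)
      _ = _ := (pow_succ _ _).symm

lemma totient_sqfree (q:ℕ) (hq : Squarefree q) : (q.totient:ℝ) = ∏ p ∈ q.primeFactors, ((p:ℝ)-1) := by
  have h := Nat.totient_mul_prod_primeFactors q
  rw [Nat.prod_primeFactors_of_squarefree hq, mul_comm] at h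
  have h2 := Nat.eq_of_mul_eq_mul_left (Nat.pos_of_ne_zero hq.ne_zero) h
  rw [h2, Nat.cast_prod]
  refine prod_congr rfl fun p hp => ?_
  rw [Nat.cast_sub (Nat.prime_of_mem_primeFactors hp).one_le, Nat.cast_one]

lemma cast_sqfree (q:ℕ) (hq : Squarefree q) : (q:ℝ) = ∏ p ∈ q.primeFactors, (p:ℝ) := by
  conv_lhs => rw [← Nat.prod_primeFactors_of_squarefree hq]
  push_cast; rfl

lemma om_div_totient_le (K q:ℕ) (hq : Squarefree q) :
    (K:ℝ)^q.primeFactors.card/q.totient ≤ ((2*K:ℕ):ℝ)^q.primeFactors.card/q := by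
  rw [totient_sqfree q hq, cast_sqfree q hq, ← Finset.prod_const, ← Finset.prod_const, ← Finset.prod_div_distrib,
    ← Finset.prod_div_distrib]
  refine Finset.prod_le_prod (fun p hp => ?_) (fun p hp => ?_)
  · have : (2:ℝ) ≤ p := by exact_mod_cast (Nat.prime_of_mem_primeFactors hp).two_le
    apply div_nonneg <;> [positivity; linarith]
  · have : (2:ℝ) ≤ p := by exact_mod_cast (Nat.prime_of_mem_primeFactors hp).two_le
    rw [div_le_div_iff₀ (by linarith) (by linarith)]
    push_cast
    have : (0:ℝ) ≤ K := by positivity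
    nlinarith

lemma om_div_totient_sqrt (K q W:ℕ) (hq : Squarefree q) (hqW : q.Coprime W)
    (hW : ∀ p : ℕ, p.Prime → p ≤ 4*K^2 → p ∣ W) :
    (K:ℝ)^q.primeFactors.card/q.totient ≤ 1/Real.sqrt q := by
  have e : Real.sqrt q = ∏ p ∈ q.primeFactors, Real.sqrt p := by
    rw [cast_sqfree q hq, Real.sqrt_prod _ (fun _ _ => by positivity)]
  rw [totient_sqfree q hq, e, ← Finset.prod_const, ← Finset.prod_div_distrib, one_div, ← Finset.prod_inv_distrib]
  refine Finset.prod_le_prod (fun p hp => ?_) (fun p hp => ?_)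
  · have : (2:ℝ) ≤ p := by exact_mod_cast (Nat.prime_of_mem_primeFactors hp).two_le
    apply div_nonneg <;> [positivity; linarith]
  · have hpp := Nat.prime_of_mem_primeFactors hp
    have h2 : (2:ℝ) ≤ p := by exact_mod_cast hpp.two_le
    have hbig : 4*K^2 < p := by
      by_contra h
      have h1 := hW p hpp (by omega)
      have h3 := Nat.dvd_of_mem_primeFactors hp
      exact hpp.one_lt.ne' (Nat.dvd_one.1 (hqW ▸ Nat.dvd_gcd h3 h1))
    have hbig' : (4:ℝ)*K^2 ≤ p := by exact_mod_cast hbig.le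
    have hs : 0 < Real.sqrt p := Real.sqrt_pos.2 (by linarith)
    have hss := Real.mul_self_sqrt (by linarith : (0:ℝ) ≤ p)
    have hK : 2*(K:ℝ) ≤ Real.sqrt p := Real.le_sqrt_of_sq_le (by nlinarith)
    rw [div_le_iff₀ (by linarith), inv_mul_eq_div, le_div_iff₀ hs]
    nlinarith

/-- sum over multiples -/
lemma S_bound (K W r x:ℕ) (hK : 1 ≤ K) (hW0 : 0 < W) (hr : 0 < r) (hW : ∀ p : ℕ, p.Prime → p ≤ 4*K^2 → p ∣ W)
    (Q : Finset ℕ) (hQ : ∀ q ∈ Q, Squarefree q ∧ q.Coprime W ∧ q ≤ x) :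
    ∑ q ∈ Q with r ∣ W*q, (K:ℝ)^q.primeFactors.card/q.totient ≤
      Real.sqrt (W/r)*(1+log ((x+1:ℕ):ℝ))^(2*K) := by
  classical
  set g := Nat.gcd r W with hg
  have hg0 : 0 < g := Nat.gcd_pos_of_pos_left _ hr
  set s := r/g with hs
  have hrs : r = g*s := (Nat.mul_div_cancel' (Nat.gcd_dvd_left r W)).symm
  have hs0 : 0 < s := Nat.pos_of_ne_zero (fun h => by rw [h, mul_zero] at hrs; omega)
  have hgW : g ≤ W := Nat.le_of_dvd hW0 (Nat.gcd_dvd_right r W)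
  have hsr : 1/Real.sqrt s ≤ Real.sqrt (W/r) := by
    rw [one_div, ← Real.sqrt_inv]
    apply Real.sqrt_le_sqrt
    rw [inv_eq_one_div, div_le_div_iff₀ (by positivity) (by positivity), hrs]
    push_cast
    have : (g:ℝ) ≤ W := by exact_mod_cast hgW
    nlinarith [(by positivity : (0:ℝ) < s)]
  have hdvd : ∀ q, r ∣ W*q → s ∣ q := by
    intro q h
    have h1 : g*s ∣ g*((W/g)*q) := by
      rw [← mul_assoc, Nat.mul_div_cancel' (Nat.gcd_dvd_right r W), ← hrs]; exact h
    have h2 := Nat.dvd_of_mul_dvd_mul_left hg0 h1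
    exact (Nat.coprime_div_gcd_div_gcd hg0).dvd_of_dvd_mul_left h2
  have hlog : 0 ≤ log ((x+1:ℕ):ℝ) := Real.log_natCast_nonneg _
  calc ∑ q ∈ Q with r ∣ W*q, (K:ℝ)^q.primeFactors.card/q.totient
      ≤ ∑ q ∈ Q with r ∣ W*q, Real.sqrt (W/r) *
        (if Squarefree (q/s) then ((2*K:ℕ):ℝ)^(q/s).primeFactors.card/(q/s:ℕ) else 0) := by
        refine sum_le_sum fun q hq => ?_
        rw [mem_filter] at hq
        obtain ⟨hsq, hcop, -⟩ := hQ q hq.1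
        obtain ⟨e, rfl⟩ := hdvd q hq.2
        rw [Nat.mul_div_cancel_left e hs0]
        obtain ⟨hcse, hss, hse⟩ := Nat.squarefree_mul_iff.1 hsq
        rw [if_pos hse, hcse.primeFactors_mul, Finset.card_union_of_disjoint hcse.disjoint_primeFactors,
          Nat.totient_mul hcse, pow_add, Nat.cast_mul, mul_div_mul_comm]
        have h1 := om_div_totient_sqrt K s W hss (Nat.Coprime.coprime_dvd_left (Dvd.intro e rfl) hcop) hW
        exact mul_le_mul (h1.trans hsr) (om_div_totient_le K e hse) (by positivity) (by positivity)
    _ = Real.sqrt (W/r)*∑ q ∈ Q with r ∣ W*q,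
        (if Squarefree (q/s) then ((2*K:ℕ):ℝ)^(q/s).primeFactors.card/(q/s:ℕ) else 0) := by rw [mul_sum]
    _ ≤ Real.sqrt (W/r)*∑ e ∈ Ioc 0 x, (if Squarefree e then ((2*K:ℕ):ℝ)^e.primeFactors.card/e else 0) := by
        refine mul_le_mul_of_nonneg_left ?_ (by positivity)
        have hinj : Set.InjOn (fun q => q/s) ↑({q ∈ Q | r ∣ W*q}) := by
          intro a ha b hb hab
          simp only [coe_filter, Set.mem_setOf_eq] at ha hb
          have h1 := Nat.div_mul_cancel (hdvd a ha.2)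
          have h2 := Nat.div_mul_cancel (hdvd b hb.2)
          dsimp only at hab
          rw [← h1, ← h2, hab]
        rw [← Finset.sum_image (f := fun e : ℕ => if Squarefree e then ((2*K:ℕ):ℝ)^e.primeFactors.card/e else 0) hinj]
        refine sum_le_sum_of_subset_of_nonneg ?_ (fun e _ _ => by split_ifs <;> positivity)
        intro e he
        obtain ⟨q, hq, rfl⟩ := mem_image.1 he
        rw [mem_filter] at hq
        obtain ⟨hsq, hcop, hqx⟩ := hQ q hq.1
        have hq0 : 0 < q := Nat.pos_of_ne_zero hsq.ne_zero
        exact mem_Ioc.2 ⟨Nat.div_pos (Nat.le_of_dvd hq0 (hdvd q hq.2)) hs0, (Nat.div_le_self _ _).trans hqx⟩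
    _ ≤ _ := mul_le_mul_of_nonneg_left (sum_omega (2*K) x) (by positivity)
end

section
open Finset
open scoped ArithmeticFunction.vonMangoldt

noncomputable def PsiN (m:ℕ) (L:ℝ) (N:ℕ) : ℝ := ∑ n ∈ Ioc 0 N, Λ n*FF m L n

noncomputable def psiAP (m:ℕ) (L:ℝ) (N q a:ℕ) : ℝ :=
  ∑ n ∈ (Ioc 0 N).filter (fun n => n ≡ a [MOD q]), Λ n*FF m L n

noncomputable def psiBad (m:ℕ) (L:ℝ) (N q:ℕ) : ℝ :=
  ∑ n ∈ (Ioc 0 N).filter (fun n => ¬ n.Coprime q), Λ n*FF m L n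

lemma psiBad_le (m:ℕ) (L:ℝ) (hL : 1 ≤ L) (N q:ℕ) (hq : 0 < q) :
    psiBad m L N q ≤ CF m*log N*(q*((Nat.log 2 N:ℕ)+1:ℝ)) := by
  classical
  unfold psiBad
  set S := (Ioc 0 N).filter (fun n => ¬ n.Coprime q ∧ IsPrimePow n) with hS
  have hCF := CF_pos m
  have h1 : ∑ n ∈ (Ioc 0 N).filter (fun n => ¬ n.Coprime q), Λ n*FF m L n ≤ ∑ n ∈ S, log N*CF m := by
    have hsub : S ⊆ (Ioc 0 N).filter (fun n => ¬ n.Coprime q) := by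
      intro n hn
      rw [hS, mem_filter] at hn
      exact mem_filter.2 ⟨hn.1, hn.2.1⟩
    rw [← Finset.sum_subset hsub]
    · refine sum_le_sum fun n hn => ?_
      rw [hS, mem_filter, mem_Ioc] at hn
      refine mul_le_mul ?_ (FF_le m L n hL) (FF_nonneg m L n hL) (Real.log_natCast_nonneg _)
      refine ArithmeticFunction.vonMangoldt_le_log.trans ?_
      exact Real.log_le_log (by exact_mod_cast hn.1.1) (by exact_mod_cast hn.1.2)
    · intro n hn hn'
      rw [mem_filter] at hn
      have : ¬ IsPrimePow n := fun h => hn' (by rw [hS, mem_filter]; exact ⟨hn.1, hn.2, h⟩)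
      rw [ArithmeticFunction.vonMangoldt_eq_zero_iff.2 this, zero_mul]
  have h2 : S ⊆ (q.primeFactors ×ˢ range (Nat.log 2 N+1)).image (fun x => x.1^x.2) := by
    intro n hn
    rw [hS, mem_filter, mem_Ioc] at hn
    obtain ⟨⟨hn0, hnN⟩, hc, hpp⟩ := hn
    obtain ⟨p, j, hp, hj, rfl⟩ := (isPrimePow_nat_iff n).1 hpp
    refine mem_image.2 ⟨(p, j), mem_product.2 ⟨?_, ?_⟩, rfl⟩
    · refine Nat.mem_primeFactors.2 ⟨hp, ?_, hq.ne'⟩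
      by_contra h
      exact hc (Nat.Coprime.pow_left _ ((Nat.Prime.coprime_iff_not_dvd hp).2 h))
    · refine mem_range.2 (Nat.lt_succ_of_le ?_)
      refine Nat.le_log_of_pow_le (by norm_num) ?_
      exact (Nat.pow_le_pow_left hp.two_le _).trans hnN
  have h3 : (S.card:ℝ) ≤ q*((Nat.log 2 N:ℕ)+1:ℝ) := by
    have : S.card ≤ q*(Nat.log 2 N+1) := by
      refine (card_le_card h2).trans (card_image_le.trans ?_)
      rw [card_product, card_range]
      refine Nat.mul_le_mul_right _ ?_
      calc q.primeFactors.card ≤ (Ioc 0 q).card := card_le_card fun p hp => by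
            have := Nat.mem_primeFactors.1 hp
            exact mem_Ioc.2 ⟨this.1.pos, Nat.le_of_dvd hq this.2.1⟩
        _ = q := by simp
    exact_mod_cast this
  refine h1.trans ?_
  rw [Finset.sum_const, nsmul_eq_mul, mul_comm, mul_comm (log N)]
  exact mul_le_mul_of_nonneg_left h3 (mul_nonneg hCF.le (Real.log_natCast_nonneg _))

/-- primitive character attached to a character -/
noncomputable def primOf {q : ℕ} (χ : DirichletCharacter ℂ q) : PC := ⟨χ.conductor, χ.primitiveCharacter⟩

lemma primOf_inj {q : ℕ} : Function.Injective (primOf (q := q)) := by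
  intro χ ψ h
  unfold primOf at h
  have key : ∀ (r s:ℕ) (hr : r ∣ q) (hs : s ∣ q) (a : DirichletCharacter ℂ r) (b : DirichletCharacter ℂ s),
      (⟨r, a⟩ : PC) = ⟨s, b⟩ → DirichletCharacter.changeLevel hr a = DirichletCharacter.changeLevel hs b := by
    intro r s hr hs a b hab
    obtain ⟨h1, h2⟩ := Sigma.mk.inj_iff.1 hab
    subst h1
    rw [eq_of_heq h2]
  have := key _ _ χ.conductor_dvd_level ψ.conductor_dvd_level _ _ h
  rwa [DirichletCharacter.changeLevel_primitiveCharacter, DirichletCharacter.changeLevel_primitiveCharacter] at this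

lemma primOf_apply {q : ℕ} (χ : DirichletCharacter ℂ q) (n:ℕ) (hn : n.Coprime q) :
    chiN (primOf χ) n = χ n := by
  unfold chiN primOf
  have h := DirichletCharacter.changeLevel_primitiveCharacter χ
  conv_rhs => rw [← h]
  have hu : IsUnit ((n:ℕ) : ZMod q) := (ZMod.isUnit_iff_coprime n q).2 hn
  obtain ⟨u, hu'⟩ := hu
  rw [← hu', DirichletCharacter.changeLevel_eq_cast_of_dvd _ χ.conductor_dvd_level, hu']
  congr 1
  dsimp only
  rw [ZMod.cast_natCast χ.conductor_dvd_level]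

open Classical in
lemma psiAP_bound (m:ℕ) (L:ℝ) (hL : 1 ≤ L) (N q a:ℕ) (hq : 0 < q) (ha : a.Coprime q) :
    |psiAP m L N q a-PsiN m L N/q.totient| ≤
      (∑ ξ ∈ (primSet q).filter (fun ξ => ξ.1 ∣ q), ‖psiF m L N (chiN ξ)‖)/q.totient+psiBad m L N q := by
  have : NeZero q := ⟨hq.ne'⟩
  have hφ : (0:ℝ) < q.totient := by exact_mod_cast Nat.totient_pos.2 hq
  have hau : IsUnit ((a:ℕ) : ZMod q) := (ZMod.isUnit_iff_coprime a q).2 ha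
  set E := psiBad m L N q with hE
  have hw : ∀ n : ℕ, 0 ≤ Λ n*FF m L n := fun n =>
    mul_nonneg ArithmeticFunction.vonMangoldt_nonneg (FF_nonneg m L n hL)
  -- orthogonality
  have h1 : ((q.totient*psiAP m L N q a:ℝ) : ℂ) =
      ∑ χ : DirichletCharacter ℂ q, χ ((a : ZMod q)⁻¹)*psiF m L N (fun n => χ n) := by
    unfold psiAP psiF
    simp_rw [mul_sum]
    rw [sum_comm, sum_filter]
    push_cast
    refine sum_congr rfl fun n hn => ?_
    have h := DirichletCharacter.sum_char_inv_mul_char_eq ℂ hau (n : ZMod q)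
    calc _ = (Λ n : ℂ)*FF m L n*(if (a : ZMod q) = n then (q.totient : ℂ) else 0) := by
          by_cases hc : n ≡ a [MOD q]
          · have : (a : ZMod q) = n := ((ZMod.natCast_eq_natCast_iff _ _ _).2 hc).symm
            rw [if_pos hc, if_pos this]; push_cast; ring
          · have : ¬ (a : ZMod q) = n := fun h => hc ((ZMod.natCast_eq_natCast_iff _ _ _).1 h.symm)
            rw [if_neg hc, if_neg this]; simp
      _ = _ := by
          rw [← h, mul_sum]
          exact sum_congr rfl fun χ _ => by ring
  -- each character
  have hχ : ∀ χ : DirichletCharacter ℂ q, ‖psiF m L N (fun n => χ n)-psiF m L N (chiN (primOf χ))‖ ≤ E := by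
    intro χ
    unfold psiF
    rw [← sum_sub_distrib, hE, psiBad, sum_filter]
    refine (norm_sum_le _ _).trans (sum_le_sum fun n hn => ?_)
    by_cases hc : n.Coprime q
    · rw [primOf_apply χ n hc, sub_self, if_neg (not_not.2 hc), norm_zero]
    · rw [if_pos hc]
      have : χ (n : ZMod q) = 0 := by
        apply MulChar.map_nonunit
        rwa [ZMod.isUnit_iff_coprime]
      beta_reduce
      rw [this, mul_zero, mul_zero, zero_sub, norm_neg, norm_mul, norm_mul, Complex.norm_real, Complex.norm_real,
        Real.norm_eq_abs, Real.norm_eq_abs, abs_of_nonneg ArithmeticFunction.vonMangoldt_nonneg,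
        abs_of_nonneg (FF_nonneg m L n hL), ← mul_assoc]
      exact mul_le_of_le_one_right (hw n) (chiN_norm _ _)
  have h10 : ‖psiF m L N (fun n => (1 : DirichletCharacter ℂ q) n)-(PsiN m L N : ℂ)‖ ≤ E := by
    unfold psiF PsiN
    push_cast
    rw [← sum_sub_distrib, hE, psiBad, sum_filter]
    refine (norm_sum_le _ _).trans (sum_le_sum fun n hn => ?_)
    by_cases hc : n.Coprime q
    · rw [MulChar.one_apply ((ZMod.isUnit_iff_coprime n q).2 hc), mul_one, sub_self, if_neg (not_not.2 hc), norm_zero]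
    · rw [if_pos hc]
      have : (1 : DirichletCharacter ℂ q) (n : ZMod q) = 0 := by
        apply MulChar.map_nonunit
        rwa [ZMod.isUnit_iff_coprime]
      beta_reduce
      rw [this, mul_zero, mul_zero, zero_sub, norm_neg, norm_mul, Complex.norm_real, Complex.norm_real,
        Real.norm_eq_abs, Real.norm_eq_abs, abs_of_nonneg ArithmeticFunction.vonMangoldt_nonneg,
        abs_of_nonneg (FF_nonneg m L n hL)]
  have hcard : ((Finset.univ : Finset (DirichletCharacter ℂ q)).card:ℝ) = q.totient := by
    rw [Finset.card_univ, ← Nat.card_eq_fintype_card, DirichletCharacter.card_eq_totient_of_hasEnoughRootsOfUnity]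
  have hinv : (1 : DirichletCharacter ℂ q) ((a : ZMod q)⁻¹) = 1 := by
    apply MulChar.one_apply
    have h := ZMod.inv_coe_unit hau.unit
    rw [IsUnit.unit_spec] at h
    rw [h]
    exact (hau.unit⁻¹).isUnit
  have h2 : ‖∑ χ : DirichletCharacter ℂ q, χ ((a : ZMod q)⁻¹)*psiF m L N (fun n => χ n)-(PsiN m L N : ℂ)‖ ≤
      (∑ χ ∈ (Finset.univ : Finset (DirichletCharacter ℂ q)).erase 1, (‖psiF m L N (chiN (primOf χ))‖ + E))+E := by
    rw [← Finset.sum_erase_add _ _ (Finset.mem_univ (1 : DirichletCharacter ℂ q)), hinv, one_mul, add_sub_assoc]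
    refine (norm_add_le _ _).trans (add_le_add ((norm_sum_le _ _).trans (sum_le_sum fun χ _ => ?_)) h10)
    rw [norm_mul]
    refine (mul_le_of_le_one_left (norm_nonneg _) (DirichletCharacter.norm_le_one _ _)).trans ?_
    have := hχ χ
    have h3 := norm_sub_norm_le (psiF m L N (fun n => χ n)) (psiF m L N (chiN (primOf χ)))
    linarith
  have h4 : (∑ χ ∈ (Finset.univ : Finset (DirichletCharacter ℂ q)).erase 1, (‖psiF m L N (chiN (primOf χ))‖ + E))+E
      ≤ (∑ ξ ∈ (primSet q).filter (fun ξ => ξ.1 ∣ q), ‖psiF m L N (chiN ξ)‖)+q.totient*E := by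
    rw [sum_add_distrib, add_assoc]
    refine add_le_add ?_ (le_of_eq ?_)
    · rw [← Finset.sum_image (s := (Finset.univ : Finset (DirichletCharacter ℂ q)).erase 1) (g := primOf)
        (f := fun ξ => ‖psiF m L N (chiN ξ)‖) (fun _ _ _ _ h => primOf_inj h)]
      refine sum_le_sum_of_subset_of_nonneg ?_ fun _ _ _ => norm_nonneg _
      intro ξ hξ
      obtain ⟨χ, hχ1, rfl⟩ := mem_image.1 hξ
      have hne : χ ≠ 1 := (mem_erase.1 hχ1).1
      have hd : χ.conductor ∣ q := χ.conductor_dvd_level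
      have h1 : χ.conductor ≠ 1 := fun h => hne (DirichletCharacter.eq_one_iff_conductor_eq_one.2 h)
      have h0 : 0 < χ.conductor := Nat.pos_of_dvd_of_pos hd hq
      refine mem_filter.2 ⟨mem_primSet.2 ⟨?_, Nat.le_of_dvd hq hd, χ.primitiveCharacter_isPrimitive⟩, hd⟩
      change 2 ≤ χ.conductor
      omega
    · rw [← hcard, ← Finset.card_erase_add_one (Finset.mem_univ (1 : DirichletCharacter ℂ q)), Finset.sum_const, nsmul_eq_mul]
      push_cast; ring
  have h5 : |q.totient*psiAP m L N q a-PsiN m L N| ≤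
      (∑ ξ ∈ (primSet q).filter (fun ξ => ξ.1 ∣ q), ‖psiF m L N (chiN ξ)‖)+q.totient*E := by
    refine le_trans (le_of_eq ?_) (h2.trans h4)
    rw [← h1, ← Complex.ofReal_sub, Complex.norm_real, Real.norm_eq_abs]
  have e : psiAP m L N q a-PsiN m L N/q.totient = (q.totient*psiAP m L N q a-PsiN m L N)/q.totient := by
    field_simp
  rw [e, abs_div, abs_of_pos hφ, div_le_iff₀ hφ]
  refine h5.trans (le_of_eq ?_)
  field_simp
end

section
open Finset

/-- weighted sum of a nonnegative function over primitive characters -/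
lemma swap_bound (K W x:ℕ) (hW0 : 0 < W) (Q : Finset ℕ)
    (hQ : ∀ q ∈ Q, Squarefree q ∧ q.Coprime W ∧ q ≤ x) (g : PC → ℝ) (hg : ∀ ξ, 0 ≤ g ξ) :
    ∑ q ∈ Q, (K:ℝ)^q.primeFactors.card *
      ((∑ ξ ∈ (primSet (W*q)).filter (fun ξ => ξ.1 ∣ W*q), g ξ)/(W*q).totient) ≤
    ∑ ξ ∈ primSet (W*x), g ξ*∑ q ∈ Q with ξ.1 ∣ W*q, (K:ℝ)^q.primeFactors.card/q.totient := by
  classical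
  calc _ ≤ ∑ q ∈ Q, ∑ ξ ∈ primSet (W*x), (if ξ.1 ∣ W*q then
        g ξ*((K:ℝ)^q.primeFactors.card/q.totient) else 0) := by
        refine sum_le_sum fun q hq => ?_
        obtain ⟨h1, h2, h3⟩ := hQ q hq
        have hq0 : 0 < q := Nat.pos_of_ne_zero h1.ne_zero
        have hφ : (0:ℝ) < q.totient := by exact_mod_cast Nat.totient_pos.2 hq0
        have hφ' : (q.totient:ℝ) ≤ (W*q).totient := by
          rw [Nat.totient_mul h2.symm]
          exact_mod_cast Nat.le_mul_of_pos_left _ (Nat.totient_pos.2 hW0)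
        have hs : ∑ ξ ∈ (primSet (W*q)).filter (fun ξ => ξ.1 ∣ W*q), g ξ ≤
            ∑ ξ ∈ (primSet (W*x)).filter (fun ξ => ξ.1 ∣ W*q), g ξ := by
          refine sum_le_sum_of_subset_of_nonneg ?_ fun _ _ _ => hg _
          intro ξ hξ
          rw [mem_filter, mem_primSet] at hξ ⊢
          exact ⟨⟨hξ.1.1, hξ.1.2.1.trans (Nat.mul_le_mul_left _ h3), hξ.1.2.2⟩, hξ.2⟩
        rw [← sum_filter, ← sum_mul]
        have hs0 : 0 ≤ ∑ ξ ∈ (primSet (W*q)).filter (fun ξ => ξ.1 ∣ W*q), g ξ := sum_nonneg fun _ _ => hg _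
        have hK0 : (0:ℝ) ≤ (K:ℝ)^q.primeFactors.card := by positivity
        have h5 := div_le_div₀ (hs0.trans hs) hs hφ hφ'
        calc _ ≤ _ := mul_le_mul_of_nonneg_left h5 hK0
          _ = _ := by ring
    _ = _ := by
        rw [sum_comm]
        refine sum_congr rfl fun ξ _ => ?_
        rw [mul_sum, sum_filter]

theorem BVthm (K A:ℕ) (hK : 1 ≤ K) : ∃ m : ℕ, m ≠ 0 ∧ ∀ W : ℕ, 0 < W →
    (∀ p : ℕ, p.Prime → p ≤ 4*K^2 → p ∣ W) → ∃ L0 : ℝ, 1 ≤ L0 ∧ ∀ L : ℝ, L0 ≤ L →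
    ∃ p0 : ℕ, p0.Prime ∧ ¬ p0 ∣ W ∧ ∀ N : ℕ, log N ≤ 5/4*L → exp (5/4*L) ≤ N+1 →
    ∀ Q : Finset ℕ, (∀ q ∈ Q, Squarefree q ∧ q.Coprime (W*p0) ∧ (q:ℝ) ≤ exp (L/20)) →
    ∀ a : ℕ → ℕ, (∀ q ∈ Q, (a q).Coprime (W*q)) →
    ∑ q ∈ Q, (K:ℝ)^q.primeFactors.card *
      |psiAP m L N (W*q) (a q)-PsiN m L N/(W*q).totient| ≤ exp L/L^A := by
  classical
  obtain ⟨B, hB⟩ : ∃ B, B = 2*K+5+A+1 := ⟨_, rfl⟩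
  obtain ⟨m, hm⟩ : ∃ m, m = 4*B+1+2*K+A+1 := ⟨_, rfl⟩
  have hm0 : m ≠ 0 := by omega
  refine ⟨m, hm0, ?_⟩
  intro W hW0 hW
  obtain ⟨L1, hL1, hsm⟩ := small_cond m (2*B) W hW0
  obtain ⟨C, hC, htot⟩ := prim_total m hm0
  have hCF := CF_pos m
  have hWR : (1:ℝ) ≤ W := by exact_mod_cast hW0
  set J := 2*K+3+A with hJ
  set Cj : ℝ := ((J+1).factorial/(1/2:ℝ)^(J+1)) with hCj
  have hCj0 : 0 < Cj := by positivity
  refine ⟨L1+100+(C*W+W+1)+80*W+8*CF m*W^2*Cj, ?_, ?_⟩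
  · have : 0 ≤ C*W+W+1 := by positivity
    have : 0 ≤ 8*CF m*W^2*Cj := by positivity
    linarith
  intro L hL
  have h0a : 0 ≤ C*W+W+1 := by positivity
  have h0b : 0 ≤ 8*CF m*W^2*Cj := by positivity
  have hLL1 : L1 ≤ L := by linarith
  have hL100 : 100 ≤ L := by linarith
  have hLa : C*W+W+1 ≤ L := by linarith
  have hLb : 80*(W:ℝ) ≤ L := by linarith
  have hLc : 8*CF m*W^2*Cj ≤ L := by linarith
  have hLpos : 0 < L := by linarith
  have hL1' : 1 ≤ L := by linarith
  obtain ⟨p0, hp0, hp0W, hp⟩ := hsm L hLL1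
  refine ⟨p0, hp0, hp0W, ?_⟩
  intro N hN1 hN2 Q hQ a ha
  have hN0 : (0:ℝ) < N+1 := lt_of_lt_of_le (Real.exp_pos _) hN2
  set x := ⌊exp (L/20)⌋₊ with hx
  have hxle : (x:ℝ) ≤ exp (L/20) := Nat.floor_le (Real.exp_pos _).le
  have hQ' : ∀ q ∈ Q, Squarefree q ∧ q.Coprime W ∧ q ≤ x := fun q hq =>
    ⟨(hQ q hq).1, Nat.Coprime.coprime_mul_right_right (hQ q hq).2.1, Nat.le_floor (hQ q hq).2.2⟩
  -- log bound
  have hlogx : 1+log ((x+1:ℕ):ℝ) ≤ L := by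
    have h1 : ((x+1:ℕ):ℝ) ≤ exp (L/20+1) := by
      rw [Real.exp_add]
      have h2 : (1:ℝ) ≤ exp (L/20) := Real.one_le_exp (by positivity)
      have h3 : (2:ℝ) ≤ exp 1 := by have := Real.add_one_le_exp (1:ℝ); linarith
      push_cast
      nlinarith
    have := Real.log_le_log (by positivity) h1
    rw [Real.log_exp] at this
    linarith
  have hlogx0 : 0 ≤ 1+log ((x+1:ℕ):ℝ) := by
    have := Real.log_natCast_nonneg (x+1); linarith
  have hS : ∀ r : ℕ, 0 < r → ∑ q ∈ Q with r ∣ W*q, (K:ℝ)^q.primeFactors.card/q.totient ≤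
      Real.sqrt (W/r)*L^(2*K) := by
    intro r hr
    refine (S_bound K W r x hK hW0 hr hW Q hQ').trans ?_
    exact mul_le_mul_of_nonneg_left (pow_le_pow_left₀ hlogx0 hlogx _) (Real.sqrt_nonneg _)
  have hsqW : ∀ r : ℕ, 0 < r → Real.sqrt (W/r) ≤ W := by
    intro r hr
    have hr1 : (1:ℝ) ≤ r := by exact_mod_cast hr
    rw [Real.sqrt_le_left (by positivity)]
    calc (W:ℝ)/r ≤ W := div_le_self (by positivity) hr1
      _ ≤ W^2 := by nlinarith
  set g : PC → ℝ := fun ξ => ‖psiF m L N (chiN ξ)‖ with hg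
  have hg0 : ∀ ξ, 0 ≤ g ξ := fun ξ => norm_nonneg _
  -- main part
  have hmain : ∑ q ∈ Q, (K:ℝ)^q.primeFactors.card *
      ((∑ ξ ∈ (primSet (W*q)).filter (fun ξ => ξ.1 ∣ W*q), g ξ)/(W*q).totient) ≤
      (W+C*W)*(exp L/L^(A+1)) := by
    refine (swap_bound K W x hW0 Q hQ' g hg0).trans ?_
    have hpt : ∀ ξ ∈ primSet (W*x), g ξ*∑ q ∈ Q with ξ.1 ∣ W*q, (K:ℝ)^q.primeFactors.card/q.totient ≤
        (if (ξ.1:ℝ) ≤ L^(2*B) then (exp L*L/L^m)*(W*L^(2*K)) else 0) +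
          g ξ*(W/L^B*L^(2*K)) := by
      intro ξ hξ
      obtain ⟨h1, h2, h3⟩ := mem_primSet.1 hξ
      have hr : 0 < ξ.1 := by omega
      have hSr := hS ξ.1 hr
      by_cases hc : (ξ.1:ℝ) ≤ L^(2*B)
      · rw [if_pos hc]
        have hn : 0 ≤ g ξ*(W/L^B*L^(2*K)) := mul_nonneg (hg0 ξ) (by positivity)
        refine le_trans ?_ (le_add_of_nonneg_right hn)
        by_cases he : ∃ q ∈ Q, ξ.1 ∣ W*q
        · obtain ⟨q, hq, hd⟩ := he
          have hgs := hp N hN2 ξ h1 h3 hc ⟨q, (hQ q hq).2.1, hd⟩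
          refine mul_le_mul hgs (hSr.trans (mul_le_mul_of_nonneg_right (hsqW _ hr) (by positivity)))
            (sum_nonneg fun _ _ => by positivity) (by positivity)
        · have : Q.filter (fun q => ξ.1 ∣ W*q) = ∅ :=
            Finset.filter_eq_empty_iff.2 fun q hq hd => he ⟨q, hq, hd⟩
          rw [this, Finset.sum_empty, mul_zero]
          positivity
      · rw [if_neg hc, zero_add]
        refine mul_le_mul_of_nonneg_left (hSr.trans (mul_le_mul_of_nonneg_right ?_ (by positivity))) (hg0 ξ)
        rw [Real.sqrt_le_left (by positivity), div_pow, ← pow_mul, mul_comm B 2]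
        push Not at hc
        refine div_le_div₀ (by positivity) ?_ (by positivity) hc.le
        nlinarith
    refine (sum_le_sum hpt).trans ?_
    rw [sum_add_distrib, ← sum_mul, ← sum_filter, Finset.sum_const, nsmul_eq_mul, add_mul]
    refine add_le_add ?_ ?_
    · have hcard : (((primSet (W*x)).filter (fun ξ => (ξ.1:ℝ) ≤ L^(2*B))).card:ℝ) ≤ L^(4*B) := by
        have hsub : (primSet (W*x)).filter (fun ξ => (ξ.1:ℝ) ≤ L^(2*B)) ⊆ primSet ⌊L^(2*B)⌋₊ := by
          intro ξ hξ
          rw [mem_filter, mem_primSet] at hξ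
          exact mem_primSet.2 ⟨hξ.1.1, Nat.le_floor hξ.2, hξ.1.2.2⟩
        have h1 := (card_le_card hsub).trans (card_primSet _)
        have h2 : (⌊L^(2*B)⌋₊:ℝ) ≤ L^(2*B) := Nat.floor_le (by positivity)
        calc (((primSet (W*x)).filter (fun ξ => (ξ.1:ℝ) ≤ L^(2*B))).card:ℝ) ≤ ((⌊L^(2*B)⌋₊^2:ℕ):ℝ) := by
              exact_mod_cast h1
          _ ≤ (L^(2*B))^2 := by push_cast; exact pow_le_pow_left₀ (by positivity) h2 _
          _ = _ := by rw [← pow_mul]; congr 1; ring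
      refine (mul_le_mul_of_nonneg_right hcard (by positivity)).trans (le_of_eq ?_)
      rw [hm]
      field_simp
      ring
    · have h1 : ((W*x:ℕ):ℝ) ≤ exp (L/16) := by
        have h2 : (W:ℝ) ≤ exp (L/80) := by
          have := Real.add_one_le_exp (L/80); linarith
        have h3 : exp (L/16) = exp (L/80)*exp (L/20) := by
          rw [← Real.exp_add]; congr 1; ring
        push_cast
        rw [h3]
        exact mul_le_mul h2 hxle (by positivity) (by positivity)
      have h2 := htot L (by linarith) N (W*x) hN1 hN2 h1
      refine (mul_le_mul_of_nonneg_right h2 (by positivity)).trans (le_of_eq ?_)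
      rw [hB]
      field_simp
      ring
  -- bad part
  have hbad : ∑ q ∈ Q, (K:ℝ)^q.primeFactors.card*psiBad m L N (W*q) ≤ exp L/L^(A+1) := by
    have hlogN : 0 ≤ log N := Real.log_natCast_nonneg _
    have hlog2 : ((Nat.log 2 N:ℕ):ℝ)+1 ≤ 4*L := by
      have h1 := Real.natLog_le_logb N 2
      have h2 : Real.logb (2:ℕ) N ≤ 2*log N := by
        rw [Real.logb, div_le_iff₀ (Real.log_pos (by norm_num))]
        have := Real.log_two_gt_d9
        push_cast
        nlinarith
      linarith
    have hpt : ∀ q ∈ Q, (K:ℝ)^q.primeFactors.card*psiBad m L N (W*q) ≤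
        ((K:ℝ)^q.primeFactors.card/q.totient)*(CF m*(2*L)*(W*(x*x)*(4*L))) := by
      intro q hq
      obtain ⟨h1, h2, h3⟩ := hQ' q hq
      have hq0 : 0 < q := Nat.pos_of_ne_zero h1.ne_zero
      have hφ : (0:ℝ) < q.totient := by exact_mod_cast Nat.totient_pos.2 hq0
      have hφ2 : (q.totient:ℝ) ≤ x := by exact_mod_cast (Nat.totient_le q).trans h3
      have hqx : (q:ℝ) ≤ x := by exact_mod_cast h3
      have h4 := psiBad_le m L hL1' N (W*q) (by positivity)
      have h5 : CF m*log N*(((W*q:ℕ):ℝ)*((Nat.log 2 N:ℕ)+1:ℝ)) ≤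
          CF m*(2*L)*((W*x)*(4*L)) := by
        push_cast
        refine mul_le_mul (mul_le_mul_of_nonneg_left (by linarith) hCF.le) ?_ (by positivity) (by positivity)
        exact mul_le_mul (mul_le_mul_of_nonneg_left hqx (by positivity)) hlog2 (by positivity) (by positivity)
      rw [div_mul_eq_mul_div, le_div_iff₀ hφ]
      have hx0 : (0:ℝ) ≤ x := by positivity
      calc (K:ℝ)^q.primeFactors.card*psiBad m L N (W*q)*q.totient
          ≤ (K:ℝ)^q.primeFactors.card*(CF m*(2*L)*((W*x)*(4*L)))*x := by
            refine mul_le_mul (mul_le_mul_of_nonneg_left (h4.trans h5) (by positivity)) hφ2 hφ.le (by positivity)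
        _ = _ := by ring
    refine (sum_le_sum hpt).trans ?_
    rw [← sum_mul]
    have h1 : ∑ q ∈ Q, (K:ℝ)^q.primeFactors.card/q.totient ≤ W*L^(2*K) := by
      have := hS 1 one_pos
      rw [Finset.filter_true_of_mem (fun q _ => one_dvd _)] at this
      exact this.trans (mul_le_mul_of_nonneg_right (hsqW 1 one_pos) (by positivity))
    have hxx : (x:ℝ)*x ≤ exp (L/10) := by
      have : exp (L/10) = exp (L/20)*exp (L/20) := by rw [← Real.exp_add]; congr 1; ring
      rw [this]
      exact mul_le_mul hxle hxle (by positivity) (by positivity)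
    have hxx2 : exp (L/10) ≤ exp (L/2) := Real.exp_le_exp.2 (by linarith)
    have htr : 8*CF m*W^2*L^J ≤ exp (L/2) := by
      have h2 := exp_pow_trade (1/2) (by norm_num) (J+1) L hLpos.le
      have h3 : 8*CF m*W^2*L^J*L ≤ L*exp (L/2) := by
        calc 8*CF m*W^2*L^J*L = 8*CF m*W^2*L^(J+1) := by ring
          _ ≤ 8*CF m*W^2*(Cj*exp (1/2*L)) := mul_le_mul_of_nonneg_left h2 (by positivity)
          _ = (8*CF m*W^2*Cj)*exp (L/2) := by rw [show 1/2*L = L/2 by ring]; ring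
          _ ≤ _ := mul_le_mul_of_nonneg_right hLc (Real.exp_pos _).le
      rw [mul_comm L] at h3
      exact le_of_mul_le_mul_right h3 hLpos
    rw [le_div_iff₀ (by positivity)]
    calc (∑ q ∈ Q, (K:ℝ)^q.primeFactors.card/q.totient)*(CF m*(2*L)*(W*(x*x)*(4*L)))*L^(A+1)
        ≤ (W*L^(2*K))*(CF m*(2*L)*(W*exp (L/2)*(4*L)))*L^(A+1) := by
          refine mul_le_mul_of_nonneg_right (mul_le_mul h1 ?_ (by positivity) (by positivity)) (by positivity)
          refine mul_le_mul_of_nonneg_left (mul_le_mul_of_nonneg_right ?_ (by positivity)) (by positivity)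
          exact mul_le_mul_of_nonneg_left (hxx.trans hxx2) (by positivity)
      _ = (8*CF m*W^2*L^J)*exp (L/2) := by rw [hJ]; ring
      _ ≤ exp (L/2)*exp (L/2) := mul_le_mul_of_nonneg_right htr (Real.exp_pos _).le
      _ = exp L := by rw [← Real.exp_add]; congr 1; ring
  -- combine
  calc _ ≤ ∑ q ∈ Q, ((K:ℝ)^q.primeFactors.card *
      ((∑ ξ ∈ (primSet (W*q)).filter (fun ξ => ξ.1 ∣ W*q), g ξ)/(W*q).totient) +
        (K:ℝ)^q.primeFactors.card*psiBad m L N (W*q)) := by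
        refine sum_le_sum fun q hq => ?_
        rw [← mul_add]
        have hq0 : 0 < q := Nat.pos_of_ne_zero (hQ q hq).1.ne_zero
        refine mul_le_mul_of_nonneg_left ?_ (by positivity)
        convert psiAP_bound m L hL1' N (W*q) (a q) (by positivity) (ha q hq)
    _ ≤ (W+C*W)*(exp L/L^(A+1))+exp L/L^(A+1) := by
        rw [sum_add_distrib]
        exact add_le_add hmain hbad
    _ = (C*W+W+1)*(exp L/L^(A+1)) := by ring
    _ ≤ L*(exp L/L^(A+1)) := mul_le_mul_of_nonneg_right hLa (by positivity)
    _ = _ := by field_simp; ring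
end

section
open Finset

section B1
variable {ι σ τ : Type*} [Fintype ι] [DecidableEq ι] [Fintype σ]

lemma gram_tensor (S : ι → Finset τ) (w : ι → τ → ℝ) (V : ι → τ → σ → ℝ) (Y : (ι → σ) → ℝ) :
    ∑ u, ∑ u', Y u*Y u'*∏ p, (∑ s ∈ S p, w p s*V p s (u p)*V p s (u' p)) =
      ∑ s ∈ Fintype.piFinset S, (∏ p, w p (s p))*(∑ u, Y u*∏ p, V p (s p) (u p))^2 := by
  calc _ = ∑ u, ∑ u', ∑ s ∈ Fintype.piFinset S,
        (∏ p, w p (s p))*((Y u*∏ p, V p (s p) (u p))*(Y u'*∏ p, V p (s p) (u' p))) := by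
        refine sum_congr rfl fun u _ => sum_congr rfl fun u' _ => ?_
        rw [Finset.prod_univ_sum, mul_sum]
        refine sum_congr rfl fun s _ => ?_
        rw [prod_mul_distrib, prod_mul_distrib]
        ring
    _ = ∑ u, ∑ s ∈ Fintype.piFinset S, ∑ u',
        (∏ p, w p (s p))*((Y u*∏ p, V p (s p) (u p))*(Y u'*∏ p, V p (s p) (u' p))) :=
        sum_congr rfl fun u _ => sum_comm
    _ = ∑ s ∈ Fintype.piFinset S, ∑ u, ∑ u',
        (∏ p, w p (s p))*((Y u*∏ p, V p (s p) (u p))*(Y u'*∏ p, V p (s p) (u' p))) := sum_comm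
    _ = _ := by
        refine sum_congr rfl fun s _ => ?_
        rw [sq, Finset.sum_mul_sum, mul_sum]
        exact sum_congr rfl fun u _ => by rw [mul_sum]

lemma tensor_mono (S T : ι → Finset τ) (hST : ∀ p, S p ⊆ T p) (w : ι → τ → ℝ) (hw : ∀ p, ∀ s ∈ T p, 0 ≤ w p s)
    (V : ι → τ → σ → ℝ) (Y : (ι → σ) → ℝ) :
    ∑ u, ∑ u', Y u*Y u'*∏ p, (∑ s ∈ S p, w p s*V p s (u p)*V p s (u' p)) ≤
    ∑ u, ∑ u', Y u*Y u'*∏ p, (∑ s ∈ T p, w p s*V p s (u p)*V p s (u' p)) := by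
  rw [gram_tensor, gram_tensor]
  refine sum_le_sum_of_subset_of_nonneg (Fintype.piFinset_subset _ _ hST) fun s hs _ => ?_
  rw [Fintype.mem_piFinset] at hs
  exact mul_nonneg (prod_nonneg fun p _ => hw p _ (hs p)) (sq_nonneg _)

lemma tensor_diag [DecidableEq σ] (D : ι → σ → ℝ) (Y : (ι → σ) → ℝ) :
    ∑ u, ∑ u', Y u*Y u'*∏ p, (if u p = u' p then D p (u p) else 0) = ∑ u, Y u^2*∏ p, D p (u p) := by
  refine sum_congr rfl fun u _ => ?_
  rw [Finset.sum_eq_single u]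
  · simp [sq]
  · intro u' _ hne
    obtain ⟨p, hp⟩ := Function.ne_iff.1 hne
    rw [Finset.prod_eq_zero (Finset.mem_univ p) (if_neg (Ne.symm hp)), mul_zero]
  · intro h; exact absurd (Finset.mem_univ u) h

/-- Change of variables -/
noncomputable def lam (M : ι → σ → σ → ℝ) (Y : (ι → σ) → ℝ) (d : ι → σ) : ℝ :=
  ∑ u, Y u*∏ p, M p (d p) (u p)

lemma sum_lam (M : ι → σ → σ → ℝ) (Y : (ι → σ) → ℝ) (v : ι → σ → ℝ) :
    ∑ d, lam M Y d*∏ p, v p (d p) = ∑ u, Y u*∏ p, ∑ x, v p x*M p x (u p) := by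
  classical
  unfold lam
  simp_rw [sum_mul]
  rw [sum_comm]
  refine sum_congr rfl fun u _ => ?_
  rw [Finset.prod_univ_sum, Fintype.piFinset_univ, mul_sum]
  refine sum_congr rfl fun d _ => ?_
  rw [prod_mul_distrib]
  ring

/-- the form in `λ` becomes a form in `Y` -/
lemma lam_form (S : ι → Finset τ) (w : ι → τ → ℝ) (v : ι → τ → σ → ℝ) (M : ι → σ → σ → ℝ) (Y : (ι → σ) → ℝ) :
    ∑ d, ∑ e, lam M Y d*lam M Y e*∏ p, (∑ s ∈ S p, w p s*v p s (d p)*v p s (e p)) =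
    ∑ u, ∑ u', Y u*Y u'*∏ p, (∑ s ∈ S p, w p s*(∑ x, v p s x*M p x (u p))*(∑ x, v p s x*M p x (u' p))) := by
  rw [gram_tensor S w v (lam M Y), gram_tensor S w (fun p s y => ∑ x, v p s x*M p x y) Y]
  refine sum_congr rfl fun s _ => ?_
  rw [sum_lam M Y (fun p => v p (s p))]

lemma fiber_sum [DecidableEq σ] (z : σ) (T : Finset σ) (hz : z ∉ T) (F : Finset ι → ℝ) :
    ∑ c ∈ Fintype.piFinset (fun _ : ι => insert z T), F (univ.filter fun p => c p ≠ z) =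
      ∑ S : Finset ι, (T.card:ℝ)^S.card*F S := by
  rw [← Finset.sum_fiberwise_of_maps_to (s := Fintype.piFinset (fun _ : ι => insert z T)) (t := (univ : Finset (Finset ι)))
    (g := fun c => univ.filter fun p => c p ≠ z) (fun _ _ => Finset.mem_univ _)]
  refine sum_congr rfl fun S _ => ?_
  have h1 : (Fintype.piFinset (fun _ : ι => insert z T)).filter (fun c => (univ.filter fun p => c p ≠ z) = S) =
      Fintype.piFinset (fun p => if p ∈ S then T else {z}) := by
    ext c
    simp only [mem_filter, Fintype.mem_piFinset, mem_insert]
    constructor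
    · rintro ⟨h1, rfl⟩ p
      by_cases hp : c p = z
      · simp [hp]
      · simpa [hp] using h1 p
    · intro h
      constructor
      · intro p
        have := h p
        split_ifs at this with hp
        · exact Or.inr this
        · exact Or.inl (mem_singleton.1 this)
      · ext p
        have := h p
        simp only [mem_filter, mem_univ, true_and]
        split_ifs at this with hp
        · exact ⟨fun _ => hp, fun _ h0 => hz (h0 ▸ this)⟩
        · exact ⟨fun h0 => absurd (mem_singleton.1 this) h0, fun h0 => absurd h0 hp⟩
  have h2 : ∀ c ∈ (Fintype.piFinset (fun _ : ι => insert z T)).filter (fun c => (univ.filter fun p => c p ≠ z) = S),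
      F (univ.filter fun p => c p ≠ z) = F S := fun c hc => by rw [(mem_filter.1 hc).2]
  rw [sum_congr rfl h2, Finset.sum_const, h1, Fintype.card_piFinset, nsmul_eq_mul]
  congr 1
  rw [← Finset.prod_const]
  push_cast
  rw [← Finset.prod_subset (Finset.subset_univ S)]
  · exact prod_congr rfl fun p hp => by rw [if_pos hp]
  · intro p _ hp; rw [if_neg hp]; simp

end B1
end

section
open Finset

section B2
variable {k : ℕ}

noncomputable def MM (r:ℝ) : Option (Fin k) → Option (Fin k) → ℝ
  | none, none => 1
  | none, some _ => 1/(r-1)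
  | some i, some l => if i = l then -1 else 0
  | some _, none => 0

def vst (s : Option (Fin k)) : Option (Fin k) → ℝ
  | none => 1
  | some i => if s = some i then 1 else 0

noncomputable def M2 (j : Fin k) (r:ℝ) (x y : Option (Fin k)) : ℝ := if x = some j then 0 else MM r x y

noncomputable def pi1 (r:ℝ) : Option (Fin k) → ℝ
  | none => 1-k/r
  | some _ => 1/r

noncomputable def V1 (r:ℝ) : Option (Fin k) ⊕ Option (Fin k) → Option (Fin k) → ℝ
  | Sum.inl _, none => 1
  | Sum.inl s, some l => 1/(r-1)-if s = some l then 1 else 0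
  | Sum.inr none, none => 0
  | Sum.inr none, some _ => 1/(r-1)
  | Sum.inr (some _), none => 1
  | Sum.inr (some i), some l => if i = l then -1 else 0

noncomputable def w1 (r:ℝ) : Option (Fin k) ⊕ Option (Fin k) → ℝ
  | Sum.inl s => pi1 r s
  | Sum.inr none => 1-2/r
  | Sum.inr (some _) => 1/(r*(r-1))

noncomputable def D1 (r:ℝ) : Option (Fin k) → ℝ
  | none => 1+k/(r*(r-1))
  | some _ => 1/(r-1)

lemma V1_eq (r:ℝ) (s y : Option (Fin k)) : ∑ x, vst s x*MM r x y = V1 r (Sum.inl s) y := by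
  rw [Fintype.sum_option]
  rcases y with _ | l
  · simp [vst, MM, V1]
  · simp only [vst, MM, V1]
    rw [one_mul, sub_eq_add_neg]
    congr 1
    simp only [ite_mul, one_mul, zero_mul, mul_ite, mul_zero, mul_neg, mul_one]
    rcases s with _ | i
    · simp
    · simp only [Option.some.injEq]
      rw [Finset.sum_eq_single l]
      · by_cases h : i = l <;> simp [h]
      · intro b _ hb; simp [hb]
      · simp

lemma S1_local (r:ℝ) (hr : 2 ≤ r) (y y' : Option (Fin k)) :
    ∑ s : Option (Fin k) ⊕ Option (Fin k), w1 r s*V1 r s y*V1 r s y' = if y = y' then D1 r y else 0 := by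
  have h0 : r ≠ 0 := by linarith
  have h1 : r-1 ≠ 0 := by intro h; linarith
  rw [Fintype.sum_sum_type, Fintype.sum_option, Fintype.sum_option]
  rcases y with _ | l <;> rcases y' with _ | l'
  · simp [w1, V1, D1, pi1]
    field_simp
    ring
  · simp [w1, V1, D1, pi1, mul_sub, sum_sub_distrib]
    field_simp
    ring
  · simp [w1, V1, D1, pi1, mul_sub, sum_sub_distrib]
    field_simp
    ring
  · by_cases hl : l = l'
    · subst hl
      simp [w1, V1, D1, pi1, mul_sub, sub_mul, sum_sub_distrib]
      field_simp
      ring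
    · have hl' : ¬ l' = l := fun h => hl h.symm
      simp [w1, V1, D1, pi1, mul_sub, sub_mul, sum_sub_distrib, hl, hl']
      field_simp
      ring

noncomputable def pi2 (j : Fin k) (r:ℝ) : Option (Fin k) → ℝ
  | none => (r-k)/(r-1)
  | some i => if i = j then 0 else 1/(r-1)

noncomputable def V2 (j : Fin k) (r:ℝ) : Option (Fin k) ⊕ (Fin k × Fin k) → Option (Fin k) → ℝ
  | Sum.inl none, none => 1
  | Sum.inl none, some l => if l = j then 1/(r-1) else 0
  | Sum.inl (some _), none => 0
  | Sum.inl (some i), some l => if i = l then 1 else 0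
  | Sum.inr _, none => 0
  | Sum.inr x, some l => (if x.1 = l then 1 else 0)-(if x.2 = l then 1 else 0)

noncomputable def w2 (j : Fin k) (r:ℝ) : Option (Fin k) ⊕ (Fin k × Fin k) → ℝ
  | Sum.inl none => 1
  | Sum.inl (some i) => if i = j then 0 else (r-k)/(r-1)^2
  | Sum.inr x => if x.1 = j then 0 else if x.2 = j then 0 else 1/(2*(r-1)^2)

noncomputable def U2 (j : Fin k) (r:ℝ) (s : Option (Fin k)) : Option (Fin k) → ℝ
  | none => 1
  | some l => 1/(r-1)-if s = some l then (if l = j then 0 else 1) else 0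

lemma U2_eq (j : Fin k) (r:ℝ) (s y : Option (Fin k)) : ∑ x, vst s x*M2 j r x y = U2 j r s y := by
  rw [Fintype.sum_option]
  rcases y with _ | l
  · simp [vst, MM, M2, U2]
  · simp only [vst, MM, M2, U2]
    simp only [reduceCtorEq, if_false, one_mul, Option.some.injEq]
    rw [sub_eq_add_neg]
    congr 1
    rw [Finset.sum_eq_single l]
    · by_cases h : s = some l <;> by_cases h' : l = j <;> simp [h, h']
    · intro b _ hb; simp [hb]
    · simp

lemma S2_local_aux (j : Fin k) (r:ℝ) (h1 : r-1 ≠ 0) (l l' : Fin k) :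
    pi2 j r none*U2 j r none (some l)*U2 j r none (some l') +
      ∑ i : Fin k, pi2 j r (some i)*U2 j r (some i) (some l)*U2 j r (some i) (some l') =
    w2 j r (Sum.inl none)*V2 j r (Sum.inl none) (some l)*V2 j r (Sum.inl none) (some l') +
      ∑ i : Fin k, w2 j r (Sum.inl (some i))*V2 j r (Sum.inl (some i)) (some l)*V2 j r (Sum.inl (some i)) (some l') +
      ∑ i : Fin k, ∑ i' : Fin k, w2 j r (Sum.inr (i, i'))*V2 j r (Sum.inr (i, i')) (some l)*V2 j r (Sum.inr (i, i')) (some l') := by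
  set f : Fin k → ℝ := fun i => if i = j then 0 else 1 with hf
  set δ : Fin k → Fin k → ℝ := fun i l => if i = l then 1 else 0 with hδ
  set c : ℝ := 1/(r-1) with hc
  have hff : ∀ i, f i*f i = f i := by intro i; simp only [hf]; split_ifs <;> simp
  have hS0 : ∑ i, f i = k-1 := by
    simp only [hf]
    rw [← Finset.sum_erase_add _ _ (Finset.mem_univ j), if_pos rfl, add_zero]
    rw [sum_congr rfl (g := fun _ => (1:ℝ)) (fun i hi => if_neg (Finset.ne_of_mem_erase hi))]
    rw [Finset.sum_const, nsmul_eq_mul, Finset.card_erase_of_mem (Finset.mem_univ j), Finset.card_fin, Nat.cast_sub j.pos]; simp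
  have hS1 : ∀ l, ∑ i, f i*δ i l = f l := by intro l; simp [hδ]
  have hS2 : ∑ i, f i*(δ i l*δ i l') = f l*δ l l' := by
    rw [Finset.sum_eq_single l]
    · simp [hδ]
    · intro b _ hb; simp [hδ, hb]
    · simp
  have e1 : ∀ i, pi2 j r (some i)*U2 j r (some i) (some l)*U2 j r (some i) (some l') =
      c^3*f i-c^2*f l*(f i*δ i l)-c^2*f l'*(f i*δ i l')+c*f l*f l'*(f i*(δ i l*δ i l')) := by
    intro i
    have a1 : pi2 j r (some i) = c*f i := by simp only [pi2, hf, hc]; split_ifs <;> simp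
    have a2 : ∀ l, U2 j r (some i) (some l) = c-δ i l*f l := by
      intro l; simp only [U2, hf, hδ, hc, Option.some.injEq]; split_ifs <;> simp
    rw [a1, a2, a2]; ring
  have e2 : ∀ i, w2 j r (Sum.inl (some i))*V2 j r (Sum.inl (some i)) (some l)*V2 j r (Sum.inl (some i)) (some l') =
      (r-k)*c^2*(f i*(δ i l*δ i l')) := by
    intro i
    have a1 : w2 j r (Sum.inl (some i)) = (r-k)*c^2*f i := by
      simp only [w2, hf, hc]; split_ifs <;> field_simp <;> simp
    simp only [a1, V2, hδ]; ring
  have e3 : ∀ i i', w2 j r (Sum.inr (i, i'))*V2 j r (Sum.inr (i, i')) (some l)*V2 j r (Sum.inr (i, i')) (some l') =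
      c^2/2*((f i*(δ i l*δ i l'))*f i' - (f i*δ i l)*(f i'*δ i' l')-(f i*δ i l')*(f i'*δ i' l)
        + f i*(f i'*(δ i' l*δ i' l'))) := by
    intro i i'
    have a1 : w2 j r (Sum.inr (i, i')) = c^2/2*(f i*f i') := by
      simp only [w2, hf, hc]; split_ifs <;> field_simp <;> simp
    simp only [a1, V2, hδ]; ring
  have e4 : pi2 j r none*U2 j r none (some l)*U2 j r none (some l') = (r-k)*c^3 := by
    simp only [pi2, U2, hc]; simp; field_simp
  have e5 : w2 j r (Sum.inl none)*V2 j r (Sum.inl none) (some l)*V2 j r (Sum.inl none) (some l') =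
      c^2*(1-f l)*(1-f l') := by
    simp only [w2, V2, hf, hc]
    split_ifs <;> simp [sq]
  simp_rw [e1, e2, e3, e4, e5]
  simp only [sum_add_distrib, sum_sub_distrib, ← mul_sum, ← sum_mul, hS0, hS1, hS2]
  have hd : f l*f l'*(f l*δ l l') = f l*δ l l' := by
    by_cases h : l = l'
    · subst h; rw [← mul_assoc, hff, hff]
    · simp [hδ, h]
  have hrc : (r-1)*c = 1 := by rw [hc]; field_simp
  have hrk : (r-k)*c = 1-(k-1)*c := by
    calc (r-k)*c = (r-1)*c-(k-1)*c := by ring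
      _ = _ := by rw [hrc]
  have h2 := hff l
  have h3 := hff l'
  clear_value f δ c
  linear_combination (c^2-c*f l*δ l l')*hrk-c^2*h2-c^2*h3+c*hd

lemma S2_local (j : Fin k) (r:ℝ) (hr : 2 ≤ r) (y y' : Option (Fin k)) :
    ∑ s : Option (Fin k), pi2 j r s*U2 j r s y*U2 j r s y' =
      ∑ s : Option (Fin k) ⊕ (Fin k × Fin k), w2 j r s*V2 j r s y*V2 j r s y' := by
  have h0 : r ≠ 0 := by linarith
  have h1 : r-1 ≠ 0 := by intro h; linarith
  rw [Fintype.sum_sum_type, Fintype.sum_option, Fintype.sum_option, Fintype.sum_prod_type]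
  have hone : ∑ i : Fin k, (if i = j then (0:ℝ) else 1/(r-1)) = (k-1)/(r-1) := by
    rw [← Finset.sum_erase_add _ _ (Finset.mem_univ j), if_pos rfl, add_zero]
    rw [sum_congr rfl (g := fun _ => 1/(r-1)) (fun i hi => if_neg (Finset.ne_of_mem_erase hi))]
    have hc : (((univ : Finset (Fin k)).erase j).card:ℝ) = k-1 := by
      rw [Finset.card_erase_of_mem (Finset.mem_univ j), Finset.card_fin, Nat.cast_sub j.pos]; simp
    rw [Finset.sum_const, nsmul_eq_mul, hc]; ring
  have hone2 : ∑ i : Fin k, (if i = j then (0:ℝ) else 1/(2*(r-1)^2)) = (k-1)/(2*(r-1)^2) := by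
    have : ∀ i : Fin k, (if i = j then (0:ℝ) else 1/(2*(r-1)^2)) =
        (if i = j then (0:ℝ) else 1/(r-1))*(1/(2*(r-1))) := by
      intro i; split_ifs <;> field_simp; ring
    rw [sum_congr rfl fun i _ => this i, ← sum_mul, hone]
    field_simp
  rcases y with _ | l <;> rcases y' with _ | l'
  · simp only [pi2, U2, w2, V2, mul_one, mul_zero, Finset.sum_const_zero, add_zero, hone]
    field_simp
    ring
  · simp only [pi2, U2, w2, V2, mul_one, mul_zero, zero_mul, Finset.sum_const_zero, add_zero, mul_sub, sum_sub_distrib,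
      Option.some.injEq, reduceCtorEq, if_false, sub_zero, ← sum_mul, hone]
    by_cases h : l' = j
    · simp [h]; field_simp; ring
    · simp [h]; field_simp; ring
  · simp only [pi2, U2, w2, V2, mul_one, mul_zero, zero_mul, Finset.sum_const_zero, add_zero, mul_sub, sum_sub_distrib,
      Option.some.injEq, reduceCtorEq, if_false, sub_zero, ← sum_mul, hone]
    by_cases h : l = j
    · simp [h]; field_simp; ring
    · simp [h]; field_simp; ring
  · exact S2_local_aux j r h1 l l'

end B2
end

section
open Finset

section B2b
variable {k : ℕ} {ι : Type*} [Fintype ι] [DecidableEq ι]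

lemma S1_form (q : ι → ℝ) (h2 : ∀ p, 2 ≤ q p) (hk : ∀ p, (k:ℝ) ≤ q p) (Y : (ι → Option (Fin k)) → ℝ) :
    ∑ d, ∑ e, lam (fun p => MM (q p)) Y d*lam (fun p => MM (q p)) Y e *
      ∏ p, (∑ s : Option (Fin k), pi1 (q p) s*vst s (d p)*vst s (e p)) ≤ ∑ u, Y u^2*∏ p, D1 (q p) (u p) := by
  rw [lam_form (fun _ => univ) (fun p => pi1 (q p)) (fun _ => vst) (fun p => MM (q p)) Y]
  simp_rw [V1_eq]
  have h := tensor_mono (fun _ : ι => (univ : Finset (Option (Fin k))).disjSum (∅ : Finset (Option (Fin k))))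
    (fun _ => univ) (fun _ => subset_univ _) (fun p => w1 (q p)) ?_ (fun p => V1 (q p)) Y
  · simp_rw [Finset.sum_disjSum, Finset.sum_empty, add_zero, S1_local _ (h2 _), tensor_diag] at h
    exact h
  · intro p s _
    have := h2 p
    have h3 := hk p
    have h0 : 0 < q p := by linarith
    have h1 : 0 < q p-1 := by linarith
    rcases s with (_ | i) | (_ | i)
    · simp only [w1, pi1]; rw [sub_nonneg, div_le_one h0]; exact h3
    · simp only [w1, pi1]; positivity
    · simp only [w1]; rw [sub_nonneg, div_le_one h0]; exact this
    · simp only [w1]; positivity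

lemma S2_form (j : Fin k) (q : ι → ℝ) (h2 : ∀ p, 2 ≤ q p) (hk : ∀ p, (k:ℝ) ≤ q p) (Y : (ι → Option (Fin k)) → ℝ) :
    ∑ s : ι → Option (Fin k), (∏ p, w2 j (q p) (Sum.inl (s p)))*(∑ u, Y u*∏ p, V2 j (q p) (Sum.inl (s p)) (u p))^2 ≤
    ∑ d, ∑ e, lam (fun p => M2 j (q p)) Y d*lam (fun p => M2 j (q p)) Y e *
      ∏ p, (∑ s : Option (Fin k), pi2 j (q p) s*vst s (d p)*vst s (e p)) := by
  rw [lam_form (fun _ => univ) (fun p => pi2 j (q p)) (fun _ => vst) (fun p => M2 j (q p)) Y]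
  simp_rw [U2_eq, S2_local j _ (h2 _)]
  have h := tensor_mono (fun _ : ι => (univ : Finset (Option (Fin k))).disjSum (∅ : Finset (Fin k × Fin k)))
    (fun _ => univ) (fun _ => subset_univ _) (fun p => w2 j (q p)) ?_ (fun p => V2 j (q p)) Y
  · refine le_trans (le_of_eq ?_) h
    simp_rw [Finset.sum_disjSum, Finset.sum_empty, add_zero]
    rw [gram_tensor (fun _ => univ) (fun p s => w2 j (q p) (Sum.inl s)) (fun p s => V2 j (q p) (Sum.inl s)) Y,
      Fintype.piFinset_univ]
  · intro p s _
    have := h2 p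
    have h3 := hk p
    have h0 : 0 < q p := by linarith
    have h1 : 0 < q p-1 := by linarith
    rcases s with (_ | i) | x
    · simp [w2]
    · simp only [w2]; split_ifs; · exact le_rfl
      exact div_nonneg (by linarith) (by positivity)
    · simp only [w2]; split_ifs <;> first | exact le_rfl | positivity

end B2b
end

section
open Finset

section B3
variable {k : ℕ} {ι : Type*} [Fintype ι] [DecidableEq ι]

noncomputable def vv (q : ι → ℕ) (z : Fin k → ℤ) (n:ℕ) (p : ι) : Option (Fin k) → ℝ
  | none => 1
  | some i => if (q p : ℤ) ∣ n+z i then 1 else 0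

def compat (x y : Option (Fin k)) : Prop := x = none ∨ y = none ∨ x = y

instance (x y : Option (Fin k)) : Decidable (compat x y) := by unfold compat; infer_instance

def suppP (d e : ι → Option (Fin k)) : Finset ι := univ.filter fun p => ¬ (d p = none ∧ e p = none)

def Tset (k:ℕ) : Finset (Option (Fin k) × Option (Fin k)) :=
  univ.filter fun x => compat x.1 x.2 ∧ x ≠ (none, none)

lemma card_Tset (k:ℕ) : (Tset k).card ≤ 3*k := by
  have hsub : Tset k ⊆ (univ.image fun i : Fin k => ((some i, none) : Option (Fin k) × Option (Fin k))) ∪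
      ((univ.image fun i : Fin k => ((none, some i) : Option (Fin k) × Option (Fin k))) ∪
      (univ.image fun i : Fin k => ((some i, some i) : Option (Fin k) × Option (Fin k)))) := by
    rintro ⟨x, y⟩ h
    rw [Tset, mem_filter] at h
    obtain ⟨-, h1, h2⟩ := h
    simp only [mem_union, mem_image, mem_univ, true_and]
    rcases x with _ | i <;> rcases y with _ | l
    · exact absurd rfl h2
    · exact Or.inr (Or.inl ⟨l, rfl⟩)
    · exact Or.inl ⟨i, rfl⟩
    · rcases h1 with h | h | h
      · simp at h
      · simp at h
      · exact Or.inr (Or.inr ⟨i, by simp at h; simp [h]⟩)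
  refine (card_le_card hsub).trans ((card_union_le _ _).trans ?_)
  have h1 := card_union_le (univ.image fun i : Fin k => ((none, some i) : Option (Fin k) × Option (Fin k)))
      (univ.image fun i : Fin k => ((some i, some i) : Option (Fin k) × Option (Fin k)))
  have h2 : ∀ f : Fin k → Option (Fin k) × Option (Fin k), (univ.image f).card ≤ k := fun f =>
    card_image_le.trans (by simp)
  have := h2 fun i => (some i, none)
  have := h2 fun i => (none, some i)
  have := h2 fun i => (some i, some i)
  omega

lemma sum_pairs_le (F : Finset ι → ℝ) (hF : ∀ S, 0 ≤ F S) :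
    ∑ d : ι → Option (Fin k), ∑ e : ι → Option (Fin k),
      (if ∀ p, compat (d p) (e p) then F (suppP d e) else 0) ≤ ∑ S : Finset ι, (3*k:ℝ)^S.card*F S := by
  have hz : ((none, none) : Option (Fin k) × Option (Fin k)) ∉ Tset k := by simp [Tset]
  have h := fiber_sum (ι := ι) (none, none) (Tset k) hz F
  have h1 : ∑ d : ι → Option (Fin k), ∑ e : ι → Option (Fin k),
      (if ∀ p, compat (d p) (e p) then F (suppP d e) else 0) =
      ∑ c ∈ Fintype.piFinset (fun _ : ι => insert (none, none) (Tset k)), F (univ.filter fun p => c p ≠ (none, none)) := by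
    rw [← Fintype.sum_prod_type' (f := fun (d e : ι → Option (Fin k)) => (if ∀ p, compat (d p) (e p) then F (suppP d e) else 0))]
    rw [← Equiv.sum_comp (Equiv.arrowProdEquivProdArrow ι (fun _ => Option (Fin k)) (fun _ => Option (Fin k)))]
    rw [← sum_filter]
    refine sum_congr ?_ ?_
    · ext c
      rw [mem_filter, Fintype.mem_piFinset]
      simp only [mem_univ, true_and, mem_insert, Tset, mem_filter]
      change (∀ p, compat (c p).1 (c p).2) ↔ _
      constructor
      · intro h p
        by_cases hp : c p = (none, none)
        · exact Or.inl hp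
        · exact Or.inr ⟨h p, hp⟩
      · intro h p
        rcases h p with h | h
        · simp [h, compat]
        · exact h.1
    · intro c _
      congr 1
      ext p
      simp [suppP, Equiv.arrowProdEquivProdArrow, Prod.ext_iff]
  rw [h1, h]
  refine sum_le_sum fun S _ => mul_le_mul_of_nonneg_right ?_ (hF S)
  refine pow_le_pow_left₀ (by positivity) ?_ _
  exact_mod_cast card_Tset k

lemma A_compat (q : ι → ℕ) (z : Fin k → ℤ) (n:ℕ) (d e : ι → Option (Fin k)) (h : ∀ p, compat (d p) (e p))
    (c : ι → Fin k) (hc : ∀ p i, (d p = some i ∨ e p = some i) → c p = i) :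
    ∏ p, vv q z n p (d p)*vv q z n p (e p) = if ∀ p ∈ suppP d e, (q p : ℤ) ∣ n+z (c p) then 1 else 0 := by
  have h1 : ∀ p, vv q z n p (d p)*vv q z n p (e p) =
      if p ∈ suppP d e → (q p : ℤ) ∣ n+z (c p) then 1 else 0 := by
    intro p
    simp only [suppP, mem_filter, mem_univ, true_and]
    have hcp := h p
    have hcc := hc p
    rcases hd : d p with _ | i <;> rcases he : e p with _ | l
    · simp [vv]
    · have : c p = l := hcc l (Or.inr he)
      simp [vv, this]
    · have : c p = i := hcc i (Or.inl hd)
      simp [vv, this]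
    · have h1 : c p = i := hcc i (Or.inl hd)
      have h2 : c p = l := hcc l (Or.inr he)
      have h3 : i = l := h1 ▸ h2
      subst h3
      simp [vv, h1]
  simp_rw [h1]
  split_ifs with hall
  · exact Finset.prod_eq_one fun p _ => if_pos (hall p)
  · push Not at hall
    obtain ⟨p, hp, hnd⟩ := hall
    exact Finset.prod_eq_zero (mem_univ p) (if_neg (fun h => hnd (h hp)))

lemma A_incompat (q : ι → ℕ) (z : Fin k → ℤ) (hz : ∀ p i l, i ≠ l → ¬ (q p : ℤ) ∣ z i-z l)
    (n:ℕ) (d e : ι → Option (Fin k)) (h : ¬ ∀ p, compat (d p) (e p)) :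
    ∏ p, vv q z n p (d p)*vv q z n p (e p) = 0 := by
  push Not at h
  obtain ⟨p, hp⟩ := h
  refine Finset.prod_eq_zero (mem_univ p) ?_
  unfold compat at hp
  push Not at hp
  rcases hd : d p with _ | i
  · exact absurd hd hp.1
  rcases he : e p with _ | l
  · exact absurd he hp.2.1
  have hil : i ≠ l := fun h' => hp.2.2 (by rw [hd, he, h'])
  simp only [vv]
  by_cases h1 : (q p : ℤ) ∣ n+z i
  · by_cases h2 : (q p : ℤ) ∣ n+z l
    · exfalso
      apply hz p i l hil
      have := dvd_sub h1 h2
      simpa using this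
    · simp [h2]
  · simp [h1]

lemma Ker_prod (ρ : ι → ℝ) (Ker : ι → Option (Fin k) → Option (Fin k) → ℝ) (d e : ι → Option (Fin k))
    (hKer : ∀ p, Ker p (d p) (e p) = if d p = none ∧ e p = none then 1 else if compat (d p) (e p) then ρ p else 0) :
    ∏ p, Ker p (d p) (e p) = if ∀ p, compat (d p) (e p) then ∏ p ∈ suppP d e, ρ p else 0 := by
  simp_rw [hKer]
  split_ifs with h
  · rw [suppP, Finset.prod_filter]
    refine prod_congr rfl fun p _ => ?_
    rw [if_pos (h p)]
    by_cases h' : d p = none ∧ e p = none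
    · rw [if_pos h', if_neg (not_not.2 h')]
    · rw [if_neg h', if_pos h']
  · push Not at h
    obtain ⟨p, hp⟩ := h
    refine Finset.prod_eq_zero (mem_univ p) ?_
    rw [if_neg, if_neg hp]
    rintro ⟨h1, -⟩
    exact hp (Or.inl h1)

theorem sieve_expand (q : ι → ℕ) (z : Fin k → ℤ) (hz : ∀ p i l, i ≠ l → ¬ (q p : ℤ) ∣ z i-z l)
    (base : Finset ℕ) (μ : ℕ → ℝ) (lm : (ι → Option (Fin k)) → ℝ) (ok : Fin k → Prop) (c0 : Fin k) (ρ : ι → ℝ)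
    (Ker : ι → Option (Fin k) → Option (Fin k) → ℝ) (M:ℝ) (E : Finset ι → ℝ) (hE0 : ∀ S, 0 ≤ E S) (B:ℝ)
    (T : Finset (Finset ι))
    (hlm : ∀ d, |lm d| ≤ B) (hok : ∀ d, lm d ≠ 0 → ∀ p i, d p = some i → ok i)
    (hT : ∀ d e, lm d ≠ 0 → lm e ≠ 0 → suppP d e ∈ T)
    (hKer : ∀ p x y, (∀ i, x = some i → ok i) → (∀ i, y = some i → ok i) →
      Ker p x y = if x = none ∧ y = none then 1 else if compat x y then ρ p else 0)
    (hE : ∀ S ∈ T, ∀ c : ι → Fin k, (∀ p ∈ S, ok (c p)) →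
      |∑ n ∈ base.filter (fun n : ℕ => ∀ p ∈ S, (q p : ℤ) ∣ (n:ℤ)+z (c p)), μ n-M*∏ p ∈ S, ρ p| ≤ E S) :
    |∑ n ∈ base, μ n*(∑ d, lm d*∏ p, vv q z n p (d p))^2 -
      M*∑ d, ∑ e, lm d*lm e*∏ p, Ker p (d p) (e p)| ≤ B^2*∑ S ∈ T, (3*k:ℝ)^S.card*E S := by
  classical
  have h1 : ∑ n ∈ base, μ n*(∑ d, lm d*∏ p, vv q z n p (d p))^2 =
      ∑ d, ∑ e, lm d*lm e*∑ n ∈ base, μ n*∏ p, vv q z n p (d p)*vv q z n p (e p) := by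
    simp_rw [sq, Finset.sum_mul_sum, mul_sum]
    rw [sum_comm]
    refine sum_congr rfl fun d _ => ?_
    rw [sum_comm]
    refine sum_congr rfl fun e _ => sum_congr rfl fun n _ => ?_
    rw [prod_mul_distrib]; ring
  have h2 : ∑ n ∈ base, μ n*(∑ d, lm d*∏ p, vv q z n p (d p))^2 -
      M*∑ d, ∑ e, lm d*lm e*∏ p, Ker p (d p) (e p) =
      ∑ d, ∑ e, lm d*lm e*(∑ n ∈ base, μ n*∏ p, vv q z n p (d p)*vv q z n p (e p) -
        M*∏ p, Ker p (d p) (e p)) := by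
    rw [h1, mul_sum, ← sum_sub_distrib]
    refine sum_congr rfl fun d _ => ?_
    rw [mul_sum, ← sum_sub_distrib]
    exact sum_congr rfl fun e _ => by ring
  have hB0 : 0 ≤ B := (abs_nonneg _).trans (hlm fun _ => none)
  set F : Finset ι → ℝ := fun S => if S ∈ T then E S else 0 with hF
  have hF0 : ∀ S, 0 ≤ F S := fun S => by simp only [hF]; split_ifs; exacts [hE0 S, le_rfl]
  have h3 : ∀ d e, |lm d*lm e*(∑ n ∈ base, μ n*∏ p, vv q z n p (d p)*vv q z n p (e p) -
        M*∏ p, Ker p (d p) (e p))| ≤ B^2*(if ∀ p, compat (d p) (e p) then F (suppP d e) else 0) := by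
    intro d e
    have hn : 0 ≤ B^2*(if ∀ p, compat (d p) (e p) then F (suppP d e) else 0) := by
      refine mul_nonneg (sq_nonneg _) ?_
      split_ifs; exacts [hF0 _, le_rfl]
    by_cases hd : lm d = 0
    · rw [hd]; simpa using hn
    by_cases he : lm e = 0
    · rw [he]; simpa using hn
    rw [abs_mul, abs_mul]
    refine mul_le_mul ?_ ?_ (abs_nonneg _) (sq_nonneg _)
    · rw [sq]; exact mul_le_mul (hlm d) (hlm e) (abs_nonneg _) hB0
    rw [Ker_prod ρ Ker d e (fun p => hKer p _ _ (fun i => hok d hd p i) (fun i => hok e he p i))]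
    by_cases hc : ∀ p, compat (d p) (e p)
    · rw [if_pos hc, if_pos hc]
      have hST := hT d e hd he
      simp only [hF, if_pos hST]
      set c : ι → Fin k := fun p => (d p).getD ((e p).getD c0) with hcdef
      have hcc : ∀ p i, (d p = some i ∨ e p = some i) → c p = i := by
        intro p i h
        simp only [hcdef]
        rcases h with h | h
        · simp [h]
        · rcases hc p with h' | h' | h'
          · simp [h, h']
          · rw [h] at h'; simp at h'
          · rw [h', h]; simp
      have h4 := hE _ hST c ?_
      · refine le_of_eq_of_le ?_ h4
        congr 2
        rw [sum_filter]
        refine sum_congr rfl fun n _ => ?_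
        rw [A_compat q z n d e hc c hcc]
        split_ifs <;> simp
      · intro p hp
        rw [suppP, mem_filter] at hp
        rcases hdp : d p with _ | i
        · rcases hep : e p with _ | i
          · exact absurd ⟨hdp, hep⟩ hp.2
          · rw [hcc p i (Or.inr hep)]; exact hok e he p i hep
        · rw [hcc p i (Or.inl hdp)]; exact hok d hd p i hdp
    · rw [if_neg hc, if_neg hc, mul_zero, sub_zero]
      rw [Finset.sum_eq_zero fun n _ => by rw [A_incompat q z hz n d e hc, mul_zero], abs_zero]
  rw [h2]
  refine (Finset.abs_sum_le_sum_abs _ _).trans ?_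
  calc _ ≤ ∑ d, ∑ e, B^2*(if ∀ p, compat (d p) (e p) then F (suppP d e) else 0) :=
        sum_le_sum fun d _ => (Finset.abs_sum_le_sum_abs _ _).trans (sum_le_sum fun e _ => h3 d e)
    _ = B^2*∑ d : ι → Option (Fin k), ∑ e : ι → Option (Fin k), (if ∀ p, compat (d p) (e p) then F (suppP d e) else 0) := by
        simp_rw [← mul_sum]
    _ ≤ B^2*∑ S : Finset ι, (3*k:ℝ)^S.card*F S :=
        mul_le_mul_of_nonneg_left (sum_pairs_le F hF0) (sq_nonneg _)
    _ = _ := by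
        congr 1
        simp only [hF, mul_ite, mul_zero]
        rw [← sum_filter]
        congr 1
        ext S; simp

lemma Ker_gen (w : Option (Fin k) → ℝ) (c:ℝ) (h1 : w none + ∑ i, w (some i) = 1) (x y : Option (Fin k))
    (hx : ∀ i, x = some i → w (some i) = c) (hy : ∀ i, y = some i → w (some i) = c) :
    ∑ s, w s*vst s x*vst s y = if x = none ∧ y = none then 1 else if compat x y then c else 0 := by
  rw [Fintype.sum_option]
  rcases x with _ | i <;> rcases y with _ | l
  · simp [vst, h1]
  · simp [vst, compat, hy]
  · simp [vst, compat, hx]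
  · by_cases h : i = l
    · subst h; simp [vst, compat, hx]
    · simp [vst, compat, h, Ne.symm h, fun h' : l = i => h h'.symm]

lemma Ker1_val (r:ℝ) (x y : Option (Fin k)) :
    ∑ s, pi1 r s*vst s x*vst s y = if x = none ∧ y = none then 1 else if compat x y then 1/r else 0 := by
  refine Ker_gen _ _ ?_ x y (fun i _ => rfl) (fun i _ => rfl)
  simp only [pi1, sum_const, card_univ, Fintype.card_fin, nsmul_eq_mul]; ring

lemma Ker2_val (j : Fin k) (r:ℝ) (hr : r-1 ≠ 0) (x y : Option (Fin k)) (hx : ∀ i, x = some i → i ≠ j)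
    (hy : ∀ i, y = some i → i ≠ j) :
    ∑ s, pi2 j r s*vst s x*vst s y = if x = none ∧ y = none then 1 else if compat x y then 1/(r-1) else 0 := by
  refine Ker_gen _ _ ?_ x y (fun i h => by simp [pi2, hx i h]) (fun i h => by simp [pi2, hy i h])
  simp only [pi2]
  have : ∀ i : Fin k, (if i = j then (0:ℝ) else 1/(r-1)) = 1/(r-1)-if i = j then 1/(r-1) else 0 := by
    intro i; split_ifs <;> simp
  simp_rw [this]
  rw [sum_sub_distrib]
  simp only [sum_const, card_univ, Fintype.card_fin, nsmul_eq_mul, Finset.sum_ite_eq', mem_univ, if_true]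
  field_simp; ring

end B3
end

section
open Finset

section B4a
variable {k : ℕ} {ι : Type*} [Fintype ι] [DecidableEq ι]

def NN (q : ι → ℕ) (S : Finset ι) : ℕ := ∏ p ∈ S, q p

def sup1 (u : ι → Option (Fin k)) : Finset ι := univ.filter fun p => u p ≠ none

lemma NN_pos (q : ι → ℕ) (hp : ∀ i, (q i).Prime) (S : Finset ι) : 0 < NN q S :=
  prod_pos fun i _ => (hp i).pos

lemma NN_mono (q : ι → ℕ) (hp : ∀ i, (q i).Prime) {S T : Finset ι} (h : S ⊆ T) : NN q S ≤ NN q T :=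
  Finset.prod_le_prod_of_subset_of_one_le' h fun i _ _ => (hp i).pos

lemma NN_union_le (q : ι → ℕ) (hp : ∀ i, (q i).Prime) (S T : Finset ι) : NN q (S ∪ T) ≤ NN q S*NN q T := by
  have h := Finset.prod_union_inter (s₁ := S) (s₂ := T) (f := q)
  unfold NN
  rw [← h]
  exact Nat.le_mul_of_pos_right _ (NN_pos q hp _)

lemma NN_primeFactors (q : ι → ℕ) (hp : ∀ i, (q i).Prime) (S : Finset ι) : (NN q S).primeFactors = S.image q := by
  ext r
  rw [Nat.mem_primeFactors_of_ne_zero (NN_pos q hp S).ne', mem_image]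
  constructor
  · rintro ⟨hr, hd⟩
    obtain ⟨i, hi, hd⟩ := (hr.prime.dvd_finset_prod_iff _).1 hd
    exact ⟨i, hi, ((Nat.prime_dvd_prime_iff_eq hr (hp i)).1 hd).symm⟩
  · rintro ⟨i, hi, rfl⟩
    exact ⟨hp i, Finset.dvd_prod_of_mem q hi⟩

lemma NN_sqfree (q : ι → ℕ) (hinj : Function.Injective q) (hp : ∀ i, (q i).Prime) (S : Finset ι) : Squarefree (NN q S) := by
  induction S using Finset.induction_on with
  | empty => simp [NN]
  | insert a S ha ih =>
    unfold NN at *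
    rw [Finset.prod_insert ha, Nat.squarefree_mul_iff]
    refine ⟨?_, (hp a).squarefree, ih⟩
    refine Nat.Coprime.prod_right fun i hi => ?_
    exact (Nat.coprime_primes (hp a) (hp i)).2 fun h => ha (hinj h ▸ hi)

lemma NN_inj (q : ι → ℕ) (hinj : Function.Injective q) (hp : ∀ i, (q i).Prime) : Function.Injective (NN q) := by
  intro S T h
  have h1 := NN_primeFactors q hp S
  rw [h, NN_primeFactors q hp T] at h1
  exact (Finset.image_injective hinj h1).symm

lemma NN_card (q : ι → ℕ) (hinj : Function.Injective q) (hp : ∀ i, (q i).Prime) (S : Finset ι) :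
    (NN q S).primeFactors.card = S.card := by
  rw [NN_primeFactors q hp, card_image_of_injective _ hinj]

lemma NN_totient (q : ι → ℕ) (hinj : Function.Injective q) (hp : ∀ i, (q i).Prime) (S : Finset ι) :
    ((NN q S).totient:ℝ) = ∏ p ∈ S, ((q p:ℝ)-1) := by
  rw [totient_sqfree _ (NN_sqfree q hinj hp S), NN_primeFactors q hp, Finset.prod_image hinj.injOn]

lemma sum_NN_le (q : ι → ℕ) (hinj : Function.Injective q) (hp : ∀ i, (q i).Prime) (f : ℕ → ℝ) (hf : ∀ n, 0 ≤ f n) (x:ℕ) :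
    ∑ S ∈ univ.filter (fun S => NN q S ≤ x), f (NN q S) ≤ ∑ n ∈ Ioc 0 x, if Squarefree n then f n else 0 := by
  rw [← Finset.sum_image (f := f) (g := NN q) ((NN_inj q hinj hp).injOn), ← sum_filter]
  refine sum_le_sum_of_subset_of_nonneg ?_ fun n _ _ => hf n
  intro n hn
  obtain ⟨S, hS, rfl⟩ := mem_image.1 hn
  exact mem_filter.2 ⟨mem_Ioc.2 ⟨NN_pos q hp S, (mem_filter.1 hS).2⟩, NN_sqfree q hinj hp S⟩

/-- the log-power bound -/
noncomputable def LB (K x:ℕ) : ℝ := (1+log ((x+1:ℕ):ℝ))^K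

lemma LB_nonneg (K x:ℕ) : 0 ≤ LB K x := by
  unfold LB
  have : 0 ≤ log ((x+1:ℕ):ℝ) := Real.log_natCast_nonneg _
  positivity

lemma sum_NN_totient (q : ι → ℕ) (hinj : Function.Injective q) (hp : ∀ i, (q i).Prime) (K x:ℕ) :
    ∑ S ∈ univ.filter (fun S => NN q S ≤ x), (K:ℝ)^S.card*∏ p ∈ S, 1/((q p:ℝ)-1) ≤ LB (2*K) x := by
  have h1 := sum_NN_le q hinj hp (fun n => (K:ℝ)^n.primeFactors.card/n.totient) (fun n => by positivity) x
  refine le_trans (le_of_eq ?_) (h1.trans ((sum_le_sum fun n _ => ?_).trans (sum_omega (2*K) x)))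
  · refine sum_congr rfl fun S _ => ?_
    rw [NN_card q hinj hp, NN_totient q hinj hp, div_eq_mul_inv, ← Finset.prod_inv_distrib]
    simp
  · split_ifs with h
    · exact om_div_totient_le K n h
    · exact le_rfl

lemma sum_NN_count (q : ι → ℕ) (hinj : Function.Injective q) (hp : ∀ i, (q i).Prime) (K x:ℕ) :
    ∑ S ∈ univ.filter (fun S => NN q S ≤ x), (K:ℝ)^S.card ≤ x*LB K x := by
  have h1 := sum_NN_le q hinj hp (fun n => (K:ℝ)^n.primeFactors.card) (fun n => by positivity) x
  have h2 : ∑ n ∈ Ioc 0 x, (if Squarefree n then (K:ℝ)^n.primeFactors.card else 0) ≤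
      x*∑ n ∈ Ioc 0 x, (if Squarefree n then (K:ℝ)^n.primeFactors.card/n else 0) := by
    rw [mul_sum]
    refine sum_le_sum fun n hn => ?_
    rw [mem_Ioc] at hn
    split_ifs
    · rw [mul_div_assoc', le_div_iff₀ (by exact_mod_cast hn.1), mul_comm]
      refine mul_le_mul_of_nonneg_right ?_ (by positivity)
      exact_mod_cast hn.2
    · simp
  refine le_trans (le_of_eq ?_) (h1.trans (h2.trans (mul_le_mul_of_nonneg_left (sum_omega K x) (by positivity))))
  refine sum_congr rfl fun S _ => ?_
  rw [NN_card q hinj hp]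

lemma sum_sup1 (F : Finset ι → ℝ) : ∑ u : ι → Option (Fin k), F (sup1 u) = ∑ S : Finset ι, (k:ℝ)^S.card*F S := by
  have h := fiber_sum (ι := ι) (none : Option (Fin k)) (univ.image some) (by simp) F
  have hc : (univ.image (some : Fin k → Option (Fin k))).card = k := by
    rw [card_image_of_injective _ (Option.some_injective _)]; simp
  rw [hc] at h
  have : (insert none (univ.image some) : Finset (Option (Fin k))) = univ := by
    ext x; rcases x with _ | i <;> simp
  rw [this, Fintype.piFinset_univ] at h
  exact h

lemma MM_supp (r:ℝ) (x y : Option (Fin k)) (h : MM r x y ≠ 0) (hx : x ≠ none) : y = x := by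
  rcases x with _ | i
  · exact absurd rfl hx
  rcases y with _ | l
  · simp [MM] at h
  · simp only [MM] at h
    by_contra hne
    have : ¬ i = l := fun h' => hne (by rw [h'])
    simp [this] at h

lemma lam_supp (q : ι → ℕ) (hp : ∀ i, (q i).Prime)
    (Y : (ι → Option (Fin k)) → ℝ) (R:ℕ) (hYR : ∀ u, Y u ≠ 0 → NN q (sup1 u) ≤ R) (d : ι → Option (Fin k)) (hd : lam (fun p => MM (q p:ℝ)) Y d ≠ 0) : NN q (sup1 d) ≤ R := by
  obtain ⟨u, -, hu⟩ := Finset.exists_ne_zero_of_sum_ne_zero hd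
  refine le_trans (NN_mono q hp ?_) (hYR u (left_ne_zero_of_mul hu))
  intro p hpd
  rw [sup1, mem_filter] at *
  refine ⟨mem_univ _, ?_⟩
  have h1 := Finset.prod_ne_zero_iff.1 (right_ne_zero_of_mul hu) p (mem_univ p)
  rw [MM_supp _ _ _ h1 hpd.2]; exact hpd.2

lemma lam_bound (q : ι → ℕ) (hinj : Function.Injective q) (hp : ∀ i, (q i).Prime)
    (Y : (ι → Option (Fin k)) → ℝ) (hY1 : ∀ u, |Y u| ≤ 1) (R:ℕ) (hYR : ∀ u, Y u ≠ 0 → NN q (sup1 u) ≤ R) (d : ι → Option (Fin k)) : |lam (fun p => MM (q p:ℝ)) Y d| ≤ LB (2*k) R := by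
  set G : Finset ι → ℝ := fun S => if NN q S ≤ R then ∏ p ∈ S, 1/((q p:ℝ)-1) else 0 with hG
  have hq1 : ∀ p, 0 < (q p:ℝ)-1 := fun p => by
    have : (2:ℝ) ≤ q p := by exact_mod_cast (hp p).two_le
    linarith
  have hG0 : ∀ S, 0 ≤ G S := fun S => by
    simp only [hG]; split_ifs
    · exact prod_nonneg fun p _ => by have := hq1 p; positivity
    · exact le_rfl
  set A : Finset (ι → Option (Fin k)) := univ.filter fun u => ∀ p, d p ≠ none → u p = d p with hA
  set t : (ι → Option (Fin k)) → (ι → Option (Fin k)) := fun u p => if d p ≠ none then none else u p with ht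
  have h1 : ∀ u, |Y u*∏ p, MM (q p:ℝ) (d p) (u p)| ≤ if u ∈ A then G (sup1 (t u)) else 0 := by
    intro u
    by_cases h0 : Y u*∏ p, MM (q p:ℝ) (d p) (u p) = 0
    · rw [h0, abs_zero]; split_ifs; exacts [hG0 _, le_rfl]
    have huA : u ∈ A := by
      rw [hA, mem_filter]
      refine ⟨mem_univ _, fun p hdp => ?_⟩
      exact MM_supp _ _ _ (Finset.prod_ne_zero_iff.1 (right_ne_zero_of_mul h0) p (mem_univ p)) hdp
    rw [if_pos huA, abs_mul]
    have hsub : sup1 (t u) ⊆ sup1 u := by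
      intro p h
      simp only [sup1, mem_filter, mem_univ, true_and, ht] at *
      split_ifs at h
      · exact absurd rfl h
      · exact h
    have hle : NN q (sup1 (t u)) ≤ R := (NN_mono q hp hsub).trans (hYR u (left_ne_zero_of_mul h0))
    simp only [hG, if_pos hle]
    refine (mul_le_of_le_one_left (abs_nonneg _) (hY1 u)).trans (le_of_eq ?_)
    rw [Finset.abs_prod, sup1, Finset.prod_filter]
    refine prod_congr rfl fun p _ => ?_
    have hup := (mem_filter.1 huA).2 p
    simp only [ht]
    rcases hd : d p with _ | i
    · rcases hu : u p with _ | l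
      · simp [MM]
      · have := hq1 p
        simp only [MM]
        rw [abs_of_pos (by positivity)]; simp
    · rw [hup (by rw [hd]; simp), hd]; simp [MM]
  have hinj2 : Set.InjOn t A := by
    intro u hu v hv huv
    funext p
    have h := congrFun huv p
    simp only [ht] at h
    by_cases hd : d p ≠ none
    · rw [(mem_filter.1 hu).2 p hd, (mem_filter.1 hv).2 p hd]
    · rwa [if_neg hd, if_neg hd] at h
  calc |lam (fun p => MM (q p:ℝ)) Y d| ≤ ∑ u, |Y u*∏ p, MM (q p:ℝ) (d p) (u p)| := Finset.abs_sum_le_sum_abs _ _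
    _ ≤ ∑ u, if u ∈ A then G (sup1 (t u)) else 0 := sum_le_sum fun u _ => h1 u
    _ = ∑ u ∈ A, G (sup1 (t u)) := by rw [← sum_filter]; congr 1; ext; simp
    _ = ∑ v ∈ A.image t, G (sup1 v) := (Finset.sum_image (f := fun v => G (sup1 v)) hinj2).symm
    _ ≤ ∑ v : ι → Option (Fin k), G (sup1 v) :=
        sum_le_sum_of_subset_of_nonneg (subset_univ _) fun v _ _ => hG0 _
    _ = ∑ S : Finset ι, (k:ℝ)^S.card*G S := sum_sup1 G
    _ = ∑ S ∈ univ.filter (fun S => NN q S ≤ R), (k:ℝ)^S.card*∏ p ∈ S, 1/((q p:ℝ)-1) := by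
        rw [sum_filter]
        refine sum_congr rfl fun S _ => ?_
        simp only [hG]; split_ifs <;> simp
    _ ≤ _ := sum_NN_totient q hinj hp k R

lemma suppP_eq (d e : ι → Option (Fin k)) : suppP d e = sup1 d ∪ sup1 e := by
  ext p
  simp only [suppP, sup1, mem_filter, mem_union, mem_univ, true_and]
  tauto

lemma vv_le (q : ι → ℕ) (z : Fin k → ℤ) (n:ℕ) (d : ι → Option (Fin k)) : |∏ p, vv q z n p (d p)| ≤ 1 := by
  rw [Finset.abs_prod]
  refine Finset.prod_le_one (fun _ _ => abs_nonneg _) fun p _ => ?_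
  rcases d p with _ | i
  · simp [vv]
  · simp only [vv]; split_ifs <;> simp

/-- trivial bound for a sieve weight -/
lemma weight_le (q : ι → ℕ) (R:ℕ) (hinj : Function.Injective q) (hp : ∀ i, (q i).Prime) (lm : (ι → Option (Fin k)) → ℝ) (B:ℝ)
    (hlm : ∀ d, |lm d| ≤ B) (hs : ∀ d, lm d ≠ 0 → NN q (sup1 d) ≤ R) (z : Fin k → ℤ) (n:ℕ) :
    (∑ d, lm d*∏ p, vv q z n p (d p))^2 ≤ (B*(R*LB k R))^2 := by
  have hB0 : 0 ≤ B := (abs_nonneg _).trans (hlm fun _ => none)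
  rw [← sq_abs]
  refine pow_le_pow_left₀ (abs_nonneg _) ?_ 2
  refine (Finset.abs_sum_le_sum_abs _ _).trans ?_
  calc _ ≤ ∑ d : ι → Option (Fin k), B*(if NN q (sup1 d) ≤ R then 1 else 0) := by
        refine sum_le_sum fun d _ => ?_
        rw [abs_mul]
        by_cases h : lm d = 0
        · rw [h]; simp only [abs_zero, zero_mul]
          split_ifs <;> simp [hB0]
        · rw [if_pos (hs d h)]
          exact mul_le_mul (hlm d) (vv_le q z n d) (abs_nonneg _) hB0
    _ = B*∑ S : Finset ι, (k:ℝ)^S.card*(if NN q S ≤ R then 1 else 0) := by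
        rw [← mul_sum, sum_sup1 (fun S => if NN q S ≤ R then (1:ℝ) else 0)]
    _ = B*∑ S ∈ univ.filter (fun S => NN q S ≤ R), (k:ℝ)^S.card := by
        rw [sum_filter]; simp
    _ ≤ _ := mul_le_mul_of_nonneg_left (sum_NN_count q hinj hp k R) hB0

end B4a
end

section
open Finset

section B4b
variable {k : ℕ} {ι : Type*} [Fintype ι] [DecidableEq ι]

lemma crt_prog (q : ι → ℕ) (hinj : Function.Injective q) (hp : ∀ i, (q i).Prime) (W b:ℕ)
    (hW : ∀ p, (q p).Coprime W) (z : Fin k → ℤ) (c : ι → Fin k) (S : Finset ι) :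
    ∃ a : ℕ, ∀ n : ℕ, (n ≡ b [MOD W] ∧ ∀ p ∈ S, (q p : ℤ) ∣ (n:ℤ)+z (c p)) ↔ n ≡ a [MOD W*NN q S] := by
  induction S using Finset.induction_on with
  | empty => exact ⟨b, fun n => by simp [NN]⟩
  | insert i S hi ih =>
    obtain ⟨a, ha⟩ := ih
    have hcop : (W*NN q S).Coprime (q i) := by
      refine Nat.Coprime.mul_left (hW i).symm ?_
      refine Nat.Coprime.prod_left fun j hj => ?_
      exact (Nat.coprime_primes (hp j) (hp i)).2 fun h => hi (hinj h ▸ hj)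
    set r : ℕ := ((-z (c i)) % (q i : ℤ)).toNat with hr
    have hq0 : (q i : ℤ) ≠ 0 := by exact_mod_cast (hp i).ne_zero
    have hrr : (r : ℤ) = (-z (c i)) % (q i : ℤ) := Int.toNat_of_nonneg (Int.emod_nonneg _ hq0)
    have hdr : ∀ n : ℕ, (q i : ℤ) ∣ (n:ℤ)+z (c i) ↔ n ≡ r [MOD q i] := by
      intro n
      rw [← Int.natCast_modEq_iff, hrr]
      have h1 : (-z (c i)) % (q i : ℤ) ≡ -z (c i) [ZMOD q i] := Int.mod_modEq _ _
      constructor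
      · intro h
        refine Int.ModEq.trans ?_ h1.symm
        rw [Int.modEq_iff_dvd]
        have := (dvd_neg.2 h)
        rwa [show -((n:ℤ)+z (c i)) = -z (c i)-n by ring] at this
      · intro h
        have h2 := Int.modEq_iff_dvd.1 (h.trans h1)
        have := (dvd_neg.2 h2)
        rwa [show -(-z (c i)-(n:ℤ)) = n+z (c i) by ring] at this
    obtain ⟨a', ha1, ha2⟩ := Nat.chineseRemainder hcop a r
    refine ⟨a', fun n => ?_⟩
    have hNN : NN q (insert i S) = NN q S*q i := by
      unfold NN; rw [Finset.prod_insert hi, mul_comm]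
    rw [hNN, ← mul_assoc, ← Nat.modEq_and_modEq_iff_modEq_mul hcop]
    rw [Finset.forall_mem_insert, hdr]
    constructor
    · rintro ⟨h1, h2, h3⟩
      exact ⟨((ha n).1 ⟨h1, h3⟩).trans ha1.symm, h2.trans ha2.symm⟩
    · rintro ⟨h1, h2⟩
      obtain ⟨h3, h4⟩ := (ha n).2 (h1.trans ha1)
      exact ⟨h3, h2.trans ha2, h4⟩

lemma NN_coprime (q : ι → ℕ) (W:ℕ) (hW : ∀ p, (q p).Coprime W) (S : Finset ι) : (NN q S).Coprime W :=
  Nat.Coprime.prod_left fun i _ => hW i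

lemma crt_coprime (q : ι → ℕ) (hp : ∀ i, (q i).Prime) (W b:ℕ) (hb : b.Coprime W)
    (z : Fin k → ℤ) (c : ι → Fin k) (S : Finset ι) (hz : ∀ p ∈ S, ¬ (q p : ℤ) ∣ z (c p)) (a:ℕ)
    (ha : ∀ n : ℕ, (n ≡ b [MOD W] ∧ ∀ p ∈ S, (q p : ℤ) ∣ (n:ℤ)+z (c p)) ↔ n ≡ a [MOD W*NN q S]) :
    a.Coprime (W*NN q S) := by
  obtain ⟨h1, h2⟩ := (ha a).2 rfl
  refine Nat.Coprime.mul_right ?_ ?_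
  · unfold Nat.Coprime at *
    rw [h1.gcd_eq, hb]
  · refine Nat.Coprime.prod_right fun p hpS => ?_
    refine ((hp p).coprime_iff_not_dvd.2 fun hd => hz p hpS ?_).symm
    have := dvd_sub (h2 p hpS) (Int.natCast_dvd_natCast.2 hd)
    simpa using this

theorem S1_bound (k:ℕ) {k' : Fin k} (q : ι → ℕ) (hinj : Function.Injective q) (hp : ∀ i, (q i).Prime) (hk : ∀ i, k ≤ q i) (W b:ℕ)
    (hW0 : 0 < W) (hW : ∀ p, (q p).Coprime W) (z : Fin k → ℤ) (hz : ∀ p i l, i ≠ l → ¬ (q p : ℤ) ∣ z i-z l)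
    (Y : (ι → Option (Fin k)) → ℝ) (hY1 : ∀ u, |Y u| ≤ 1) (R:ℕ) (hYR : ∀ u, Y u ≠ 0 → NN q (sup1 u) ≤ R)
    (m:ℕ) (L:ℝ) (hL : 1 ≤ L) (M:ℕ) :
    ∑ n ∈ (range M).filter (fun n => n ≡ b [MOD W]), FF m L n*(∑ d, lam (fun p => MM (q p:ℝ)) Y d*∏ p, vv q z n p (d p))^2 ≤
      (∑ n ∈ range M, FF m L n)/W*∑ u, Y u^2*∏ p, D1 (q p:ℝ) (u p) +
      LB (2*k) R^2*((R*R:ℕ)*LB (3*k) (R*R)*(CF m*(3+log M))) := by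
  have h2 : ∀ p, (2:ℝ) ≤ q p := fun p => by exact_mod_cast (hp p).two_le
  have hkr : ∀ p, (k:ℝ) ≤ q p := fun p => by exact_mod_cast hk p
  have hE0 : 0 ≤ CF m*(3+log M) := by
    have := CF_pos m
    have : 0 ≤ log M := Real.log_natCast_nonneg _
    positivity
  set T : Finset (Finset ι) := univ.filter fun S => NN q S ≤ R*R with hT
  have h := sieve_expand (k := k) q z hz ((range M).filter (fun n => n ≡ b [MOD W])) (fun n => FF m L n)
    (lam (fun p => MM (q p:ℝ)) Y) (fun _ => True) k' (fun p => 1/(q p:ℝ))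
    (fun p x y => ∑ s, pi1 (q p:ℝ) s*vst s x*vst s y) ((∑ n ∈ range M, FF m L n)/W)
    (fun _ => CF m*(3+log M)) (fun _ => hE0) (LB (2*k) R) T
    (lam_bound q hinj hp Y hY1 R hYR) (fun _ _ _ _ _ => trivial) ?_ (fun p x y _ _ => Ker1_val _ x y) ?_
  · have h3 := S1_form (fun p => (q p:ℝ)) h2 hkr Y
    have hX : 0 ≤ (∑ n ∈ range M, FF m L n)/W :=
      div_nonneg (sum_nonneg fun n _ => FF_nonneg m L n hL) (by positivity)
    have h4 := mul_le_mul_of_nonneg_left h3 hX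
    have h5 := (abs_le.1 h).2
    have h6 : ∑ S ∈ T, (3*k:ℝ)^S.card*(CF m*(3+log M)) ≤
        (R*R:ℕ)*LB (3*k) (R*R)*(CF m*(3+log M)) := by
      rw [← sum_mul]
      refine mul_le_mul_of_nonneg_right ?_ hE0
      have := sum_NN_count q hinj hp (3*k) (R*R)
      push_cast at this ⊢
      exact this
    have h7 := mul_le_mul_of_nonneg_left h6 (sq_nonneg (LB (2*k) R))
    linarith
  · intro d e hd he
    rw [hT, mem_filter, suppP_eq]
    refine ⟨mem_univ _, (NN_union_le q hp _ _).trans (Nat.mul_le_mul ?_ ?_)⟩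
    · exact lam_supp q hp Y R hYR d hd
    · exact lam_supp q hp Y R hYR e he
  · intro S hS c _
    obtain ⟨a, ha⟩ := crt_prog q hinj hp W b hW z c S
    have h8 := progression_FF m L hL (W*NN q S) (Nat.mul_pos hW0 (NN_pos q hp S)).ne' a M
    refine le_of_eq_of_le ?_ h8
    congr 2
    · rw [Finset.filter_filter]
      refine sum_congr ?_ fun _ _ => rfl
      ext n
      simp only [mem_filter, ha n]
    · rw [Finset.prod_div_distrib]
      simp only [Finset.prod_const_one, NN]
      push_cast
      rw [div_mul_div_comm, mul_one]

end B4b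
end

section
open Finset
open scoped ArithmeticFunction.vonMangoldt

section B4c
variable {k : ℕ} {ι : Type*} [Fintype ι] [DecidableEq ι]

lemma lamM2 (q : ι → ℕ) (j : Fin k) (Y : (ι → Option (Fin k)) → ℝ) (d : ι → Option (Fin k)) :
    lam (fun p => M2 j (q p:ℝ)) Y d = if ∃ p, d p = some j then 0 else lam (fun p => MM (q p:ℝ)) Y d := by
  unfold lam
  split_ifs with h
  · obtain ⟨p, hpd⟩ := h
    refine Finset.sum_eq_zero fun u _ => ?_
    rw [Finset.prod_eq_zero (mem_univ p) (by simp [M2, hpd]), mul_zero]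
  · push Not at h
    refine sum_congr rfl fun u _ => ?_
    congr 1
    refine prod_congr rfl fun p _ => ?_
    simp [M2, h p]

lemma exists_max_res (f : ℕ → ℝ) (q:ℕ) (hq : 0 < q) (hf : ∀ a b, a ≡ b [MOD q] → f a = f b) :
    ∃ a : ℕ, a.Coprime q ∧ ∀ b : ℕ, b.Coprime q → f b ≤ f a := by
  have hc : ∀ b : ℕ, b.Coprime q → (b % q).Coprime q := by
    intro b hb
    have := (Nat.mod_modEq b q).gcd_eq
    unfold Nat.Coprime at *; rw [this, hb]
  obtain ⟨a, ha, hmax⟩ := Finset.exists_max_image ((range q).filter fun a => a.Coprime q) f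
    ⟨1 % q, mem_filter.2 ⟨mem_range.2 (Nat.mod_lt _ hq), hc 1 (Nat.coprime_one_left q)⟩⟩
  refine ⟨a, (mem_filter.1 ha).2, fun b hb => ?_⟩
  rw [hf b (b % q) (Nat.mod_modEq b q).symm]
  exact hmax _ (mem_filter.2 ⟨mem_range.2 (Nat.mod_lt _ hq), hc b hb⟩)

theorem S2_bound (q : ι → ℕ) (hinj : Function.Injective q) (hp : ∀ i, (q i).Prime) (hk : ∀ i, k ≤ q i) (W p0 b:ℕ)
    (hW0 : 0 < W) (hW : ∀ p, (q p).Coprime (W*p0)) (hb : b.Coprime W) (z : Fin k → ℤ)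
    (hz : ∀ p i l, i ≠ l → ¬ (q p : ℤ) ∣ z i-z l) (j : Fin k) (hzj : z j = 0)
    (Y : (ι → Option (Fin k)) → ℝ) (hY1 : ∀ u, |Y u| ≤ 1) (R:ℕ) (hYR : ∀ u, Y u ≠ 0 → NN q (sup1 u) ≤ R)
    (m:ℕ) (L:ℝ) (hL : 1 ≤ L) (N:ℕ) (hR : ((R*R:ℕ):ℝ) ≤ exp (L/20)) (Eps:ℝ)
    (hBV : ∀ Q : Finset ℕ, (∀ q ∈ Q, Squarefree q ∧ q.Coprime (W*p0) ∧ (q:ℝ) ≤ exp (L/20)) →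
      ∀ a : ℕ → ℕ, (∀ q ∈ Q, (a q).Coprime (W*q)) →
      ∑ q ∈ Q, ((3*k:ℕ):ℝ)^q.primeFactors.card * |psiAP m L N (W*q) (a q)-PsiN m L N/(W*q).totient| ≤ Eps) :
    PsiN m L N/W.totient*(∑ s : ι → Option (Fin k), (∏ p, w2 j (q p:ℝ) (Sum.inl (s p))) *
        (∑ u, Y u*∏ p, V2 j (q p:ℝ) (Sum.inl (s p)) (u p))^2)-LB (2*k) R^2*Eps ≤
    ∑ n ∈ (Ioc 0 N).filter (fun n => n ≡ b [MOD W]), Λ n*FF m L n *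
      (∑ d, lam (fun p => M2 j (q p:ℝ)) Y d*∏ p, vv q z n p (d p))^2 := by
  classical
  have h2 : ∀ p, (2:ℝ) ≤ q p := fun p => by exact_mod_cast (hp p).two_le
  have hkr : ∀ p, (k:ℝ) ≤ q p := fun p => by exact_mod_cast hk p
  have hWq : ∀ p, (q p).Coprime W := fun p => Nat.Coprime.coprime_mul_right_right (hW p)
  set T : Finset (Finset ι) := univ.filter fun S => NN q S ≤ R*R with hT
  have hex : ∀ Q' : ℕ, ∃ a : ℕ, 0 < Q' → a.Coprime (W*Q') ∧ ∀ c : ℕ, c.Coprime (W*Q') →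
      |psiAP m L N (W*Q') c-PsiN m L N/(W*Q').totient| ≤ |psiAP m L N (W*Q') a-PsiN m L N/(W*Q').totient| := by
    intro Q'
    by_cases hQ : 0 < Q'
    · have hmod : ∀ a c, a ≡ c [MOD W*Q'] → |psiAP m L N (W*Q') a-PsiN m L N/(W*Q').totient| =
          |psiAP m L N (W*Q') c-PsiN m L N/(W*Q').totient| := by
        intro a c hac
        have : psiAP m L N (W*Q') a = psiAP m L N (W*Q') c := by
          unfold psiAP
          refine sum_congr ?_ fun _ _ => rfl
          ext n
          simp only [mem_filter]
          exact and_congr_right fun _ => ⟨fun h => h.trans hac, fun h => h.trans hac.symm⟩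
        rw [this]
      obtain ⟨a, ha⟩ := exists_max_res (fun c => |psiAP m L N (W*Q') c-PsiN m L N/(W*Q').totient|) (W*Q')
        (Nat.mul_pos hW0 hQ) hmod
      exact ⟨a, fun _ => ha⟩
    · exact ⟨0, fun h => absurd h hQ⟩
  choose a ha using hex
  set E : Finset ι → ℝ := fun S => |psiAP m L N (W*NN q S) (a (NN q S))-PsiN m L N/(W*NN q S).totient| with hE
  have hlm : ∀ d, lam (fun p => M2 j (q p:ℝ)) Y d ≠ 0 →
      (¬ ∃ p, d p = some j) ∧ lam (fun p => MM (q p:ℝ)) Y d ≠ 0 := by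
    intro d hd
    rw [lamM2] at hd
    split_ifs at hd with h
    · exact absurd rfl hd
    · exact ⟨h, hd⟩
  have hLB : ∀ d, |lam (fun p => M2 j (q p:ℝ)) Y d| ≤ LB (2*k) R := by
    intro d
    rw [lamM2]
    split_ifs
    · rw [abs_zero]; exact LB_nonneg _ _
    · exact lam_bound q hinj hp Y hY1 R hYR d
  have h := sieve_expand (k := k) q z hz ((Ioc 0 N).filter (fun n => n ≡ b [MOD W])) (fun n => Λ n*FF m L n)
    (lam (fun p => M2 j (q p:ℝ)) Y) (fun i => i ≠ j) j (fun p => 1/((q p:ℝ)-1))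
    (fun p x y => ∑ s, pi2 j (q p:ℝ) s*vst s x*vst s y) (PsiN m L N/W.totient)
    E (fun _ => abs_nonneg _) (LB (2*k) R) T hLB ?_ ?_
    (fun p x y hx hy => Ker2_val j _ (by have := h2 p; linarith) x y hx hy) ?_
  · have h3 := S2_form j (fun p => (q p:ℝ)) h2 hkr Y
    have hX : 0 ≤ PsiN m L N/W.totient := by
      refine div_nonneg ?_ (by positivity)
      unfold PsiN
      exact sum_nonneg fun n _ => mul_nonneg ArithmeticFunction.vonMangoldt_nonneg (FF_nonneg m L n hL)
    have h4 := mul_le_mul_of_nonneg_left h3 hX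
    have h5 := (abs_le.1 h).1
    have h6 : ∑ S ∈ T, (3*k:ℝ)^S.card*E S ≤ Eps := by
      have h7 := hBV (T.image (NN q)) ?_ a ?_
      · rw [Finset.sum_image ((NN_inj q hinj hp).injOn)] at h7
        refine le_of_eq_of_le (sum_congr rfl fun S _ => ?_) h7
        rw [NN_card q hinj hp]; push_cast; rfl
      · intro r hr
        obtain ⟨S, hS, rfl⟩ := mem_image.1 hr
        refine ⟨NN_sqfree q hinj hp S, NN_coprime q _ hW S, le_trans ?_ hR⟩
        exact_mod_cast (mem_filter.1 hS).2
      · intro r hr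
        obtain ⟨S, hS, rfl⟩ := mem_image.1 hr
        exact (ha _ (NN_pos q hp S)).1
    have h7 := mul_le_mul_of_nonneg_left h6 (sq_nonneg (LB (2*k) R))
    linarith
  · rintro d hd p i hi rfl
    exact (hlm d hd).1 ⟨p, hi⟩
  · intro d e hd he
    rw [hT, mem_filter, suppP_eq]
    refine ⟨mem_univ _, (NN_union_le q hp _ _).trans (Nat.mul_le_mul ?_ ?_)⟩
    · exact lam_supp q hp Y R hYR d (hlm d hd).2
    · exact lam_supp q hp Y R hYR e (hlm e he).2
  · intro S hS c hc
    obtain ⟨a', ha'⟩ := crt_prog q hinj hp W b hWq z c S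
    have hco : a'.Coprime (W*NN q S) := by
      refine crt_coprime q hp W b hb z c S (fun p hpS => ?_) a' ha'
      have := hz p (c p) j (hc p hpS)
      rwa [hzj, sub_zero] at this
    refine le_of_eq_of_le ?_ ((ha _ (NN_pos q hp S)).2 a' hco)
    congr 2
    · unfold psiAP
      rw [Finset.filter_filter]
      refine sum_congr ?_ fun _ _ => rfl
      ext n
      simp only [mem_filter, ha' n]
    · rw [Nat.totient_mul (NN_coprime q W hWq S).symm, Nat.cast_mul, NN_totient q hinj hp, Finset.prod_div_distrib]
      simp only [Finset.prod_const_one]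
      rw [div_mul_div_comm, mul_one]

end B4c
end

section
open Finset

section B5a

lemma cop_block (W:ℕ) (hW : 0 < W) (J:ℕ) :
    ∑ n ∈ (Ico W ((J+1)*W)).filter (fun n => W.Coprime n), (1/(n:ℝ)) ≤
      (W.totient:ℝ)/W*∑ j ∈ Ioc 0 J, (1/(j:ℝ)) ∧
    (W.totient:ℝ)/W*∑ j ∈ Ioc 0 J, (1/((j:ℝ)+1)) ≤
      ∑ n ∈ (Ico W ((J+1)*W)).filter (fun n => W.Coprime n), (1/(n:ℝ)) := by
  have hWr : (0:ℝ) < W := by exact_mod_cast hW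
  induction J with
  | zero => simp
  | succ J ih =>
    have hsplit : (Ico W ((J+1+1)*W)).filter (fun n => W.Coprime n) =
        (Ico W ((J+1)*W)).filter (fun n => W.Coprime n) ∪
        (Ico ((J+1)*W) ((J+1)*W+W)).filter (fun n => W.Coprime n) := by
      rw [← Finset.filter_union, Ico_union_Ico_eq_Ico (by nlinarith) (by omega)]
      congr 2; ring
    have hdis : Disjoint ((Ico W ((J+1)*W)).filter (fun n => W.Coprime n))
        ((Ico ((J+1)*W) ((J+1)*W+W)).filter (fun n => W.Coprime n)) := by
      refine Finset.disjoint_filter_filter ?_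
      rw [Finset.disjoint_left]
      intro n h1 h2
      rw [mem_Ico] at h1 h2; omega
    have hcard : ((Ico ((J+1)*W) ((J+1)*W+W)).filter (fun n => W.Coprime n)).card = W.totient :=
      Nat.filter_coprime_Ico_eq_totient W _
    rw [hsplit, Finset.sum_union hdis, Finset.sum_Ioc_succ_top (by omega), Finset.sum_Ioc_succ_top (by omega),
      mul_add, mul_add]
    have hJ : (0:ℝ) < (J:ℝ)+1 := by positivity
    constructor
    · refine add_le_add ih.1 ?_
      refine (Finset.sum_le_card_nsmul _ _ (1/(((J:ℝ)+1)*W)) ?_).trans ?_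
      · intro n hn
        rw [mem_filter, mem_Ico] at hn
        refine one_div_le_one_div_of_le (by positivity) ?_
        exact_mod_cast hn.1.1
      · rw [hcard, nsmul_eq_mul]
        push_cast
        rw [div_mul_div_comm, mul_one_div]
        rw [mul_comm (W:ℝ), mul_one]
    · refine add_le_add ih.2 ?_
      refine le_trans ?_ (Finset.card_nsmul_le_sum _ _ (1/(((J:ℝ)+2)*W)) ?_)
      · rw [hcard, nsmul_eq_mul]
        push_cast
        rw [div_mul_div_comm, mul_one_div]
        rw [mul_comm (W:ℝ), mul_one, show (J:ℝ)+1+1 = J+2 by ring]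
      · intro n hn
        rw [mem_filter, mem_Ico] at hn
        have hn0 : 0 < n := by nlinarith [hn.1.1]
        refine one_div_le_one_div_of_le (by exact_mod_cast hn0) ?_
        have : n ≤ (J+2)*W := by nlinarith [hn.1.2]
        exact_mod_cast this

lemma cop_harm_upper (W:ℕ) (hW : 0 < W) (M:ℕ) :
    ∑ n ∈ (Ioc 0 M).filter (fun n => W.Coprime n), (1/(n:ℝ)) ≤
      W+(W.totient:ℝ)/W*(1+log ((M+1:ℕ):ℝ)) := by
  have hsub : (Ioc 0 M).filter (fun n => W.Coprime n) ⊆ Ioc 0 W ∪ (Ico W ((M+1)*W)).filter (fun n => W.Coprime n) := by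
    intro n hn
    rw [mem_filter, mem_Ioc] at hn
    rw [mem_union, mem_Ioc, mem_filter, mem_Ico]
    by_cases h : n ≤ W
    · exact Or.inl ⟨hn.1.1, h⟩
    · exact Or.inr ⟨⟨by omega, by nlinarith [hn.1.2]⟩, hn.2⟩
  refine (sum_le_sum_of_subset_of_nonneg hsub fun n _ _ => by positivity).trans ?_
  have h0 := Finset.sum_union_inter (s₁ := Ioc 0 W) (s₂ := (Ico W ((M+1)*W)).filter (fun n => W.Coprime n))
    (f := fun n : ℕ => 1/(n:ℝ))
  have h1 : 0 ≤ ∑ n ∈ Ioc 0 W ∩ (Ico W ((M+1)*W)).filter (fun n => W.Coprime n), (1/(n:ℝ)) :=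
    sum_nonneg fun _ _ => by positivity
  have h2 : ∑ n ∈ Ioc 0 W, (1/(n:ℝ)) ≤ W := by
    refine (Finset.sum_le_card_nsmul _ _ 1 ?_).trans (by simp)
    intro n hn
    rw [mem_Ioc] at hn
    rw [div_le_one (by exact_mod_cast hn.1)]
    exact_mod_cast hn.1
  have h3 := (cop_block W hW M).1
  have h4 := mul_le_mul_of_nonneg_left (sum_Ioc_one_div_le M) (by positivity : 0 ≤ (W.totient:ℝ)/W)
  linarith

lemma sum_inv_succ_ge (J:ℕ) : log ((J+2:ℕ):ℝ)-1 ≤ ∑ j ∈ Ioc 0 J, (1/((j:ℝ)+1)) := by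
  induction J with
  | zero =>
    have := Real.log_le_sub_one_of_pos (x := 2) (by norm_num)
    simp; linarith
  | succ J ih =>
    rw [Finset.sum_Ioc_succ_top (by omega)]
    have h1 : log ((J+1+2:ℕ):ℝ)-log ((J+2:ℕ):ℝ) ≤ 1/(((J+1:ℕ):ℝ)+1) := by
      rw [← Real.log_div (by positivity) (by positivity)]
      refine (Real.log_le_sub_one_of_pos (by positivity)).trans (le_of_eq ?_)
      push_cast
      field_simp
      ring
    linarith

lemma cop_harm_lower (W:ℕ) (hW : 2 ≤ W) (M:ℕ) (hM : 1 ≤ M) :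
    (W.totient:ℝ)/W*(log M-log W) ≤
    ∑ n ∈ (Ioc 0 M).filter (fun n => W.Coprime n), (1/(n:ℝ)) := by
  have hWr : (0:ℝ) < W := by exact_mod_cast (by omega : 0 < W)
  have hB1 : (W.totient:ℝ)/W ≤ 1 := by
    rw [div_le_one hWr]; exact_mod_cast Nat.totient_le W
  have hB0 : 0 ≤ (W.totient:ℝ)/W := by positivity
  by_cases hMW : M+1 < W
  · refine le_trans ?_ (sum_nonneg fun _ _ => by positivity)
    refine mul_nonpos_of_nonneg_of_nonpos hB0 ?_
    have : log M ≤ log W := Real.log_le_log (by exact_mod_cast hM) (by exact_mod_cast (by omega : M ≤ W))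
    linarith
  push Not at hMW
  obtain ⟨J, hJ⟩ : ∃ J, (M+1)/W = J+1 := by
    have : 0 < (M+1)/W := Nat.div_pos hMW (by omega)
    exact ⟨(M+1)/W-1, by omega⟩
  have h1 : (J+1)*W ≤ M+1 := by rw [← hJ]; exact Nat.div_mul_le_self _ _
  have h2 : M+1 < (J+2)*W := by
    have h := Nat.div_lt_iff_lt_mul (x := M+1) (y := J+2) (by omega : 0 < W)
    exact h.1 (by omega)
  have hsub : insert 1 ((Ico W ((J+1)*W)).filter (fun n => W.Coprime n)) ⊆ (Ioc 0 M).filter (fun n => W.Coprime n) := by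
    intro n hn
    rw [mem_insert, mem_filter, mem_Ico] at hn
    rw [mem_filter, mem_Ioc]
    rcases hn with rfl | ⟨hn, hc⟩
    · exact ⟨⟨by omega, hM⟩, by simp⟩
    · exact ⟨⟨by omega, by omega⟩, hc⟩
  refine le_trans ?_ (sum_le_sum_of_subset_of_nonneg hsub fun n _ _ => by positivity)
  rw [Finset.sum_insert (by simp; omega)]
  have h3 := (cop_block W (by omega) J).2
  have h4 := mul_le_mul_of_nonneg_left (sum_inv_succ_ge J) hB0
  have h5 : log M-log W ≤ log ((J+2:ℕ):ℝ) := by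
    rw [← Real.log_div (by positivity) (by positivity)]
    refine Real.log_le_log (by positivity) ?_
    rw [div_le_iff₀ hWr]
    exact_mod_cast (by omega : M ≤ (J+2)*W)
  have h6 := mul_le_mul_of_nonneg_left h5 hB0
  rw [mul_sub, mul_one] at h4
  norm_num at h3 h4 h6 ⊢
  linarith

lemma sqfree_lower (W:ℕ) (hW : 2 ≤ W) (p0:ℕ) (hp0 : p0.Prime) (hp0W : ¬ p0 ∣ W) (M:ℕ) (hM : 1 ≤ M) :
    (W.totient:ℝ)/W*(log M-log W) ≤
    4*∑ n ∈ (Ioc 0 M).filter (fun n => Squarefree n ∧ n.Coprime (W*p0)), (1/(n:ℝ)) := by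
  classical
  refine (cop_harm_lower W hW M hM).trans ?_
  set A := (Ioc 0 M).filter (fun n => Squarefree n ∧ W.Coprime n) with hA
  set A' := (Ioc 0 M).filter (fun n => Squarefree n ∧ n.Coprime (W*p0)) with hA'
  have hstep1 : ∑ n ∈ (Ioc 0 M).filter (fun n => W.Coprime n), (1/(n:ℝ)) ≤ 2*∑ n ∈ A, (1/(n:ℝ)) := by
    choose a b hab hsq using Nat.sq_mul_squarefree
    have hb0 : ∀ n, 0 < n → 0 < a n ∧ 0 < b n := by
      intro n hn
      have := hab n
      constructor
      · rcases Nat.eq_zero_or_pos (a n) with h | h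
        · rw [h] at this; simp at this; omega
        · exact h
      · rcases Nat.eq_zero_or_pos (b n) with h | h
        · rw [h] at this; simp at this; omega
        · exact h
    calc ∑ n ∈ (Ioc 0 M).filter (fun n => W.Coprime n), (1/(n:ℝ))
        = ∑ n ∈ (Ioc 0 M).filter (fun n => W.Coprime n), (fun x : ℕ × ℕ => (1/(x.1:ℝ))*(1/((x.2:ℝ)^2))) (a n, b n) := by
          refine sum_congr rfl fun n hn => ?_
          simp only
          rw [one_div_mul_one_div]
          congr 1
          have h := hab n
          have h' : ((b n:ℝ))^2*(a n:ℝ) = n := by exact_mod_cast h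
          rw [← h', mul_comm]
      _ = ∑ x ∈ ((Ioc 0 M).filter (fun n => W.Coprime n)).image (fun n => (a n, b n)), (1/(x.1:ℝ))*(1/((x.2:ℝ)^2)) := by
          rw [Finset.sum_image]
          intro n _ n' _ h
          simp only [Prod.mk.injEq] at h
          rw [← hab n, ← hab n', h.1, h.2]
      _ ≤ ∑ x ∈ A ×ˢ Ioc 0 M, (1/(x.1:ℝ))*(1/((x.2:ℝ)^2)) := by
          refine sum_le_sum_of_subset_of_nonneg ?_ fun x _ _ => by positivity
          intro x hx
          obtain ⟨n, hn, rfl⟩ := mem_image.1 hx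
          rw [mem_filter, mem_Ioc] at hn
          obtain ⟨⟨h1, h2⟩, h3⟩ := hn
          obtain ⟨ha0, hb0'⟩ := hb0 n h1
          have h := hab n
          rw [mem_product, hA, mem_filter, mem_Ioc, mem_Ioc]
          have hb2 : 1 ≤ b n^2 := Nat.one_le_pow _ _ hb0'
          refine ⟨⟨⟨ha0, ?_⟩, hsq n, ?_⟩, hb0', ?_⟩
          · simp only; nlinarith
          · refine Nat.Coprime.coprime_dvd_right ?_ h3
            exact ⟨b n^2, by rw [mul_comm]; exact h.symm⟩
          · simp only; nlinarith
      _ = (∑ n ∈ A, (1/(n:ℝ)))*∑ b ∈ Ioc 0 M, (1/((b:ℝ)^2)) := by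
          rw [sum_product, Finset.sum_mul_sum]
      _ ≤ _ := by
          rw [mul_comm 2]
          have hI : Ioc 0 M = Ico 1 (M+1) := by ext x; simp only [mem_Ioc, mem_Ico]; omega
          have hsq2 : ∑ b ∈ Ioc 0 M, (1/((b:ℝ)^2)) ≤ 2 := by rw [hI]; exact sum_inv_sq_le (M+1)
          exact mul_le_mul_of_nonneg_left hsq2 (sum_nonneg fun _ _ => by positivity)
  have hstep2 : ∑ n ∈ A, (1/(n:ℝ)) ≤ 2*∑ n ∈ A', (1/(n:ℝ)) := by
    rw [← Finset.sum_filter_add_sum_filter_not A (fun n => p0 ∣ n), two_mul]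
    refine add_le_add ?_ ?_
    · have : ∑ n ∈ A.filter (fun n => p0 ∣ n), (1/(n:ℝ)) ≤ ∑ n ∈ A.filter (fun n => p0 ∣ n), (fun x : ℕ => 1/(x:ℝ)) (n/p0) := by
        refine sum_le_sum fun n hn => ?_
        obtain ⟨hn1, c, rfl⟩ := mem_filter.1 hn
        rw [Nat.mul_div_cancel_left _ hp0.pos]
        have hc : 0 < c := by
          rcases Nat.eq_zero_or_pos c with h | h
          · rw [h] at hn1; simp [hA] at hn1
          · exact h
        refine one_div_le_one_div_of_le (by exact_mod_cast hc) ?_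
        exact_mod_cast Nat.le_mul_of_pos_left c hp0.pos
      refine this.trans ?_
      rw [← Finset.sum_image (f := fun x : ℕ => 1/(x:ℝ))]
      · refine sum_le_sum_of_subset_of_nonneg ?_ fun x _ _ => by positivity
        intro x hx
        obtain ⟨n, hn, rfl⟩ := mem_image.1 hx
        obtain ⟨hn1, c, rfl⟩ := mem_filter.1 hn
        rw [Nat.mul_div_cancel_left _ hp0.pos]
        rw [hA, mem_filter, mem_Ioc] at hn1
        obtain ⟨⟨h1, h2⟩, h3, h4⟩ := hn1
        rw [Nat.squarefree_mul_iff] at h3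
        rw [hA', mem_filter, mem_Ioc]
        refine ⟨⟨Nat.pos_of_mul_pos_left h1, le_trans (Nat.le_mul_of_pos_left c hp0.pos) h2⟩, h3.2.2, ?_⟩
        exact Nat.Coprime.mul_right (Nat.Coprime.coprime_mul_left_right h4).symm h3.1.symm
      · intro n hn n' hn' h
        obtain ⟨-, c, rfl⟩ := mem_filter.1 hn
        obtain ⟨-, c', rfl⟩ := mem_filter.1 hn'
        simp only [Nat.mul_div_cancel_left _ hp0.pos] at h
        rw [h]
    · refine sum_le_sum_of_subset_of_nonneg ?_ fun x _ _ => by positivity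
      intro n hn
      obtain ⟨hn1, hn2⟩ := mem_filter.1 hn
      rw [hA, mem_filter] at hn1
      rw [hA', mem_filter]
      exact ⟨hn1.1, hn1.2.1, Nat.Coprime.mul_right hn1.2.2.symm ((hp0.coprime_iff_not_dvd.2 hn2).symm)⟩
  linarith

end B5a
end

section
open Finset

section B5b
variable {ι : Type*} [Fintype ι] [DecidableEq ι]

noncomputable def ph (q : ι → ℕ) (A : Finset ι) : ℝ := ∏ p ∈ A, 1/((q p:ℝ)-1)
noncomputable def lg (q : ι → ℕ) (A : Finset ι) : ℝ := log (NN q A)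
noncomputable def NU (q : ι → ℕ) (t:ℝ) : ℝ := ∑ A ∈ univ.filter (fun A => lg q A ≤ t), ph q A

lemma qm1_pos (q : ι → ℕ) (hp : ∀ i, (q i).Prime) (p : ι) : 0 < (q p:ℝ)-1 := by
  have : (2:ℝ) ≤ q p := by exact_mod_cast (hp p).two_le
  linarith

lemma ph_pos (q : ι → ℕ) (hp : ∀ i, (q i).Prime) (A : Finset ι) : 0 < ph q A :=
  prod_pos fun p _ => by have := qm1_pos q hp p; positivity

lemma lg_nonneg (q : ι → ℕ) (A : Finset ι) : 0 ≤ lg q A := Real.log_natCast_nonneg _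

lemma lg_mono (q : ι → ℕ) (hp : ∀ i, (q i).Prime) {A B : Finset ι} (h : A ⊆ B) : lg q A ≤ lg q B :=
  Real.log_le_log (by exact_mod_cast NN_pos q hp A) (by exact_mod_cast NN_mono q hp h)

lemma tail_sq (D M:ℕ) (hD : 2 ≤ D) (hM : D ≤ M) :
    ∑ n ∈ Ioc D M, 1/((n:ℝ)-1)^2 ≤ 1/((D:ℝ)-1)-1/((M:ℝ)-1) := by
  induction M, hM using Nat.le_induction with
  | base => simp
  | succ M hM ih =>
    rw [Finset.sum_Ioc_succ_top (by omega)]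
    have hMr : (2:ℝ) ≤ M := by exact_mod_cast hD.trans hM
    have : 1/(((M+1:ℕ):ℝ)-1)^2 ≤ 1/((M:ℝ)-1)-1/(((M+1:ℕ):ℝ)-1) := by
      push_cast
      have h1 : (0:ℝ) < M-1 := by linarith
      have h2 : (0:ℝ) < M := by linarith
      rw [show (M:ℝ)+1-1 = M by ring, div_sub_div _ _ h1.ne' h2.ne', div_le_div_iff₀ (by positivity) (by positivity)]
      nlinarith
    linarith

lemma sum_sq_tail (q : ι → ℕ) (hinj : Function.Injective q) (D:ℕ) (hD : 2 ≤ D) (hDq : ∀ i, D < q i) :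
    ∑ i, (1/((q i:ℝ)-1)^2) ≤ 2/(D:ℝ) := by
  set M := D + ∑ i, q i with hM
  have hDr : (2:ℝ) ≤ D := by exact_mod_cast hD
  have h1 : ∑ i, (1/((q i:ℝ)-1)^2) = ∑ n ∈ univ.image q, 1/((n:ℝ)-1)^2 := by
    rw [Finset.sum_image hinj.injOn]
  rw [h1]
  have h2 : univ.image q ⊆ Ioc D M := by
    intro n hn
    obtain ⟨i, -, rfl⟩ := mem_image.1 hn
    have := Finset.single_le_sum (f := q) (fun _ _ => Nat.zero_le _) (mem_univ i)
    exact mem_Ioc.2 ⟨hDq i, by omega⟩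
  refine (sum_le_sum_of_subset_of_nonneg h2 fun n _ _ => by positivity).trans ?_
  refine (tail_sq D M hD (by omega)).trans ?_
  have h3 : 0 ≤ 1/((M:ℝ)-1) := by
    have : (2:ℝ) ≤ M := by exact_mod_cast (by omega : 2 ≤ M)
    exact div_nonneg zero_le_one (by linarith)
  have h4 : 1/((D:ℝ)-1) ≤ 2/D := by
    rw [div_le_div_iff₀ (by linarith) (by linarith)]; linarith
  linarith

lemma prod_one_add_le (q : ι → ℕ) (hinj : Function.Injective q) (hp : ∀ i, (q i).Prime) (D:ℕ) (hD : 2 ≤ D) (hDq : ∀ i, D < q i)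
    (c:ℝ) (hc : 0 ≤ c) (S : Finset ι) : ∏ p ∈ S, (1+c/((q p:ℝ)*(q p-1))) ≤ exp (c*(2/D)) := by
  calc ∏ p ∈ S, (1+c/((q p:ℝ)*(q p-1))) ≤ ∏ p ∈ S, exp (c*(1/((q p:ℝ)-1)^2)) := by
        refine Finset.prod_le_prod (fun p _ => ?_) fun p _ => ?_
        · have := qm1_pos q hp p
          positivity
        · have h := qm1_pos q hp p
          refine le_trans ?_ (Real.add_one_le_exp _)
          rw [add_comm]
          refine add_le_add_left ?_ 1
          rw [mul_one_div]
          refine div_le_div_of_nonneg_left hc (by positivity) ?_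
          rw [sq]
          exact mul_le_mul_of_nonneg_right (by linarith) h.le
    _ = exp (∑ p ∈ S, c*(1/((q p:ℝ)-1)^2)) := (Real.exp_sum _ _).symm
    _ ≤ _ := by
        refine Real.exp_le_exp.2 ?_
        rw [← mul_sum]
        refine mul_le_mul_of_nonneg_left ?_ hc
        refine le_trans ?_ (sum_sq_tail q hinj D hD hDq)
        exact sum_le_sum_of_subset_of_nonneg (subset_univ _) fun _ _ _ => by positivity

lemma lg_le_iff (q : ι → ℕ) (hp : ∀ i, (q i).Prime) (A : Finset ι) (t:ℝ) : lg q A ≤ t ↔ NN q A ≤ ⌊exp t⌋₊ := by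
  have h : (0:ℝ) < NN q A := by exact_mod_cast NN_pos q hp A
  rw [lg, Real.log_le_iff_le_exp h, Nat.le_floor_iff (Real.exp_pos t).le]

lemma NU_upper (q : ι → ℕ) (hinj : Function.Injective q) (hp : ∀ i, (q i).Prime) (D:ℕ) (hD : 2 ≤ D) (hDq : ∀ i, D < q i)
    (W:ℕ) (hW0 : 0 < W) (hW : ∀ p, (q p).Coprime W) (t:ℝ) (ht : 0 ≤ t) :
    NU q t ≤ 3*(W+(W.totient:ℝ)/W*(2+t)) := by
  set M := ⌊exp t⌋₊ with hM
  have hfil : ∀ A : Finset ι, lg q A ≤ t ↔ NN q A ≤ M := fun A => lg_le_iff q hp A t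
  set f : Finset ι → ℝ := fun C => 1/(NN q C:ℝ) with hf
  set g : Finset ι → ℝ := fun C => ∏ p ∈ C, 1/((q p:ℝ)*(q p-1)) with hg
  have hf0 : ∀ C, 0 ≤ f C := fun C => by simp only [hf]; positivity
  have hg0 : ∀ C, 0 ≤ g C := fun C => prod_nonneg fun p _ => by have := qm1_pos q hp p; positivity
  have hph : ∀ A, ph q A = ∑ C ∈ A.powerset, f C*g (A \ C) := by
    intro A
    have h := Finset.prod_add (fun p => 1/(q p:ℝ)) (fun p => 1/((q p:ℝ)*(q p-1))) A
    rw [ph, prod_congr rfl (g := fun p => 1/(q p:ℝ)+1/((q p:ℝ)*(q p-1))), h]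
    · refine sum_congr rfl fun C _ => ?_
      simp only [hf, hg, NN]
      rw [Finset.prod_div_distrib]
      push_cast
      simp
    · intro p _
      have h1 := qm1_pos q hp p
      have h2 : (0:ℝ) < q p := by linarith
      field_simp
      ring
  have h1 : NU q t ≤ ∑ C ∈ univ.filter (fun C => NN q C ≤ M), ∑ E : Finset ι, f C*g E := by
    unfold NU
    simp_rw [hph]
    rw [sum_comm' (t' := univ.filter (fun C => NN q C ≤ M))
      (s' := fun C => univ.filter (fun A => lg q A ≤ t ∧ C ⊆ A))]
    · refine sum_le_sum fun C _ => ?_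
      rw [← Finset.sum_image (f := fun E => f C*g E) (g := fun A => A \ C)]
      · exact sum_le_sum_of_subset_of_nonneg (subset_univ _) fun E _ _ => mul_nonneg (hf0 _) (hg0 _)
      · intro A hA A' hA' h
        have h1 := (mem_filter.1 hA).2.2
        have h2 := (mem_filter.1 hA').2.2
        simp only at h
        rw [← Finset.sdiff_union_of_subset h1, ← Finset.sdiff_union_of_subset h2, h]
    · intro A C
      simp only [mem_filter, mem_univ, true_and, mem_powerset]
      constructor
      · rintro ⟨h1, h2⟩
        exact ⟨⟨h1, h2⟩, (NN_mono q hp h2).trans ((hfil A).1 h1)⟩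
      · rintro ⟨h1, h2⟩; exact h1
  have h2 : ∑ E : Finset ι, g E ≤ 3 := by
    have h := Finset.prod_one_add (f := fun p => 1/((q p:ℝ)*(q p-1))) (univ : Finset ι)
    rw [Finset.powerset_univ] at h
    rw [hg, ← h]
    refine (prod_one_add_le q hinj hp D hD hDq 1 zero_le_one univ).trans ?_
    have hDr : (2:ℝ) ≤ D := by exact_mod_cast hD
    have : 1*(2/(D:ℝ)) ≤ 1 := by rw [one_mul, div_le_one (by linarith)]; exact hDr
    refine (Real.exp_le_exp.2 this).trans ?_
    have := Real.exp_one_lt_d9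
    linarith
  have h3 : ∑ C ∈ univ.filter (fun C => NN q C ≤ M), f C ≤ W+(W.totient:ℝ)/W*(2+t) := by
    have h4 := cop_harm_upper W hW0 M
    have h5 : ∑ C ∈ univ.filter (fun C => NN q C ≤ M), f C ≤ ∑ n ∈ (Ioc 0 M).filter (fun n => W.Coprime n), (1/(n:ℝ)) := by
      rw [← Finset.sum_image (f := fun n : ℕ => 1/(n:ℝ)) (g := NN q) ((NN_inj q hinj hp).injOn)]
      refine sum_le_sum_of_subset_of_nonneg ?_ fun n _ _ => by positivity
      intro n hn
      obtain ⟨S, hS, rfl⟩ := mem_image.1 hn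
      exact mem_filter.2 ⟨mem_Ioc.2 ⟨NN_pos q hp S, (mem_filter.1 hS).2⟩, (NN_coprime q W hW S).symm⟩
    have h6 : log ((M+1:ℕ):ℝ) ≤ 1+t := by
      rw [Real.log_le_iff_le_exp (by positivity), Real.exp_add]
      have h7 : (M:ℝ) ≤ exp t := Nat.floor_le (Real.exp_pos t).le
      have h8 : (1:ℝ) ≤ exp t := Real.one_le_exp ht
      have h9 : (2:ℝ) ≤ exp 1 := by have := Real.add_one_le_exp (1:ℝ); linarith
      push_cast
      nlinarith
    have h7 := mul_le_mul_of_nonneg_left h6 (by positivity : 0 ≤ (W.totient:ℝ)/W)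
    linarith
  have h4 : 0 ≤ ∑ E : Finset ι, g E := sum_nonneg fun _ _ => hg0 _
  calc NU q t ≤ _ := h1
    _ = (∑ C ∈ univ.filter (fun C => NN q C ≤ M), f C)*∑ E : Finset ι, g E := by rw [Finset.sum_mul_sum]
    _ ≤ (W+(W.totient:ℝ)/W*(2+t))*3 := mul_le_mul h3 h2 h4 (by positivity)
    _ = _ := mul_comm _ _

lemma NU_lower (q : ι → ℕ) (hinj : Function.Injective q) (hp : ∀ i, (q i).Prime)
    (W p0:ℕ) (hW2 : 2 ≤ W) (hp0 : p0.Prime) (hp0W : ¬ p0 ∣ W) (R:ℕ)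
    (hsurj : ∀ p : ℕ, p.Prime → p ≤ R → ¬ p ∣ W*p0 → ∃ i, q i = p) (t:ℝ) (ht1 : 1 ≤ t) (ht : 4*log W+4 ≤ t)
    (htR : ⌊exp t⌋₊ ≤ R) :
    (W.totient:ℝ)/W*t/8 ≤ NU q t := by
  set M := ⌊exp t⌋₊ with hM
  have hM1 : 1 ≤ M := Nat.le_floor (by simpa using Real.one_le_exp (by linarith))
  have h1 := sqfree_lower W hW2 p0 hp0 hp0W M hM1
  have h2 : ∑ n ∈ (Ioc 0 M).filter (fun n => Squarefree n ∧ n.Coprime (W*p0)), (1/(n:ℝ)) ≤ NU q t := by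
    have h3 : (Ioc 0 M).filter (fun n => Squarefree n ∧ n.Coprime (W*p0)) ⊆ (univ.filter (fun A => lg q A ≤ t)).image (NN q) := by
      intro n hn
      rw [mem_filter, mem_Ioc] at hn
      obtain ⟨⟨hn0, hnM⟩, hsq, hco⟩ := hn
      set A : Finset ι := univ.filter fun i => q i ∣ n with hA
      have hNA : NN q A = n := by
        rw [← Nat.prod_primeFactors_of_squarefree hsq]
        have : n.primeFactors = A.image q := by
          ext r
          rw [Nat.mem_primeFactors_of_ne_zero hn0.ne', mem_image]
          constructor
          · rintro ⟨hr, hd⟩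
            obtain ⟨i, rfl⟩ := hsurj r hr ((Nat.le_of_dvd hn0 hd).trans (hnM.trans htR)) (fun h => by
              have := Nat.dvd_gcd hd h
              rw [hco] at this
              exact hr.one_lt.ne' (Nat.dvd_one.1 this))
            exact ⟨i, by simp [hA, hd], rfl⟩
          · rintro ⟨i, hi, rfl⟩
            exact ⟨hp i, (mem_filter.1 hi).2⟩
        rw [this, Finset.prod_image hinj.injOn, NN]
      refine mem_image.2 ⟨A, mem_filter.2 ⟨mem_univ _, ?_⟩, hNA⟩
      rw [lg_le_iff q hp, hNA]; exact hnM
    refine (sum_le_sum_of_subset_of_nonneg h3 fun n _ _ => by positivity).trans ?_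
    rw [Finset.sum_image ((NN_inj q hinj hp).injOn)]
    refine sum_le_sum fun A _ => ?_
    rw [ph, NN, Finset.prod_div_distrib]
    push_cast
    simp only [Finset.prod_const_one]
    refine one_div_le_one_div_of_le (prod_pos fun p _ => qm1_pos q hp p) ?_
    exact Finset.prod_le_prod (fun p _ => (qm1_pos q hp p).le) fun p _ => by linarith
  have h3 : t/2 ≤ log M-log W := by
    have h4 : exp t/2 ≤ M := by
      have h5 : exp t < M+1 := Nat.lt_floor_add_one _
      have h6 : (1:ℝ) ≤ M := by exact_mod_cast hM1
      linarith
    have h5 : t-1 ≤ log M := by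
      rw [Real.le_log_iff_exp_le (by exact_mod_cast hM1)]
      refine le_trans ?_ h4
      rw [Real.exp_sub]
      refine div_le_div_of_nonneg_left (Real.exp_pos _).le (by norm_num) ?_
      have := Real.add_one_le_exp (1:ℝ); linarith
    linarith
  have h4 := mul_le_mul_of_nonneg_left h3 (by positivity : 0 ≤ (W.totient:ℝ)/W)
  have : (W.totient:ℝ)/W*t/8 = (W.totient:ℝ)/W*(t/2)/4 := by ring
  rw [this]
  linarith

end B5b
end

section
open Finset

section B5c
variable {ι : Type*} [Fintype ι] [DecidableEq ι]

noncomputable def gg (J:ℕ) (l t:ℝ) : ℝ := ∑ i ∈ range J, (1/2:ℝ)^(i+1)*(if t ≤ 2^i*l then 1 else 0)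

lemma gg_nonneg (J:ℕ) (l t:ℝ) : 0 ≤ gg J l t :=
  sum_nonneg fun i _ => mul_nonneg (by positivity) (by split_ifs <;> simp)

lemma gg_le_one (J:ℕ) (l t:ℝ) : gg J l t ≤ 1 := by
  have h : gg J l t ≤ ∑ i ∈ range J, (1/2:ℝ)^(i+1) :=
    sum_le_sum fun i _ => mul_le_of_le_one_right (by positivity) (by split_ifs <;> simp)
  refine h.trans ?_
  have : ∀ J : ℕ, ∑ i ∈ range J, (1/2:ℝ)^(i+1) = 1-(1/2)^J := by
    intro J
    induction J with
    | zero => simp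
    | succ J ih => rw [Finset.sum_range_succ, ih, pow_succ]; ring
  rw [this]
  have : (0:ℝ) < (1/2)^J := by positivity
  linarith

lemma gg_anti (J:ℕ) (l:ℝ) {t t' : ℝ} (h : t ≤ t') : gg J l t' ≤ gg J l t := by
  refine sum_le_sum fun i _ => mul_le_mul_of_nonneg_left ?_ (by positivity)
  by_cases h1 : t' ≤ 2^i*l
  · rw [if_pos h1, if_pos (h.trans h1)]
  · rw [if_neg h1]; split_ifs <;> simp

lemma gg_zero (J:ℕ) (hJ : 1 ≤ J) (l t:ℝ) (hl : 0 ≤ l) (h : 2^(J-1)*l < t) : gg J l t = 0 := by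
  refine Finset.sum_eq_zero fun i hi => ?_
  rw [mem_range] at hi
  rw [if_neg, mul_zero]
  rw [not_le]
  refine lt_of_le_of_lt (mul_le_mul_of_nonneg_right (pow_le_pow_right₀ (by norm_num) (by omega)) hl) h

lemma gg_half (J:ℕ) (hJ : 1 ≤ J) (l t:ℝ) (h : t ≤ l) : 1/2 ≤ gg J l t := by
  unfold gg
  have := Finset.single_le_sum (f := fun i => (1/2:ℝ)^(i+1)*(if t ≤ 2^i*l then 1 else 0))
    (fun i _ => mul_nonneg (by positivity) (by split_ifs <;> simp)) (mem_range.2 (by omega : 0 < J))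
  refine le_trans ?_ this
  simp [h]

lemma gg_sq (J:ℕ) (l t:ℝ) : gg J l t^2 ≤ ∑ i ∈ range J, (1/4:ℝ)^i*(if t ≤ 2^i*l then 1 else 0) := by
  induction J generalizing l with
  | zero => simp [gg]
  | succ J ih =>
    have hrhs : 0 ≤ ∑ i ∈ range J, (1/4:ℝ)^(i+1)*(if t ≤ 2^(i+1)*l then (1:ℝ) else 0) :=
      sum_nonneg fun i _ => mul_nonneg (by positivity) (by split_ifs <;> simp)
    rw [Finset.sum_range_succ']
    by_cases h : t ≤ 2^0*l
    · rw [if_pos h]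
      have h1 := gg_le_one (J+1) l t
      have h2 := gg_nonneg (J+1) l t
      have : gg (J+1) l t^2 ≤ 1 := pow_le_one₀ h2 h1
      simp only [pow_zero, mul_one]
      linarith
    · have h1 : gg (J+1) l t = 1/2*gg J (2*l) t := by
        unfold gg
        rw [Finset.sum_range_succ', if_neg h, mul_zero, add_zero, mul_sum]
        refine sum_congr rfl fun i _ => ?_
        rw [show (2:ℝ)^(i+1)*l = 2^i*(2*l) by ring]
        ring
      rw [h1, if_neg h, mul_zero, add_zero, mul_pow]
      have h2 := ih (2*l)
      have h3 : ∑ i ∈ range J, (1/4:ℝ)^(i+1)*(if t ≤ 2^(i+1)*l then (1:ℝ) else 0) =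
          1/4*∑ i ∈ range J, (1/4:ℝ)^i*(if t ≤ 2^i*(2*l) then 1 else 0) := by
        rw [mul_sum]
        refine sum_congr rfl fun i _ => ?_
        rw [show (2:ℝ)^(i+1)*l = 2^i*(2*l) by ring]
        ring
      rw [h3]
      linarith

noncomputable def G1 (q : ι → ℕ) (J:ℕ) (l:ℝ) : ℝ := ∑ A, gg J l (lg q A)*ph q A
noncomputable def G2 (q : ι → ℕ) (J:ℕ) (l:ℝ) : ℝ := ∑ A, gg J l (lg q A)^2*ph q A
noncomputable def M1 (q : ι → ℕ) (J:ℕ) (l:ℝ) : ℝ := ∑ A, gg J l (lg q A)^2*ph q A*lg q A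

lemma NU_eq (q : ι → ℕ) (t:ℝ) : NU q t = ∑ A, (if lg q A ≤ t then 1 else 0)*ph q A := by
  rw [NU, sum_filter]
  exact sum_congr rfl fun A _ => by split_ifs <;> simp

lemma G_bounds (q : ι → ℕ) (hp : ∀ i, (q i).Prime) (J:ℕ) (hJ : 1 ≤ J) (l B:ℝ) (hl : 0 < l) (hB : 0 ≤ B)
    (hlow : ∀ i < J, B*(2^i*l)/8 ≤ NU q (2^i*l)) (hup : ∀ i < J, NU q (2^i*l) ≤ 6*B*(2^i*l)) :
    B*l*J/16 ≤ G1 q J l ∧ B*l/32 ≤ G2 q J l ∧ G2 q J l ≤ 12*B*l ∧ M1 q J l ≤ 6*B*l^2*J ∧ 1/4 ≤ G2 q J l := by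
  have hph : ∀ A, 0 ≤ ph q A := fun A => (ph_pos q hp A).le
  refine ⟨?_, ?_, ?_, ?_, ?_⟩
  · have h1 : G1 q J l = ∑ i ∈ range J, (1/2:ℝ)^(i+1)*NU q (2^i*l) := by
      unfold G1 gg
      simp_rw [NU_eq, sum_mul, mul_sum]
      rw [sum_comm]
      exact sum_congr rfl fun i _ => sum_congr rfl fun A _ => by ring
    rw [h1]
    have h2 : B*l*J/16 = ∑ i ∈ range J, B*l/16 := by simp; ring
    rw [h2]
    refine sum_le_sum fun i hi => ?_
    refine le_trans (le_of_eq ?_) (mul_le_mul_of_nonneg_left (hlow i (mem_range.1 hi)) (by positivity))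
    have : (1/2:ℝ)^(i+1)*2^i = 1/2 := by
      rw [pow_succ, mul_right_comm, ← mul_pow]; norm_num
    linear_combination (- B*l/8)*this
  · have h1 := hlow 0 (by omega)
    simp only [pow_zero, one_mul] at h1
    have h2 : 1/4*NU q l ≤ G2 q J l := by
      rw [NU_eq, mul_sum]
      refine sum_le_sum fun A _ => ?_
      rw [← mul_assoc]
      refine mul_le_mul_of_nonneg_right ?_ (hph A)
      split_ifs with h
      · have := gg_half J hJ l _ h
        nlinarith
      · rw [mul_zero]; positivity
    linarith
  · have h1 : G2 q J l ≤ ∑ i ∈ range J, (1/4:ℝ)^i*NU q (2^i*l) := by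
      calc G2 q J l ≤ ∑ A, (∑ i ∈ range J, (1/4:ℝ)^i*(if lg q A ≤ 2^i*l then 1 else 0))*ph q A :=
            sum_le_sum fun A _ => mul_le_mul_of_nonneg_right (gg_sq J l _) (hph A)
        _ = _ := by
            simp_rw [NU_eq, sum_mul, mul_sum]
            rw [sum_comm]
            exact sum_congr rfl fun i _ => sum_congr rfl fun A _ => by ring
    have h2 : ∑ i ∈ range J, (1/4:ℝ)^i*NU q (2^i*l) ≤ ∑ i ∈ range J, 12*B*l*(1/2)^(i+1) := by
      refine sum_le_sum fun i hi => ?_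
      refine (mul_le_mul_of_nonneg_left (hup i (mem_range.1 hi)) (by positivity)).trans (le_of_eq ?_)
      have : (1/4:ℝ)^i*2^i = (1/2)^i := by rw [← mul_pow]; norm_num
      rw [pow_succ]
      linear_combination (6*B*l)*this
    have h3 : ∑ i ∈ range J, (1/2:ℝ)^(i+1) ≤ 1 := by
      have h4 := gg_le_one J 0 0
      simpa [gg] using h4
    rw [← mul_sum] at h2
    have h4 := mul_le_mul_of_nonneg_left h3 (by positivity : 0 ≤ 12*B*l)
    linarith
  · have h1 : M1 q J l ≤ ∑ i ∈ range J, (1/4:ℝ)^i*(2^i*l)*NU q (2^i*l) := by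
      calc M1 q J l ≤ ∑ A, (∑ i ∈ range J, (1/4:ℝ)^i*(2^i*l)*(if lg q A ≤ 2^i*l then 1 else 0))*ph q A := by
            refine sum_le_sum fun A _ => ?_
            rw [mul_right_comm]
            refine mul_le_mul_of_nonneg_right ?_ (hph A)
            refine (mul_le_mul_of_nonneg_right (gg_sq J l _) (lg_nonneg q A)).trans ?_
            rw [sum_mul]
            refine sum_le_sum fun i _ => ?_
            split_ifs with h
            · rw [mul_one, mul_one]
              exact mul_le_mul_of_nonneg_left h (by positivity)
            · simp
        _ = _ := by
            simp_rw [NU_eq, sum_mul, mul_sum]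
            rw [sum_comm]
            exact sum_congr rfl fun i _ => sum_congr rfl fun A _ => by ring
    have h2 : ∑ i ∈ range J, (1/4:ℝ)^i*(2^i*l)*NU q (2^i*l) ≤ ∑ i ∈ range J, 6*B*l^2 := by
      refine sum_le_sum fun i hi => ?_
      refine (mul_le_mul_of_nonneg_left (hup i (mem_range.1 hi)) (by positivity)).trans (le_of_eq ?_)
      have : (1/4:ℝ)^i*2^i*2^i = 1 := by rw [← mul_pow, ← mul_pow]; norm_num
      linear_combination (6*B*l^2)*this
    simp only [sum_const, card_range, nsmul_eq_mul] at h2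
    linarith
  · have h1 := Finset.single_le_sum (f := fun A => gg J l (lg q A)^2*ph q A)
      (fun A _ => mul_nonneg (sq_nonneg _) (hph A)) (mem_univ ∅)
    refine le_trans ?_ h1
    have : lg q ∅ ≤ l := by simp [lg, NN, hl.le]
    have := gg_half J hJ l _ this
    simp only [ph, Finset.prod_empty, mul_one]
    nlinarith

/-- decreasing weights: the mass of sets containing `p` -/
lemma mass_mem (q : ι → ℕ) (hp : ∀ i, (q i).Prime) (f : ℝ → ℝ) (hf0 : ∀ t, 0 ≤ f t) (hf : ∀ t t', t ≤ t' → f t' ≤ f t) (p : ι) :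
    ∑ A ∈ univ.filter (fun A : Finset ι => p ∈ A), f (lg q A)*ph q A ≤ 1/((q p:ℝ)-1)*∑ A, f (lg q A)*ph q A := by
  have hph : ∀ A, 0 ≤ ph q A := fun A => (ph_pos q hp A).le
  have h1 := qm1_pos q hp p
  calc ∑ A ∈ univ.filter (fun A : Finset ι => p ∈ A), f (lg q A)*ph q A
      ≤ ∑ A ∈ univ.filter (fun A : Finset ι => p ∈ A), (fun C : Finset ι => 1/((q p:ℝ)-1)*(f (lg q C)*ph q C)) (A.erase p) := by
        refine sum_le_sum fun A hA => ?_
        have hpA := (mem_filter.1 hA).2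
        have h2 : ph q A = 1/((q p:ℝ)-1)*ph q (A.erase p) := by
          rw [ph, ph, Finset.mul_prod_erase A (fun p => 1/((q p:ℝ)-1)) hpA]
        simp only
        rw [h2, mul_left_comm]
        refine mul_le_mul_of_nonneg_left (mul_le_mul_of_nonneg_right ?_ (hph _)) (by positivity)
        exact hf _ _ (lg_mono q hp (Finset.erase_subset _ _))
    _ = ∑ C ∈ (univ.filter (fun A : Finset ι => p ∈ A)).image (fun A : Finset ι => A.erase p), 1/((q p:ℝ)-1)*(f (lg q C)*ph q C) := by
        rw [Finset.sum_image]
        intro A hA A' hA' h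
        simp only at h
        rw [← Finset.insert_erase (mem_filter.1 hA).2, ← Finset.insert_erase (mem_filter.1 hA').2, h]
    _ ≤ ∑ C, 1/((q p:ℝ)-1)*(f (lg q C)*ph q C) :=
        sum_le_sum_of_subset_of_nonneg (subset_univ _) fun C _ _ =>
          mul_nonneg (by positivity) (mul_nonneg (hf0 _) (hph _))
    _ = _ := by rw [mul_sum]

end B5c
end

section
open Finset

section B6a

lemma prod_mass {α : Type*} [Fintype α] [DecidableEq α] {k : ℕ} (ν : Fin k → α → ℝ) (hν : ∀ i a, 0 ≤ ν i a) (f : α → ℝ) (hf : ∀ a, 0 ≤ f a)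
    (c:ℝ) (hc : ∀ i, ∑ a, ν i a*f a ≤ c*∑ a, ν i a) (I : Finset (Fin k)) :
    ∑ S : Fin k → α, (∏ i, ν i (S i))*∏ i ∈ I, f (S i) ≤ c^I.card*∏ i, ∑ a, ν i a := by
  have h1 : ∀ S : Fin k → α, (∏ i, ν i (S i))*∏ i ∈ I, f (S i) = ∏ i, (ν i (S i)*if i ∈ I then f (S i) else 1) := by
    intro S
    rw [prod_mul_distrib, Finset.prod_ite_mem, Finset.univ_inter]
  simp_rw [h1]
  have h2 := Finset.prod_univ_sum (fun _ : Fin k => (univ : Finset α)) (fun i a => ν i a*if i ∈ I then f a else 1)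
  rw [Fintype.piFinset_univ] at h2
  rw [← h2]
  have h3 : c^I.card = ∏ i, if i ∈ I then c else 1 := by
    rw [Finset.prod_ite_mem, Finset.univ_inter, Finset.prod_const]
  rw [h3, ← prod_mul_distrib]
  refine Finset.prod_le_prod (fun i _ => sum_nonneg fun a _ => mul_nonneg (hν i a) ?_) fun i _ => ?_
  · split_ifs
    · exact hf a
    · exact zero_le_one
  · by_cases h : i ∈ I
    · simp only [if_pos h]; exact hc i
    · simp only [if_neg h]; simp

variable {ι : Type*} [Fintype ι] [DecidableEq ι] {k : ℕ}

def goodT (q : ι → ℕ) (T:ℝ) (S : Fin k → Finset ι) : Prop :=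
  (∀ i l, i ≠ l → Disjoint (S i) (S l)) ∧ ∑ i, ∑ p ∈ S i, (k:ℝ)*(1/((q p:ℝ)-1)) ≤ 1/2 ∧ ∑ i, lg q (S i) ≤ T/2

open Classical in
lemma good_mass (q : ι → ℕ) (hp : ∀ i, (q i).Prime) (T D τ:ℝ) (hT : 0 < T) (hD : 0 < D)
    (hsq : ∑ p, (1/((q p:ℝ)-1)^2) ≤ 2/D) (ν : Fin k → Finset ι → ℝ) (hν : ∀ i a, 0 ≤ ν i a)
    (ha : ∀ i p, ∑ A ∈ univ.filter (fun A : Finset ι => p ∈ A), ν i A ≤ 1/((q p:ℝ)-1)*∑ A, ν i A)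
    (hb : ∀ i, ∑ A, ν i A*lg q A ≤ τ*∑ A, ν i A)
    (hfin : (k:ℝ)^2*6/D+2*k*τ/T ≤ 1/2) :
    1/2*∏ i, ∑ A, ν i A ≤ ∑ S ∈ univ.filter (fun S : Fin k → Finset ι => goodT q T S), ∏ i, ν i (S i) := by
  set P := ∏ i, ∑ A, ν i A with hP
  have hP0 : 0 ≤ P := prod_nonneg fun i _ => sum_nonneg fun a _ => hν i a
  have hP' : ∑ S : Fin k → Finset ι, ∏ i, ν i (S i) = P := by
    rw [hP, Finset.prod_univ_sum, Fintype.piFinset_univ]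
  have hc0 : ∀ p, 0 ≤ 1/((q p:ℝ)-1) := fun p => (div_pos one_pos (qm1_pos q hp p)).le
  have hw0 : ∀ S : Fin k → Finset ι, 0 ≤ ∏ i, ν i (S i) := fun S => prod_nonneg fun i _ => hν i _
  -- mass facts
  have hm : ∀ (p : ι) (I : Finset (Fin k)), ∑ S : Fin k → Finset ι, (∏ i, ν i (S i))*∏ i ∈ I, (if p ∈ S i then (1:ℝ) else 0) ≤
      (1/((q p:ℝ)-1))^I.card*P := by
    intro p I
    refine prod_mass ν hν (fun A => if p ∈ A then (1:ℝ) else 0) (fun A => by split_ifs <;> simp) _ (fun i => ?_) I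
    refine le_trans (le_of_eq ?_) (ha i p)
    rw [sum_filter]
    exact sum_congr rfl fun A _ => by split_ifs <;> simp
  have hl : ∀ i, ∑ S : Fin k → Finset ι, (∏ i, ν i (S i))*lg q (S i) ≤ τ*P := by
    intro i
    have := prod_mass ν hν (lg q) (lg_nonneg q) τ hb {i}
    simpa using this
  have hind : ∀ S : Fin k → Finset ι, ¬ goodT q T S →
      1 ≤ (∑ x ∈ (univ : Finset (Fin k × Fin k)).filter (fun x => x.1 ≠ x.2), ∑ p, ∏ i ∈ ({x.1, x.2} : Finset (Fin k)), (if p ∈ S i then (1:ℝ) else 0)) +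
        2*(∑ i, ∑ p, (k:ℝ)*(1/((q p:ℝ)-1))*(if p ∈ S i then 1 else 0))+2/T*∑ i, lg q (S i) := by
    intro S hS
    have e1 : 0 ≤ (∑ x ∈ (univ : Finset (Fin k × Fin k)).filter (fun x => x.1 ≠ x.2), ∑ p, ∏ i ∈ ({x.1, x.2} : Finset (Fin k)), (if p ∈ S i then (1:ℝ) else 0)) :=
      sum_nonneg fun x _ => sum_nonneg fun p _ => prod_nonneg fun i _ => by split_ifs <;> simp
    have e2' : ∑ i, ∑ p, (k:ℝ)*(1/((q p:ℝ)-1))*(if p ∈ S i then 1 else 0) = ∑ i, ∑ p ∈ S i, (k:ℝ)*(1/((q p:ℝ)-1)) := by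
      refine sum_congr rfl fun i _ => ?_
      simp
    have e2 : 0 ≤ ∑ i, ∑ p ∈ S i, (k:ℝ)*(1/((q p:ℝ)-1)) :=
      sum_nonneg fun i _ => sum_nonneg fun p _ => mul_nonneg (by positivity) (hc0 p)
    have e3 : 0 ≤ ∑ i, lg q (S i) := sum_nonneg fun i _ => lg_nonneg q _
    have e3' : 0 ≤ 2/T*∑ i, lg q (S i) := by positivity
    rw [e2']
    unfold goodT at hS
    by_cases c1 : ∀ i l, i ≠ l → Disjoint (S i) (S l)
    · by_cases c2 : ∑ i, ∑ p ∈ S i, (k:ℝ)*(1/((q p:ℝ)-1)) ≤ 1/2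
      · have c3 : T/2 < ∑ i, lg q (S i) := by
          by_contra hh
          exact hS ⟨c1, c2, not_lt.1 hh⟩
        have : 1 ≤ 2/T*∑ i, lg q (S i) := by
          rw [div_mul_eq_mul_div, le_div_iff₀ hT]; linarith
        linarith
      · rw [not_le] at c2
        linarith
    · push Not at c1
      obtain ⟨i, l, hil, hd⟩ := c1
      obtain ⟨p, hpi, hpl⟩ := Finset.not_disjoint_iff.1 hd
      have h1 : (1:ℝ) ≤ ∑ x ∈ (univ : Finset (Fin k × Fin k)).filter (fun x => x.1 ≠ x.2), ∑ p, ∏ i ∈ ({x.1, x.2} : Finset (Fin k)), (if p ∈ S i then (1:ℝ) else 0) := by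
        refine le_trans ?_ (Finset.single_le_sum (f := fun x : Fin k × Fin k => ∑ p, ∏ i ∈ ({x.1, x.2} : Finset (Fin k)), (if p ∈ S i then (1:ℝ) else 0))
          (fun x _ => sum_nonneg fun p _ => prod_nonneg fun i _ => by split_ifs <;> simp)
          (mem_filter.2 ⟨mem_univ (i, l), hil⟩))
        refine le_trans ?_ (Finset.single_le_sum (f := fun p => ∏ i ∈ ({i, l} : Finset (Fin k)), (if p ∈ S i then (1:ℝ) else 0))
          (fun p _ => prod_nonneg fun i _ => by split_ifs <;> simp) (mem_univ p))
        rw [Finset.prod_pair hil]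
        simp [hpi, hpl]
      linarith
  have hbad : ∑ S ∈ univ.filter (fun S : Fin k → Finset ι => ¬ goodT q T S), ∏ i, ν i (S i) ≤ 1/2*P := by
    calc _ ≤ ∑ S : Fin k → Finset ι, (∏ i, ν i (S i))*((∑ x ∈ (univ : Finset (Fin k × Fin k)).filter (fun x => x.1 ≠ x.2), ∑ p, ∏ i ∈ ({x.1, x.2} : Finset (Fin k)), (if p ∈ S i then (1:ℝ) else 0)) +
        2*(∑ i, ∑ p, (k:ℝ)*(1/((q p:ℝ)-1))*(if p ∈ S i then 1 else 0))+2/T*∑ i, lg q (S i)) := by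
          rw [sum_filter]
          refine sum_le_sum fun S _ => ?_
          by_cases hS : ¬ goodT q T S
          · rw [if_pos hS]
            exact le_mul_of_one_le_right (hw0 S) (hind S hS)
          · rw [if_neg hS]
            refine mul_nonneg (hw0 S) (add_nonneg (add_nonneg ?_ ?_) ?_)
            · exact sum_nonneg fun x _ => sum_nonneg fun p _ => prod_nonneg fun i _ => by split_ifs <;> simp
            · exact mul_nonneg (by norm_num) (sum_nonneg fun i _ => sum_nonneg fun p _ =>
                mul_nonneg (mul_nonneg (by positivity) (hc0 p)) (by split_ifs <;> simp))
            · exact mul_nonneg (by positivity) (sum_nonneg fun i _ => lg_nonneg q _)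
      _ = (∑ x ∈ (univ : Finset (Fin k × Fin k)).filter (fun x => x.1 ≠ x.2), ∑ p, ∑ S : Fin k → Finset ι, (∏ i, ν i (S i))*∏ i ∈ ({x.1, x.2} : Finset (Fin k)), (if p ∈ S i then (1:ℝ) else 0)) +
          2*(∑ i, ∑ p, (k:ℝ)*(1/((q p:ℝ)-1))*∑ S : Fin k → Finset ι, (∏ i, ν i (S i))*(if p ∈ S i then 1 else 0)) +
          2/T*∑ i, ∑ S : Fin k → Finset ι, (∏ i, ν i (S i))*lg q (S i) := by
          simp_rw [mul_add, sum_add_distrib]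
          congr 1
          · congr 1
            · simp_rw [mul_sum]
              rw [sum_comm]
              exact sum_congr rfl fun x _ => sum_comm
            · simp_rw [mul_sum]
              rw [sum_comm]
              refine sum_congr rfl fun x _ => ?_
              rw [sum_comm]
              refine sum_congr rfl fun x _ => sum_congr rfl fun S _ => by ring
          · simp_rw [mul_sum]
            rw [sum_comm]
            refine sum_congr rfl fun x _ => sum_congr rfl fun S _ => by ring
      _ ≤ (∑ x ∈ (univ : Finset (Fin k × Fin k)).filter (fun x => x.1 ≠ x.2), ∑ p, 1/((q p:ℝ)-1)^2*P) +
          2*(∑ i : Fin k, ∑ p, (k:ℝ)*(1/((q p:ℝ)-1))*(1/((q p:ℝ)-1)*P)) +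
          2/T*∑ i : Fin k, τ*P := by
          refine add_le_add (add_le_add ?_ ?_) ?_
          · refine sum_le_sum fun x hx => sum_le_sum fun p _ => ?_
            have := hm p {x.1, x.2}
            rw [Finset.card_pair (mem_filter.1 hx).2, div_pow, one_pow] at this
            exact this
          · refine mul_le_mul_of_nonneg_left ?_ (by norm_num)
            refine sum_le_sum fun i _ => sum_le_sum fun p _ => mul_le_mul_of_nonneg_left ?_ (mul_nonneg (by positivity) (hc0 p))
            have := hm p {i}
            simpa using this
          · exact mul_le_mul_of_nonneg_left (sum_le_sum fun i _ => hl i) (by positivity)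
      _ ≤ (k:ℝ)^2*(2/D*P)+2*((k:ℝ)^2*(2/D*P))+2/T*(k*(τ*P)) := by
          have hs : ∑ p, 1/((q p:ℝ)-1)^2*P ≤ 2/D*P := by
            rw [← sum_mul]; exact mul_le_mul_of_nonneg_right hsq hP0
          have hs0 : 0 ≤ 2/D*P := by positivity
          refine add_le_add (add_le_add ?_ ?_) ?_
          · rw [Finset.sum_const, nsmul_eq_mul]
            refine mul_le_mul ?_ hs (sum_nonneg fun p _ => by positivity) (by positivity)
            have : ((univ : Finset (Fin k × Fin k)).filter (fun x => x.1 ≠ x.2)).card ≤ k^2 := by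
              refine (Finset.card_filter_le _ _).trans ?_
              rw [Finset.card_univ, Fintype.card_prod, Fintype.card_fin, sq]
            exact_mod_cast this
          · refine mul_le_mul_of_nonneg_left ?_ (by norm_num)
            rw [Finset.sum_const, nsmul_eq_mul, Finset.card_univ, Fintype.card_fin, sq, mul_assoc]
            refine mul_le_mul_of_nonneg_left ?_ (by positivity)
            refine le_trans (le_of_eq ?_) (mul_le_mul_of_nonneg_left hs (by positivity))
            rw [mul_sum]
            refine sum_congr rfl fun p _ => ?_
            have := (qm1_pos q hp p).ne'
            field_simp
          · simp
      _ = ((k:ℝ)^2*6/D+2*k*τ/T)*P := by ring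
      _ ≤ _ := mul_le_mul_of_nonneg_right hfin hP0
  have := Finset.sum_filter_add_sum_filter_not univ (fun S : Fin k → Finset ι => goodT q T S) (fun S => ∏ i, ν i (S i))
  linarith

end B6a
end

section
open Finset

section B6b
variable {ι : Type*} [Fintype ι] [DecidableEq ι] {k : ℕ}

lemma prod_one_sub_ge {α : Type*} [DecidableEq α] (S : Finset α) (x : α → ℝ) (h0 : ∀ a ∈ S, 0 ≤ x a) (h1 : ∀ a ∈ S, x a ≤ 1) :
    1 - ∑ a ∈ S, x a ≤ ∏ a ∈ S, (1-x a) := by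
  induction S using Finset.induction_on with
  | empty => simp
  | insert a S ha ih =>
    rw [Finset.sum_insert ha, Finset.prod_insert ha]
    have ih' := ih (fun b hb => h0 b (mem_insert_of_mem hb)) (fun b hb => h1 b (mem_insert_of_mem hb))
    have hs : 0 ≤ ∑ a ∈ S, x a := sum_nonneg fun b hb => h0 b (mem_insert_of_mem hb)
    have e0 := h0 a (mem_insert_self a S)
    have e1 := h1 a (mem_insert_self a S)
    nlinarith

def fib (u : ι → Option (Fin k)) (i : Fin k) : Finset ι := univ.filter fun p => u p = some i

lemma mem_fib (u : ι → Option (Fin k)) (i : Fin k) (p : ι) : p ∈ fib u i ↔ u p = some i := by simp [fib]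

lemma fib_inj : Function.Injective (fib : (ι → Option (Fin k)) → Fin k → Finset ι) := by
  intro u u' h
  funext p
  have h1 : ∀ i, u p = some i ↔ u' p = some i := fun i => by
    rw [← mem_fib, ← mem_fib, h]
  rcases hu : u p with _ | i
  · rcases hu' : u' p with _ | i
    · rfl
    · rw [(h1 i).2 hu'] at hu; exact absurd hu (by simp)
  · exact ((h1 i).1 hu).symm

lemma fib_disj (u : ι → Option (Fin k)) (i l : Fin k) (h : i ≠ l) : Disjoint (fib u i) (fib u l) := by
  rw [Finset.disjoint_left]
  intro p hp hp'
  rw [mem_fib] at hp hp'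
  rw [hp] at hp'
  exact h (Option.some_injective _ hp')

lemma exists_fib (S : Fin k → Finset ι) (h : ∀ i l, i ≠ l → Disjoint (S i) (S l)) : ∃ u, fib u = S := by
  classical
  refine ⟨fun p => if h : ∃ i, p ∈ S i then some h.choose else none, ?_⟩
  funext i
  ext p
  rw [mem_fib]
  constructor
  · intro hh
    split_ifs at hh with h1
    have := h1.choose_spec
    rwa [Option.some_injective _ hh] at this
  · intro hh
    have h1 : ∃ i, p ∈ S i := ⟨i, hh⟩
    rw [dif_pos h1]
    congr 1
    by_contra hne
    exact (Finset.disjoint_left.1 (h _ _ hne)) h1.choose_spec hh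

lemma prod_fib (c : ι → ℝ) (u : ι → Option (Fin k)) :
    ∏ i, ∏ p ∈ fib u i, c p = ∏ p, (if u p = none then 1 else c p) := by
  unfold fib
  simp_rw [Finset.prod_filter]
  rw [Finset.prod_comm]
  refine prod_congr rfl fun p _ => ?_
  rcases hu : u p with _ | i
  · simp
  · simp

lemma sum_fib (c : ι → ℝ) (u : ι → Option (Fin k)) :
    ∑ i, ∑ p ∈ fib u i, c p = ∑ p ∈ sup1 u, c p := by
  unfold fib sup1
  simp_rw [sum_filter]
  rw [sum_comm]
  refine sum_congr rfl fun p _ => ?_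
  rcases hu : u p with _ | i
  · simp
  · simp

lemma lg_sum (q : ι → ℕ) (hp : ∀ i, (q i).Prime) (A : Finset ι) : lg q A = ∑ p ∈ A, log (q p) := by
  unfold lg NN
  push_cast
  rw [Real.log_prod]
  intro p _
  exact_mod_cast (hp p).ne_zero

lemma sum_fib_le (F : (Fin k → Finset ι) → ℝ) (hF : ∀ S, 0 ≤ F S) : ∑ u : ι → Option (Fin k), F (fib u) ≤ ∑ S, F S := by
  classical
  rw [← Finset.sum_image (f := F) (g := fib) (s := univ) (fun u _ u' _ h => fib_inj h)]
  exact sum_le_sum_of_subset_of_nonneg (subset_univ _) fun S _ _ => hF S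

open Classical in
lemma sum_good (q : ι → ℕ) (T:ℝ) (F : (Fin k → Finset ι) → ℝ) :
    ∑ S ∈ univ.filter (fun S : Fin k → Finset ι => goodT q T S), F S =
    ∑ u ∈ univ.filter (fun u : ι → Option (Fin k) => goodT q T (fib u)), F (fib u) := by
  rw [← Finset.sum_image (f := F) (g := fib) (fun u _ u' _ h => fib_inj h)]
  refine sum_congr ?_ fun _ _ => rfl
  ext S
  simp only [mem_filter, mem_univ, true_and, mem_image]
  constructor
  · intro h
    obtain ⟨u, hu⟩ := exists_fib S h.1
    exact ⟨u, by rw [hu]; exact h, hu⟩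
  · rintro ⟨u, hu, rfl⟩
    exact hu

noncomputable def YY (q : ι → ℕ) (J:ℕ) (l:ℝ) (R:ℕ) (u : ι → Option (Fin k)) : ℝ :=
  (∏ i, gg J l (lg q (fib u i)))*(if NN q (sup1 u) ≤ R then 1 else 0)

lemma YY_nonneg (q : ι → ℕ) (J:ℕ) (l:ℝ) (R:ℕ) (u : ι → Option (Fin k)) : 0 ≤ YY q J l R u :=
  mul_nonneg (prod_nonneg fun _ _ => gg_nonneg _ _ _) (by split_ifs <;> simp)

lemma YY_le_prod (q : ι → ℕ) (J:ℕ) (l:ℝ) (R:ℕ) (u : ι → Option (Fin k)) : YY q J l R u ≤ ∏ i, gg J l (lg q (fib u i)) :=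
  mul_le_of_le_one_right (prod_nonneg fun _ _ => gg_nonneg _ _ _) (by split_ifs <;> simp)

lemma YY_abs (q : ι → ℕ) (J:ℕ) (l:ℝ) (R:ℕ) (u : ι → Option (Fin k)) : |YY q J l R u| ≤ 1 := by
  rw [abs_of_nonneg (YY_nonneg q J l R u)]
  refine (YY_le_prod q J l R u).trans ?_
  exact Finset.prod_le_one (fun _ _ => gg_nonneg _ _ _) fun _ _ => gg_le_one _ _ _

lemma YY_supp (q : ι → ℕ) (J:ℕ) (l:ℝ) (R:ℕ) (u : ι → Option (Fin k)) (h : YY q J l R u ≠ 0) : NN q (sup1 u) ≤ R := by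
  by_contra hh
  exact h (by simp [YY, hh])

lemma S1_num (q : ι → ℕ) (hinj : Function.Injective q) (hp : ∀ i, (q i).Prime) (D:ℕ) (hD : 2 ≤ D) (hDq : ∀ i, D < q i)
    (J:ℕ) (l:ℝ) (R:ℕ) :
    ∑ u : ι → Option (Fin k), YY q J l R u^2*∏ p, D1 (q p:ℝ) (u p) ≤ exp (k*(2/D))*G2 q J l^k := by
  have hE := (Real.exp_pos ((k:ℝ)*(2/D))).le
  have h1 : ∀ u : ι → Option (Fin k), YY q J l R u^2*∏ p, D1 (q p:ℝ) (u p) ≤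
      exp (k*(2/D))*∏ i, (gg J l (lg q (fib u i))^2*ph q (fib u i)) := by
    intro u
    have e1 : YY q J l R u^2 ≤ ∏ i, gg J l (lg q (fib u i))^2 := by
      rw [Finset.prod_pow]
      exact pow_le_pow_left₀ (YY_nonneg q J l R u) (YY_le_prod q J l R u) 2
    have e2 : ∏ p, D1 (q p:ℝ) (u p) ≤ exp (k*(2/D))*∏ i, ph q (fib u i) := by
      unfold ph
      rw [prod_fib]
      refine le_trans ?_ (mul_le_mul_of_nonneg_right (prod_one_add_le q hinj hp D hD hDq k (by positivity) univ) ?_)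
      · rw [← prod_mul_distrib]
        refine Finset.prod_le_prod (fun p _ => ?_) fun p _ => ?_
        · have := qm1_pos q hp p
          rcases u p with _ | i
          · simp only [D1]; positivity
          · simp only [D1]; positivity
        · have h1 := qm1_pos q hp p
          have h2 : 0 ≤ (k:ℝ)/((q p:ℝ)*((q p:ℝ)-1)) := by positivity
          rcases u p with _ | i
          · simp [D1]
          · simp only [D1, reduceCtorEq, if_false]
            exact le_mul_of_one_le_left (by positivity) (by linarith)
      · refine prod_nonneg fun p _ => ?_
        have := qm1_pos q hp p
        split_ifs
        · exact zero_le_one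
        · positivity
    have e3 : 0 ≤ ∏ p, D1 (q p:ℝ) (u p) := by
      refine prod_nonneg fun p _ => ?_
      have := qm1_pos q hp p
      rcases u p with _ | i
      · simp only [D1]; positivity
      · simp only [D1]; positivity
    rw [prod_mul_distrib]
    calc _ ≤ (∏ i, gg J l (lg q (fib u i))^2)*(exp (k*(2/D))*∏ i, ph q (fib u i)) :=
          mul_le_mul e1 e2 e3 (prod_nonneg fun _ _ => sq_nonneg _)
      _ = _ := by ring
  refine (sum_le_sum fun u _ => h1 u).trans ?_
  rw [← mul_sum]
  refine mul_le_mul_of_nonneg_left ?_ hE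
  refine (sum_fib_le (fun S => ∏ i, (gg J l (lg q (S i))^2*ph q (S i)))
    (fun S => prod_nonneg fun i _ => mul_nonneg (sq_nonneg _) (ph_pos q hp _).le)).trans ?_
  have h2 := Finset.prod_univ_sum (fun _ : Fin k => (univ : Finset (Finset ι))) (fun _ A => gg J l (lg q A)^2*ph q A)
  rw [Fintype.piFinset_univ] at h2
  rw [← h2, Finset.prod_const, Finset.card_univ, Fintype.card_fin]
  exact le_rfl

end B6b
end

section
open Finset

section B6c
variable {ι : Type*} [Fintype ι] [DecidableEq ι] {k : ℕ}

lemma V2_nonneg (j : Fin k) (r:ℝ) (hr : 0 < r-1) (s x : Option (Fin k)) : 0 ≤ V2 j r (Sum.inl s) x := by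
  rcases s with _ | i <;> rcases x with _ | l <;> simp only [V2]
  · exact zero_le_one
  · split_ifs
    · positivity
    · exact le_rfl
  · exact le_rfl
  · split_ifs <;> simp

/-- inner sum lower bound -/
lemma S2_inner (q : ι → ℕ) (hp : ∀ i, (q i).Prime) (J:ℕ) (hJ : 1 ≤ J) (l:ℝ) (hl0 : 0 ≤ l) (R:ℕ) (T:ℝ)
    (hR : ∀ x : ℕ, (x:ℝ) ≤ exp T → x ≤ R) (hlT : 2^(J-1)*l ≤ T/2) (hk1 : 1 ≤ k)
    (j : Fin k) (s : ι → Option (Fin k)) (hs : goodT q T (fib s)) (hj : fib s j = ∅) :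
    (∏ i ∈ univ.erase j, gg J l (lg q (fib s i)))*(G1 q J l/2) ≤
      ∑ u, YY q J l R u*∏ p, V2 j (q p:ℝ) (Sum.inl (s p)) (u p) := by
  classical
  set E : ℝ := ∏ i ∈ univ.erase j, gg J l (lg q (fib s i)) with hE
  have hE0 : 0 ≤ E := prod_nonneg fun _ _ => gg_nonneg _ _ _
  set uA : Finset ι → ι → Option (Fin k) := fun A p => if p ∈ A then some j else s p with huA
  set F := (univ : Finset (Finset ι)).filter (fun A => Disjoint A (sup1 s)) with hF
  have hns : ∀ A ∈ F, ∀ p ∈ A, s p = none := by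
    intro A hA p hpA
    by_contra hh
    exact Finset.disjoint_left.1 (mem_filter.1 hA).2 hpA (by simp [sup1, hh])
  have hnj : ∀ p, s p ≠ some j := by
    intro p hh
    have : p ∈ fib s j := (mem_fib s j p).2 hh
    rw [hj] at this
    simp at this
  have hfj : ∀ A, fib (uA A) j = A := by
    intro A
    ext p
    rw [mem_fib]
    simp only [huA]
    by_cases h : p ∈ A
    · simp [h]
    · simp [h, hnj p]
  have hfi : ∀ A ∈ F, ∀ i, i ≠ j → fib (uA A) i = fib s i := by
    intro A hA i hi
    ext p
    rw [mem_fib, mem_fib]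
    simp only [huA]
    by_cases h : p ∈ A
    · simp [h, hns A hA p h, hi.symm]
    · simp [h]
  have hterm : ∀ A ∈ F, E*(gg J l (lg q A)*ph q A) ≤ YY q J l R (uA A)*∏ p, V2 j (q p:ℝ) (Sum.inl (s p)) (uA A p) := by
    intro A hA
    have e1 : ∏ p, V2 j (q p:ℝ) (Sum.inl (s p)) (uA A p) = ph q A := by
      unfold ph
      rw [← Finset.prod_subset (subset_univ A)]
      · refine prod_congr rfl fun p hpA => ?_
        simp [huA, hpA, hns A hA p hpA, V2]
      · intro p _ hpA
        simp only [huA, if_neg hpA]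
        rcases s p with _ | i <;> simp [V2]
    rw [e1]
    by_cases hz : gg J l (lg q A) = 0
    · rw [hz, zero_mul, mul_zero]
      exact mul_nonneg (YY_nonneg _ _ _ _ _) (ph_pos q hp A).le
    · have hlA : lg q A ≤ T/2 := by
        by_contra hh
        exact hz (gg_zero J hJ l _ hl0 (lt_of_le_of_lt hlT (not_le.1 hh)))
      have hNN : NN q (sup1 (uA A)) ≤ R := by
        refine hR _ ?_
        have hpos : (0:ℝ) < NN q (sup1 (uA A)) := by exact_mod_cast NN_pos q hp _
        rw [← Real.log_le_iff_le_exp hpos]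
        change lg q (sup1 (uA A)) ≤ T
        rw [lg_sum q hp, ← sum_fib, ← Finset.add_sum_erase _ _ (mem_univ j), hfj, ← lg_sum q hp]
        have h3 : ∑ i ∈ univ.erase j, ∑ p ∈ fib (uA A) i, log (q p) ≤ ∑ i, lg q (fib s i) := by
          rw [← Finset.add_sum_erase _ _ (mem_univ j)]
          refine le_add_of_nonneg_of_le (lg_nonneg q _) (le_of_eq ?_)
          refine sum_congr rfl fun i hi => ?_
          rw [hfi A hA i (ne_of_mem_erase hi), lg_sum q hp]
        have := hs.2.2
        linarith
      have hY : YY q J l R (uA A) = E*gg J l (lg q A) := by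
        rw [YY, if_pos hNN, mul_one, ← Finset.mul_prod_erase _ _ (mem_univ j), hfj, mul_comm, hE]
        congr 1
        refine prod_congr rfl fun i hi => ?_
        rw [hfi A hA i (ne_of_mem_erase hi)]
      rw [hY, mul_assoc]
  have hG : G1 q J l/2 ≤ ∑ A ∈ F, gg J l (lg q A)*ph q A := by
    have h1 := Finset.sum_filter_add_sum_filter_not univ (fun A : Finset ι => Disjoint A (sup1 s)) (fun A => gg J l (lg q A)*ph q A)
    have h0 : ∀ A, 0 ≤ gg J l (lg q A)*ph q A := fun A => mul_nonneg (gg_nonneg _ _ _) (ph_pos q hp A).le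
    have hG0 : 0 ≤ G1 q J l := sum_nonneg fun A _ => h0 A
    have h2 : ∑ A ∈ univ.filter (fun A : Finset ι => ¬ Disjoint A (sup1 s)), gg J l (lg q A)*ph q A ≤ 1/2*G1 q J l := by
      calc _ ≤ ∑ p ∈ sup1 s, ∑ A ∈ univ.filter (fun A : Finset ι => p ∈ A), gg J l (lg q A)*ph q A := by
            simp_rw [sum_filter]
            rw [sum_comm]
            refine sum_le_sum fun A _ => ?_
            have hn : ∀ p ∈ sup1 s, 0 ≤ (if p ∈ A then gg J l (lg q A)*ph q A else 0) := fun p _ => by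
              split_ifs
              · exact h0 A
              · exact le_rfl
            by_cases hA : ¬ Disjoint A (sup1 s)
            · rw [if_pos hA]
              obtain ⟨p, h1, h2⟩ := Finset.not_disjoint_iff.1 hA
              refine le_trans (by rw [if_pos h1]) (Finset.single_le_sum hn h2)
            · rw [if_neg hA]
              exact sum_nonneg hn
        _ ≤ ∑ p ∈ sup1 s, 1/((q p:ℝ)-1)*G1 q J l := sum_le_sum fun p _ =>
            mass_mem q hp (gg J l) (gg_nonneg J l) (fun t t' h => gg_anti J l h) p
        _ = (∑ p ∈ sup1 s, 1/((q p:ℝ)-1))*G1 q J l := by rw [sum_mul]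
        _ ≤ 1/2*G1 q J l := by
            refine mul_le_mul_of_nonneg_right ?_ hG0
            have h3 := hs.2.1
            rw [sum_fib] at h3
            refine le_trans (sum_le_sum fun p _ => ?_) h3
            have := qm1_pos q hp p
            have hk1' : (1:ℝ) ≤ k := by exact_mod_cast hk1
            exact le_mul_of_one_le_left (by positivity) hk1'
    have h3 : ∑ A, gg J l (lg q A)*ph q A = G1 q J l := rfl
    rw [h3] at h1
    linarith
  calc E*(G1 q J l/2) ≤ E*∑ A ∈ F, gg J l (lg q A)*ph q A := mul_le_mul_of_nonneg_left hG hE0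
    _ = ∑ A ∈ F, E*(gg J l (lg q A)*ph q A) := by rw [mul_sum]
    _ ≤ ∑ A ∈ F, (fun u => YY q J l R u*∏ p, V2 j (q p:ℝ) (Sum.inl (s p)) (u p)) (uA A) := sum_le_sum hterm
    _ = ∑ u ∈ F.image uA, YY q J l R u*∏ p, V2 j (q p:ℝ) (Sum.inl (s p)) (u p) := by
        rw [Finset.sum_image]
        intro A _ A' _ h
        rw [← hfj A, ← hfj A', h]
    _ ≤ _ := sum_le_sum_of_subset_of_nonneg (subset_univ _) fun u _ _ =>
        mul_nonneg (YY_nonneg _ _ _ _ _) (prod_nonneg fun p _ => V2_nonneg j _ (qm1_pos q hp p) _ _)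

lemma w2_prod (q : ι → ℕ) (hp : ∀ i, (q i).Prime) (hk : ∀ i, k ≤ q i) (hk1 : 1 ≤ k) (T:ℝ) (j : Fin k) (s : ι → Option (Fin k)) (hs : goodT q T (fib s))
    (hj : fib s j = ∅) : 1/2*∏ i, ph q (fib s i) ≤ ∏ p, w2 j (q p:ℝ) (Sum.inl (s p)) := by
  have hnj : ∀ p, s p ≠ some j := by
    intro p hh
    have : p ∈ fib s j := (mem_fib s j p).2 hh
    rw [hj] at this
    simp at this
  have hk1' : (1:ℝ) ≤ k := by exact_mod_cast hk1
  have e1 : ∏ p, w2 j (q p:ℝ) (Sum.inl (s p)) = (∏ i, ph q (fib s i))*∏ p ∈ sup1 s, (1-((k:ℝ)-1)/((q p:ℝ)-1)) := by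
    unfold ph
    rw [prod_fib, sup1, Finset.prod_filter, ← prod_mul_distrib]
    refine prod_congr rfl fun p _ => ?_
    have := (qm1_pos q hp p).ne'
    rcases hsp : s p with _ | i
    · simp [w2]
    · have hij : i ≠ j := fun h => hnj p (by rw [hsp, h])
      simp only [w2, if_neg hij, reduceCtorEq, if_false, ne_eq, not_false_eq_true, if_true]
      field_simp
      ring
  rw [e1, mul_comm]
  refine mul_le_mul_of_nonneg_left ?_ (prod_nonneg fun i _ => (ph_pos q hp _).le)
  refine le_trans ?_ (prod_one_sub_ge _ _ (fun p _ => ?_) (fun p _ => ?_))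
  · have h3 := hs.2.1
    rw [sum_fib] at h3
    have : ∑ p ∈ sup1 s, ((k:ℝ)-1)/((q p:ℝ)-1) ≤ ∑ p ∈ sup1 s, (k:ℝ)*(1/((q p:ℝ)-1)) := by
      refine sum_le_sum fun p _ => ?_
      rw [mul_one_div]
      exact div_le_div_of_nonneg_right (by linarith) (qm1_pos q hp p).le
    linarith
  · exact div_nonneg (by linarith) (qm1_pos q hp p).le
  · rw [div_le_one (qm1_pos q hp p)]
    have : (k:ℝ) ≤ q p := by exact_mod_cast hk p
    linarith

lemma S2_num (q : ι → ℕ) (hp : ∀ i, (q i).Prime) (hk : ∀ i, k ≤ q i) (hk1 : 1 ≤ k) (J:ℕ) (hJ : 1 ≤ J) (l:ℝ) (hl0 : 0 ≤ l) (R:ℕ) (T D τ:ℝ)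
    (hT : 0 < T) (hD : 0 < D) (hτ : 0 ≤ τ) (hsq : ∑ p, (1/((q p:ℝ)-1)^2) ≤ 2/D)
    (hR : ∀ x : ℕ, (x:ℝ) ≤ exp T → x ≤ R) (hlT : 2^(J-1)*l ≤ T/2)
    (hM : M1 q J l ≤ τ*G2 q J l) (hfin : (k:ℝ)^2*6/D+2*k*τ/T ≤ 1/2) (j : Fin k) :
    G1 q J l^2/16*G2 q J l^(k-1) ≤ ∑ s : ι → Option (Fin k), (∏ p, w2 j (q p:ℝ) (Sum.inl (s p))) *
        (∑ u, YY q J l R u*∏ p, V2 j (q p:ℝ) (Sum.inl (s p)) (u p))^2 := by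
  classical
  set ν : Fin k → Finset ι → ℝ := fun i A => if i = j then (if A = ∅ then 1 else 0) else gg J l (lg q A)^2*ph q A with hν
  have hν0 : ∀ i A, 0 ≤ ν i A := by
    intro i A
    simp only [hν]
    split_ifs
    · exact zero_le_one
    · exact le_rfl
    · exact mul_nonneg (sq_nonneg _) (ph_pos q hp A).le
  have htj : ∑ A, ν j A = 1 := by simp [hν]
  have hti : ∀ i, i ≠ j → ∑ A, ν i A = G2 q J l := by
    intro i hi
    simp only [hν, if_neg hi]
    rfl
  have hgm := good_mass q hp T D τ hT hD hsq ν hν0 (fun i p => ?_) (fun i => ?_) hfin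
  rotate_left
  · by_cases hi : i = j
    · subst hi
      rw [htj]
      have : ∑ A ∈ univ.filter (fun A : Finset ι => p ∈ A), ν i A = 0 := by
        refine Finset.sum_eq_zero fun A hA => ?_
        have hpA := (mem_filter.1 hA).2
        simp only [hν, if_true]
        rw [if_neg]
        rintro rfl
        simp at hpA
      rw [this]
      have := qm1_pos q hp p
      positivity
    · simp only [hν, if_neg hi]
      exact mass_mem q hp (fun t => gg J l t^2) (fun t => sq_nonneg _) (fun t t' h => pow_le_pow_left₀ (gg_nonneg _ _ _) (gg_anti J l h) 2) p
  · by_cases hi : i = j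
    · subst hi
      rw [htj]
      have : ∑ A, ν i A*lg q A = 0 := by
        refine Finset.sum_eq_zero fun A _ => ?_
        simp only [hν, if_true]
        by_cases hA : A = ∅
        · subst hA; simp [lg, NN]
        · simp [hA]
      rw [this]; linarith
    · rw [hti i hi]
      simp only [hν, if_neg hi]
      exact hM
  have hprod : ∏ i, ∑ A, ν i A = G2 q J l^(k-1) := by
    rw [← Finset.mul_prod_erase _ _ (mem_univ j), htj, one_mul, prod_congr rfl fun i hi => hti i (ne_of_mem_erase hi),
      Finset.prod_const, Finset.card_erase_of_mem (mem_univ j), Finset.card_univ, Fintype.card_fin]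
  rw [hprod, sum_good q T (fun S => ∏ i, ν i (S i))] at hgm
  have hw0 : ∀ s : ι → Option (Fin k), 0 ≤ (∏ p, w2 j (q p:ℝ) (Sum.inl (s p))) := by
    intro s
    refine prod_nonneg fun p _ => ?_
    have : (k:ℝ) ≤ q p := by exact_mod_cast hk p
    rcases s p with _ | i
    · simp [w2]
    · simp only [w2]
      split_ifs
      · exact le_rfl
      · exact div_nonneg (by linarith) (sq_nonneg _)
  calc G1 q J l^2/16*G2 q J l^(k-1) = G1 q J l^2/8*(1/2*G2 q J l^(k-1)) := by ring
    _ ≤ G1 q J l^2/8*∑ u ∈ univ.filter (fun u : ι → Option (Fin k) => goodT q T (fib u)), ∏ i, ν i (fib u i) :=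
        mul_le_mul_of_nonneg_left hgm (by positivity)
    _ = ∑ u ∈ univ.filter (fun u : ι → Option (Fin k) => goodT q T (fib u)), G1 q J l^2/8*∏ i, ν i (fib u i) := by
        rw [mul_sum]
    _ ≤ ∑ s ∈ univ.filter (fun u : ι → Option (Fin k) => goodT q T (fib u)), (∏ p, w2 j (q p:ℝ) (Sum.inl (s p))) *
        (∑ u, YY q J l R u*∏ p, V2 j (q p:ℝ) (Sum.inl (s p)) (u p))^2 := by
        refine sum_le_sum fun s hs => ?_
        have hsg := (mem_filter.1 hs).2
        by_cases hj : fib s j = ∅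
        · have i1 := S2_inner q hp J hJ l hl0 R T hR hlT hk1 j s hsg hj
          have i2 := w2_prod q hp hk hk1 T j s hsg hj
          have hG0 : 0 ≤ G1 q J l := sum_nonneg fun A _ => mul_nonneg (gg_nonneg _ _ _) (ph_pos q hp A).le
          have hE0 : 0 ≤ ∏ i ∈ univ.erase j, gg J l (lg q (fib s i)) := prod_nonneg fun _ _ => gg_nonneg _ _ _
          have i3 := pow_le_pow_left₀ (mul_nonneg hE0 (by positivity)) i1 2
          refine le_trans (le_of_eq ?_) (mul_le_mul i2 i3 (sq_nonneg _) (hw0 s))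
          rw [← Finset.mul_prod_erase _ (fun i => ν i (fib s i)) (mem_univ j), ← Finset.mul_prod_erase _ (fun i => ph q (fib s i)) (mem_univ j), hj]
          have e1 : ν j ∅ = 1 := by simp [hν]
          have e2 : ph q (∅ : Finset ι) = 1 := by simp [ph]
          have e3 : ∏ i ∈ univ.erase j, ν i (fib s i) = (∏ i ∈ univ.erase j, gg J l (lg q (fib s i)))^2*∏ i ∈ univ.erase j, ph q (fib s i) := by
            rw [← Finset.prod_pow, ← prod_mul_distrib]
            refine prod_congr rfl fun i hi => ?_
            simp only [hν, if_neg (ne_of_mem_erase hi)]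
          rw [e1, e2, e3]
          ring
        · have : ∏ i, ν i (fib s i) = 0 := Finset.prod_eq_zero (mem_univ j) (by simp [hν, hj])
          rw [this, mul_zero]
          exact mul_nonneg (hw0 s) (sq_nonneg _)
    _ ≤ _ := sum_le_sum_of_subset_of_nonneg (subset_univ _) fun s _ _ => mul_nonneg (hw0 s) (sq_nonneg _)

end B6c
end

section
open Finset
open scoped ArithmeticFunction.vonMangoldt

section B7a

lemma Psi_lower (m:ℕ) (L:ℝ) (hL : 20 ≤ L) (N:ℕ) (hN : exp (5/4*L) ≤ N+1) :
    exp (-(log 100)^2)*exp L ≤ PsiN m L N := by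
  set X := exp L with hX
  have hX20 : (20:ℝ) ≤ X := by
    have := Real.add_one_le_exp L
    linarith
  have hXN : 100*X ≤ N := by
    have h1 : exp (5/4*L) = X*exp (L/4) := by
      rw [hX, ← Real.exp_add]; congr 1; ring
    have h2 : (101:ℝ) ≤ exp (L/4) := by
      have h3 : exp 5 ≤ exp (L/4) := Real.exp_le_exp.2 (by linarith)
      have h4 : exp 5 = exp 1^5 := by rw [← Real.exp_nat_mul]; norm_num
      have h5 := Real.exp_one_gt_d9
      have h6 : (2.7:ℝ)^5 ≤ exp 1^5 := pow_le_pow_left₀ (by norm_num) (by linarith) 5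
      norm_num at h6
      linarith
    nlinarith
  have hlogX : log X = L := Real.log_exp L
  -- Chebyshev
  have hpsi : X ≤ Chebyshev.psi (100*X)-Chebyshev.psi X := by
    have h1 := Chebyshev.psi_ge' (x := 100*X) (by linarith)
    have h2 := Chebyshev.psi_le_const_mul_self (x := X) (by linarith)
    have h3 : log (100*X+2) ≤ 5+X := by
      have : log (100*X+2) ≤ log (128*X) := Real.log_le_log (by linarith) (by linarith)
      rw [Real.log_mul (by norm_num) (by linarith), hlogX] at this
      have h4 : log 128 = 7*log 2 := by
        rw [show (128:ℝ) = 2^7 by norm_num, Real.log_pow]; norm_num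
      have h5 := Real.log_two_lt_d9
      have h6 := Real.add_one_le_exp L
      linarith
    have h4 : log 4 = 2*log 2 := by
      rw [show (4:ℝ) = 2^2 by norm_num, Real.log_pow]; norm_num
    have h5 := Real.log_two_lt_d9
    have h6 := Real.log_two_gt_d9
    rw [h4] at h2
    nlinarith
  have hsplit : Chebyshev.psi (100*X)-Chebyshev.psi X = ∑ n ∈ Ioc ⌊X⌋₊ ⌊100*X⌋₊, Λ n := by
    unfold Chebyshev.psi
    rw [sub_eq_iff_eq_add, add_comm]
    exact (Finset.sum_Ioc_consecutive _ (Nat.zero_le _) (Nat.floor_mono (by linarith))).symm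
  have hsub : Ioc ⌊X⌋₊ ⌊100*X⌋₊ ⊆ Ioc 0 N := by
    intro n hn
    rw [mem_Ioc] at hn ⊢
    refine ⟨by omega, ?_⟩
    have : ⌊100*X⌋₊ ≤ N := by
      have := Nat.floor_mono hXN
      rwa [Nat.floor_natCast] at this
    omega
  calc exp (-(log 100)^2)*X ≤ exp (-(log 100)^2)*∑ n ∈ Ioc ⌊X⌋₊ ⌊100*X⌋₊, Λ n := by
        rw [← hsplit]
        exact mul_le_mul_of_nonneg_left hpsi (Real.exp_pos _).le
    _ = ∑ n ∈ Ioc ⌊X⌋₊ ⌊100*X⌋₊, Λ n*exp (-(log 100)^2) := by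
        rw [mul_sum]; exact sum_congr rfl fun n _ => mul_comm _ _
    _ ≤ ∑ n ∈ Ioc ⌊X⌋₊ ⌊100*X⌋₊, Λ n*FF m L n := by
        refine sum_le_sum fun n hn => mul_le_mul_of_nonneg_left ?_ ArithmeticFunction.vonMangoldt_nonneg
        rw [mem_Ioc] at hn
        have h1 : X < n := (Nat.floor_lt (by linarith)).1 hn.1
        have h2 : (n:ℝ) ≤ 100*X := (Nat.le_floor_iff (by linarith)).1 hn.2
        have h3 : L ≤ log n := by rw [← hlogX]; exact Real.log_le_log (by linarith) h1.le
        have h4 : log n ≤ log 100+L := by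
          rw [← hlogX, ← Real.log_mul (by norm_num) (by linarith)]
          exact Real.log_le_log (by linarith) h2
        unfold FF
        have h5 : 1 ≤ (log n/L)^m := one_le_pow₀ (by rw [le_div_iff₀ (by linarith)]; linarith)
        have h6 : exp (-(log 100)^2) ≤ exp (-(log n-L)^2) := by
          refine Real.exp_le_exp.2 ?_
          have : (log n-L)^2 ≤ (log 100)^2 := pow_le_pow_left₀ (by linarith) (by linarith) 2
          linarith
        exact h6.trans (le_mul_of_one_le_left (Real.exp_pos _).le h5)
    _ ≤ ∑ n ∈ Ioc 0 N, Λ n*FF m L n :=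
        sum_le_sum_of_subset_of_nonneg hsub fun n _ _ =>
          mul_nonneg ArithmeticFunction.vonMangoldt_nonneg (FF_nonneg m L n (by linarith))

lemma FF_exp_bound (m:ℕ) (L:ℝ) (hL : 1 ≤ L) (hm : (m:ℝ) ≤ L) (n:ℕ) :
    FF m L n ≤ exp (9/4)*exp (-(2 * |log n-L|)) := by
  unfold FF
  set u := log n-L with hu
  have hlog : 0 ≤ log n := Real.log_natCast_nonneg n
  have h0 : 0 ≤ log n/L := by positivity
  have h1 : log n/L ≤ exp (u/L) := by
    have := Real.add_one_le_exp (u/L)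
    refine le_trans (le_of_eq ?_) this
    rw [hu]; field_simp; ring
  have h2 : (log n/L)^m ≤ exp |u| := by
    calc (log n/L)^m ≤ exp (u/L)^m := pow_le_pow_left₀ h0 h1 m
      _ = exp (m*(u/L)) := by rw [Real.exp_nat_mul]
      _ ≤ exp |u| := by
        refine Real.exp_le_exp.2 ?_
        calc (m:ℝ)*(u/L) ≤ m*(|u| / L) := by
              refine mul_le_mul_of_nonneg_left (div_le_div_of_nonneg_right (le_abs_self u) (by linarith)) (by positivity)
          _ = (m/L) * |u| := by ring
          _ ≤ 1 * |u| := mul_le_mul_of_nonneg_right (by rw [div_le_one (by linarith)]; exact hm) (abs_nonneg _)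
          _ = |u| := one_mul _
  calc (log n/L)^m*exp (-u^2) ≤ exp |u| * exp (-u^2) := mul_le_mul_of_nonneg_right h2 (Real.exp_pos _).le
    _ = exp (|u| - |u| ^ 2) := by rw [← Real.exp_add, sq_abs]; rfl
    _ ≤ exp (9/4 + -(2 * |u|)) := Real.exp_le_exp.2 (by nlinarith [sq_nonneg (|u| - 3/2)])
    _ = _ := Real.exp_add _ _

lemma FF_sum_upper (m:ℕ) (L:ℝ) (hL : 1 ≤ L) (hm : (m:ℝ) ≤ L) (M:ℕ) :
    ∑ n ∈ range M, FF m L n ≤ 4*exp (9/4)*exp L := by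
  set X := exp L with hX
  have hX1 : (1:ℝ) ≤ X := by
    have := Real.add_one_le_exp L
    linarith
  have hE := Real.exp_pos (9/4:ℝ)
  have hsub : range M ⊆ range (⌊X⌋₊ + 1) ∪ Ioo ⌊X⌋₊ M := by
    intro n hn
    rw [mem_range] at hn
    rw [mem_union, mem_range, mem_Ioo]
    omega
  have hA : ∑ n ∈ range (⌊X⌋₊ + 1), FF m L n ≤ exp (9/4)*(2*X) := by
    have : ∀ n ∈ range (⌊X⌋₊ + 1), FF m L n ≤ exp (9/4) := fun n _ => by
      refine (FF_exp_bound m L hL hm n).trans (mul_le_of_le_one_right hE.le ?_)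
      rw [Real.exp_le_one_iff]
      have := abs_nonneg (log n-L)
      linarith
    refine (sum_le_sum this).trans ?_
    rw [Finset.sum_const, card_range, nsmul_eq_mul, mul_comm]
    refine mul_le_mul_of_nonneg_left ?_ hE.le
    push_cast
    have := Nat.floor_le (show 0 ≤ X by linarith)
    linarith
  have hB : ∑ n ∈ Ioo ⌊X⌋₊ M, FF m L n ≤ exp (9/4)*(2*X) := by
    have : ∀ n ∈ Ioo ⌊X⌋₊ M, FF m L n ≤ exp (9/4)*X^2*((n:ℝ)^2)⁻¹ := fun n hn => by
      rw [mem_Ioo] at hn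
      have hn1 : X < n := (Nat.floor_lt (by linarith)).1 hn.1
      have hn0 : (0:ℝ) < n := by linarith
      refine (FF_exp_bound m L hL hm n).trans ?_
      rw [mul_assoc]
      refine mul_le_mul_of_nonneg_left (le_of_eq ?_) hE.le
      have h3 : L ≤ log n := by
        rw [← Real.log_exp L]; exact Real.log_le_log (Real.exp_pos L) hn1.le
      rw [abs_of_nonneg (by linarith), show -(2*(log n-L)) = L+L + -(log n+log n) by ring, Real.exp_add, Real.exp_neg,
        Real.exp_add, Real.exp_add, Real.exp_log hn0, sq, sq]
    refine (sum_le_sum this).trans ?_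
    rw [← mul_sum, mul_assoc]
    refine mul_le_mul_of_nonneg_left ?_ hE.le
    have h2 := sum_Ioo_inv_sq_le (α := ℝ) ⌊X⌋₊ M
    have h4 : X < ⌊X⌋₊ + 1 := Nat.lt_floor_add_one X
    have h5 : 2/((⌊X⌋₊:ℝ)+1) ≤ 2/X := div_le_div_of_nonneg_left (by norm_num) (by linarith) h4.le
    refine (mul_le_mul_of_nonneg_left (h2.trans h5) (by positivity)).trans (le_of_eq ?_)
    field_simp
  have h0 : ∀ n, 0 ≤ FF m L n := fun n => FF_nonneg m L n hL
  calc _ ≤ ∑ n ∈ range (⌊X⌋₊ + 1) ∪ Ioo ⌊X⌋₊ M, FF m L n := sum_le_sum_of_subset_of_nonneg hsub fun n _ _ => h0 n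
    _ ≤ ∑ n ∈ range (⌊X⌋₊ + 1), FF m L n + ∑ n ∈ Ioo ⌊X⌋₊ M, FF m L n := by
        rw [← Finset.sum_union_inter]
        exact le_add_of_nonneg_right (sum_nonneg fun n _ => h0 n)
    _ ≤ _ := by linarith

end B7a
end

section
open Finset
open scoped ArithmeticFunction.vonMangoldt

section B7b

lemma FF_shift (m:ℕ) (L:ℝ) (hL : 1 ≤ L) (n:ℕ) (hn : 1 ≤ n) (h:ℕ) : FF m L (n+h) ≤ FF m L n+h*(CF m*(1/n)) := by
  induction h with
  | zero => simp
  | succ h ih =>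
    have h1 := FF_diff m L 1 (n+h) hL le_rfl (by omega)
    rw [one_mul, one_mul] at h1
    have h2 := (abs_le.1 h1).2
    have h3 : CF m*(1/((n+h:ℕ):ℝ)) ≤ CF m*(1/n) := by
      refine mul_le_mul_of_nonneg_left ?_ (CF_pos m).le
      have : (0:ℝ) < n := by exact_mod_cast hn
      exact one_div_le_one_div_of_le this (by push_cast; linarith [(Nat.cast_nonneg h : (0:ℝ) ≤ h)])
    rw [← add_assoc]
    push_cast
    push_cast at h2 h3
    linarith

lemma split_abs (m:ℕ) (L:ℝ) (hL : 1 ≤ L) (N:ℕ) (hN : 1 ≤ N) (W b h n0 n1:ℕ) (hn1 : n0+h ≤ n1) (w v : ℕ → ℝ) (hw : ∀ n, 0 ≤ w n)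
    (hv : ∀ n, 0 ≤ v n) (Wt:ℝ) (hvW : ∀ n, v n ≤ Wt) (heq : ∀ n, (n+h).Prime → n1 < n+h → v (n+h) = w n) :
    ∑ n ∈ (Ioc 0 N).filter (fun n : ℕ => n ≡ b+h [MOD W]), Λ n*FF m L n*v n ≤
      log N*(∑ n ∈ (range (N+1)).filter (fun n : ℕ => n ≡ b [MOD W] ∧ n0 ≤ n ∧ (n+h).Prime), FF m L (n+h)*w n) +
        CF m*Wt*(n1*log N+2*√N*log N) := by
  have hFF : ∀ n, 0 ≤ FF m L n := fun n => FF_nonneg m L n hL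
  have hWt : 0 ≤ Wt := (hv 0).trans (hvW 0)
  have hLam : ∀ n, 0 ≤ Λ n := fun n => ArithmeticFunction.vonMangoldt_nonneg
  have hLN : ∀ n ∈ Ioc 0 N, Λ n ≤ log N := by
    intro n hn
    rw [mem_Ioc] at hn
    refine ArithmeticFunction.vonMangoldt_le_log.trans (Real.log_le_log (by exact_mod_cast hn.1) (by exact_mod_cast hn.2))
  have hlogN : 0 ≤ log N := Real.log_natCast_nonneg N
  rw [← Finset.sum_filter_add_sum_filter_not _ (fun n : ℕ => n.Prime ∧ n1 < n)]
  refine add_le_add ?_ ?_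
  · set A := ((Ioc 0 N).filter (fun n : ℕ => n ≡ b+h [MOD W])).filter (fun n : ℕ => n.Prime ∧ n1 < n) with hA
    have hmem : ∀ n ∈ A, h ≤ n ∧ n ∈ Ioc 0 N ∧ n ≡ b+h [MOD W] ∧ n.Prime ∧ n1 < n := by
      intro n hn
      rw [hA, mem_filter, mem_filter] at hn
      exact ⟨by omega, hn.1.1, hn.1.2, hn.2.1, hn.2.2⟩
    rw [mul_sum]
    calc ∑ n ∈ A, Λ n*FF m L n*v n ≤ ∑ n ∈ A, (fun n => log N*(FF m L (n+h)*w n)) (n-h) := by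
          refine sum_le_sum fun n hn => ?_
          obtain ⟨h1, h2, h3, h4, h5⟩ := hmem n hn
          have h6 := heq (n-h) (by rwa [Nat.sub_add_cancel h1]) (by rwa [Nat.sub_add_cancel h1])
          rw [Nat.sub_add_cancel h1] at h6
          simp only
          rw [Nat.sub_add_cancel h1, ← h6, mul_assoc]
          exact mul_le_mul_of_nonneg_right (hLN n h2) (mul_nonneg (hFF n) (hv n))
      _ = ∑ n ∈ A.image (fun n => n-h), log N*(FF m L (n+h)*w n) := by
          rw [Finset.sum_image]
          intro n hn n' hn' e
          have h1 := (hmem n hn).1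
          have h2 := (hmem n' hn').1
          simp only at e
          omega
      _ ≤ _ := by
          refine sum_le_sum_of_subset_of_nonneg ?_ fun n _ _ => mul_nonneg hlogN (mul_nonneg (hFF _) (hw _))
          intro n hn
          obtain ⟨n', hn', rfl⟩ := mem_image.1 hn
          obtain ⟨h1, h2, h3, h4, h5⟩ := hmem n' hn'
          rw [mem_Ioc] at h2
          rw [mem_filter, mem_range]
          refine ⟨by omega, ?_, by omega, ?_⟩
          · have : n' - h+h ≡ b+h [MOD W] := by rw [Nat.sub_add_cancel h1]; exact h3
            exact Nat.ModEq.add_right_cancel' h this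
          · rw [Nat.sub_add_cancel h1]; exact h4
  · calc _ ≤ ∑ n ∈ ((Ioc 0 N).filter (fun n : ℕ => n ≡ b+h [MOD W])).filter (fun n : ℕ => ¬ (n.Prime ∧ n1 < n)), CF m*Wt*Λ n := by
          refine sum_le_sum fun n _ => ?_
          rw [mul_comm (CF m*Wt), mul_assoc]
          exact mul_le_mul_of_nonneg_left (mul_le_mul (FF_le m L n hL) (hvW n) (hv n) (CF_pos m).le) (hLam n)
      _ = CF m*Wt*∑ n ∈ ((Ioc 0 N).filter (fun n : ℕ => n ≡ b+h [MOD W])).filter (fun n : ℕ => ¬ (n.Prime ∧ n1 < n)), Λ n := by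
          rw [mul_sum]
      _ ≤ _ := by
          refine mul_le_mul_of_nonneg_left ?_ (mul_nonneg (CF_pos m).le hWt)
          calc _ ≤ ∑ n ∈ (Ioc 0 N).filter (fun n : ℕ => n ≤ n1) ∪ (Ioc 0 N).filter (fun n : ℕ => ¬ n.Prime), Λ n := by
                refine sum_le_sum_of_subset_of_nonneg ?_ fun n _ _ => hLam n
                intro n hn
                rw [mem_filter, mem_filter, not_and_or, not_lt] at hn
                rw [mem_union, mem_filter, mem_filter]
                rcases hn.2 with h | h
                · exact Or.inr ⟨hn.1.1, h⟩
                · exact Or.inl ⟨hn.1.1, h⟩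
            _ ≤ ∑ n ∈ (Ioc 0 N).filter (fun n : ℕ => n ≤ n1), Λ n + ∑ n ∈ (Ioc 0 N).filter (fun n : ℕ => ¬ n.Prime), Λ n := by
                rw [← Finset.sum_union_inter]
                exact le_add_of_nonneg_right (sum_nonneg fun n _ => hLam n)
            _ ≤ n1*log N+2*√N*log N := by
                refine add_le_add ?_ ?_
                · refine (sum_le_sum fun n hn => hLN n (mem_filter.1 hn).1).trans ?_
                  rw [Finset.sum_const, nsmul_eq_mul]
                  refine mul_le_mul_of_nonneg_right ?_ hlogN
                  have : ((Ioc 0 N).filter (fun n : ℕ => n ≤ n1)).card ≤ (Ioc 0 n1).card := by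
                    refine Finset.card_le_card fun n hn => ?_
                    rw [mem_filter, mem_Ioc] at hn
                    rw [mem_Ioc]
                    exact ⟨hn.1.1, hn.2⟩
                  rw [Nat.card_Ioc] at this
                  exact_mod_cast this
                · have h1 := Chebyshev.psi_sub_theta_le (x := (N:ℝ)) (by exact_mod_cast hN)
                  rw [Chebyshev.psi_sub_theta_eq_sum_not_prime, Nat.floor_natCast] at h1
                  exact h1

lemma one_prime (m:ℕ) (L:ℝ) (hL : 1 ≤ L) (N W b n0 H:ℕ) (hn0 : 1 ≤ n0) {k : ℕ} (h : Fin k → ℕ) (hH : ∀ i, h i ≤ H) (w : ℕ → ℝ) (hw : ∀ n, 0 ≤ w n)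
    (Wt:ℝ) (hwW : ∀ n, w n ≤ Wt)
    (hone : ∀ n, n0 ≤ n → n ≡ b [MOD W] → ∀ i j, (n+h i).Prime → (n+h j).Prime → i = j) :
    ∑ j, ∑ n ∈ (range (N+1)).filter (fun n : ℕ => n ≡ b [MOD W] ∧ n0 ≤ n ∧ (n+h j).Prime), FF m L (n+h j)*w n ≤
      ∑ n ∈ (range (N+1)).filter (fun n : ℕ => n ≡ b [MOD W]), FF m L n*w n+H*(CF m*Wt*(1+log ((N+1:ℕ):ℝ))) := by
  have hFF : ∀ n, 0 ≤ FF m L n := fun n => FF_nonneg m L n hL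
  have hWt : 0 ≤ Wt := (hw 0).trans (hwW 0)
  have hstep : ∀ n ∈ (range (N+1)).filter (fun n : ℕ => n ≡ b [MOD W]),
      ∑ j, (if n0 ≤ n ∧ (n+h j).Prime then FF m L (n+h j)*w n else 0) ≤ FF m L n*w n+(if 0 < n then H*(CF m*Wt*(1/n)) else 0) := by
    intro n hn
    have hnb := (mem_filter.1 hn).2
    have hpos : 0 ≤ FF m L n*w n+(if 0 < n then H*(CF m*Wt*(1/n)) else 0) := by
      refine add_nonneg (mul_nonneg (hFF n) (hw n)) ?_
      split_ifs
      · have := (CF_pos m).le; positivity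
      · exact le_rfl
    by_cases hex : ∃ j, n0 ≤ n ∧ (n+h j).Prime
    · obtain ⟨j, hj0, hj⟩ := hex
      rw [Finset.sum_eq_single j]
      · rw [if_pos ⟨hj0, hj⟩, if_pos (by omega)]
        have h1 := FF_shift m L hL n (by omega) (h j)
        have hn1 : (0:ℝ) < n := by exact_mod_cast (by omega : 0 < n)
        have h2 := mul_le_mul_of_nonneg_right h1 (hw n)
        have h3 : (h j:ℝ)*(CF m*(1/n))*w n ≤ H*(CF m*Wt*(1/n)) := by
          have e1 : (h j:ℝ) ≤ H := by exact_mod_cast hH j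
          have e2 := hwW n
          have e3 := (CF_pos m).le
          calc (h j:ℝ)*(CF m*(1/n))*w n = (h j:ℝ)*(CF m*(1/n)*w n) := by ring
            _ ≤ H*(CF m*(1/n)*Wt) := mul_le_mul e1 (mul_le_mul_of_nonneg_left e2 (by positivity)) (mul_nonneg (by positivity) (hw n)) (by positivity)
            _ = _ := by ring
        rw [add_mul] at h2
        linarith
      · intro i _ hij
        rw [if_neg]
        rintro ⟨-, hi⟩
        exact hij (hone n hj0 hnb i j hi hj)
      · simp
    · rw [Finset.sum_eq_zero]
      · exact hpos
      · intro j _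
        rw [if_neg]
        exact fun hh => hex ⟨j, hh⟩
  calc _ = ∑ n ∈ (range (N+1)).filter (fun n : ℕ => n ≡ b [MOD W]), ∑ j, (if n0 ≤ n ∧ (n+h j).Prime then FF m L (n+h j)*w n else 0) := by
        rw [sum_comm]
        refine sum_congr rfl fun j _ => ?_
        rw [← sum_filter, Finset.filter_filter]
    _ ≤ _ := sum_le_sum hstep
    _ = ∑ n ∈ (range (N+1)).filter (fun n : ℕ => n ≡ b [MOD W]), FF m L n*w n +
        ∑ n ∈ (range (N+1)).filter (fun n : ℕ => n ≡ b [MOD W]), (if 0 < n then H*(CF m*Wt*(1/(n:ℝ))) else 0) := by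
        rw [sum_add_distrib]
    _ ≤ _ := by
        refine add_le_add_right ?_ _
        have e3 := (CF_pos m).le
        calc _ ≤ ∑ n ∈ Ioc 0 N, H*(CF m*Wt*(1/(n:ℝ))) := by
              rw [← sum_filter]
              refine sum_le_sum_of_subset_of_nonneg ?_ fun n _ _ => by positivity
              intro n hn
              rw [mem_filter, mem_filter, mem_range] at hn
              rw [mem_Ioc]
              omega
          _ = H*(CF m*Wt*∑ n ∈ Ioc 0 N, (1/(n:ℝ))) := by rw [mul_sum, mul_sum]
          _ ≤ _ := by
              refine mul_le_mul_of_nonneg_left (mul_le_mul_of_nonneg_left (sum_Ioc_one_div_le N) (by positivity)) (by positivity)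

variable {k : ℕ} {ι : Type*} [Fintype ι] [DecidableEq ι]

lemma weight_eq (q : ι → ℕ) (hp : ∀ i, (q i).Prime) (n1:ℕ) (hq : ∀ p, q p ≤ n1) (Y : (ι → Option (Fin k)) → ℝ) (h : Fin k → ℕ) (j : Fin k) (n:ℕ)
    (hn : (n+h j).Prime) (hn1 : n1 < n+h j) :
    (∑ d, lam (fun p => M2 j (q p:ℝ)) Y d*∏ p, vv q (fun i => (h i : ℤ)-h j) (n+h j) p (d p))^2 =
    (∑ d, lam (fun p => MM (q p:ℝ)) Y d*∏ p, vv q (fun i => (h i : ℤ)) n p (d p))^2 := by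
  classical
  congr 1
  refine sum_congr rfl fun d _ => ?_
  rw [lamM2]
  have hv : ∀ p x, vv q (fun i => (h i : ℤ)-h j) (n+h j) p x = vv q (fun i => (h i : ℤ)) n p x := by
    intro p x
    rcases x with _ | i
    · rfl
    · simp only [vv]
      have : ((n+h j:ℕ) : ℤ)+((h i : ℤ)-h j) = (n:ℤ)+h i := by push_cast; ring
      rw [this]
  simp_rw [hv]
  split_ifs with hd
  · obtain ⟨p, hpd⟩ := hd
    rw [zero_mul, Finset.prod_eq_zero (mem_univ p), mul_zero]
    rw [hpd]
    simp only [vv]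
    rw [if_neg]
    intro hdvd
    have h1 : q p ∣ n+h j := by exact_mod_cast hdvd
    have h2 := (Nat.prime_dvd_prime_iff_eq (hp p) hn).1 h1
    have := hq p
    omega
  · rfl

end B7b
end

section
open Finset
open scoped ArithmeticFunction.vonMangoldt

section B7c
variable {k : ℕ} {ι : Type*} [Fintype ι] [DecidableEq ι]

noncomputable def ErrT (k m:ℕ) (L:ℝ) (N R n1 H:ℕ) (Eps:ℝ) : ℝ :=
  k*(LB (2*k) R^2*Eps)+k*(CF m*(LB (2*k) R*(R*LB k R))^2*(n1*log N+2*√N*log N)) +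
    log N*(H*(CF m*(LB (2*k) R*(R*LB k R))^2*(1+log ((N+1:ℕ):ℝ)))) +
    log N*(LB (2*k) R^2*((R*R:ℕ)*LB (3*k) (R*R)*(CF m*(3+log ((N+1:ℕ):ℝ)))))

theorem core_ineq (q : ι → ℕ) (hinj : Function.Injective q) (hp : ∀ i, (q i).Prime) (hk : ∀ i, k ≤ q i) (hk1 : 1 ≤ k) (W p0 b:ℕ)
    (hW0 : 0 < W) (hW : ∀ p, (q p).Coprime (W*p0)) (h : Fin k → ℕ) (hb : ∀ i, (b+h i).Coprime W)
    (hz : ∀ p i l, i ≠ l → ¬ (q p : ℤ) ∣ (h i : ℤ)-h l)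
    (Y : (ι → Option (Fin k)) → ℝ) (hY1 : ∀ u, |Y u| ≤ 1) (R:ℕ) (hYR : ∀ u, Y u ≠ 0 → NN q (sup1 u) ≤ R)
    (m:ℕ) (L:ℝ) (hL : 1 ≤ L) (N:ℕ) (hN : 1 ≤ N) (hR : ((R*R:ℕ):ℝ) ≤ exp (L/20)) (Eps:ℝ)
    (hBV : ∀ Q : Finset ℕ, (∀ q ∈ Q, Squarefree q ∧ q.Coprime (W*p0) ∧ (q:ℝ) ≤ exp (L/20)) →
      ∀ a : ℕ → ℕ, (∀ q ∈ Q, (a q).Coprime (W*q)) →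
      ∑ q ∈ Q, ((3*k:ℕ):ℝ)^q.primeFactors.card * |psiAP m L N (W*q) (a q)-PsiN m L N/(W*q).totient| ≤ Eps)
    (n0 n1 H:ℕ) (hn0 : 1 ≤ n0) (hH : ∀ i, h i ≤ H) (hn1 : n0+H ≤ n1) (hq : ∀ p, q p ≤ n1)
    (hone : ∀ n, n0 ≤ n → n ≡ b [MOD W] → ∀ i j, (n+h i).Prime → (n+h j).Prime → i = j)
    (F1 F2:ℝ) (hF1 : ∑ u, Y u^2*∏ p, D1 (q p:ℝ) (u p) ≤ F1)
    (hF2 : ∀ j, F2 ≤ ∑ s : ι → Option (Fin k), (∏ p, w2 j (q p:ℝ) (Sum.inl (s p))) *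
        (∑ u, Y u*∏ p, V2 j (q p:ℝ) (Sum.inl (s p)) (u p))^2) :
    k*(PsiN m L N/W.totient*F2) ≤ log N*((∑ n ∈ range (N+1), FF m L n)/W*F1)+ErrT k m L N R n1 H Eps := by
  classical
  set w : ℕ → ℝ := fun n => (∑ d, lam (fun p => MM (q p:ℝ)) Y d*∏ p, vv q (fun i => (h i : ℤ)) n p (d p))^2 with hw
  set Wt : ℝ := (LB (2*k) R*(R*LB k R))^2 with hWt
  have hlb := lam_bound q hinj hp Y hY1 R hYR
  have hls := lam_supp q hp Y R hYR
  have hw0 : ∀ n, 0 ≤ w n := fun n => sq_nonneg _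
  have hwW : ∀ n, w n ≤ Wt := fun n => weight_le q R hinj hp _ _ hlb hls _ n
  have hPsi : 0 ≤ PsiN m L N/W.totient := div_nonneg (sum_nonneg fun n _ =>
    mul_nonneg ArithmeticFunction.vonMangoldt_nonneg (FF_nonneg m L n hL)) (by positivity)
  have hlogN : 0 ≤ log N := Real.log_natCast_nonneg N
  -- per j
  have hj : ∀ j : Fin k, PsiN m L N/W.totient*F2 ≤ LB (2*k) R^2*Eps +
      (log N*(∑ n ∈ (range (N+1)).filter (fun n : ℕ => n ≡ b [MOD W] ∧ n0 ≤ n ∧ (n+h j).Prime), FF m L (n+h j)*w n) +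
        CF m*Wt*(n1*log N+2*√N*log N)) := by
    intro j
    have h1 := S2_bound q hinj hp hk W p0 (b+h j) hW0 hW (hb j) (fun i => (h i : ℤ)-h j)
      (fun p i l hil => by
        have := hz p i l hil
        rwa [show (h i : ℤ)-h j-((h l : ℤ)-h j) = (h i : ℤ)-h l by ring]) j (by simp) Y hY1 R hYR m L hL N hR Eps hBV
    have h2 := split_abs m L hL N hN W b (h j) n0 n1 (le_trans (Nat.add_le_add_left (hH j) n0) hn1) w
      (fun n => (∑ d, lam (fun p => M2 j (q p:ℝ)) Y d*∏ p, vv q (fun i => (h i : ℤ)-h j) n p (d p))^2) hw0 (fun n => sq_nonneg _) Wt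
      (fun n => weight_le q R hinj hp _ _ (fun d => ?_) (fun d hd => ?_) _ n) (fun n hn hn' => weight_eq q hp n1 hq Y h j n hn hn')
    · have h3 := mul_le_mul_of_nonneg_left (hF2 j) hPsi
      linarith
    · rw [lamM2]
      split_ifs
      · rw [abs_zero]; exact LB_nonneg _ _
      · exact hlb d
    · rw [lamM2] at hd
      split_ifs at hd with hh
      · exact absurd rfl hd
      · exact hls d hd
  have hsum := sum_le_sum fun j (_ : j ∈ (univ : Finset (Fin k))) => hj j
  rw [Finset.sum_const, card_univ, Fintype.card_fin, nsmul_eq_mul, sum_add_distrib, sum_add_distrib, Finset.sum_const,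
    Finset.sum_const, card_univ, Fintype.card_fin, nsmul_eq_mul, nsmul_eq_mul, ← mul_sum] at hsum
  have h4 := one_prime m L hL N W b n0 H hn0 h hH w hw0 Wt hwW hone
  have h5 := S1_bound k (k' := ⟨0, hk1⟩) q hinj hp hk W b hW0 (fun p => Nat.Coprime.coprime_mul_right_right (hW p)) (fun i => (h i : ℤ)) hz Y hY1 R hYR m L hL (N+1)
  have hX : 0 ≤ (∑ n ∈ range (N+1), FF m L n)/W :=
    div_nonneg (sum_nonneg fun n _ => FF_nonneg m L n hL) (by positivity)
  have h6 := mul_le_mul_of_nonneg_left hF1 hX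
  have h7 : ∑ n ∈ (range (N+1)).filter (fun n : ℕ => n ≡ b [MOD W]), FF m L n*w n ≤ (∑ n ∈ range (N+1), FF m L n)/W*F1 +
      LB (2*k) R^2*((R*R:ℕ)*LB (3*k) (R*R)*(CF m*(3+log ((N+1:ℕ):ℝ)))) := h5.trans (add_le_add_left h6 _)
  have h8 := mul_le_mul_of_nonneg_left (h4.trans (add_le_add_left h7 _)) hlogN
  unfold ErrT
  rw [← hWt]
  clear_value Wt w
  nlinarith [h8, hsum]

end B7c
end

section
open Finset

section B8a

lemma LB_le_pow (K x:ℕ) (L:ℝ) (hL : 3 ≤ L) (hx : (x:ℝ) ≤ exp (L/20)) : LB K x ≤ L^K := by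
  unfold LB
  have hlog : 0 ≤ log ((x+1:ℕ):ℝ) := Real.log_natCast_nonneg _
  refine pow_le_pow_left₀ (by linarith) ?_ K
  have h1 : ((x+1:ℕ):ℝ) ≤ exp (1+L/20) := by
    push_cast
    rw [Real.exp_add]
    have h2 := Real.exp_one_gt_d9
    have h3 : 1 ≤ exp (L/20) := Real.one_le_exp (by linarith)
    nlinarith
  have h2 := Real.log_le_log (by positivity) h1
  rw [Real.log_exp] at h2
  linarith

set_option maxHeartbeats 2000000 in
lemma Err_small (k m n0 H:ℕ) (ε:ℝ) (hε : 0 < ε) : ∃ L1 : ℝ, ∀ L, L1 ≤ L → ∀ N : ℕ, 1 ≤ N → log N ≤ 5/4*L →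
    ErrT k m L N ⌊exp (L/40)⌋₊ (⌊exp (L/40)⌋₊ + n0+H) H (exp L/L^(4*k+2)) ≤ ε*exp L := by
  set C : ℝ := k*CF m*(2*(1+n0+H)+4)+6*H*CF m+6*CF m with hC
  have hCF := CF_pos m
  have hC0 : 0 ≤ C := by positivity
  set C' : ℝ := ((7*k+2).factorial/(1/10:ℝ)^(7*k+2)) with hC'
  have hC'0 : 0 ≤ C' := by positivity
  refine ⟨max 8 ((k+5*(C*C'))/ε), fun L hL N hN hlN => ?_⟩
  have hL8 : 8 ≤ L := (le_max_left _ _).trans hL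
  have hLε : (k+5*(C*C')) ≤ ε*L := by
    have := (le_max_right _ _).trans hL
    rw [div_le_iff₀ hε] at this; linarith
  set R := ⌊exp (L/40)⌋₊ with hR
  have hE40 : 1 ≤ exp (L/40) := Real.one_le_exp (by linarith)
  have hRle : (R:ℝ) ≤ exp (L/40) := Nat.floor_le (by positivity)
  have hE20 : exp (L/20) = exp (L/40)^2 := by rw [← Real.exp_nat_mul]; congr 1; push_cast; ring
  have hRR : ((R*R:ℕ):ℝ) ≤ exp (L/20) := by
    push_cast
    rw [hE20, sq]
    exact mul_le_mul hRle hRle (by positivity) (by positivity)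
  have hR20 : (R:ℝ) ≤ exp (L/20) := hRle.trans (Real.exp_le_exp.2 (by linarith))
  have hb1 := LB_le_pow (2*k) R L (by linarith) hR20
  have hb2 := LB_le_pow k R L (by linarith) hR20
  have hb3 := LB_le_pow (3*k) (R*R) L (by linarith) hRR
  have hn1 := LB_nonneg (2*k) R
  have hn2 := LB_nonneg k R
  have hn3 := LB_nonneg (3*k) (R*R)
  have hlogN : 0 ≤ log N := Real.log_natCast_nonneg N
  have hN0 : (0:ℝ) < N := by exact_mod_cast hN
  have hlN1 : log ((N+1:ℕ):ℝ) ≤ 1+5/4*L := by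
    have h1 : ((N+1:ℕ):ℝ) ≤ exp 1*N := by
      have h2 := Real.exp_one_gt_d9
      have : (1:ℝ) ≤ N := by exact_mod_cast hN
      push_cast
      nlinarith
    have h2 := Real.log_le_log (by positivity) h1
    rw [Real.log_mul (Real.exp_pos 1).ne' hN0.ne', Real.log_exp] at h2
    linarith
  have hlN10 : 0 ≤ log ((N+1:ℕ):ℝ) := Real.log_natCast_nonneg _
  have hsq : √(N:ℝ) ≤ exp (5/8*L) := by
    rw [Real.sqrt_le_left (Real.exp_pos _).le, ← Real.exp_nat_mul, ← Real.log_le_iff_le_exp hN0]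
    push_cast; linarith
  have hE58 : 1 ≤ exp (5/8*L) := Real.one_le_exp (by linarith)
  have hRn1 : ((R+n0+H:ℕ):ℝ) ≤ (1+n0+H)*exp (5/8*L) := by
    have : (R:ℝ) ≤ exp (5/8*L) := hRle.trans (Real.exp_le_exp.2 (by linarith))
    push_cast
    nlinarith [(Nat.cast_nonneg n0 : (0:ℝ) ≤ n0), (Nat.cast_nonneg H : (0:ℝ) ≤ H)]
  set Z := exp (L/20) with hZ
  have hZ0 : 0 < Z := Real.exp_pos _
  have hWt : (LB (2*k) R*(R*LB k R))^2 ≤ L^(6*k)*Z := by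
    calc _ ≤ (L^(2*k)*(exp (L/40)*L^k))^2 := by
          refine pow_le_pow_left₀ (by positivity) ?_ 2
          exact mul_le_mul hb1 (mul_le_mul hRle hb2 hn2 (by positivity)) (by positivity) (by positivity)
      _ = _ := by rw [hE20]; ring
  have hWt0 : 0 ≤ (LB (2*k) R*(R*LB k R))^2 := sq_nonneg _
  have hL1 : 1 ≤ L := by linarith
  set P := L^(7*k+2) with hP
  set E7 := exp (27/40*L) with hE7
  have hZE : Z*exp (5/8*L) = E7 := by rw [hZ, hE7, ← Real.exp_add]; congr 1; ring
  have hZE' : Z ≤ E7 := Real.exp_le_exp.2 (by linarith)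
  have hE70 : 0 < E7 := Real.exp_pos _
  have hP0 : 0 ≤ P := by positivity
  have hP1 : P = L^(7*k+2) := hP
  have hE71 : E7 = exp (27/40*L) := hE7
  have hC1 : C = k*CF m*(2*(1+n0+H)+4)+6*H*CF m+6*CF m := hC
  clear_value R P E7 Z C C'
  have t1 : (k:ℝ)*(LB (2*k) R^2*(exp L/L^(4*k+2))) ≤ k*(exp L/L) := by
    refine mul_le_mul_of_nonneg_left ?_ (by positivity)
    calc LB (2*k) R^2*(exp L/L^(4*k+2)) ≤ (L^(2*k))^2*(exp L/L^(4*k+2)) :=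
          mul_le_mul_of_nonneg_right (pow_le_pow_left₀ hn1 hb1 2) (by positivity)
      _ = exp L/L^2 := by
          rw [← pow_mul, pow_add, show 2*k*2 = 4*k by ring]; field_simp
      _ ≤ exp L/L := div_le_div_of_nonneg_left (Real.exp_pos _).le (by linarith) (by nlinarith)
  have t2 : (k:ℝ)*(CF m*(LB (2*k) R*(R*LB k R))^2*(((R+n0+H:ℕ):ℝ)*log N+2*√N*log N)) ≤
      k*CF m*(2*(1+n0+H)+4)*(P*E7) := by
    have e1 : ((R+n0+H:ℕ):ℝ)*log N+2*√N*log N ≤ (2*(1+n0+H)+4)*(L*exp (5/8*L)) := by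
      have : ((R+n0+H:ℕ):ℝ)+2*√N ≤ ((1+n0+H)+2)*exp (5/8*L) := by linarith
      calc _ = (((R+n0+H:ℕ):ℝ)+2*√N)*log N := by ring
        _ ≤ (((1+n0+H)+2)*exp (5/8*L))*(2*L) := mul_le_mul this (by linarith) hlogN (by positivity)
        _ = _ := by ring
    have e2 : L^(6*k)*L ≤ P := by
      rw [← pow_succ, hP1]; exact pow_le_pow_right₀ hL1 (by omega)
    calc _ ≤ (k:ℝ)*(CF m*(L^(6*k)*Z)*((2*(1+n0+H)+4)*(L*exp (5/8*L)))) := by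
          refine mul_le_mul_of_nonneg_left ?_ (by positivity)
          exact mul_le_mul (mul_le_mul_of_nonneg_left hWt hCF.le) e1 (by positivity) (by positivity)
      _ = k*CF m*(2*(1+n0+H)+4)*((L^(6*k)*L)*(Z*exp (5/8*L))) := by ring
      _ ≤ _ := by
          rw [hZE]
          exact mul_le_mul_of_nonneg_left (mul_le_mul_of_nonneg_right e2 hE70.le) (by positivity)
  have t3 : log N*(H*(CF m*(LB (2*k) R*(R*LB k R))^2*(1+log ((N+1:ℕ):ℝ)))) ≤ 6*H*CF m*(P*E7) := by
    have e2 : L^(6*k)*L^2 ≤ P := by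
      rw [← pow_add, hP1]; exact pow_le_pow_right₀ hL1 (by omega)
    calc _ ≤ (2*L)*(H*(CF m*(L^(6*k)*Z)*(3*L))) := by
          refine mul_le_mul (by linarith) ?_ (by positivity) (by positivity)
          refine mul_le_mul_of_nonneg_left ?_ (by positivity)
          exact mul_le_mul (mul_le_mul_of_nonneg_left hWt hCF.le) (by linarith) (by positivity) (by positivity)
      _ = 6*H*CF m*((L^(6*k)*L^2)*Z) := by ring
      _ ≤ _ := mul_le_mul_of_nonneg_left (mul_le_mul e2 hZE' hZ0.le (by positivity)) (by positivity)
  have t4 : log N*(LB (2*k) R^2*((R*R:ℕ)*LB (3*k) (R*R)*(CF m*(3+log ((N+1:ℕ):ℝ))))) ≤ 6*CF m*(P*E7) := by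
    calc _ ≤ (2*L)*((L^(2*k))^2*(Z*L^(3*k)*(CF m*(3*L)))) := by
          refine mul_le_mul (by linarith) ?_ (by positivity) (by positivity)
          refine mul_le_mul (pow_le_pow_left₀ hn1 hb1 2) ?_ (by positivity) (by positivity)
          exact mul_le_mul (mul_le_mul hRR hb3 hn3 hZ0.le) (mul_le_mul_of_nonneg_left (by linarith) hCF.le) (by positivity) (by positivity)
      _ = 6*CF m*(P*Z) := by rw [hP]; ring
      _ ≤ _ := mul_le_mul_of_nonneg_left (mul_le_mul_of_nonneg_left hZE' (by positivity)) (by positivity)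
  have t5 : P*E7 ≤ C'*(5*(exp L/L)) := by
    have e1 := exp_pow_trade (1/10) (by norm_num) (7*k+2) L (by linarith)
    rw [← hP, ← hC'] at e1
    have e2 : exp (1/10*L)*E7 ≤ 5*(exp L/L) := by
      have e3 : exp (1/10*L)*E7*exp (1/5*L) ≤ exp L := by
        rw [hE7, ← Real.exp_add, ← Real.exp_add]; exact Real.exp_le_exp.2 (by linarith)
      have e4 := Real.add_one_le_exp (1/5*L)
      have e5 : 0 < exp (1/10*L)*E7 := by positivity
      rw [mul_div_assoc', le_div_iff₀ (by linarith)]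
      nlinarith
    calc P*E7 ≤ (C'*exp (1/10*L))*E7 := mul_le_mul_of_nonneg_right e1 hE70.le
      _ = C'*(exp (1/10*L)*E7) := by ring
      _ ≤ _ := mul_le_mul_of_nonneg_left e2 hC'0
  have t6 := mul_le_mul_of_nonneg_left t5 hC0
  unfold ErrT
  have t7 : (k+5*(C*C'))*(exp L/L) ≤ ε*exp L := by
    rw [mul_div_assoc', div_le_iff₀ (by linarith)]
    nlinarith [Real.exp_pos L]
  have t8 : k*CF m*(2*(1+n0+H)+4)*(P*E7)+6*H*CF m*(P*E7)+6*CF m*(P*E7) = C*(P*E7) := by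
    rw [hC]; ring
  have t9 : C*(C'*(5*(exp L/L))) = 5*(C*C')*(exp L/L) := by ring
  linarith

end B8a
end

section
open Finset

section B8b

lemma fin_arith (k J:ℕ) (c1 C2 X L l B ph W P g G Psi S lN Err ε:ℝ) (hX : 0 < X) (hL : 1 ≤ L) (hl : 1 ≤ l)
    (hB : 0 < B) (hph : 0 < ph) (hW : 0 < W) (hBW : B*W = ph) (hP : 0 < P) (hg0 : 0 ≤ g) (hS : 0 ≤ S) (hlN : 0 ≤ lN) (hc1 : 0 ≤ c1)
    (hC2 : 0 ≤ C2) (hkJl : 61440*k*J*l = L) (hPsi : c1*X ≤ Psi) (hG : B*l*J/16 ≤ G) (hS' : S ≤ C2*X)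
    (hlN' : lN ≤ 5/4*L) (hg : g ≤ 12*B*l) (hJ : 4096*61440*(45*C2+1) ≤ c1*J) (hErr : Err ≤ ε*X)
    (hε : ε < P*B/W)
    (hmain : k*(Psi/ph*(G^2/16*P)) ≤ lN*(S/W*(3*(g*P)))+Err) : False := by
  have h1 : k*(c1*X/ph*((B*l*J/16)^2/16*P)) ≤ k*(Psi/ph*(G^2/16*P)) := by
    refine mul_le_mul_of_nonneg_left ?_ (by positivity)
    refine mul_le_mul (div_le_div_of_nonneg_right hPsi hph.le) ?_ (by positivity) (div_nonneg (le_trans (by positivity) hPsi) hph.le)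
    refine mul_le_mul_of_nonneg_right (div_le_div_of_nonneg_right ?_ (by norm_num)) hP.le
    exact pow_le_pow_left₀ (by positivity) hG 2
  have h2 : k*(c1*X/ph*((B*l*J/16)^2/16*P)) = (c1*J)*(X*P*B*l*L/W)/(4096*61440) := by
    rw [← hBW, ← hkJl]
    field_simp
    ring
  have h3 : lN*(S/W*(3*(g*P))) ≤ (5/4*L)*(C2*X/W*(3*(12*B*l*P))) := by
    refine mul_le_mul hlN' ?_ (by positivity) (by positivity)
    refine mul_le_mul (div_le_div_of_nonneg_right hS' hW.le) ?_ (by positivity) (by positivity)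
    exact mul_le_mul_of_nonneg_left (mul_le_mul_of_nonneg_right hg hP.le) (by norm_num)
  have h4 : (5/4*L)*(C2*X/W*(3*(12*B*l*P))) = 45*C2*(X*P*B*l*L/W) := by ring
  have hQ : 0 < X*P*B*l*L/W := by positivity
  have h5 : (45*C2+1)*(X*P*B*l*L/W) ≤ (c1*J)*(X*P*B*l*L/W)/(4096*61440) := by
    rw [le_div_iff₀ (by norm_num)]
    have := mul_le_mul_of_nonneg_right hJ hQ.le
    linarith
  have h6 : ε*X < X*P*B*l*L/W := by
    have e1 : ε*X < P*B/W*X := mul_lt_mul_of_pos_right hε hX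
    have e2 : P*B/W*X*1 ≤ P*B/W*X*(l*L) :=
      mul_le_mul_of_nonneg_left (one_le_mul_of_one_le_of_one_le hl hL) (by positivity)
    have e3 : P*B/W*X*(l*L) = X*P*B*l*L/W := by ring
    linarith
  linarith

set_option maxHeartbeats 1000000 in
theorem maynard : ∃ k : ℕ, 2 ≤ k ∧ ∃ D0 : ℕ, ∀ (h : Fin k → ℕ) (W b n0:ℕ), 0 < W → (∀ p : ℕ, p.Prime → p ≤ D0 → p ∣ W) →
    (∀ i l, i ≠ l → ∀ p : ℕ, p.Prime → (p : ℤ) ∣ (h i : ℤ)-h l → p ∣ W) → (∀ i, (b+h i).Coprime W) → 1 ≤ n0 →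
    ∃ n, n0 ≤ n ∧ n ≡ b [MOD W] ∧ ∃ i j, i ≠ j ∧ (n+h i).Prime ∧ (n+h j).Prime := by
  classical
  obtain ⟨c1, hc1⟩ : ∃ c, c = exp (-(log 100)^2) := ⟨_, rfl⟩
  obtain ⟨C2, hC2⟩ : ∃ c, c = 4*exp (9/4) := ⟨_, rfl⟩
  have hc10 : 0 < c1 := hc1 ▸ Real.exp_pos _
  have hC20 : 0 < C2 := by rw [hC2]; positivity
  obtain ⟨J, hJ⟩ := exists_nat_ge (4096*61440*(45*C2+1)/c1)
  rw [div_le_iff₀ hc10] at hJ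
  have hJ1 : 1 ≤ J := by
    rcases Nat.eq_zero_or_pos J with h0 | h0
    · subst h0
      simp only [Nat.cast_zero, zero_mul] at hJ
      linarith
    · exact h0
  obtain ⟨k, hk⟩ : ∃ k, k = 2^J := ⟨_, rfl⟩
  have hk2 : 2 ≤ k := by rw [hk]; exact Nat.le_self_pow (by omega) 2
  obtain ⟨m, -, hBV⟩ := BVthm (3*k) (4*k+2) (by omega)
  obtain ⟨D, hD⟩ : ∃ D, D = 4*(3*k)^2 := ⟨_, rfl⟩
  refine ⟨k, hk2, D, ?_⟩
  rw [← hD] at hBV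
  intro h W b n0 hW0 hWD hWh hb hn0
  by_contra hcon
  have hone : ∀ n, n0 ≤ n → n ≡ b [MOD W] → ∀ i j, (n+h i).Prime → (n+h j).Prime → i = j := by
    intro n hn hnb i j hi hj
    by_contra hij
    exact hcon ⟨n, hn, hnb, i, j, hij, hi, hj⟩
  obtain ⟨H, hH⟩ : ∃ H, H = ∑ i, h i := ⟨_, rfl⟩
  have hHi : ∀ i, h i ≤ H := fun i => hH ▸ Finset.single_le_sum (f := h) (fun _ _ => Nat.zero_le _) (mem_univ i)
  have hkr : (2:ℝ) ≤ k := by exact_mod_cast hk2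
  have hJr : (1:ℝ) ≤ J := by exact_mod_cast hJ1
  have hD36 : (D:ℝ) = 36*(k:ℝ)^2 := by rw [hD]; push_cast; ring
  have hkD : k ≤ D := by rw [hD]; nlinarith
  have hWr : (0:ℝ) < W := by exact_mod_cast hW0
  have hW2 : 2 ≤ W := Nat.le_of_dvd hW0 (hWD 2 Nat.prime_two (by omega))
  have hφ : (1:ℝ) ≤ W.totient := by exact_mod_cast Nat.totient_pos.2 hW0
  obtain ⟨B, hB⟩ : ∃ B : ℝ, B = (W.totient:ℝ)/W := ⟨_, rfl⟩
  have hB0 : 0 < B := by rw [hB]; positivity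
  have hBW : B*W = W.totient := by rw [hB]; field_simp
  obtain ⟨L0, hL0, hBV⟩ := hBV W hW0 hWD
  obtain ⟨ε, hε⟩ : ∃ ε : ℝ, ε = (1/4)^(k-1)*B/(2*W) := ⟨_, rfl⟩
  have hε0 : 0 < ε := by rw [hε]; positivity
  obtain ⟨L1, hL1⟩ := Err_small k m n0 H ε hε0
  have hlW : 0 ≤ log W := Real.log_natCast_nonneg W
  obtain ⟨l, hl1, hl2, hl3, hl4, hl5⟩ : ∃ l : ℝ, (W:ℝ)^2+4*log W+6 ≤ l ∧ L0 ≤ l ∧ L1 ≤ l ∧ 20 ≤ l ∧ (m:ℝ) ≤ l :=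
    ⟨max ((W:ℝ)^2+4*log W+6) (max L0 (max L1 (max 20 m))), by simp, by simp, by simp, by simp, by simp⟩
  obtain ⟨L, hL⟩ : ∃ L : ℝ, 61440*k*J*l = L := ⟨_, rfl⟩
  have hkJ : (1:ℝ) ≤ 61440*k*J := by nlinarith
  have hlL : l ≤ L := by rw [← hL]; nlinarith
  obtain ⟨p0, hp0, hp0W, hBV⟩ := hBV L (by linarith)
  obtain ⟨N, hN⟩ : ∃ N, N = ⌊exp (5/4*L)⌋₊ := ⟨_, rfl⟩
  have hE1 : 1 ≤ exp (5/4*L) := Real.one_le_exp (by linarith)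
  have hN1 : 1 ≤ N := by rw [hN]; exact Nat.le_floor (by simpa using hE1)
  have hNu : exp (5/4*L) ≤ N+1 := by rw [hN]; exact (Nat.lt_floor_add_one _).le
  have hNl : log N ≤ 5/4*L := by
    rw [Real.log_le_iff_le_exp (by exact_mod_cast hN1), hN]
    exact Nat.floor_le (by positivity)
  have hBV := hBV N hNl hNu
  have hErr := hL1 L (by linarith) N hN1 hNl
  obtain ⟨R, hR⟩ : ∃ R, R = ⌊exp (L/40)⌋₊ := ⟨_, rfl⟩
  rw [← hR] at hErr
  have hRle : (R:ℝ) ≤ exp (L/40) := by rw [hR]; exact Nat.floor_le (by positivity)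
  have hRR : ((R*R:ℕ):ℝ) ≤ exp (L/20) := by
    push_cast
    rw [show L/20 = L/40+L/40 by ring, Real.exp_add]
    exact mul_le_mul hRle hRle (by positivity) (by positivity)
  -- the sieving primes
  let ι := {p : Fin (R+1) // (p:ℕ).Prime ∧ ¬ (p:ℕ) ∣ W*p0}
  let q : ι → ℕ := fun p => ((p : Fin (R+1)):ℕ)
  have hinj : Function.Injective q := fun x y hxy => Subtype.ext (Fin.ext hxy)
  have hp : ∀ i, (q i).Prime := fun i => i.2.1
  have hqW : ∀ p, (q p).Coprime (W*p0) := fun p => (Nat.Prime.coprime_iff_not_dvd (hp p)).2 p.2.2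
  have hqR : ∀ p, q p ≤ R := fun p => Nat.lt_succ_iff.1 p.1.2
  have hqnW : ∀ p, ¬ q p ∣ W := fun p hd => p.2.2 (Dvd.dvd.mul_right hd p0)
  have hsurj : ∀ p : ℕ, p.Prime → p ≤ R → ¬ p ∣ W*p0 → ∃ i, q i = p :=
    fun p h1 h2 h3 => ⟨⟨⟨p, by omega⟩, h1, h3⟩, rfl⟩
  have hDq : ∀ i, D < q i := by
    intro i
    by_contra hlt
    exact hqnW i (hWD _ (hp i) (by omega))
  have hkq : ∀ i, k ≤ q i := fun i => hkD.trans (hDq i).le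
  have hD2 : 2 ≤ D := hk2.trans hkD
  clear_value q
  have hpow : ∀ i < J, (2:ℝ)^i*l ≤ L/40/2 := by
    intro i hi
    have e1 : (2:ℝ)^i ≤ k := by
      rw [hk]; push_cast; exact pow_le_pow_right₀ (by norm_num) hi.le
    have e2 : (2:ℝ)^i*l ≤ k*l := mul_le_mul_of_nonneg_right e1 (by linarith)
    have e3 : k*l*1 ≤ k*l*J := mul_le_mul_of_nonneg_left hJr (by nlinarith)
    have e4 : 61440*(k*l*J) = L := by rw [← hL]; ring
    nlinarith
  have hlpow : ∀ i : ℕ, l ≤ 2^i*l := fun i => by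
    nlinarith [one_le_pow₀ (M₀ := ℝ) (n := i) (by norm_num : (1:ℝ) ≤ 2)]
  obtain ⟨b1, b2, b3, b4, b5⟩ := G_bounds q hp J hJ1 l B (by linarith) hB0.le
    (by
      intro i hi
      rw [hB]
      have h1 := hlpow i
      refine NU_lower q hinj hp W p0 hW2 hp0 hp0W R hsurj _ (by linarith) (by nlinarith) ?_
      rw [hR]
      exact Nat.floor_le_floor (Real.exp_le_exp.2 (by have := hpow i hi; linarith)))
    (by
      intro i hi
      have h1 := hlpow i
      set t := (2:ℝ)^i*l
      have h2 := NU_upper q hinj hp D hD2 hDq W hW0 (fun p => Nat.Coprime.coprime_mul_right_right (hqW p)) t (by linarith)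
      rw [← hB] at h2
      have h3 : (W:ℝ)^2 ≤ t-2 := by linarith
      have h4 : B*W^2 ≤ B*(t-2) := mul_le_mul_of_nonneg_left h3 hB0.le
      have h5 : B*W^2 = W.totient*W := by rw [← hBW]; ring
      have h6 : 1*(W:ℝ) ≤ W.totient*W := mul_le_mul_of_nonneg_right hφ hWr.le
      linarith)
  have hgpos : 0 < G2 q J l := by linarith
  have hF1 := S1_num (k := k) q hinj hp D hD2 hDq J l R
  have hF2 := S2_num (k := k) q hp hkq (by omega) J hJ1 l (by linarith) R (L/40) D (192*l*J) (by linarith)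
    (by rw [hD36]; positivity) (by positivity) (sum_sq_tail q hinj D hD2 hDq) (fun x hx => by rw [hR]; exact Nat.le_floor hx)
    (hpow (J-1) (by omega))
    (by
      have e1 := mul_le_mul_of_nonneg_left b2 (show 0 ≤ 192*l*J by positivity)
      have e2 : 192*l*J*(B*l/32) = 6*B*l^2*J := by ring
      linarith)
    (by
      rw [hD36, ← hL]
      have hk0 : (k:ℝ) ≠ 0 := by linarith
      have hJ0 : (J:ℝ) ≠ 0 := by linarith
      have hl0 : l ≠ 0 := by linarith
      have e1 : (k:ℝ)^2*6/(36*k^2) = 1/6 := by field_simp; norm_num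
      have e2 : 2*k*(192*l*J)/(61440*k*J*l/40) = 1/4 := by field_simp; norm_num
      rw [e1, e2]; norm_num)
  have hexp : exp (k*(2/D)) ≤ 3 := by
    have e1 : (k:ℝ)*(2/D) ≤ 1 := by
      rw [hD36, mul_div_assoc', div_le_one (by positivity)]; nlinarith
    have e2 := Real.exp_one_lt_d9
    exact (Real.exp_le_exp.2 e1).trans (by linarith)
  have hF1' := hF1.trans (mul_le_mul_of_nonneg_right hexp (pow_nonneg hgpos.le k))
  have hz : ∀ p i l, i ≠ l → ¬ (q p : ℤ) ∣ (h i : ℤ)-h l := fun p i l hil hd => hqnW p (hWh i l hil _ (hp p) hd)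
  have hmain := core_ineq (k := k) q hinj hp hkq (by omega) W p0 b hW0 hqW h hb hz (YY q J l R) (YY_abs q J l R) R (YY_supp q J l R)
    m L (by linarith) N hN1 hRR _ hBV n0 (R+n0+H) H hn0 hHi (by omega) (fun p => (hqR p).trans (by omega)) hone _ _ hF1' hF2
  have hPsi := Psi_lower m L (by linarith) N hNu
  have hS := FF_sum_upper m L (by linarith) (by linarith) (N+1)
  rw [← hc1] at hPsi
  rw [← hC2] at hS
  have hP : (1/4:ℝ)^(k-1) ≤ G2 q J l^(k-1) := pow_le_pow_left₀ (by norm_num) b5 _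
  have hgk : G2 q J l^k = G2 q J l*G2 q J l^(k-1) := (mul_pow_sub_one (by omega) _).symm
  rw [hgk] at hmain
  refine fin_arith k J c1 C2 (exp L) L l B W.totient W (G2 q J l^(k-1)) (G2 q J l) (G1 q J l) (PsiN m L N)
    (∑ n ∈ range (N+1), FF m L n) (log N) _ ε (Real.exp_pos L) (by linarith) (by linarith) hB0 (by linarith) hWr hBW
    (by positivity) hgpos.le (sum_nonneg fun n _ => FF_nonneg m L n (by linarith)) (Real.log_natCast_nonneg N) hc10.le hC20.le hL
    hPsi b1 hS hNl b3 (by linarith) hErr ?_ hmain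
  rw [hε, div_lt_div_iff₀ (by positivity) hWr]
  have e1 := mul_le_mul_of_nonneg_right hP (show 0 ≤ B*W by positivity)
  have e2 : 0 < G2 q J l^(k-1)*(B*W) := by positivity
  linarith

end B8b
end

lemma dePolignac_of (u v : ℕ) (hP : ∀ n0, ∃ n, n0 ≤ n ∧ (n + u).Prime ∧ (n + v).Prime ∧ u < v ∧ ∀ t, u < t → t < v → ¬ (n + t).Prime) :
    DePolignac (v - u) := by
  refine Set.infinite_of_forall_exists_gt fun a => ?_
  obtain ⟨n, hn, h1, h2, huv, hno⟩ := hP (Nat.nth Nat.Prime (a + 1))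
  have hmono := Nat.nth_strictMono Nat.infinite_setOf_prime
  set r := Nat.count Nat.Prime (n + u) with hr
  have e1 : Nat.nth Nat.Prime r = n + u := Nat.nth_count h1
  have e2 : Nat.nth Nat.Prime (Nat.count Nat.Prime (n + v)) = n + v := Nat.nth_count h2
  have h3 : r < Nat.count Nat.Prime (n + v) := by rw [← hmono.lt_iff_lt, e1, e2]; omega
  have h4 : Nat.nth Nat.Prime (r + 1) ≤ n + v := by rw [← e2]; exact hmono.monotone h3
  have h5 : n + u < Nat.nth Nat.Prime (r + 1) := by rw [← e1]; exact hmono (Nat.lt_succ_self r)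
  have h6 : (Nat.nth Nat.Prime (r + 1)).Prime := Nat.prime_nth_prime _
  have h7 : Nat.nth Nat.Prime (r + 1) = n + v := by
    by_contra hne
    have h8 := hno (Nat.nth Nat.Prime (r + 1) - n) (by omega) (by omega)
    rw [Nat.add_sub_cancel' (by omega)] at h8
    exact h8 h6
  refine ⟨r, ?_, ?_⟩
  · change Nat.nth Nat.Prime (r + 1) - Nat.nth Nat.Prime r = v - u
    rw [h7, e1]; omega
  · have : Nat.nth Nat.Prime (a + 1) ≤ Nat.nth Nat.Prime r := by rw [e1]; omega
    have := hmono.le_iff_le.1 this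
    omega

lemma exists_residue {k : ℕ} (hk : 2 ≤ k) (h : Fin k → ℕ) (p : ℕ) (hp : p.Prime) (hcong : p ≤ k → ∀ i j, h i ≡ h j [MOD p]) :
    ∃ r : ℕ, ∀ j, ¬ p ∣ r + h j := by
  classical
  haveI : Fact p.Prime := ⟨hp⟩
  have hlt : (Finset.univ.image (fun j : Fin k => -((h j : ℕ) : ZMod p))).card < Fintype.card (ZMod p) := by
    rw [ZMod.card]
    by_cases hpk : p ≤ k
    · refine lt_of_le_of_lt (Finset.card_le_one.2 ?_) hp.one_lt
      intro a ha b hb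
      simp only [Finset.mem_image, Finset.mem_univ, true_and] at ha hb
      obtain ⟨i, rfl⟩ := ha
      obtain ⟨j, rfl⟩ := hb
      rw [(ZMod.natCast_eq_natCast_iff _ _ _).2 (hcong hpk i j)]
    · refine lt_of_le_of_lt Finset.card_image_le ?_
      simp; omega
  obtain ⟨x, hx⟩ : ∃ x, x ∉ Finset.univ.image (fun j : Fin k => -((h j : ℕ) : ZMod p)) := by
    by_contra hcon
    push Not at hcon
    rw [Finset.eq_univ_iff_forall.2 hcon, Finset.card_univ] at hlt
    exact lt_irrefl _ hlt
  refine ⟨x.val, fun j hd => hx ?_⟩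
  rw [← ZMod.natCast_eq_zero_iff] at hd
  push_cast at hd
  rw [ZMod.natCast_val, ZMod.cast_id'] at hd
  simp only [Finset.mem_image, Finset.mem_univ, true_and]
  exact ⟨j, (eq_neg_of_add_eq_zero_left hd).symm⟩

lemma exists_W_b {k : ℕ} (hk : 2 ≤ k) (D0 : ℕ) (h : Fin k → ℕ) (hinj : Function.Injective h) (hcong : ∀ i j, h i ≡ h j [MOD k.factorial]) :
    ∃ W b : ℕ, 0 < W ∧ (∀ p : ℕ, p.Prime → p ≤ D0 → p ∣ W) ∧
    (∀ i l, i ≠ l → ∀ p : ℕ, p.Prime → (p : ℤ) ∣ (h i : ℤ) - h l → p ∣ W) ∧ (∀ i, (b + h i).Coprime W) ∧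
    ∀ n, W < n → n ≡ b [MOD W] → ∀ t, (∃ j, t ≤ h j) → (∀ j, t ≠ h j) → ¬ (n + t).Prime := by
  classical
  obtain ⟨H, hH⟩ : ∃ H, H = ∑ i, h i := ⟨_, rfl⟩
  have hHi : ∀ i, h i ≤ H := fun i => hH ▸ Finset.single_le_sum (f := h) (fun _ _ => Nat.zero_le _) (Finset.mem_univ i)
  have hpp : ∀ i, (Nat.nth Nat.Prime i).Prime := Nat.prime_nth_prime
  have hmono := Nat.nth_strictMono Nat.infinite_setOf_prime
  have hge : ∀ i, i + 2 ≤ Nat.nth Nat.Prime i := Nat.add_two_le_nth_prime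
  set Z := D0 + H + (H + 1) with hZ
  have hres : ∀ i, ∃ r : ℕ, (∀ j, ¬ Nat.nth Nat.Prime i ∣ r + h j) ∧
      ∀ t, t ≤ H → (∀ j, t ≠ h j) → i = D0 + H + t → Nat.nth Nat.Prime i ∣ r + t := by
    intro i
    by_cases hi : ∃ t, t ≤ H ∧ (∀ j, t ≠ h j) ∧ i = D0 + H + t
    · obtain ⟨t, ht, htj, rfl⟩ := hi
      have hg := hge (D0 + H + t)
      set p := Nat.nth Nat.Prime (D0 + H + t)
      refine ⟨p - t, fun j hd => ?_, fun t' _ _ ht' => ?_⟩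
      · have h1 := hHi j
        rcases lt_or_gt_of_ne (htj j) with hlt | hlt
        · rw [show p - t + h j = (h j - t) + p by omega, Nat.dvd_add_self_right] at hd
          have := Nat.le_of_dvd (by omega) hd
          omega
        · have := Nat.le_of_dvd (by omega) hd
          omega
      · rw [show p - t + t' = p by omega]
    · obtain ⟨r, hr⟩ := exists_residue hk h _ (hpp i) fun hle a b => (hcong a b).of_dvd ((hpp i).dvd_factorial.2 hle)
      exact ⟨r, hr, fun t h1 h2 h3 => absurd ⟨t, h1, h2, h3⟩ hi⟩
  choose r hr1 hr2 using hres
  obtain ⟨b, hb⟩ := Nat.chineseRemainderOfFinset r (Nat.nth Nat.Prime) (Finset.range Z) (fun i _ => (hpp i).ne_zero)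
    (fun i _ j _ hij => (Nat.coprime_primes (hpp i) (hpp j)).2 (hmono.injective.ne hij))
  have hdiv : ∀ i < Z, Nat.nth Nat.Prime i ∣ ∏ i ∈ Finset.range Z, Nat.nth Nat.Prime i :=
    fun i hi => Finset.dvd_prod_of_mem _ (Finset.mem_range.2 hi)
  have hsmall : ∀ p : ℕ, p.Prime → p ≤ D0 + H → p ∣ ∏ i ∈ Finset.range Z, Nat.nth Nat.Prime i := by
    intro p hp hle
    rw [← Nat.nth_count hp]
    exact hdiv _ (lt_of_le_of_lt (Nat.count_le _) (by omega))
  have hW0 : 0 < ∏ i ∈ Finset.range Z, Nat.nth Nat.Prime i := Finset.prod_pos fun i _ => (hpp i).pos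
  refine ⟨∏ i ∈ Finset.range Z, Nat.nth Nat.Prime i, b, hW0, fun p hp hle => hsmall p hp (by omega), ?_, ?_, ?_⟩
  · intro i l hil p hp hd
    refine hsmall p hp ?_
    have h1 : (h i : ℤ) - h l ≠ 0 := sub_ne_zero.2 (by exact_mod_cast hinj.ne hil)
    have h2 := Int.le_of_dvd (abs_pos.2 h1) ((dvd_abs _ _).2 hd)
    have h3 : |(h i : ℤ) - h l| ≤ H := by
      have := hHi i
      have := hHi l
      rw [abs_le]; constructor <;> omega
    omega
  · intro j
    refine Nat.Coprime.prod_right fun i hi => Nat.Coprime.symm ((hpp i).coprime_iff_not_dvd.2 fun hd => hr1 i j ?_)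
    exact (((hb i hi).add_right (h j)).dvd_iff dvd_rfl).1 hd
  · intro n hn hnb t ⟨j, htj⟩ hne hpr
    have htH := htj.trans (hHi j)
    have hi : D0 + H + t < Z := by omega
    have h1 := hr2 (D0 + H + t) t htH hne rfl
    have h2 := (hnb.of_dvd (hdiv _ hi)).trans (hb _ (Finset.mem_range.2 hi))
    have h3 := ((h2.add_right t).dvd_iff dvd_rfl).2 h1
    have h4 := (Nat.prime_dvd_prime_iff_eq (hpp _) hpr).1 h3
    have h5 := Nat.le_of_dvd hW0 (hdiv _ hi)
    omega

lemma exists_pair {k : ℕ} (h : Fin k → ℕ) (hm : StrictMono h) (n : ℕ)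
    (hno : ∀ t, (∃ j, t ≤ h j) → (∀ j, t ≠ h j) → ¬ (n + t).Prime) (i j : Fin k) (hij : i < j) (hi : (n + h i).Prime) (hj : (n + h j).Prime) :
    ∃ j', i < j' ∧ (n + h j').Prime ∧ ∀ t, h i < t → t < h j' → ¬ (n + t).Prime := by
  classical
  have hne : (Finset.univ.filter (fun l : Fin k => i < l ∧ (n + h l).Prime)).Nonempty := ⟨j, by simp [hij, hj]⟩
  have hmem := Finset.min'_mem _ hne
  set j' := Finset.min' _ hne with hj'
  simp only [Finset.mem_filter, Finset.mem_univ, true_and] at hmem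
  refine ⟨j', hmem.1, hmem.2, fun t h1 h2 hpr => ?_⟩
  by_cases ht : ∃ l, t = h l
  · obtain ⟨l, rfl⟩ := ht
    have h3 := Finset.min'_le (Finset.univ.filter (fun l : Fin k => i < l ∧ (n + h l).Prime)) l (by simp [hm.lt_iff_lt.1 h1, hpr])
    exact absurd (hm.lt_iff_lt.1 h2) (not_lt.2 h3)
  · push Not at ht
    exact hno t ⟨j', h2.le⟩ ht hpr

theorem exists_dePolignac_diff : ∃ k : ℕ, 2 ≤ k ∧ ∀ h : Fin k → ℕ, StrictMono h → (∀ i j, h i ≡ h j [MOD k.factorial]) →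
    ∃ i j, i < j ∧ DePolignac (h j - h i) := by
  obtain ⟨k, hk, D0, hmay⟩ := maynard
  refine ⟨k, hk, fun h hm hcong => ?_⟩
  obtain ⟨W, b, hW0, hWD, hWh, hb, hno⟩ := exists_W_b hk D0 h hm.injective hcong
  by_contra hcon
  push Not at hcon
  have hbad : ∀ x : Fin k × Fin k, ∃ n0, ∀ n, n0 ≤ n → x.1 < x.2 → (n + h x.1).Prime → (n + h x.2).Prime →
      ¬ ∀ t, h x.1 < t → t < h x.2 → ¬ (n + t).Prime := by
    intro x
    by_cases hx : x.1 < x.2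
    · by_contra hc
      push Not at hc
      refine hcon x.1 x.2 hx (dePolignac_of _ _ fun n0 => ?_)
      obtain ⟨n, h1, -, h2, h3, h4⟩ := hc n0
      exact ⟨n, h1, h2, h3, hm hx, h4⟩
    · exact ⟨0, fun n _ h1 => absurd h1 hx⟩
  choose n0 hn0 using hbad
  have hle : ∀ x, n0 x ≤ ∑ y, n0 y := fun x => Finset.single_le_sum (f := n0) (fun _ _ => Nat.zero_le _) (Finset.mem_univ x)
  obtain ⟨n, h1, h2, i, j, hij, hi, hj⟩ := hmay h W b (W + 1 + ∑ y, n0 y) hW0 hWD hWh hb (by omega)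
  have key : ∀ i j, i < j → (n + h i).Prime → (n + h j).Prime → False := by
    intro i j hij hi hj
    obtain ⟨j', h3, h4, h5⟩ := exists_pair h hm n (hno n (by omega) h2) i j hij hi hj
    exact hn0 (i, j') n ((hle _).trans (by omega)) h3 hi h4 h5
  rcases lt_or_gt_of_ne hij with h3 | h3
  · exact key i j h3 hi hj
  · exact key j i h3 hj hi

theorem ip_sets_contain_infinitely_many_de_polignac_numbers
    (A : Set ℕ) (hA : IsIPSet A) (hEven : ∀ a ∈ A, Even a ∧ 0 < a) :
    {a ∈ A | DePolignac a}.Infinite := by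
  obtain ⟨M, hM, hM0, rfl⟩ := hA
  obtain ⟨k, hk, hdp⟩ := exists_dePolignac_diff
  refine Set.infinite_of_forall_exists_gt fun X => ?_
  have hmm : StrictMono (Nat.nth (· ∈ M)) := Nat.nth_strictMono hM
  set e : ℕ → ℕ := fun i => Nat.nth (· ∈ M) (X + 1 + i) with he
  have heM : ∀ i, e i ∈ M := fun i => Nat.nth_mem_of_infinite hM _
  have heinj : Function.Injective e := fun i j hij => by
    have := hmm.injective hij
    omega
  have heX : ∀ i, X < e i := fun i => lt_of_lt_of_le (by omega : X < X + 1 + i) hmm.le_apply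
  set s : ℕ → ℕ := fun n => ∑ i ∈ Finset.range n, e i with hs
  have hsdiff : ∀ a b, a < b → s b - s a = ∑ i ∈ Finset.Ico a b, e i := fun a b hab => by
    have := Finset.sum_range_add_sum_Ico e hab.le
    simp only [hs]; omega
  have hspos : ∀ a b, a < b → X < ∑ i ∈ Finset.Ico a b, e i := fun a b hab =>
    lt_of_lt_of_le (heX a) (Finset.single_le_sum (f := e) (fun _ _ => Nat.zero_le _) (Finset.mem_Ico.2 ⟨le_rfl, hab⟩))
  have hsm : StrictMono s := fun a b hab => by
    have := hsdiff a b hab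
    have := hspos a b hab
    omega
  haveI : NeZero k.factorial := ⟨k.factorial_ne_zero⟩
  obtain ⟨c, hc⟩ := Finite.exists_infinite_fiber (fun n => ((s n : ℕ) : ZMod k.factorial))
  have hS := Set.infinite_coe_iff.1 hc
  set S := (fun n => ((s n : ℕ) : ZMod k.factorial)) ⁻¹' {c} with hSdef
  have hnn : StrictMono (Nat.nth (· ∈ S)) := Nat.nth_strictMono hS
  have hnS : ∀ i, ((s (Nat.nth (· ∈ S) i) : ℕ) : ZMod k.factorial) = c := fun i => by
    have : Nat.nth (· ∈ S) i ∈ S := Nat.nth_mem_of_infinite hS i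
    simpa [hSdef] using this
  obtain ⟨i, j, hij, hd⟩ := hdp (fun i => s (Nat.nth (· ∈ S) i)) (fun a b hab => hsm (hnn hab))
    (fun a b => (ZMod.natCast_eq_natCast_iff _ _ _).1 (by rw [hnS, hnS]))
  have hlt : Nat.nth (· ∈ S) (i : ℕ) < Nat.nth (· ∈ S) (j : ℕ) := hnn hij
  set a := Nat.nth (· ∈ S) (i : ℕ)
  set b := Nat.nth (· ∈ S) (j : ℕ)
  have h1 := hsdiff a b hlt
  have h2 := hspos a b hlt
  refine ⟨s b - s a, ⟨⟨by omega, (Finset.Ico a b).image e, ?_, ?_, ?_⟩, hd⟩, by omega⟩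
  · exact (Finset.nonempty_Ico.2 hlt).image e
  · intro x hx
    simp only [Finset.coe_image, Set.mem_image] at hx
    obtain ⟨y, -, rfl⟩ := hx
    exact heM y
  · rw [Finset.sum_image fun x _ y _ h => heinj h, h1]
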